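/- Let K be a field of characteristic 0 and 𝔤 a split semisimple Lie algebra over K. Let I be a primitive ideal of U(𝔤) (the annihilator of a simple left U(𝔤)-module) with K-rational infinitesimal central character, i.e. I ⊇ ker(χ_λ)·U(𝔤) for some λ ∈ 𝔥*, where χ_λ : Z(U(𝔤)) → K is the central character of the Verma module M(λ). Then there exists μ ∈ 𝔥* such that I = Ann_{U(𝔤)}(L(μ)), the annihilator of the simple highest weight module L(μ). -/

import Mathlib

open UniversalEnvelopingAlgebra

/-- The root space of `g` relative to a Lie subalgebra `H` and a linear form `α` on `H`:
the set of `x ∈ g` with `⁅h, x⁆ = α(h) • x` for all `h ∈ H`. -/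
def rootSpaceOf {K g : Type*} [Field K] [LieRing g] [LieAlgebra K g]
    (H : LieSubalgebra K g) (α : Module.Dual K ↥H) : Submodule K g where
  carrier := {x : g | ∀ h : ↥H, ⁅(h : g), x⁆ = α h • x}
  add_mem' := fun {a b} ha hb h => by rw [lie_add, ha h, hb h, smul_add]
  zero_mem' := fun h => by simp
  smul_mem' := fun c a ha h => by rw [lie_smul, ha h, smul_comm]

/-- A triangular decomposition `g = 𝔫⁻ ⊕ 𝔥 ⊕ 𝔫⁺` of a split semisimple Lie algebra,
together with its root data: a splitting Cartan subalgebra `𝔥`, the set of positive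
roots `Φ⁺` (so that `𝔫⁺` is the sum of the root spaces of the positive roots and `𝔫⁻`
the sum of the root spaces of their negatives), and the coroot `α∨ ∈ 𝔥` of each root. -/
structure TriangularDecomposition (K g : Type*) [Field K] [LieRing g] [LieAlgebra K g] where
  H : LieSubalgebra K g
  nneg : LieSubalgebra K g
  npos : LieSubalgebra K g
  isCartan : H.IsCartanSubalgebra
  decomp : ∀ x : g, ∃! t : ↥nneg × ↥H × ↥npos, ((t.1 : g) + (t.2.1 : g) + (t.2.2 : g)) = x
  posRoots : Finset (Module.Dual K ↥H)
  posRoots_ne_zero : ∀ α ∈ posRoots, α ≠ 0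
  npos_eq : npos.toSubmodule = ⨆ α ∈ posRoots, rootSpaceOf H α
  nneg_eq : nneg.toSubmodule = ⨆ α ∈ posRoots, rootSpaceOf H (-α)
  coroot : Module.Dual K ↥H → ↥H
  coroot_self_eq_two : ∀ α ∈ posRoots, α (coroot α) = (2 : K)

variable {K g : Type*} [Field K] [LieRing g] [LieAlgebra K g]

/-- `ρ`, the half sum of the positive roots. -/
noncomputable def TriangularDecomposition.rho (T : TriangularDecomposition K g) :
    Module.Dual K ↥T.H :=
  (2 : K)⁻¹ • ∑ α ∈ T.posRoots, α

/-- A weight `λ ∈ 𝔥*` is dominant if `(λ + ρ)(α∨)` is not a negative integer for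
every positive root `α`. -/
def TriangularDecomposition.IsDominant (T : TriangularDecomposition K g)
    (lam : Module.Dual K ↥T.H) : Prop :=
  ∀ α ∈ T.posRoots, ∀ n : ℕ, (lam + T.rho) (T.coroot α) ≠ -(n + 1 : K)

/-- The left ideal of `U(g)` generated by `𝔫⁺` and `{h - λ(h) : h ∈ 𝔥}`. -/
def vermaIdeal (T : TriangularDecomposition K g) (lam : Module.Dual K ↥T.H) :
    Ideal (UniversalEnvelopingAlgebra K g) :=
  Ideal.span
    (Set.range (fun x : ↥T.npos => ι K (x : g)) ∪
     Set.range (fun h : ↥T.H =>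
       ι K (h : g) - algebraMap K (UniversalEnvelopingAlgebra K g) (lam h)))

/-- The Verma module `M(λ) = U(g)/(U(g)·𝔫⁺ + Σ_h U(g)·(h − λ(h)))`, a left `U(g)`-module. -/
def VermaModule (T : TriangularDecomposition K g) (lam : Module.Dual K ↥T.H) :=
  UniversalEnvelopingAlgebra K g ⧸ vermaIdeal T lam

noncomputable instance (T : TriangularDecomposition K g) (lam : Module.Dual K ↥T.H) :
    AddCommGroup (VermaModule T lam) :=
  inferInstanceAs (AddCommGroup (UniversalEnvelopingAlgebra K g ⧸ vermaIdeal T lam))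

noncomputable instance (T : TriangularDecomposition K g) (lam : Module.Dual K ↥T.H) :
    Module (UniversalEnvelopingAlgebra K g) (VermaModule T lam) :=
  inferInstanceAs (Module (UniversalEnvelopingAlgebra K g)
    (UniversalEnvelopingAlgebra K g ⧸ vermaIdeal T lam))

/-- The annihilator of a left `A`-module `M`, as a two-sided ideal of `A`. -/
def annihilatorTwoSided (A : Type*) [Ring A] (M : Type*) [AddCommGroup M] [Module A M] :
    TwoSidedIdeal A :=
  TwoSidedIdeal.mk' {a : A | ∀ m : M, a • m = 0}
    (fun m => by simp)
    (fun {x y} hx hy m => by simp [add_smul, hx m, hy m])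
    (fun {x} hx m => by simp [neg_smul, hx m])
    (fun {x y} hy m => by rw [mul_smul, hy m, smul_zero])
    (fun {x y} hx m => by rw [mul_smul, hx (y • m)])

/-- The submodule `I·M` of a left `A`-module `M`, for `I` a two-sided ideal of `A`. -/
def idealSmul {A : Type*} [Ring A] (I : TwoSidedIdeal A)
    (M : Type*) [AddCommGroup M] [Module A M] : Submodule A M :=
  Submodule.span A {x : M | ∃ a ∈ I, ∃ m : M, x = a • m}

set_option linter.style.haveILetI false
set_option linter.unusedSectionVars false
section PA
variable {K g : Type*} [Field K] [LieRing g] [LieAlgebra K g]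
variable {T : TriangularDecomposition K g}
theorem rs_lie {v w : Module.Dual K T.H} {x y : g} (hx : x ∈ rootSpaceOf T.H v)
    (hy : y ∈ rootSpaceOf T.H w) : ⁅x, y⁆ ∈ rootSpaceOf T.H (v + w) := by
  intro h
  rw [leibniz_lie, hx h, hy h]
  simp [add_smul]
theorem rs_pow {v w : Module.Dual K T.H} {x y : g} (hx : x ∈ rootSpaceOf T.H v)
    (hy : y ∈ rootSpaceOf T.H w) (n : ℕ) :
    ((LieAlgebra.ad K g x) ^ n) y ∈ rootSpaceOf T.H (w + n • v) := by
  induction n with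
  | zero => simpa using hy
  | succ n ih =>
    rw [pow_succ', Module.End.mul_apply]
    have := rs_lie hx ih
    rwa [← add_assoc, add_comm v w, add_assoc, ← succ_nsmul'] at this
theorem rs_top (P : Submodule K g) (hH : ∀ h : T.H, (h : g) ∈ P)
    (hp : ∀ α ∈ T.posRoots, rootSpaceOf T.H α ≤ P)
    (hn : ∀ α ∈ T.posRoots, rootSpaceOf T.H (-α) ≤ P) (x : g) : x ∈ P := by
  obtain ⟨t, rfl, -⟩ := T.decomp x
  refine P.add_mem (P.add_mem ?_ (hH _)) ?_
  · have : (t.1 : g) ∈ T.nneg.toSubmodule := t.1.2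
    rw [T.nneg_eq] at this
    exact (iSup₂_le hn : _ ≤ P) this
  · have : (t.2.2 : g) ∈ T.npos.toSubmodule := t.2.2.2
    rw [T.npos_eq] at this
    exact (iSup₂_le hp : _ ≤ P) this
variable [LieAlgebra.IsSemisimple K g]
theorem cen0 (K : Type*) {g : Type*} [Field K] [LieRing g] [LieAlgebra K g]
    [LieAlgebra.IsSemisimple K g] (x : g) (h : ∀ y : g, ⁅x, y⁆ = 0) : x = 0 := by
  have : x ∈ LieAlgebra.center K g := by
    rw [LieModule.mem_maxTrivSubmodule]; intro y; rw [← lie_skew, h y, neg_zero]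
  rwa [LieAlgebra.center_eq_bot, LieSubmodule.mem_bot] at this
/-- if `h ∈ H` kills all roots (as an action), with `h` central in `H`, then `h = 0` -/
theorem H_zero (h : T.H) (hc : ∀ h' : T.H, ⁅h, h'⁆ = 0)
    (hp : ∀ α ∈ T.posRoots, ∀ x ∈ rootSpaceOf T.H α, ⁅(h : g), x⁆ = 0)
    (hn : ∀ α ∈ T.posRoots, ∀ x ∈ rootSpaceOf T.H (-α), ⁅(h : g), x⁆ = 0) : h = 0 := by
  refine Subtype.ext (cen0 K (h : g) fun y => ?_)
  refine rs_top (T := T) (LinearMap.ker (LieAlgebra.ad K g (h : g))) (fun h' => ?_) hp hn y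
  have := congrArg (Subtype.val) (hc h'); simpa using this
theorem H_abel (T : TriangularDecomposition K g) (h h' : T.H) : ⁅h, h'⁆ = 0 := by
  haveI := T.isCartan
  let c : LieIdeal K T.H :=
    { carrier := {h | (∀ α ∈ T.posRoots, ∀ x ∈ rootSpaceOf T.H α, ⁅(h : g), x⁆ = 0) ∧
        (∀ α ∈ T.posRoots, ∀ x ∈ rootSpaceOf T.H (-α), ⁅(h : g), x⁆ = 0)}
      add_mem' := fun {a b} ha hb => ⟨fun α hα x hx => by simp [ha.1 α hα x hx, hb.1 α hα x hx],
        fun α hα x hx => by simp [ha.2 α hα x hx, hb.2 α hα x hx]⟩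
      zero_mem' := by simp
      smul_mem' := fun a b hb => ⟨fun α hα x hx => by simp [hb.1 α hα x hx],
        fun α hα x hx => by simp [hb.2 α hα x hx]⟩
      lie_mem := fun {a b} hb => ⟨fun α hα x hx => by
          simp only [LieSubalgebra.coe_bracket, lie_lie, hb.1 α hα x hx, hx a, lie_smul]; simp,
        fun α hα x hx => by
          simp only [LieSubalgebra.coe_bracket, lie_lie, hb.2 α hα x hx, hx a, lie_smul]; simp⟩ }
  have hc : c = ⊥ := by
    by_contra hne
    haveI : Nontrivial c := (LieSubmodule.nontrivial_iff_ne_bot K T.H T.H).2 hne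
    haveI : LieRing.IsNilpotent T.H := LieSubalgebra.IsCartanSubalgebra.nilpotent
    haveI : LieModule.IsNilpotent T.H c :=
      Function.Injective.lieModuleIsNilpotent (f := (LieHom.id : T.H →ₗ⁅K⁆ T.H))
        (g := (LieSubmodule.incl c : _ →ₗ[K] T.H)) (fun _ _ => rfl) Subtype.val_injective
    have := LieModule.nontrivial_max_triv_of_isNilpotent K T.H c
    obtain ⟨⟨y, hy⟩, hy0⟩ := exists_ne (0 : LieModule.maxTrivSubmodule K T.H c)
    rw [LieModule.mem_maxTrivSubmodule] at hy
    apply hy0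
    have : (y : T.H) = 0 := H_zero y.1 (fun h' => by
      have := congrArg Subtype.val (hy h')
      rw [← lie_skew, neg_eq_zero]; simpa using this) y.2.1 y.2.2
    ext; simp [this]
  have : ⁅h, h'⁆ ∈ c := ⟨fun α _ x hx => by
      rw [LieSubalgebra.coe_bracket, lie_lie, hx h, hx h', lie_smul, lie_smul, hx h, hx h', smul_comm]
      simp,
    fun α _ x hx => by
      rw [LieSubalgebra.coe_bracket, lie_lie, hx h, hx h', lie_smul, lie_smul, hx h, hx h', smul_comm]
      simp⟩
  rw [hc] at this
  simpa using this
theorem H_zero' (h : T.H) (hv : ∀ v : Module.Dual K T.H, rootSpaceOf T.H v ≠ ⊥ → v h = 0) :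
    h = 0 := by
  refine H_zero h (fun h' => H_abel T h h') (fun α _ x hx => ?_) (fun α _ x hx => ?_)
  all_goals
    rw [hx h]
    by_cases h0 : x = 0
    · simp [h0]
    · rw [hv _ (fun hb => h0 (by simpa [hb] using hx)), zero_smul]
theorem H_sub : ∀ h : T.H, (h : g) ∈ rootSpaceOf T.H (0 : Module.Dual K T.H) := fun h h' => by
  have := congrArg Subtype.val (H_abel T h' h)
  simpa using this
variable [CharZero K]
theorem rs_sep (S : Finset (Module.Dual K T.H)) :
    ∃ h0 : T.H, ∀ v ∈ S, ∀ w ∈ S, v h0 = w h0 → v = w := by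
  classical
  let D := ((S ×ˢ S).image fun p => p.1 - p.2).erase 0
  obtain ⟨h0, h⟩ := Module.Dual.exists_forall_mem_ne_zero_of_forall_exists (⊤ : Submodule K T.H)
    (fun d : D => (d : Module.Dual K T.H)) (fun d => by
      by_contra hcon
      push Not at hcon
      exact (Finset.mem_erase.1 d.2).1 (LinearMap.ext fun x => hcon x trivial))
  refine ⟨h0, fun v hv w hw e => ?_⟩
  by_contra hne
  exact h.2 ⟨v - w, Finset.mem_erase.2 ⟨sub_ne_zero.2 hne, Finset.mem_image.2 ⟨(v, w), by simp [hv, hw], rfl⟩⟩⟩ (by simp [e])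
theorem rs_indep (S : Finset (Module.Dual K T.H)) (v : Module.Dual K T.H) (hv : v ∉ S) (x : g)
    (hx : x ∈ rootSpaceOf T.H v) (hx' : x ∈ ⨆ w ∈ S, rootSpaceOf T.H w) : x = 0 := by
  classical
  obtain ⟨h0, h⟩ := rs_sep (insert v S)
  have hi := Module.End.eigenspaces_iSupIndep (LieAlgebra.ad K g (h0 : g))
  refine Submodule.disjoint_def.1 (hi (v h0)) x (by simpa using hx h0) ?_
  refine (iSup₂_le (fun w hw => ?_) : (⨆ w ∈ S, rootSpaceOf T.H w) ≤ _) hx'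
  refine le_trans (fun y hy => ?_) (le_iSup₂ (w h0) (fun e => hv ?_))
  · simpa using hy h0
  · rw [h v (by simp) w (by simp [hw]) e.symm]; exact hw
open Classical in
theorem rs_top' (x : g) : x ∈ ⨆ w ∈ insert 0 (T.posRoots ∪ T.posRoots.image (fun a => -a)),
    rootSpaceOf T.H w := by
  refine rs_top (T := T) _ (fun h => ?_) (fun α hα => ?_) (fun α hα => ?_) x
  · exact Submodule.mem_iSup_of_mem 0 (Submodule.mem_iSup_of_mem (by simp) (H_sub h))
  · exact le_iSup₂_of_le α (by simp [hα]) le_rfl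
  · exact le_iSup₂_of_le (-α) (by simp [hα]) le_rfl
theorem wts_fin : {v : Module.Dual K T.H | rootSpaceOf T.H v ≠ ⊥}.Finite := by
  classical
  refine (insert 0 (T.posRoots ∪ T.posRoots.image (fun a => -a))).finite_toSet.subset fun v hv => ?_
  by_contra hn
  obtain ⟨x, hx, h0⟩ := (Submodule.ne_bot_iff _).1 hv
  exact h0 (rs_indep _ v hn x hx (rs_top' x))
theorem rs_zero (x : g) (hx : x ∈ rootSpaceOf T.H (0 : Module.Dual K T.H)) : x ∈ T.H := by
  classical
  obtain ⟨t, rfl, -⟩ := T.decomp x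
  have h1 : (t.1 : g) ∈ T.nneg.toSubmodule := t.1.2
  have h2 : (t.2.2 : g) ∈ T.npos.toSubmodule := t.2.2.2
  rw [T.nneg_eq] at h1; rw [T.npos_eq] at h2
  have : (t.1 : g) + t.2.2 = 0 := by
    refine rs_indep (T.posRoots ∪ T.posRoots.image (fun a => -a)) 0 ?_ _ ?_ (add_mem ?_ ?_)
    · simp only [Finset.mem_union, Finset.mem_image, not_or]
      exact ⟨fun h => T.posRoots_ne_zero _ h rfl, fun ⟨a, h, e⟩ => T.posRoots_ne_zero _ h (by simpa using e)⟩
    · have := sub_mem hx (H_sub t.2.1)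
      convert this using 1; abel
    · exact (show (⨆ α ∈ T.posRoots, rootSpaceOf T.H (-α)) ≤ _ from
        iSup₂_le fun α hα => le_iSup₂_of_le (-α) (by simp [hα]) le_rfl) h1
    · exact (show (⨆ α ∈ T.posRoots, rootSpaceOf T.H α) ≤ _ from
        iSup₂_le fun α hα => le_iSup₂_of_le α (by simp [hα]) le_rfl) h2
  have e : (t.1 : g) + t.2.1 + t.2.2 = t.2.1 := by rw [add_right_comm, this, zero_add]
  rw [e]; exact t.2.1.2
theorem rs_nilp {γ v : Module.Dual K T.H} (hγ : γ ≠ 0) {x z : g} (hx : x ∈ rootSpaceOf T.H γ)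
    (hz : z ∈ rootSpaceOf T.H v) : ∃ k : ℕ, ((LieAlgebra.ad K g x) ^ k) z = 0 := by
  by_contra hc
  push Not at hc
  refine Set.infinite_of_injective_forall_mem (f := fun k : ℕ => v + k • γ) ?_ (fun k => ?_)
    (wts_fin (T := T))
  · intro a b hab
    by_contra hne
    have : (a : K) • γ = (b : K) • γ := by
      simpa only [Nat.cast_smul_eq_nsmul] using add_left_cancel hab
    exact hne (Nat.cast_injective (smul_left_injective K hγ this))
  · exact (Submodule.ne_bot_iff _).2 ⟨_, rs_pow hx hz k, hc k⟩
/-- last nonzero element of a string -/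
theorem rs_last {γ v : Module.Dual K T.H} (hγ : γ ≠ 0) {x z : g} (hx : x ∈ rootSpaceOf T.H γ)
    (hz : z ∈ rootSpaceOf T.H v) (h0 : z ≠ 0) :
    ∃ k : ℕ, ((LieAlgebra.ad K g x) ^ k) z ≠ 0 ∧ ⁅x, ((LieAlgebra.ad K g x) ^ k) z⁆ = 0 := by
  classical
  have h := rs_nilp hγ hx hz
  have h1 : Nat.find h ≠ 0 := fun e => h0 (by have := Nat.find_spec h; rw [e] at this; simpa using this)
  refine ⟨Nat.find h - 1, Nat.find_min h (by omega), ?_⟩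
  have := Nat.find_spec h
  rwa [← Nat.sub_add_cancel (Nat.one_le_iff_ne_zero.2 h1), pow_succ', Module.End.mul_apply] at this
/-- commutation along a string -/
theorem rs_string {γ v : Module.Dual K T.H} {x y z : g} {t : T.H} (ht : (t : g) = ⁅x, y⁆)
    (hy : y ∈ rootSpaceOf T.H (-γ)) (hz : z ∈ rootSpaceOf T.H v) (hxz : ⁅x, z⁆ = 0) (k : ℕ) :
    ⁅x, ((LieAlgebra.ad K g y) ^ (k + 1)) z⁆ =
      ((k + 1) * (v t - k * γ t / 2)) • ((LieAlgebra.ad K g y) ^ k) z := by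
  have key : ∀ k : ℕ, ⁅x, ((LieAlgebra.ad K g y) ^ (k + 1)) z⁆ =
      ⁅y, ⁅x, ((LieAlgebra.ad K g y) ^ k) z⁆⁆ +
      (v t - k * γ t) • ((LieAlgebra.ad K g y) ^ k) z := fun k => by
    have h := rs_pow hy hz k t
    rw [pow_succ', Module.End.mul_apply, LieAlgebra.ad_apply, leibniz_lie, ← ht, h, add_comm]
    congr 2
    simp [sub_eq_add_neg]
  induction k with
  | zero => rw [key]; simp [hxz]
  | succ k ih =>
    rw [key, ih, lie_smul, ← LieAlgebra.ad_apply K, ← Module.End.mul_apply, ← pow_succ',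
      ← add_smul]
    congr 1; push_cast; ring
theorem rs_null {γ : Module.Dual K T.H} (hγ : γ ≠ 0) {x y : g} {t : T.H} (ht : (t : g) = ⁅x, y⁆)
    (hx : x ∈ rootSpaceOf T.H γ) (hy : y ∈ rootSpaceOf T.H (-γ)) (h0 : γ t = 0) : t = 0 := by
  refine H_zero' t fun v hv => ?_
  by_contra hvt
  obtain ⟨z, hz, hz0⟩ := (Submodule.ne_bot_iff _).1 hv
  obtain ⟨k, hk, hk'⟩ := rs_last hγ hx hz hz0
  have hz' := rs_pow hx hz k
  obtain ⟨m, hm⟩ := rs_nilp (neg_ne_zero.2 hγ) hy hz'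
  have : ∀ m, ((LieAlgebra.ad K g y) ^ m) (((LieAlgebra.ad K g x) ^ k) z) ≠ 0 := fun m => by
    induction m with
    | zero => simpa using hk
    | succ m ih =>
      intro h
      have := rs_string ht hy hz' hk' m
      rw [h, lie_zero] at this
      refine (smul_ne_zero (mul_ne_zero ?_ ?_) ih) this.symm
      · exact_mod_cast m.succ_ne_zero
      · simpa [h0] using hvt
  exact this m hm
end PA
set_option linter.style.haveILetI false
section PB
variable {K g : Type*} [Field K] [LieRing g] [LieAlgebra K g]
  {T : TriangularDecomposition K g}
structure Tri (T : TriangularDecomposition K g) (γ : Module.Dual K T.H) (e f : g) (h : T.H) :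
    Prop where
  he : e ∈ rootSpaceOf T.H γ
  hf : f ∈ rootSpaceOf T.H (-γ)
  hh : (h : g) = ⁅e, f⁆
  h2 : γ h = 2
theorem Tri.symm {γ : Module.Dual K T.H} {e f : g} {h : T.H} (t : Tri T γ e f h) :
    Tri T (-γ) f e (-h) :=
  ⟨t.hf, by rw [neg_neg]; exact t.he, by rw [← lie_skew, ← t.hh]; rfl, by simpa using t.h2⟩
variable [LieAlgebra.IsSemisimple K g] [CharZero K]
variable {γ v : Module.Dual K T.H} {e f z : g} {h : T.H}
theorem Tri.ne (t : Tri T γ e f h) : γ ≠ 0 := fun h0 => by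
  have := t.h2; rw [h0] at this; simp at this
theorem Tri.prim (t : Tri T γ e f h) (hz : z ∈ rootSpaceOf T.H v) (h0 : z ≠ 0) (hez : ⁅e, z⁆ = 0) :
    ∃ N : ℕ, v h = N ∧ ∀ i ≤ N, ((LieAlgebra.ad K g f) ^ i) z ≠ 0 := by
  have key : ∀ i : ℕ, (∀ j < i, v h ≠ j) → ((LieAlgebra.ad K g f) ^ i) z ≠ 0 := fun i => by
    induction i with
    | zero => intro _; simpa using h0
    | succ i ih =>
      intro hj hc
      have := rs_string t.hh t.hf hz hez i
      rw [hc, lie_zero, t.h2] at this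
      refine smul_ne_zero (mul_ne_zero ?_ ?_) (ih fun j hji => hj j (by omega)) this.symm
      · exact_mod_cast i.succ_ne_zero
      · simpa [sub_eq_zero] using hj i (by omega)
  obtain ⟨k, hk⟩ := rs_nilp (neg_ne_zero.2 t.ne) t.hf hz
  have : ∃ N : ℕ, v h = N := by
    by_contra hc; push Not at hc
    exact key k (fun j _ => hc j) hk
  obtain ⟨N, hN⟩ := this
  refine ⟨N, hN, fun i hi => key i fun j hj => ?_⟩
  rw [hN]; exact_mod_cast (by omega : N ≠ j)
theorem Tri.one (t : Tri T γ e f h) (hz : z ∈ rootSpaceOf T.H γ) : ∃ c : K, z = c • e := by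
  have hm : ⁅z, f⁆ ∈ T.H := rs_zero _ (by have := rs_lie hz t.hf; rwa [add_neg_cancel] at this)
  let c := γ ⟨_, hm⟩ / 2
  refine ⟨c, ?_⟩
  have hz' : z - c • e ∈ rootSpaceOf T.H γ := sub_mem hz (Submodule.smul_mem _ _ t.he)
  have h0 : (⟨_, hm⟩ - c • h : T.H) = 0 := by
    refine rs_null (x := z - c • e) (y := f) t.ne ?_ hz' t.hf ?_
    · simp [t.hh]
    · rw [map_sub, map_smul, t.h2]; simp [c]
  by_contra hne
  have hne : z - c • e ≠ 0 := sub_ne_zero.2 hne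
  obtain ⟨N, hN, -⟩ := t.symm.prim hz' hne (by
    have := congrArg Subtype.val h0
    rw [← lie_skew, sub_lie, smul_lie, ← t.hh, neg_eq_zero]; exact this)
  rw [map_neg, t.h2] at hN
  have : ((2 + N : ℕ) : K) = 0 := by push_cast; rw [← hN]; ring
  exact absurd (Nat.cast_eq_zero.1 this) (by omega)
theorem Tri.two (t : Tri T γ e f h) : rootSpaceOf T.H (γ + γ) = ⊥ := by
  by_contra hne
  obtain ⟨z, hz, hz0⟩ := (Submodule.ne_bot_iff _).1 hne
  obtain ⟨k, hk, hk'⟩ := rs_last t.ne t.he hz hz0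
  have hw := rs_pow t.he hz k
  have h1 := rs_string t.hh t.hf hw hk' k
  have h2 : ((LieAlgebra.ad K g f) ^ (k + 1)) (((LieAlgebra.ad K g e) ^ k) z) ∈
      rootSpaceOf T.H γ := by
    convert rs_pow t.hf hw (k + 1) using 2
    rw [succ_nsmul, smul_neg]; abel
  obtain ⟨c, hc⟩ := t.one h2
  rw [hc, lie_smul, lie_self, smul_zero] at h1
  obtain ⟨N, hN, hN'⟩ := t.prim hw hk hk'
  have e1 : (γ + γ + k • γ) h = ((4 + 2 * k : ℕ) : K) := by
    simp [t.h2]; ring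
  refine smul_ne_zero (mul_ne_zero ?_ ?_) (hN' k ?_) h1.symm
  · exact_mod_cast k.succ_ne_zero
  · rw [e1, t.h2, mul_div_assoc, div_self two_ne_zero, mul_one, ← Nat.cast_sub (by omega)]
    exact_mod_cast (by omega : 4 + 2 * k - k ≠ 0)
  · rw [e1] at hN; have := Nat.cast_injective hN; omega
theorem Tri.int (t : Tri T γ e f h) (hv : rootSpaceOf T.H v ≠ ⊥) : ∃ m : ℤ, v h = m := by
  obtain ⟨z, hz, hz0⟩ := (Submodule.ne_bot_iff _).1 hv
  obtain ⟨k, hk, hk'⟩ := rs_last t.ne t.he hz hz0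
  obtain ⟨N, hN, -⟩ := t.prim (rs_pow t.he hz k) hk hk'
  refine ⟨N - 2 * k, ?_⟩
  simp [t.h2] at hN
  push_cast; rw [← hN]; ring
theorem Tri.refl0 (t : Tri T γ e f h) (hv : rootSpaceOf T.H v ≠ ⊥) {m : ℕ} (hm : v h = m) :
    rootSpaceOf T.H (v - v h • γ) ≠ ⊥ := by
  obtain ⟨z, hz, hz0⟩ := (Submodule.ne_bot_iff _).1 hv
  obtain ⟨k, hk, hk'⟩ := rs_last t.ne t.he hz hz0
  obtain ⟨N, hN, hN'⟩ := t.prim (rs_pow t.he hz k) hk hk'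
  have : m + 2 * k = N := by
    simp [t.h2, hm] at hN
    rw [mul_comm]; exact_mod_cast hN
  refine (Submodule.ne_bot_iff _).2 ⟨_, ?_, hN' (k + m) (by omega)⟩
  convert rs_pow t.hf (rs_pow t.he hz k) (k + m) using 2
  rw [hm, Nat.cast_smul_eq_nsmul, add_smul, smul_neg, smul_neg]; abel
theorem Tri.refl (t : Tri T γ e f h) (hv : rootSpaceOf T.H v ≠ ⊥) : rootSpaceOf T.H (v - v h • γ) ≠ ⊥ := by
  obtain ⟨m, hm⟩ := t.int hv
  rcases Int.eq_nat_or_neg m with ⟨n, rfl | rfl⟩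
  · exact t.refl0 hv (m := n) (by simpa using hm)
  · have := t.symm.refl0 hv (m := n) (by simp [hm])
    simpa using this
theorem Tri.up (t : Tri T γ e f h) (hz : z ∈ rootSpaceOf T.H v) (h0 : z ≠ 0) {n : ℕ} (hn : v h = -n)
    (h1 : ∀ y ∈ rootSpaceOf T.H v, ∃ c : K, y = c • z) : ((LieAlgebra.ad K g e) ^ n) z ≠ 0 := by
  obtain ⟨k, hk, hk'⟩ := rs_last t.symm.ne t.hf hz h0
  obtain ⟨N, hN, hN'⟩ := t.symm.prim (rs_pow t.hf hz k) hk hk'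
  have : n + 2 * k = N := by
    simp [t.h2, hn] at hN
    rw [mul_comm]; exact_mod_cast hN
  obtain ⟨c, hc⟩ := h1 _ (by
    have := rs_pow t.he (rs_pow t.hf hz k) k
    rwa [add_assoc, ← smul_add, neg_add_cancel, smul_zero, add_zero] at this)
  have := hN' (n + k) (by omega)
  rw [pow_add, Module.End.mul_apply, hc, map_smul] at this
  exact fun h => this (by rw [h, smul_zero])
noncomputable def kap (T : TriangularDecomposition K g) (a b : T.H) : K :=
  ∑ v ∈ (wts_fin (T := T)).toFinset, v a * v b
theorem Tri.kp (t : Tri T γ e f h) (h' : T.H) : 2 * kap T h h' = γ h' * kap T h h := by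
  have e : kap T h h' = ∑ v ∈ (wts_fin (T := T)).toFinset,
      (v - v h • γ) h * (v - v h • γ) h' := by
    refine Finset.sum_nbij' (fun v => v - v h • γ) (fun v => v - v h • γ) ?_ ?_ ?_ ?_ ?_
    · intro v hv; simp only [Set.Finite.mem_toFinset, Set.mem_ofPred_eq] at hv ⊢; exact t.refl hv
    · intro v hv; simp only [Set.Finite.mem_toFinset, Set.mem_ofPred_eq] at hv ⊢; exact t.refl hv
    · intro v _; ext x; simp [t.h2]; ring
    · intro v _; ext x; simp [t.h2]; ring
    · intro v _; simp [t.h2]; ring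
  have e2 : kap T h h' = - kap T h h' + γ h' * kap T h h := by
    conv_lhs => rw [e]
    simp only [kap]
    rw [Finset.mul_sum, ← Finset.sum_neg_distrib, ← Finset.sum_add_distrib]
    refine Finset.sum_congr rfl fun v _ => ?_
    simp [t.h2]; ring
  linear_combination e2
theorem Tri.kap_pos (t : Tri T γ e f h) : ∃ m : ℕ, 0 < m ∧ kap T h h = m := by
  have hi : ∀ v ∈ (wts_fin (T := T)).toFinset, ∃ n : ℕ, v h * v h = n := fun v hv => by
    obtain ⟨m, hm⟩ := t.int (v := v) (by simpa using hv)
    refine ⟨m.natAbs ^ 2, ?_⟩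
    rw [hm, ← Int.cast_mul, ← pow_two, ← Int.natAbs_sq]; norm_cast
  choose! n hn using hi
  refine ⟨∑ v ∈ (wts_fin (T := T)).toFinset, n v, ?_, ?_⟩
  · have hmem : γ ∈ (wts_fin (T := T)).toFinset := by
      simp only [Set.Finite.mem_toFinset, Set.mem_ofPred_eq]
      refine (Submodule.ne_bot_iff _).2 ⟨e, t.he, fun h0 => ?_⟩
      have := t.hh; rw [h0, zero_lie] at this
      have h2 := t.h2
      rw [show h = 0 from Subtype.ext this] at h2; simp at h2
    refine lt_of_lt_of_le ?_ (Finset.single_le_sum (fun _ _ => Nat.zero_le _) hmem)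
    have := hn _ hmem
    rw [t.h2] at this
    rcases Nat.eq_zero_or_pos (n γ) with h0 | h0
    · rw [h0] at this; norm_num at this
    · exact h0
  · rw [kap, Finset.sum_congr rfl hn]; push_cast; rfl
/-- a root is real as soon as some bracket is nonzero -/
theorem real_of {γ : Module.Dual K T.H} (hγ : γ ≠ 0) {x y : g} (hx : x ∈ rootSpaceOf T.H γ)
    (hy : y ∈ rootSpaceOf T.H (-γ)) (hxy : ⁅x, y⁆ ≠ 0) : ∃ f h, Tri T γ x f h := by
  have hm : ⁅x, y⁆ ∈ T.H := rs_zero _ (by have := rs_lie hx hy; rwa [add_neg_cancel] at this)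
  have h0 : γ ⟨_, hm⟩ ≠ 0 := fun h0 =>
    hxy (congrArg Subtype.val (rs_null (t := ⟨_, hm⟩) hγ rfl hx hy h0))
  refine ⟨(2 / γ ⟨_, hm⟩) • y, (2 / γ ⟨_, hm⟩) • ⟨_, hm⟩, hx, Submodule.smul_mem _ _ hy, ?_, ?_⟩
  · simp
  · rw [map_smul, smul_eq_mul, div_mul_cancel₀ _ h0]
/-- `β + γ` real and `γ` real with proportional coroots is impossible -/
theorem no_mix {β γ : Module.Dual K T.H} (hβ : β ≠ 0) (hβ' : rootSpaceOf T.H β ≠ ⊥)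
    {e f e' f' : g} {h h' : T.H} (t : Tri T γ e f h) (t' : Tri T (β + γ) e' f' h') {c : K}
    (hc : h' = c • h) : False := by
  obtain ⟨m, hm, hm'⟩ := t.kap_pos
  have hm0 : kap T h h ≠ 0 := by rw [hm']; exact_mod_cast hm.ne'
  have hc0 : c ≠ 0 := fun h0 => by have := t'.h2; rw [hc, h0] at this; simp at this
  -- γ = c • (β + γ)
  have hk : ∀ a b : K, ∀ x y, kap T (a • x) (b • y) = a * b * kap T x y := fun a b x y => by
    simp only [kap, Finset.mul_sum]; refine Finset.sum_congr rfl fun v _ => ?_; simp; ring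
  have hg : γ = c • (β + γ) := by
    ext x
    have h1 := t.kp x
    have h2 := t'.kp x
    have e1 := hk c 1 h x
    have e2 := hk c c h h
    rw [one_smul] at e1
    rw [hc, e1, e2] at h2
    simp only [LinearMap.smul_apply, smul_eq_mul]
    apply mul_right_cancel₀ hm0
    apply mul_left_cancel₀ hc0
    linear_combination h2 - c * h1
  have hE : ∀ {γ : Module.Dual K T.H} {e f h}, Tri T γ e f h → rootSpaceOf T.H γ ≠ ⊥ :=
    fun {γ e f h} t hb => by
      have h1 := t.he; rw [hb] at h1
      have h2 := t.hh; rw [(Submodule.mem_bot K).1 h1, zero_lie] at h2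
      have h3 := t.h2; rw [show h = 0 from Subtype.ext h2] at h3; simp at h3
  -- integers
  obtain ⟨a, ha⟩ := t.int (v := β + γ) (hE t')
  obtain ⟨b, hb⟩ := t'.int (v := γ) (hE t)
  have h1 : c * a = 2 := by have := t'.h2; rwa [hc, map_smul, ha] at this
  have h2 : c * 2 = b := by have := hb; rwa [hc, map_smul, t.h2] at this
  have hab : a * b = 4 := by
    have : (a : K) * b = 4 := by rw [← h2]; linear_combination 2 * h1
    exact_mod_cast this
  have hbb : β + γ + (β + γ) ≠ γ := fun h0 => hE t (h0 ▸ t'.two)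
  have hbb' : γ + γ ≠ β + γ := fun h0 => hE t' (h0 ▸ t.two)
  have hnb : -(β + γ) + -(β + γ) ≠ γ := fun h0 => hE t (h0 ▸ t'.symm.two)
  have hnb' : -γ + -γ ≠ β + γ := fun h0 => hE t' (h0 ▸ t.symm.two)
  have hb2 : β + γ + (β + γ) ≠ β := fun h0 => hβ' (h0 ▸ t'.two)
  have hcb : c = b / 2 := by rw [← h2]; ring
  have hdvd : b ∣ 4 := ⟨a, by rw [← hab]; ring⟩
  have hle := Int.le_of_dvd (by norm_num) hdvd
  have hge := Int.le_of_dvd (by norm_num) (neg_dvd.2 hdvd)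
  have fin : ∀ q : ℤ, b = q → (2 : K) • γ = (q : K) • (β + γ) := fun q hq => by
    conv_lhs => rw [hg]
    rw [smul_smul, hcb, hq]; congr 1; field_simp
  have hs : ∀ x y : Module.Dual K T.H, (2 : K) • x = (2 : K) • y → x = y :=
    fun x y h => smul_right_injective _ (two_ne_zero (α := K)) h
  have : b = -4 ∨ b = -2 ∨ b = -1 ∨ b = 1 ∨ b = 2 ∨ b = 4 := by
    have : b = -4 ∨ b = -3 ∨ b = -2 ∨ b = -1 ∨ b = 0 ∨ b = 1 ∨ b = 2 ∨ b = 3 ∨ b = 4 := by omega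
    rcases this with h | h | h | h | h | h | h | h | h <;> rw [h] at hab <;> omega
  rcases this with h | h | h | h | h | h <;> have := fin _ h <;> push_cast at this
  · exact hnb (hs _ _ (by rw [this]; module))
  · have h4 : γ = -(β + γ) := hs _ _ (by rw [this]; module)
    exact hb2 (by rw [add_assoc, eq_neg_iff_add_eq_zero.1 h4, add_zero])
  · exact hnb' (by rw [show -γ + -γ = -((2 : K) • γ) by module, this]; module)
  · exact hbb' (by rw [one_smul, two_smul] at this; exact this)
  · exact hβ (by have := hs _ _ this; simpa using this)
  · exact hbb (hs _ _ (by rw [this]; module))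
theorem all_real {γ : Module.Dual K T.H} (hγ : γ ≠ 0) (hγ' : rootSpaceOf T.H γ ≠ ⊥) :
    ∃ e f h, Tri T γ e f h := by
  let NR : Module.Dual K T.H → Prop := fun β => β ≠ 0 ∧ ∀ x ∈ rootSpaceOf T.H β,
    ∀ y ∈ rootSpaceOf T.H (-β), ⁅x, y⁆ = 0
  have key : ∀ β, NR β → ∀ x ∈ rootSpaceOf T.H β, ∀ w, ∀ y ∈ rootSpaceOf T.H w, ⁅y, x⁆ ≠ 0 →
      NR (w + β) := fun β hβ x hx w y hy hxy => by
    have hm := rs_lie hy hx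
    have h0 : w + β ≠ 0 := fun h0 => hxy (by
      rw [← lie_skew, hβ.2 x hx y (by rwa [eq_neg_of_add_eq_zero_left h0] at hy), neg_zero])
    by_contra hn
    have hn' : ∃ x1 ∈ rootSpaceOf T.H (w + β), ∃ y1 ∈ rootSpaceOf T.H (-(w + β)), ⁅x1, y1⁆ ≠ 0 := by
      by_contra hc; push Not at hc; exact hn ⟨h0, hc⟩
    obtain ⟨x1, hx1, y1, hy1, h1⟩ := hn'
    obtain ⟨f1, h1, t1⟩ := real_of h0 hx1 hy1 h1
    obtain ⟨c, hc⟩ := t1.one hm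
    obtain ⟨f', h', t'⟩ := real_of h0 hm t1.hf (by
      rw [hc, smul_lie, ← t1.hh]
      refine smul_ne_zero (fun h => hxy (by rw [hc, h, zero_smul])) fun h => ?_
      have := t1.h2; rw [show h1 = 0 from Subtype.ext h] at this; simp at this)
    have hu : ⁅x, f'⁆ ∈ rootSpaceOf T.H (-w) := by
      convert rs_lie hx t'.hf using 2; abel
    have hv : ⁅x, ⁅y, f'⁆⁆ = 0 := hβ.2 x hx _ (by convert rs_lie hy t'.hf using 2; abel)
    have hh := t'.hh
    rw [lie_lie, hv, sub_zero] at hh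
    have hw : w ≠ 0 := fun hw => hn (by rw [hw, zero_add]; exact hβ)
    obtain ⟨f, h, t⟩ := real_of hw hy hu (by
      rw [← hh]; intro h
      have := t'.h2; rw [show h' = 0 from Subtype.ext h] at this; simp at this)
    obtain ⟨c', hc'⟩ := t.symm.one hu
    rw [hc', lie_smul, ← t.hh] at hh
    refine no_mix (β := β) (γ := w) hβ.1 ?_ t (by rwa [add_comm β w]) (c := c') (Subtype.ext hh)
    exact (Submodule.ne_bot_iff _).2 ⟨x, hx, fun h => hxy (by rw [h, lie_zero])⟩
  let N : LieIdeal K g :=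
    { (⨆ (β : Module.Dual K T.H) (_ : NR β), rootSpaceOf T.H β) with
      lie_mem := fun {y x} hx => by
        change ⁅y, x⁆ ∈ ⨆ (β : Module.Dual K T.H) (_ : NR β), rootSpaceOf T.H β
        have h1 : (⨆ (β : Module.Dual K T.H) (_ : NR β), rootSpaceOf T.H β) ≤
            (⨆ (β : Module.Dual K T.H) (_ : NR β), rootSpaceOf T.H β).comap
              (LieAlgebra.ad K g y) := by
          refine iSup₂_le fun β hβ x hx => ?_
          have h2 := rs_top' (T := T) y
          change ⁅y, x⁆ ∈ ⨆ (β : Module.Dual K T.H) (_ : NR β), rootSpaceOf T.H β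
          rw [← lie_skew]
          refine (show _ ≤ (⨆ (β : Module.Dual K T.H) (_ : NR β), rootSpaceOf T.H β).comap
              (-(LieAlgebra.ad K g x)) from iSup₂_le fun w _ y hy => ?_) h2
          change -⁅x, y⁆ ∈ ⨆ (β : Module.Dual K T.H) (_ : NR β), rootSpaceOf T.H β
          rw [lie_skew]
          by_cases h0 : ⁅y, x⁆ = 0
          · rw [h0]; exact zero_mem _
          · exact Submodule.mem_iSup_of_mem _
              (Submodule.mem_iSup_of_mem (key β hβ x hx w y hy h0) (rs_lie hy hx))
        exact h1 hx }
  have hNmem : ∀ x, x ∈ N ↔ x ∈ ⨆ (β : Module.Dual K T.H) (_ : NR β), rootSpaceOf T.H β :=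
    fun x => Iff.rfl
  have hN0 : ∀ x ∈ N, x ∈ T.H → x = 0 := fun x hx hH => by
    classical
    refine rs_indep ((wts_fin (T := T)).toFinset.filter NR) 0
      (fun h => (Finset.mem_filter.1 h).2.1 rfl) x (H_sub ⟨x, hH⟩) ?_
    refine (show (⨆ (β : Module.Dual K T.H) (_ : NR β), rootSpaceOf T.H β) ≤ _ from
      iSup₂_le fun β hβ => ?_) ((hNmem x).1 hx)
    by_cases hb : rootSpaceOf T.H β = ⊥
    · rw [hb]; exact bot_le
    · exact le_iSup₂_of_le β (by simp [hb, hβ]) le_rfl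
  obtain ⟨N', hN'⟩ := exists_isCompl N
  have hdis : ∀ x, x ∈ N → x ∈ N' → x = 0 := fun x h1 h2 => by
    have : x ∈ N ⊓ N' := ⟨h1, h2⟩
    rwa [hN'.inf_eq_bot, LieSubmodule.mem_bot] at this
  have hH : ∀ h : T.H, (h : g) ∈ N' := fun h => by
    have : (h : g) ∈ N ⊔ N' := by rw [hN'.sup_eq_top]; trivial
    obtain ⟨a, ha, b, hb, hab⟩ := LieSubmodule.mem_sup _ _ _ |>.1 this
    have : a = 0 := hN0 a ha (rs_zero a fun h' => by
      rw [LinearMap.zero_apply, zero_smul]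
      refine hdis _ (N.lie_mem ha) ?_
      have := H_sub h h'
      rw [← hab, lie_add, LinearMap.zero_apply, zero_smul] at this
      rw [eq_neg_of_add_eq_zero_left this]
      exact neg_mem (N'.lie_mem hb))
    rw [← hab, this, zero_add]; exact hb
  by_contra hcon
  obtain ⟨x, hx, hx0⟩ := (Submodule.ne_bot_iff _).1 hγ'
  have hNRγ : NR γ := ⟨hγ, fun x hx y hy => by
    by_contra h0
    obtain ⟨f, h, t⟩ := real_of hγ hx hy h0
    exact hcon ⟨_, _, _, t⟩⟩
  have hxN : x ∈ N := (hNmem x).2 (Submodule.mem_iSup_of_mem _ (Submodule.mem_iSup_of_mem hNRγ hx))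
  refine hx0 (hN0 x hxN (rs_zero x fun h' => ?_))
  rw [LinearMap.zero_apply, zero_smul]
  refine hdis _ (N.lie_mem hxN) ?_
  rw [← lie_skew]
  exact neg_mem (N'.lie_mem (hH h'))
end PB
section
variable {K g : Type*} [Field K] [LieRing g] [LieAlgebra K g] {T : TriangularDecomposition K g}
  [LieAlgebra.IsSemisimple K g] [CharZero K]
open Classical in
noncomputable def PR (T : TriangularDecomposition K g) : Finset (Module.Dual K T.H) :=
  T.posRoots.filter fun v => rootSpaceOf T.H v ≠ ⊥
theorem PR_mem {v : Module.Dual K T.H} (h : v ∈ PR T) : v ≠ 0 ∧ rootSpaceOf T.H v ≠ ⊥ := by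
  classical
  obtain ⟨h1, h2⟩ := Finset.mem_filter.1 h
  exact ⟨T.posRoots_ne_zero v h1, h2⟩
theorem PR_np : T.npos.toSubmodule = ⨆ v ∈ PR T, rootSpaceOf T.H v := by
  classical
  rw [T.npos_eq]
  refine le_antisymm (iSup₂_le fun v hv => ?_)
    (iSup₂_le fun v hv => le_iSup₂_of_le v (Finset.mem_filter.1 hv).1 le_rfl)
  by_cases hb : rootSpaceOf T.H v = ⊥
  · rw [hb]; exact bot_le
  · exact le_iSup₂_of_le v (Finset.mem_filter.2 ⟨hv, hb⟩) le_rfl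
theorem PR_of {v : Module.Dual K T.H} {x : g} (hx : x ∈ rootSpaceOf T.H v) (h0 : x ≠ 0)
    (h : x ∈ T.npos) : v ∈ PR T := by
  by_contra hn
  refine h0 (rs_indep (PR T) v hn x hx ?_)
  rw [← PR_np]; exact h
theorem PR_sub {v : Module.Dual K T.H} (hv : v ∈ PR T) {x : g} (hx : x ∈ rootSpaceOf T.H v) :
    x ∈ T.npos := by
  change x ∈ T.npos.toSubmodule
  rw [PR_np]; exact Submodule.mem_iSup_of_mem v (Submodule.mem_iSup_of_mem hv hx)
theorem PR_neg {v : Module.Dual K T.H} (hv : v ∈ PR T) : -v ∉ PR T := fun h => by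
  classical
  obtain ⟨x, hx, h0⟩ := (Submodule.ne_bot_iff _).1 (PR_mem hv).2
  have h1 : x ∈ T.nneg := by
    change x ∈ T.nneg.toSubmodule
    rw [T.nneg_eq]
    exact Submodule.mem_iSup_of_mem (-v) (Submodule.mem_iSup_of_mem (Finset.mem_filter.1 h).1
      (by rwa [neg_neg]))
  obtain ⟨t, -, ht⟩ := T.decomp x
  have e1 := ht (⟨x, h1⟩, 0, 0) (by simp)
  have e2 := ht (0, 0, ⟨x, PR_sub hv hx⟩) (by simp)
  have := congrArg (fun t => (t.1 : g)) (e1.trans e2.symm)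
  exact h0 (by simpa using this)
theorem PR_sum {α : Module.Dual K T.H} (hα : α ∈ PR T) {e f : g} {h : T.H} (t : Tri T α e f h) :
    ∃ m : ℕ, 0 < m ∧ ∑ β ∈ PR T, β h = m := by
  classical
  choose! m hm using fun β (hβ : β ∈ PR T) => t.int (PR_mem hβ).2
  have h2 : m α = 2 := by have := hm α hα; rw [t.h2] at this; exact_mod_cast this.symm
  have hs : ∀ β ∈ PR T, m β < 0 → β - (m β : K) • α ∈ PR T := fun β hβ hlt => by
    obtain ⟨z, hz, hz0⟩ := (Submodule.ne_bot_iff _).1 (PR_mem hβ).2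
    obtain ⟨n, hn⟩ := Int.eq_ofNat_of_zero_le (a := - m β) (by omega)
    obtain ⟨e', f', h', t'⟩ := all_real (PR_mem hβ).1 (PR_mem hβ).2
    have hup := t.up hz hz0 (n := n) (by
      rw [hm β hβ, show m β = -(n : ℤ) by omega]; simp) (fun y hy => by
        obtain ⟨c, rfl⟩ := t'.one hy
        obtain ⟨c', rfl⟩ := t'.one hz
        have hc : c' ≠ 0 := fun h => hz0 (by rw [h, zero_smul])
        exact ⟨c / c', by rw [smul_smul, div_mul_cancel₀ _ hc]⟩)
    have hin : ∀ n : ℕ, ((LieAlgebra.ad K g e) ^ n) z ∈ T.npos := fun n => by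
      induction n with
      | zero => simpa using PR_sub hβ hz
      | succ n ih => rw [pow_succ']; exact T.npos.lie_mem (PR_sub hα t.he) ih
    have := PR_of (rs_pow t.he hz n) hup (hin n)
    rw [show m β = -(n : ℤ) by omega]
    convert this using 1
    rw [← Nat.cast_smul_eq_nsmul K]; push_cast; module
  have e1 : ∑ β ∈ PR T, m β = ∑ β ∈ (PR T).filter (fun β => m β < 0), m β +
      ∑ β ∈ (PR T).filter (fun β => ¬ m β < 0), m β := (Finset.sum_filter_add_sum_filter_not ..).symm
  have hval : ∀ β ∈ PR T, m β < 0 → m (β - (m β : K) • α) = - m β := fun β hβ hlt => by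
    have := hm _ (hs β hβ hlt)
    simp [hm β hβ, t.h2] at this
    have h3 : ((m (β - (m β : K) • α) : ℤ) : K) = ((- m β : ℤ) : K) := by
      rw [← this]; push_cast; ring
    exact_mod_cast h3
  have e2 : ∑ β ∈ (PR T).filter (fun β => m β < 0), - m β ≤
      ∑ β ∈ ((PR T).filter (fun β => ¬ m β < 0)).erase α, m β := by
    rw [Finset.sum_congr rfl (g := fun β => m (β - (m β : K) • α)) (fun β hβ => by
      rw [Finset.mem_filter] at hβ; rw [hval β hβ.1 hβ.2]),
      ← Finset.sum_image (f := m) (g := fun β => β - (m β : K) • α)]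
    · refine Finset.sum_le_sum_of_subset_of_nonneg (fun γ hγ => ?_) (fun γ hγ _ => ?_)
      · obtain ⟨β, hβ, rfl⟩ := Finset.mem_image.1 hγ
        rw [Finset.mem_filter] at hβ
        refine Finset.mem_erase.2 ⟨fun h => ?_, Finset.mem_filter.2 ⟨hs β hβ.1 hβ.2, ?_⟩⟩
        · have := hval β hβ.1 hβ.2
          rw [h, h2] at this
          have h5 : m β = -2 := by omega
          refine PR_neg hα ?_
          convert hβ.1
          have h6 : β = α + (m β : K) • α := (sub_eq_iff_eq_add.1 h)
          rw [h6, h5]; push_cast; module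
        · rw [hval β hβ.1 hβ.2]; omega
      · simp only [Finset.mem_erase, Finset.mem_filter] at hγ; omega
    · intro β hβ γ hγ heq
      simp only [Finset.coe_filter, Set.mem_ofPred_eq] at hβ hγ
      have h1 := hval β hβ.1 hβ.2
      have h2 := hval γ hγ.1 hγ.2
      simp only at heq
      rw [heq] at h1
      rw [show m β = m γ by omega] at heq
      exact sub_left_injective heq
  have e3 := Finset.add_sum_erase ((PR T).filter (fun β => ¬ m β < 0)) m
    (a := α) (Finset.mem_filter.2 ⟨hα, by omega⟩)
  rw [Finset.sum_neg_distrib] at e2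
  refine ⟨(∑ β ∈ PR T, m β).toNat, by omega, ?_⟩
  rw [Finset.sum_congr rfl hm, ← Int.cast_sum]
  have : ((∑ β ∈ PR T, m β).toNat : ℤ) = ∑ β ∈ PR T, m β := Int.toNat_of_nonneg (by omega)
  exact_mod_cast (congrArg (Int.cast : ℤ → K) this.symm)
theorem ex_delta (T : TriangularDecomposition K g) :
    ∃ δ : T.H, ∀ α ∈ PR T, ∃ m : ℕ, 0 < m ∧ α δ = m := by
  classical
  choose! e f h t using fun β (hβ : β ∈ PR T) => all_real (PR_mem hβ).1 (PR_mem hβ).2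
  choose! k hk0 hk using fun β (hβ : β ∈ PR T) => (t β hβ).kap_pos
  have hk' : ∀ β ∈ PR T, (k β : K) ≠ 0 := fun β hβ => by exact_mod_cast (hk0 β hβ).ne'
  refine ⟨∑ β ∈ PR T, ((∏ γ ∈ PR T, k γ : ℕ) / k β : K) • h β, fun α hα => ?_⟩
  obtain ⟨m, hm0, hm⟩ := PR_sum hα (t α hα)
  refine ⟨(∏ γ ∈ (PR T).erase α, k γ) * m, Nat.mul_pos (Finset.prod_pos fun γ hγ =>
    hk0 γ (Finset.mem_of_mem_erase hγ)) hm0, ?_⟩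
  rw [map_sum]
  push_cast
  rw [← hm, Finset.mul_sum]
  refine Finset.sum_congr rfl fun β hβ => ?_
  have h1 := (t α hα).kp (h β)
  have h2 := (t β hβ).kp (h α)
  rw [hk α hα] at h1
  rw [hk β hβ] at h2
  have h3 : kap T (h α) (h β) = kap T (h β) (h α) := by simp only [kap, mul_comm]
  rw [← h3, h1] at h2
  rw [map_smul, smul_eq_mul, ← Finset.mul_prod_erase _ _ hα, div_mul_eq_mul_div,
    div_eq_iff (hk' β hβ)]
  linear_combination (∏ x ∈ (PR T).erase α, (k x : K)) * h2
theorem PR_of_neg {α : Module.Dual K T.H} (hα : α ∈ T.posRoots) {x : g}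
    (hx : x ∈ rootSpaceOf T.H (-α)) (h0 : x ≠ 0) : α ∈ PR T := by
  classical
  obtain ⟨e, f, h, t⟩ := all_real (neg_ne_zero.2 (T.posRoots_ne_zero α hα))
    ((Submodule.ne_bot_iff _).2 ⟨x, hx, h0⟩)
  refine Finset.mem_filter.2 ⟨hα, (Submodule.ne_bot_iff _).2 ⟨f, ?_, fun hf => ?_⟩⟩
  · have := t.hf; rwa [neg_neg] at this
  · have h1 := t.hh
    rw [hf, lie_zero] at h1
    have := t.h2; rw [show h = 0 from Subtype.ext h1] at this; simp at this
theorem H_sep (h : T.H) (hp : ∀ α ∈ PR T, α h = 0) : h = 0 := by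
  classical
  refine H_zero h (fun h' => H_abel T h h') (fun α hα x hx => ?_) (fun α hα x hx => ?_)
  · by_cases h0 : x = 0
    · rw [h0, lie_zero]
    · rw [hx h, hp α (Finset.mem_filter.2 ⟨hα, (Submodule.ne_bot_iff _).2 ⟨x, hx, h0⟩⟩), zero_smul]
  · by_cases h0 : x = 0
    · rw [h0, lie_zero]
    · rw [hx h]; simp [hp α (PR_of_neg hα hx h0)]
theorem H_fd : FiniteDimensional K T.H :=
  Module.Finite.of_injective (LinearMap.pi fun α : PR T => (α : Module.Dual K T.H))
    (LinearMap.ker_eq_bot.1 (LinearMap.ker_eq_bot'.2 fun h hh =>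
      H_sep h fun α hα => congrFun hh ⟨α, hα⟩))
/-- Root data package. -/
structure RD (K g : Type*) [Field K] [LieRing g] [LieAlgebra K g] where
  n : ℕ
  r : ℕ
  b : Module.Basis (Fin n ⊕ Fin n ⊕ Fin r) K g
  w : Fin n ⊕ Fin n ⊕ Fin r → Fin r → K
  w_f : ∀ a, w (.inr (.inl a)) = - w (.inl a)
  w_h : ∀ i, w (.inr (.inr i)) = 0
  lie_h : ∀ i k, ⁅b (.inr (.inr i)), b k⁆ = w k i • b k
  d : Fin r → K
  z : Fin n ⊕ Fin n ⊕ Fin r → ℤ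
  z_e : ∀ a, 0 < z (.inl a)
  z_f : ∀ a, z (.inr (.inl a)) = - z (.inl a)
  z_h : ∀ i, z (.inr (.inr i)) = 0
  z_eq : ∀ k, ∑ i, d i * w k i = z k
  inj : Function.Injective fun a : Fin n => w (.inl a)
  sp : ∀ c : Fin r → K, (∀ a : Fin n, ∑ i, c i * w (.inl a) i = 0) → c = 0
abbrev RD.ix {K g : Type*} [Field K] [LieRing g] [LieAlgebra K g] (D : RD K g) :=
  Fin D.n ⊕ Fin D.n ⊕ Fin D.r
theorem ex_RD (T : TriangularDecomposition K g) : ∃ D : RD K g,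
    T.npos.toSubmodule = Submodule.span K (Set.range fun a => D.b (.inl a)) ∧
    T.H.toSubmodule = Submodule.span K (Set.range fun i => D.b (.inr (.inr i))) := by
  classical
  haveI := H_fd (T := T)
  obtain ⟨δ, hδ⟩ := ex_delta T
  let n := (PR T).card
  let r := Module.finrank K T.H
  let hb : Module.Basis (Fin r) K T.H := Module.finBasis K T.H
  let q : Fin n → Module.Dual K T.H := fun a => ((PR T).equivFin.symm a : Module.Dual K T.H)
  have hq : ∀ a, q a ∈ PR T := fun a => ((PR T).equivFin.symm a).2
  have hqi : Function.Injective q := Subtype.val_injective.comp (Equiv.injective _)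
  have hqs : ∀ α ∈ PR T, ∃ a, q a = α := fun α hα => ⟨(PR T).equivFin ⟨α, hα⟩, by simp [q]⟩
  choose e f h t using fun a => all_real (PR_mem (hq a)).1 (PR_mem (hq a)).2
  have he0 : ∀ a, e a ≠ 0 := fun a h1 => by
    have h3 := (t a).hh
    rw [h1, zero_lie] at h3
    have := (t a).h2; rw [show h a = 0 from Subtype.ext h3] at this; simp at this
  have hf0 : ∀ a, f a ≠ 0 := fun a h1 => by
    have h3 := (t a).hh
    rw [h1, lie_zero] at h3
    have := (t a).h2; rw [show h a = 0 from Subtype.ext h3] at this; simp at this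
  obtain ⟨h0, hs⟩ := rs_sep (PR T)
  have hi : Function.Injective fun a => q a h0 := fun a a' h => hqi (hs _ (hq a) _ (hq a') h)
  have lie : LinearIndependent K e := Module.End.eigenvectors_linearIndependent'
    (LieAlgebra.ad K g (h0 : g)) (fun a => q a h0) hi e fun a =>
      ⟨Module.End.mem_eigenspace_iff.2 ((t a).he h0), he0 a⟩
  have lif : LinearIndependent K f := Module.End.eigenvectors_linearIndependent'
    (LieAlgebra.ad K g (h0 : g)) (fun a => -(q a h0)) (fun a a' h => hi (neg_injective h)) f fun a =>
      ⟨Module.End.mem_eigenspace_iff.2 ((t a).hf h0), hf0 a⟩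
  have hn : T.npos.toSubmodule = Submodule.span K (Set.range e) := by
    rw [PR_np]
    refine le_antisymm (iSup₂_le fun v hv x hx => ?_) (Submodule.span_le.2 ?_)
    · obtain ⟨a, rfl⟩ := hqs v hv
      obtain ⟨c, rfl⟩ := (t a).one hx
      exact Submodule.smul_mem _ _ (Submodule.subset_span ⟨a, rfl⟩)
    · rintro _ ⟨a, rfl⟩
      exact Submodule.mem_iSup_of_mem _ (Submodule.mem_iSup_of_mem (hq a) (t a).he)
  have hm : T.nneg.toSubmodule = Submodule.span K (Set.range f) := by
    rw [T.nneg_eq]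
    refine le_antisymm (iSup₂_le fun v hv x hx => ?_) (Submodule.span_le.2 ?_)
    · by_cases hx0 : x = 0
      · rw [hx0]; exact zero_mem _
      obtain ⟨a, rfl⟩ := hqs v (PR_of_neg hv hx hx0)
      obtain ⟨c, rfl⟩ := (t a).symm.one hx
      exact Submodule.smul_mem _ _ (Submodule.subset_span ⟨a, rfl⟩)
    · rintro _ ⟨a, rfl⟩
      exact Submodule.mem_iSup_of_mem _ (Submodule.mem_iSup_of_mem
        (Finset.mem_filter.1 (hq a)).1 (t a).hf)
  have hH : T.H.toSubmodule = Submodule.span K (Set.range fun i => (hb i : g)) := by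
    rw [Set.range_comp' Subtype.val hb]
    have := congrArg (Submodule.map T.H.toSubmodule.subtype) hb.span_eq
    rw [Submodule.map_span, Submodule.map_top, Submodule.range_subtype] at this
    exact this.symm
  let v : Fin n ⊕ Fin n ⊕ Fin r → g := Sum.elim e (Sum.elim f fun i => (hb i : g))
  have hli : LinearIndependent K v := by
    rw [Fintype.linearIndependent_iff]
    intro c hc
    simp only [Fintype.sum_sum_type, v, Sum.elim_inl, Sum.elim_inr] at hc
    have m1 : ∑ a, c (.inl a) • e a ∈ T.npos := by
      change _ ∈ T.npos.toSubmodule; rw [hn]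
      exact sum_mem fun a _ => Submodule.smul_mem _ _ (Submodule.subset_span ⟨a, rfl⟩)
    have m2 : ∑ a, c (.inr (.inl a)) • f a ∈ T.nneg := by
      change _ ∈ T.nneg.toSubmodule; rw [hm]
      exact sum_mem fun a _ => Submodule.smul_mem _ _ (Submodule.subset_span ⟨a, rfl⟩)
    obtain ⟨s, -, hs⟩ := T.decomp 0
    have e1 := (hs (⟨_, m2⟩, ∑ i, c (.inr (.inr i)) • hb i, ⟨_, m1⟩) (by
      rw [← hc]; push_cast; abel)).trans (hs 0 (by simp)).symm
    have k1 := congrArg (fun t => (t.1 : g)) e1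
    have k2 := congrArg (fun t => t.2.1) e1
    have k3 := congrArg (fun t => (t.2.2 : g)) e1
    rintro (a | a | i)
    · exact Fintype.linearIndependent_iff.1 lie (fun a => c (.inl a)) (by simpa using k3) a
    · exact Fintype.linearIndependent_iff.1 lif (fun a => c (.inr (.inl a))) (by simpa using k1) a
    · exact Fintype.linearIndependent_iff.1 hb.linearIndependent (fun i => c (.inr (.inr i)))
        (by simpa using k2) i
  have hsp : ⊤ ≤ Submodule.span K (Set.range v) := fun x _ => by
    obtain ⟨s, rfl, -⟩ := T.decomp x
    have a1 : (s.1 : g) ∈ T.nneg.toSubmodule := s.1.2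
    have a2 : (s.2.1 : g) ∈ T.H.toSubmodule := s.2.1.2
    have a3 : (s.2.2 : g) ∈ T.npos.toSubmodule := s.2.2.2
    rw [hm] at a1; rw [hH] at a2; rw [hn] at a3
    refine add_mem (add_mem (Submodule.span_mono ?_ a1) (Submodule.span_mono ?_ a2))
      (Submodule.span_mono ?_ a3)
    · rintro _ ⟨a, rfl⟩; exact ⟨.inr (.inl a), rfl⟩
    · rintro _ ⟨a, rfl⟩; exact ⟨.inr (.inr a), rfl⟩
    · rintro _ ⟨a, rfl⟩; exact ⟨.inl a, rfl⟩
  choose m hm0 hm using fun a => hδ (q a) (hq a)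
  have hd : ∀ α : Module.Dual K T.H, ∀ c : Fin r → K, ∑ i, c i * α (hb i) = α (∑ i, c i • hb i) :=
    fun α c => by rw [map_sum]; simp
  have hzq : ∀ a, ∑ i, hb.repr δ i * q a (hb i) = m a := fun a => by
    rw [hd, hb.sum_repr, hm]
  refine ⟨⟨n, r, Module.Basis.mk hli hsp, Sum.elim (fun a i => q a (hb i))
    (Sum.elim (fun a i => -(q a (hb i))) fun _ _ => 0), fun a => rfl, fun i => rfl, ?_,
    fun i => hb.repr δ i, Sum.elim (fun a => (m a : ℤ)) (Sum.elim (fun a => -(m a : ℤ)) fun _ => 0),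
    fun a => by simpa using hm0 a, fun a => rfl, fun i => rfl, ?_, ?_, ?_⟩, ?_, ?_⟩
  · rintro i (a | a | j)
    · simpa [v] using (t a).he (hb i)
    · simpa [v] using (t a).hf (hb i)
    · simpa [v] using congrArg Subtype.val (H_abel T (hb i) (hb j))
  · rintro (a | a | j)
    · simpa using hzq a
    · simpa [Finset.sum_neg_distrib] using hzq a
    · simp
  · intro a a' haa
    exact hqi (hb.ext fun i => congrFun haa i)
  · intro c hc
    have h1 := H_sep (∑ i, c i • hb i) fun α hα => by
      obtain ⟨a, rfl⟩ := hqs α hα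
      rw [← hd]; exact hc a
    exact funext fun i => Fintype.linearIndependent_iff.1 hb.linearIndependent c h1 i
  · simpa [v] using hn
  · simpa [v] using hH
end
set_option linter.deprecated false
set_option linter.unusedVariables false
section
variable {K g : Type*} [Field K] [LieRing g] [LieAlgebra K g]
local notation "U" => UniversalEnvelopingAlgebra K g
attribute [local instance 100] LieRing.ofAssociativeRing
variable (K g) in
noncomputable def io : g →ₗ[K] U := (ι K : g →ₗ⁅K⁆ U)
theorem io_lie (x y : g) : io K g ⁅x, y⁆ = io K g x * io K g y - io K g y * io K g x :=
  LieHom.map_lie (ι K : g →ₗ⁅K⁆ U) x y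
theorem U_lift {A : Type*} [Ring A] [Algebra K A] (φ : g →ₗ[K] A)
    (h : ∀ x y, φ ⁅x, y⁆ = φ x * φ y - φ y * φ x) : ∃ Φ : U →ₐ[K] A, ∀ x, Φ (io K g x) = φ x := by
  let f : g →ₗ⁅K⁆ A := { φ with map_lie' := fun {x y} => h x y }
  exact ⟨lift K f, fun x => lift_ι_apply K f x⟩
theorem U_ind (P : Submodule K U) (h1 : 1 ∈ P) (hm : ∀ x, ∀ u ∈ P, io K g x * u ∈ P) (u : U) :
    u ∈ P := by
  have key : ∀ t : TensorAlgebra K g, ∀ u ∈ P, mkAlgHom K g t * u ∈ P := fun t => by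
    induction t using TensorAlgebra.induction with
    | algebraMap c =>
      intro u hu; rw [AlgHom.commutes, ← Algebra.smul_def]; exact P.smul_mem c hu
    | ι x => intro u hu; exact hm x u hu
    | mul a b ha hb => intro u hu; rw [map_mul, mul_assoc]; exact ha _ (hb _ hu)
    | add a b ha hb => intro u hu; rw [map_add, add_mul]; exact add_mem (ha _ hu) (hb _ hu)
  obtain ⟨t, rfl⟩ : ∃ t, mkAlgHom K g t = u := Quotient.exists_rep u
  simpa using key t 1 h1
variable (K g) in
noncomputable def FF (d : ℕ) : Submodule K U :=
  (1 ⊔ LinearMap.range (io K g)) ^ d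
theorem FF_succ_le {d : ℕ} {P : Submodule K U} (h1 : FF K g d ≤ P)
    (h2 : ∀ x, ∀ u ∈ FF K g d, io K g x * u ∈ P) : FF K g (d + 1) ≤ P := by
  rw [FF, pow_succ', Submodule.sup_mul, one_mul]
  refine sup_le h1 (Submodule.mul_le.2 ?_)
  rintro _ ⟨x, rfl⟩ u hu
  exact h2 x u hu
theorem FF_mono {a b : ℕ} (h : a ≤ b) : FF K g a ≤ FF K g b :=
  monotone_nat_of_le_succ (f := FF K g) (fun n => by
    rw [FF, FF, pow_succ' _ n, Submodule.sup_mul, one_mul]; exact le_sup_left) h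
theorem FF_one (d : ℕ) : (1 : U) ∈ FF K g d :=
  FF_mono (Nat.zero_le d) (by rw [FF, pow_zero]; exact Submodule.one_le.1 le_rfl)
theorem FF_io {d : ℕ} (x : g) {u : U} (hu : u ∈ FF K g d) : io K g x * u ∈ FF K g (d + 1) := by
  rw [FF, pow_succ']
  exact Submodule.mul_mem_mul (Submodule.mem_sup_right ⟨x, rfl⟩) hu
theorem FF_mul {a b : ℕ} {u v : U} (hu : u ∈ FF K g a) (hv : v ∈ FF K g b) :
    u * v ∈ FF K g (a + b) := by
  rw [FF, pow_add]; exact Submodule.mul_mem_mul hu hv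
theorem FF_io1 (x : g) : io K g x ∈ FF K g 1 := by simpa using FF_io x (FF_one 0)
theorem FF_top (u : U) : ∃ d, u ∈ FF K g d := by
  have hmem : ∀ u, u ∈ (⨆ d, FF K g d) ↔ ∃ d, u ∈ FF K g d := fun u =>
    Submodule.mem_iSup_of_directed _ (monotone_nat_of_le_succ fun n =>
      FF_mono n.le_succ).directed_le
  refine (hmem u).1 (U_ind _ ((hmem _).2 ⟨0, FF_one 0⟩) (fun x u hu => ?_) u)
  obtain ⟨d, hd⟩ := (hmem u).1 hu
  exact (hmem _).2 ⟨d + 1, FF_io x hd⟩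
theorem FF_fd [FiniteDimensional K g] (d : ℕ) : FiniteDimensional K (FF K g d) := by
  refine Module.Finite.iff_fg.2 (Submodule.FG.pow (Submodule.FG.sup ?_ ?_) d)
  · rw [Submodule.one_eq_span]; exact Submodule.fg_span (Set.finite_singleton _)
  · exact Module.Finite.iff_fg.1 inferInstance
theorem FF_comm (d : ℕ) (x : g) : ∀ u ∈ FF K g d, io K g x * u - u * io K g x ∈ FF K g d := by
  induction d with
  | zero =>
    intro u hu
    rw [FF, pow_zero, Submodule.mem_one] at hu
    obtain ⟨c, rfl⟩ := hu
    rw [Algebra.commutes, sub_self]; exact zero_mem _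
  | succ d ih =>
    refine FF_succ_le (P := (FF K g (d + 1)).comap (LinearMap.mulLeft K (io K g x) -
      LinearMap.mulRight K (io K g x))) (fun u hu => FF_mono d.le_succ (ih u hu)) fun y u hu => ?_
    have : io K g x * (io K g y * u) - io K g y * u * io K g x =
        io K g ⁅x, y⁆ * u + io K g y * (io K g x * u - u * io K g x) := by rw [io_lie]; noncomm_ring
    change io K g x * (io K g y * u) - io K g y * u * io K g x ∈ FF K g (d + 1)
    rw [this]
    exact add_mem (FF_io _ hu) (FF_io _ (ih u hu))
abbrev RD.A (D : RD K g) := MvPolynomial (Fin D.r) K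
noncomputable def RD.e (D : RD K g) (a : Fin D.n) : U := io K g (D.b (.inl a))
noncomputable def RD.f (D : RD K g) (a : Fin D.n) : U := io K g (D.b (.inr (.inl a)))
noncomputable def RD.h (D : RD K g) (i : Fin D.r) : U := io K g (D.b (.inr (.inr i)))
variable (D : RD K g)
theorem RD.h_comm (i k) : D.h i * D.h k = D.h k * D.h i := by
  have := io_lie (K := K) (D.b (.inr (.inr i))) (D.b (.inr (.inr k)))
  rw [D.lie_h, D.w_h] at this
  exact sub_eq_zero.1 (this.symm.trans (by simp))
theorem RD.h_b (i k) : D.h i * io K g (D.b k) = io K g (D.b k) * D.h i + D.w k i • io K g (D.b k) := by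
  have := io_lie (K := K) (D.b (.inr (.inr i))) (D.b k)
  rw [D.lie_h, map_smul] at this
  rw [this]; unfold RD.h; abel
theorem RD.ex_j : ∃ j : D.A →ₐ[K] U, ∀ i, j (.X i) = D.h i := by
  have hc : ∀ a ∈ Set.range D.h, ∀ b ∈ Set.range D.h, a * b = b * a := by
    rintro _ ⟨i, rfl⟩ _ ⟨k, rfl⟩; exact D.h_comm i k
  letI := Algebra.adjoinCommRingOfComm K hc
  exact ⟨(Algebra.adjoin K (Set.range D.h)).val.comp (MvPolynomial.aeval fun i =>
    (⟨D.h i, Algebra.subset_adjoin ⟨i, rfl⟩⟩ : Algebra.adjoin K (Set.range D.h))), fun i => by simp⟩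
noncomputable def RD.j : D.A →ₐ[K] U := D.ex_j.choose
theorem RD.j_X (i) : D.j (.X i) = D.h i := D.ex_j.choose_spec i
noncomputable def RD.UN : Ideal U := Ideal.span (Set.range D.e)
noncomputable def RD.NU : Submodule K U := Submodule.span K {x | ∃ a u, x = D.f a * u}
noncomputable def RD.Q : Submodule K U := D.NU ⊔ D.UN.restrictScalars K
theorem RD.UN_e (u : U) (a) : u * D.e a ∈ D.UN :=
  Ideal.mul_mem_left _ u (Ideal.subset_span ⟨a, rfl⟩)
theorem RD.NU_f (u : U) (a) : D.f a * u ∈ D.NU := Submodule.subset_span ⟨a, u, rfl⟩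
theorem RD.UN_ind (P : Submodule K U) (h : ∀ u a, u * D.e a ∈ P) : ∀ u ∈ D.UN, u ∈ P := by
  intro u hu
  induction hu using Submodule.span_induction with
  | mem x hx => obtain ⟨a, rfl⟩ := hx; simpa using h 1 a
  | zero => exact zero_mem _
  | add x y _ _ h1 h2 => exact add_mem h1 h2
  | smul c x hx h0 =>
    clear h0
    induction hx using Submodule.span_induction generalizing c with
    | mem x hx => obtain ⟨a, rfl⟩ := hx; exact h c a
    | zero => simp
    | add x y _ _ h1 h2 => rw [smul_add]; exact add_mem (h1 c) (h2 c)
    | smul c' x _ ih => rw [smul_smul]; exact ih (c * c')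
theorem RD.UN_h (u : U) (hu : u ∈ D.UN) (i) : u * D.h i ∈ D.UN :=
  D.UN_ind ((D.UN.restrictScalars K).comap (LinearMap.mulRight K (D.h i))) (fun u a => by
    change u * D.e a * D.h i ∈ D.UN
    have := D.h_b i (.inl a)
    rw [mul_assoc, show D.e a * D.h i = D.h i * D.e a - D.w (.inl a) i • D.e a from
      eq_sub_of_add_eq this.symm, mul_sub, ← mul_assoc]
    refine sub_mem (D.UN_e _ a) ?_
    rw [mul_smul_comm]
    exact (D.UN.restrictScalars K).smul_mem _ (D.UN_e u a)) u hu
theorem RD.NU_h (u : U) (hu : u ∈ D.NU) (i) : D.h i * u ∈ D.NU := by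
  refine (Submodule.span_le (p := D.NU.comap (LinearMap.mulLeft K (D.h i)))).2 ?_ hu
  rintro _ ⟨a, u, rfl⟩
  change D.h i * (D.f a * u) ∈ D.NU
  have := D.h_b i (.inr (.inl a))
  rw [← mul_assoc, show D.h i * D.f a = D.f a * D.h i + _ from this, add_mul, mul_assoc,
    smul_mul_assoc]
  exact add_mem (D.NU_f _ a) (Submodule.smul_mem _ _ (D.NU_f u a))
theorem RD.Q_h (u : U) (hu : u ∈ D.Q) (i) : D.h i * u ∈ D.Q := by
  obtain ⟨x, hx, y, hy, rfl⟩ := Submodule.mem_sup.1 hu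
  rw [mul_add]
  exact Submodule.add_mem_sup (D.NU_h x hx i) (D.UN.mul_mem_left _ hy)
theorem RD.Q_h' (u : U) (hu : u ∈ D.Q) (i) : u * D.h i ∈ D.Q := by
  obtain ⟨x, hx, y, hy, rfl⟩ := Submodule.mem_sup.1 hu
  rw [add_mul]
  refine Submodule.add_mem_sup ?_ (D.UN_h y hy i)
  refine (Submodule.span_le (p := D.NU.comap (LinearMap.mulRight K (D.h i)))).2 ?_ hx
  rintro _ ⟨a, u, rfl⟩
  change D.f a * u * D.h i ∈ D.NU
  rw [mul_assoc]; exact D.NU_f _ a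
theorem A_ind {r : ℕ} {V : Type*} [AddCommGroup V] [Module K V]
    (L : MvPolynomial (Fin r) K →ₗ[K] V) (W : Submodule K V) (h1 : L 1 ∈ W)
    (hX : ∀ i P, L P ∈ W → L (P * .X i) ∈ W) (P) : L P ∈ W := by
  induction P using MvPolynomial.induction_on with
  | C c => rw [← mul_one (MvPolynomial.C c), ← MvPolynomial.smul_eq_C_mul, map_smul]
           exact W.smul_mem c h1
  | add p q hp hq => rw [map_add]; exact add_mem hp hq
  | mul_X p i hp => exact hX i p hp
theorem RD.Q_j (u : U) (hu : u ∈ D.Q) (P) : u * D.j P ∈ D.Q :=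
  A_ind ((LinearMap.mulLeft K u).comp D.j.toLinearMap) D.Q (by simpa using hu) (fun i P h => by
    change u * D.j P ∈ D.Q at h
    change u * D.j (P * .X i) ∈ D.Q
    rw [map_mul, D.j_X, ← mul_assoc]; exact D.Q_h' _ h i) P
/-- Polynomials of degree less than `d`. -/
def VV (K : Type*) [Field K] {σ : Type*} (d : ℕ) : Submodule K (MvPolynomial σ K) where
  carrier := {P | ∀ m, d ≤ m.degree → P.coeff m = 0}
  add_mem' := fun ha hb m hm => by rw [MvPolynomial.coeff_add, ha m hm, hb m hm, add_zero]
  zero_mem' := fun m _ => by simp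
  smul_mem' := fun c P hP m hm => by rw [MvPolynomial.coeff_smul, hP m hm, smul_zero]
theorem VV_mono {σ : Type*} {a b : ℕ} (h : a ≤ b) : VV K (σ := σ) a ≤ VV K b :=
  fun P hP m hm => hP m (h.trans hm)
theorem VV_mul {σ : Type*} {a b : ℕ} {P Q : MvPolynomial σ K} (hP : P ∈ VV K (a + 1)) (hQ : Q ∈ VV K b) :
    P * Q ∈ VV K (a + b) := fun m hm => by
  classical
  rw [MvPolynomial.coeff_mul]
  refine Finset.sum_eq_zero fun x hx => ?_
  rw [Finset.HasAntidiagonal.mem_antidiagonal] at hx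
  by_cases h : a + 1 ≤ x.1.degree
  · rw [hP _ h, zero_mul]
  · rw [hQ x.2 (by rw [← hx, map_add] at hm; omega), mul_zero]
theorem VV_X {σ : Type*} (i : σ) : (.X i : MvPolynomial σ K) ∈ VV K 2 := fun m hm => by
  classical
  rw [MvPolynomial.coeff_X, if_neg]
  rintro rfl
  simp at hm
noncomputable def RD.pi : g →ₗ[K] D.A := D.b.constr K
  (Sum.elim (fun _ => 0) (Sum.elim (fun _ => 0) fun i => .X i))
theorem RD.pi_e (a) : D.pi (D.b (.inl a)) = 0 := by simp [RD.pi]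
theorem RD.pi_f (a) : D.pi (D.b (.inr (.inl a))) = 0 := by simp [RD.pi]
theorem RD.pi_h (i) : D.pi (D.b (.inr (.inr i))) = .X i := by simp [RD.pi]
theorem RD.FQ (d : ℕ) : FF K g d ≤ (VV K (d + 1)).map D.j.toLinearMap ⊔ D.Q := by
  induction d with
  | zero =>
    rw [FF, pow_zero, Submodule.one_le]
    refine Submodule.mem_sup_left ⟨1, fun m hm => ?_, by simp⟩
    rw [MvPolynomial.coeff_one, if_neg]
    rintro rfl; simp at hm
  | succ d ih =>
    have hup : (VV K (d + 1)).map D.j.toLinearMap ⊔ D.Q ≤ (VV K (d + 1 + 1)).map D.j.toLinearMap ⊔ D.Q :=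
      sup_le_sup_right (Submodule.map_mono (VV_mono (by omega))) _
    refine FF_succ_le (fun u hu => ?_) fun x u hu => ?_
    · exact hup (ih hu)
    rw [← D.b.sum_repr x, map_sum, Finset.sum_mul]
    refine sum_mem fun k _ => ?_
    rw [map_smul, smul_mul_assoc]
    refine Submodule.smul_mem _ _ ?_
    rcases k with a | a | i
    · rw [← sub_add_cancel (io K g (D.b (.inl a)) * u) (u * io K g (D.b (.inl a)))]
      refine add_mem ?_ (Submodule.mem_sup_right (Submodule.mem_sup_right (D.UN_e u a)))
      exact hup (ih (FF_comm d _ u hu))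
    · exact Submodule.mem_sup_right (Submodule.mem_sup_left (D.NU_f u a))
    · obtain ⟨_, ⟨P, hP, rfl⟩, q, hq, rfl⟩ := Submodule.mem_sup.1 (ih hu)
      rw [mul_add]
      refine Submodule.add_mem_sup ⟨.X i * P, ?_, ?_⟩ (D.Q_h q hq i)
      · rw [show d + 1 + 1 = 1 + (d + 1) by ring]; exact VV_mul (VV_X i) hP
      · simp [D.j_X, RD.h]
noncomputable def RD.Um : Subalgebra K U := Algebra.adjoin K (Set.range D.f)
theorem RD.UmA (u : U) : u ∈ D.Um.toSubmodule * LinearMap.range D.j.toLinearMap ⊔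
    D.UN.restrictScalars K := by
  obtain ⟨d, hd⟩ := FF_top u
  revert u
  change FF K g d ≤ _
  induction d with
  | zero =>
    rw [FF, pow_zero, Submodule.one_le]
    refine Submodule.mem_sup_left ?_
    rw [← one_mul (1 : U)]
    exact Submodule.mul_mem_mul (one_mem D.Um) ⟨1, by simp⟩
  | succ d ih =>
    have hR : ∀ x ∈ D.Um.toSubmodule * LinearMap.range D.j.toLinearMap, ∀ i, x * D.h i ∈
        D.Um.toSubmodule * LinearMap.range D.j.toLinearMap := fun x hx i => by
      refine (Submodule.mul_le (P := (D.Um.toSubmodule * LinearMap.range D.j.toLinearMap).comap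
        (LinearMap.mulRight K (D.h i)))).2 ?_ hx
      rintro m hm _ ⟨P, rfl⟩
      change m * D.j P * D.h i ∈ D.Um.toSubmodule * LinearMap.range D.j.toLinearMap
      rw [mul_assoc, ← D.j_X, ← map_mul]
      exact Submodule.mul_mem_mul hm ⟨_, rfl⟩
    refine FF_succ_le ih fun x u hu => ?_
    rw [← D.b.sum_repr x, map_sum, Finset.sum_mul]
    refine sum_mem fun k _ => ?_
    rw [map_smul, smul_mul_assoc]
    refine Submodule.smul_mem _ _ ?_
    rcases k with a | a | i
    · rw [← sub_add_cancel (io K g (D.b (.inl a)) * u) (u * io K g (D.b (.inl a)))]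
      exact add_mem (ih (FF_comm d _ u hu)) (Submodule.mem_sup_right (D.UN_e u a))
    · obtain ⟨y, hy, q, hq, rfl⟩ := Submodule.mem_sup.1 (ih hu)
      rw [mul_add]
      refine Submodule.add_mem_sup ?_ (D.UN.mul_mem_left _ hq)
      have h1 : D.f a * y ∈ D.Um.toSubmodule * (D.Um.toSubmodule * LinearMap.range D.j.toLinearMap) :=
        Submodule.mul_mem_mul (Algebra.subset_adjoin ⟨a, rfl⟩) hy
      rwa [← mul_assoc, D.Um.isIdempotentElem_toSubmodule.eq] at h1
    · rw [← sub_add_cancel (io K g (D.b (.inr (.inr i))) * u) (u * io K g (D.b (.inr (.inr i))))]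
      refine add_mem (ih (FF_comm d _ u hu)) ?_
      obtain ⟨y, hy, q, hq, rfl⟩ := Submodule.mem_sup.1 (ih hu)
      rw [add_mul]
      exact Submodule.add_mem_sup (hR y hy i) (D.UN_h q hq i)
end
section
variable {K g : Type*} [Field K] [LieRing g] [LieAlgebra K g]
local notation "U" => UniversalEnvelopingAlgebra K g
variable (D : RD K g)
noncomputable def RD.dl : U := ∑ i, D.d i • D.h i
theorem RD.dl_b (k) : D.dl * io K g (D.b k) = io K g (D.b k) * D.dl + (D.z k : K) • io K g (D.b k) := by
  rw [RD.dl, Finset.sum_mul, Finset.mul_sum, ← D.z_eq, Finset.sum_smul, ← Finset.sum_add_distrib]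
  refine Finset.sum_congr rfl fun i _ => ?_
  rw [smul_mul_assoc, D.h_b, smul_add, mul_smul_comm, smul_smul]
section hw
variable [CharZero K] {M : Type*} [AddCommGroup M] [Module K M] (Φ : UniversalEnvelopingAlgebra K g →ₐ[K] Module.End K M)
  {v : M} {ν : Fin D.r → K}
noncomputable def RD.hwL (ν : Fin D.r → K) : Submodule K M :=
  ⨆ (k : ℕ) (_ : 1 ≤ k), Module.End.eigenspace (Φ D.dl) (∑ i, D.d i * ν i - k)
theorem RD.hw_dl (hh : ∀ i, Φ (D.h i) v = ν i • v) : Φ D.dl v = (∑ i, D.d i * ν i) • v := by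
  simp [RD.dl, hh, Finset.sum_smul, smul_smul]
theorem RD.eig (k) (c : K) {m : M} (hm : m ∈ Module.End.eigenspace (Φ D.dl) c) :
    Φ (io K g (D.b k)) m ∈ Module.End.eigenspace (Φ D.dl) (c + D.z k) := by
  rw [Module.End.mem_eigenspace_iff] at hm ⊢
  have := congrArg (fun u => Φ u m) (D.dl_b k)
  simp only [map_add, map_mul, map_smul, LinearMap.add_apply, Module.End.mul_apply,
    LinearMap.smul_apply, hm] at this
  rw [this, add_smul]
theorem RD.hw_f (hh : ∀ i, Φ (D.h i) v = ν i • v) (a) (m : M)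
    (hm : m ∈ Submodule.span K {v} ⊔ D.hwL Φ ν) : Φ (D.f a) m ∈ D.hwL Φ ν := by
  have hz := D.z_e a
  have key : ∀ k : ℕ, ∀ m ∈ Module.End.eigenspace (Φ D.dl) (∑ i, D.d i * ν i - k),
      Φ (D.f a) m ∈ D.hwL Φ ν := fun k m hm => by
    have := D.eig Φ (.inr (.inl a)) _ hm
    refine Submodule.mem_iSup_of_mem (k + (D.z (.inl a)).toNat)
      (Submodule.mem_iSup_of_mem (by omega) ?_)
    change Φ (io K g (D.b (.inr (.inl a)))) m ∈ _
    convert this using 2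
    rw [D.z_f]
    have : ((D.z (.inl a)).toNat : K) = ((D.z (.inl a) : ℤ) : K) := by
      rw [← Int.cast_natCast, Int.toNat_of_nonneg hz.le]
    push_cast [this]; ring
  refine (show _ ≤ (D.hwL Φ ν).comap (Φ (D.f a)) from sup_le ?_ (iSup₂_le fun k _ => key k)) hm
  rw [Submodule.span_le, Set.singleton_subset_iff]
  refine key 0 v ?_
  rw [Module.End.mem_eigenspace_iff, D.hw_dl Φ hh]; simp
theorem RD.hw_UN (he : ∀ a, Φ (D.e a) v = 0) {u : U} (hu : u ∈ D.UN) : Φ u v = 0 :=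
  D.UN_ind (LinearMap.ker (LinearMap.flip (Φ.toLinearMap) v)) (fun u a => by simp [he]) u hu
theorem RD.hw_j (hh : ∀ i, Φ (D.h i) v = ν i • v) (P) : Φ (D.j P) v = P.eval ν • v := by
  have := A_ind (Φ.toLinearMap.comp D.j.toLinearMap - (LinearMap.toSpanSingleton K _ 1).comp
    (MvPolynomial.aeval ν).toLinearMap) (LinearMap.ker (LinearMap.flip (LinearMap.id) v)) (by simp)
    (fun i P h => by
      simp [sub_eq_zero, MvPolynomial.aeval_def] at h ⊢
      rw [D.j_X, hh, map_smul, h, smul_smul, mul_comm]) P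
  simpa [sub_eq_zero, MvPolynomial.aeval_def, MvPolynomial.eval₂_eq_eval_map] using this
theorem RD.hw_W (he : ∀ a, Φ (D.e a) v = 0) (hh : ∀ i, Φ (D.h i) v = ν i • v) (u : U) :
    Φ u v ∈ Submodule.span K {v} ⊔ D.hwL Φ ν := by
  have hm : ∀ m ∈ D.Um, ∀ x ∈ Submodule.span K {v} ⊔ D.hwL Φ ν,
      Φ m x ∈ Submodule.span K {v} ⊔ D.hwL Φ ν := fun m hm => by
    induction hm using Algebra.adjoin_induction with
    | mem x hx =>
      obtain ⟨a, rfl⟩ := hx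
      exact fun x hx => Submodule.mem_sup_right (D.hw_f Φ hh a x hx)
    | algebraMap c => intro x hx; simpa using Submodule.smul_mem _ c hx
    | add a b _ _ ha hb => intro x hx; simpa using add_mem (ha x hx) (hb x hx)
    | mul a b _ _ ha hb => intro x hx; simpa using ha _ (hb x hx)
  obtain ⟨y, hy, q, hq, rfl⟩ := Submodule.mem_sup.1 (D.UmA u)
  rw [map_add, LinearMap.add_apply, D.hw_UN Φ he hq, add_zero]
  refine (Submodule.mul_le (P := (Submodule.span K {v} ⊔ D.hwL Φ ν).comap
    (LinearMap.flip (Φ.toLinearMap) v))).2 ?_ hy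
  rintro m hm' _ ⟨P, rfl⟩
  simp only [Submodule.mem_comap, LinearMap.flip_apply, AlgHom.toLinearMap_apply, map_mul,
    Module.End.mul_apply]
  rw [D.hw_j Φ hh, map_smul]
  exact Submodule.smul_mem _ _ (hm m hm' v (Submodule.mem_sup_left (Submodule.mem_span_singleton_self v)))
theorem RD.hw_NU (he : ∀ a, Φ (D.e a) v = 0) (hh : ∀ i, Φ (D.h i) v = ν i • v) {u : U}
    (hu : u ∈ D.NU) : Φ u v ∈ D.hwL Φ ν := by
  refine (Submodule.span_le (p := (D.hwL Φ ν).comap (LinearMap.flip (Φ.toLinearMap) v))).2 ?_ hu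
  rintro _ ⟨a, u, rfl⟩
  simpa using D.hw_f Φ hh a _ (D.hw_W Φ he hh u)
theorem RD.hw_not (hh : ∀ i, Φ (D.h i) v = ν i • v) (hv : v ∈ D.hwL Φ ν) : v = 0 := by
  have hi := Module.End.eigenspaces_iSupIndep (Φ D.dl)
  refine (Submodule.disjoint_def.1 (hi (∑ i, D.d i * ν i))) v
    (Module.End.mem_eigenspace_iff.2 (D.hw_dl Φ hh)) ?_
  refine (iSup₂_le fun k hk => ?_ : D.hwL Φ ν ≤ _) hv
  refine le_iSup₂_of_le _ (fun h => ?_) le_rfl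
  rw [sub_eq_self, Nat.cast_eq_zero] at h; omega
theorem RD.hw_eval (he : ∀ a, Φ (D.e a) v = 0) (hh : ∀ i, Φ (D.h i) v = ν i • v) (hv : v ≠ 0)
    {P} (hP : D.j P ∈ D.Q) : P.eval ν = 0 := by
  by_contra h0
  obtain ⟨x, hx, y, hy, hxy⟩ := Submodule.mem_sup.1 hP
  have h1 := D.hw_j Φ hh P
  rw [← hxy, map_add, LinearMap.add_apply, D.hw_UN Φ he hy, add_zero] at h1
  have h2 := D.hw_NU Φ he hh hx
  rw [h1] at h2
  exact hv (D.hw_not Φ hh ((Submodule.smul_mem_iff _ h0).1 h2))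
end hw
theorem RD.grad {i k l : D.ix} (h : D.b.repr ⁅D.b i, D.b k⁆ l ≠ 0) : D.w l = D.w i + D.w k := by
  funext m
  have e1 : ⁅D.b (.inr (.inr m)), ⁅D.b i, D.b k⁆⁆ = (D.w i m + D.w k m) • ⁅D.b i, D.b k⁆ := by
    rw [leibniz_lie, D.lie_h, D.lie_h]; simp [add_smul]
  have e2 : ∀ y : g, D.b.repr ⁅D.b (.inr (.inr m)), y⁆ l = D.w l m * D.b.repr y l := fun y => by
    have : (D.b.coord l).comp (LieAlgebra.ad K g (D.b (.inr (.inr m))) : g →ₗ[K] g) =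
        D.w l m • D.b.coord l := D.b.ext fun q => by
      simp only [LinearMap.comp_apply, LieAlgebra.ad_apply, D.lie_h, map_smul,
        LinearMap.smul_apply, D.b.coord_apply, D.b.repr_self, smul_eq_mul]
      by_cases hq : q = l
      · rw [hq]; rfl
      · simp [Finsupp.single_apply, hq]
    exact LinearMap.congr_fun this y
  have := congrArg (fun y => D.b.repr y l) e1
  simp only [e2, map_smul, Finsupp.smul_apply, smul_eq_mul] at this
  exact mul_right_cancel₀ h this
theorem RD.gradz [CharZero K] {i k l : D.ix} (h : D.b.repr ⁅D.b i, D.b k⁆ l ≠ 0) :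
    D.z l = D.z i + D.z k := by
  have : (D.z l : K) = D.z i + D.z k := by
    rw [← D.z_eq, D.grad h, ← D.z_eq, ← D.z_eq, ← Finset.sum_add_distrib]
    simp [mul_add]
  exact_mod_cast this
end
section
theorem der_det {K R n : Type*} [Field K] [CommRing R] [Algebra K R] [Fintype n] [DecidableEq n]
    (Δ : Derivation K R R) (M B : Matrix n n R) (h : ∀ i j, Δ (M i j) = ∑ k, B i k * M k j) :
    Δ M.det = B.trace * M.det := by
  let φ : R →+* DualNumber R :=
    { toFun := fun a => TrivSqZeroExt.inl a + TrivSqZeroExt.inr (Δ a)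
      map_one' := by simp
      map_zero' := by simp
      map_mul' := fun a b => by ext <;> simp [mul_comm, add_comm]
      map_add' := fun a b => by ext <;> simp }
  let i := TrivSqZeroExt.inlHom R R
  have e : φ.mapMatrix M = (1 + (DualNumber.eps : DualNumber R) • i.mapMatrix B) * i.mapMatrix M := by
    rw [add_mul, one_mul, Matrix.smul_mul]
    ext a b <;> simp [φ, i, Matrix.mul_apply, h, TrivSqZeroExt.fst_sum, TrivSqZeroExt.snd_sum]
  have := congrArg Matrix.det e
  rw [Matrix.det_mul, Matrix.det_one_add_smul, ← RingHom.map_det, ← RingHom.map_det, pow_two,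
    DualNumber.eps_mul_eps, mul_zero, add_zero] at this
  have t : (i.mapMatrix B).trace = i B.trace := by simp [Matrix.trace]
  rw [t] at this
  have := congrArg TrivSqZeroExt.snd this
  simpa [φ, i, mul_comm] using this
variable {K g : Type*} [Field K] [LieRing g] [LieAlgebra K g]
variable (D : RD K g)
abbrev RD.R := MvPolynomial (D.ix × D.ix) K
noncomputable def RD.lam (a : D.ix) : g →ₗ[K] D.R := D.b.constr K fun k => .X (k, a)
theorem RD.lam_b (a k : D.ix) : D.lam a (D.b k) = .X (k, a) := by simp [RD.lam]
noncomputable def RD.der (x : g) : Derivation K D.R D.R :=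
  MvPolynomial.mkDerivation K fun q => D.lam q.2 ⁅x, D.b q.1⁆
theorem RD.der_X (x : g) (q) : D.der x (.X q) = D.lam q.2 ⁅x, D.b q.1⁆ := by simp [RD.der]
theorem RD.der_lam (x y : g) (a) : D.der x (D.lam a y) = D.lam a ⁅x, y⁆ := by
  have : (D.der x).toLinearMap ∘ₗ D.lam a = D.lam a ∘ₗ (LieAlgebra.ad K g x : g →ₗ[K] g) :=
    D.b.ext fun k => by simp [RD.lam_b, RD.der_X]
  exact LinearMap.congr_fun this y
theorem RD.der_lie (x y : g) : D.der ⁅x, y⁆ = ⁅D.der x, D.der y⁆ :=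
  MvPolynomial.derivation_ext fun q => by
    rw [Derivation.commutator_apply, D.der_X, D.der_X, D.der_X, D.der_lam, D.der_lam, lie_lie, map_sub]
theorem RD.ex_Ph : ∃ Φ : UniversalEnvelopingAlgebra K g →ₐ[K] Module.End K D.R,
    ∀ x, Φ (io K g x) = (D.der x).toLinearMap := by
  refine U_lift (A := Module.End K D.R) ⟨⟨fun x => (D.der x).toLinearMap, fun x y => ?_⟩, fun c x => ?_⟩ fun x y => ?_
  · have : D.der (x + y) = D.der x + D.der y := MvPolynomial.derivation_ext fun q => by
      simp [RD.der_X]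
    rw [this]; rfl
  · have : D.der (c • x) = c • D.der x := MvPolynomial.derivation_ext fun q => by
      simp [RD.der_X]
    change (D.der (c • x)).toLinearMap = _
    rw [this]; rfl
  · change (D.der ⁅x, y⁆).toLinearMap = _
    rw [D.der_lie]; rfl
noncomputable def RD.Ph := D.ex_Ph.choose
theorem RD.Ph_io (x : g) (P) : D.Ph (io K g x) P = D.der x P :=
  LinearMap.congr_fun (D.ex_Ph.choose_spec x) P
theorem RD.b_sum (y : g) : y = ∑ k, D.b.repr y k • D.b k := (D.b.sum_repr y).symm
noncomputable def RD.mi (J : Finset D.ix) : D.R := (Matrix.of fun i a : J => (.X (i.1, a.1) : D.R)).det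
theorem RD.mi_ne (J : Finset D.ix) : D.mi J ≠ 0 := fun h => by
  classical
  have := congrArg (MvPolynomial.eval fun q : D.ix × D.ix => if q.1 = q.2 then (1 : K) else 0) h
  rw [RD.mi, RingHom.map_det, map_zero] at this
  have e : (MvPolynomial.eval fun q : D.ix × D.ix => if q.1 = q.2 then (1 : K) else 0).mapMatrix
    (Matrix.of fun i a : J => (.X (i.1, a.1) : D.R)) = 1 := by
    ext i a
    simp only [RingHom.mapMatrix_apply, Matrix.map_apply, Matrix.of_apply, MvPolynomial.eval_X,
      Matrix.one_apply, Subtype.ext_iff]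
  rw [e, Matrix.det_one] at this
  exact one_ne_zero this
theorem RD.mi_der (J : Finset D.ix) (x : g) (hJ : ∀ i ∈ J, ∀ k, D.b.repr ⁅x, D.b i⁆ k ≠ 0 → k ∈ J) :
    D.der x (D.mi J) = (∑ i ∈ J, D.b.repr ⁅x, D.b i⁆ i) • D.mi J := by
  classical
  rw [RD.mi, der_det (D.der x) _ (Matrix.of fun i k : J => .C (D.b.repr ⁅x, D.b i.1⁆ k.1))]
  · rw [MvPolynomial.smul_eq_C_mul, Matrix.trace, map_sum, ← Finset.sum_coe_sort J]
    rfl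
  · rintro ⟨i, hi⟩ a
    simp only [Matrix.of_apply, D.der_X]
    conv_lhs => rw [D.b_sum ⁅x, D.b i⁆]
    rw [map_sum, Finset.sum_coe_sort J fun k => (.C (D.b.repr ⁅x, D.b i⁆ k) * .X (k, a.1) : D.R)]
    rw [← Finset.sum_subset (Finset.subset_univ J)]
    · simp [D.lam_b, MvPolynomial.smul_eq_C_mul]
    · intro k _ hk
      rw [not_not.1 fun h => hk (hJ i hi k h)]; simp
variable [CharZero K]
open Classical in
noncomputable def RD.JJ : D.ix ⊕ D.ix → Finset D.ix
  | .inl i => Finset.univ.filter fun j => D.z i < D.z j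
  | .inr i => insert i (Finset.univ.filter fun j => D.z i < D.z j)
theorem RD.JJ_up (q) {i k} (hi : i ∈ D.JJ q) (hk : D.z i < D.z k) : k ∈ D.JJ q := by
  rcases q with q | q <;> simp [RD.JJ] at hi ⊢
  · omega
  · rcases hi with rfl | hi
    · exact .inr hk
    · right; omega
theorem RD.mi_e (q a) : D.der (D.b (.inl a)) (D.mi (D.JJ q)) = 0 := by
  have hz := D.z_e a
  rw [D.mi_der, Finset.sum_eq_zero, zero_smul]
  · intro i _; by_contra h; have := D.gradz h; omega
  · intro i hi k h; exact D.JJ_up q hi (by have := D.gradz h; omega)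
theorem RD.mi_h (q i) : D.der (D.b (.inr (.inr i))) (D.mi (D.JJ q)) =
    (∑ k ∈ D.JJ q, D.w k i) • D.mi (D.JJ q) := by
  rw [D.mi_der]
  · congr 1; exact Finset.sum_congr rfl fun k _ => by simp [D.lie_h]
  · intro l hl k h
    rw [D.lie_h] at h
    by_cases hk : l = k
    · rwa [← hk]
    · simp [hk] at h
theorem der_prod {K R q : Type*} [Field K] [CommRing R] [Algebra K R] (Δ : Derivation K R R)
    (s : Finset q) (d : q → R) (c : q → K) (N : q → ℕ) (h : ∀ i, Δ (d i) = c i • d i) :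
    Δ (∏ i ∈ s, d i ^ N i) = (∑ i ∈ s, N i * c i) • ∏ i ∈ s, d i ^ N i := by
  classical
  induction s using Finset.induction with
  | empty => simp
  | insert a s ha ih =>
    have e : Δ (d a ^ N a) = (N a * c a) • d a ^ N a := by
      rw [Derivation.leibniz_pow, h]
      rcases N a with _ | m
      · simp
      · simp only [Nat.add_sub_cancel, smul_eq_mul, mul_smul_comm, ← pow_succ, ← Nat.cast_smul_eq_nsmul K, smul_smul]
    rw [Finset.prod_insert ha, Finset.sum_insert ha, Derivation.leibniz, ih, e, add_smul]
    simp only [smul_eq_mul, mul_smul_comm]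
    rw [add_comm, mul_comm (∏ i ∈ s, d i ^ N i)]
theorem RD.j_inj {P} (hP : D.j P ∈ D.Q) : P = 0 := by
  let W : D.ix ⊕ D.ix → Fin D.r → K := fun q i => ∑ k ∈ D.JJ q, D.w k i
  have h1 : ∀ N : D.ix ⊕ D.ix → ℕ, P.eval (fun i => ∑ q, N q * W q i) = 0 := fun N => by
    refine D.hw_eval D.Ph (v := ∏ q, D.mi (D.JJ q) ^ N q) (fun a => ?_) (fun i => ?_) ?_ hP
    · rw [RD.e, D.Ph_io, der_prod _ _ _ (fun _ => 0) _ (fun q => by rw [D.mi_e, zero_smul])]; simp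
    · rw [RD.h, D.Ph_io, der_prod _ _ _ (fun q => W q i) _ (fun q => D.mi_h q i)]
    · exact Finset.prod_ne_zero_iff.2 fun q _ => pow_ne_zero _ (D.mi_ne _)
  let P' : MvPolynomial (D.ix ⊕ D.ix) K := MvPolynomial.aeval (fun i => ∑ q, .C (W q i) * .X q) P
  have ev : ∀ s : D.ix ⊕ D.ix → K, P'.eval s = P.eval (fun i => ∑ q, s q * W q i) := fun s => by
    have : (MvPolynomial.aeval s).comp (MvPolynomial.aeval (R := K)
        (fun i => ∑ q, (.C (W q i) * .X q : MvPolynomial (D.ix ⊕ D.ix) K))) =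
        MvPolynomial.aeval (fun i => ∑ q, s q * W q i) := MvPolynomial.algHom_ext fun i => by
      simp [mul_comm]
    exact DFunLike.congr_fun this P
  have h2 : P' = 0 := MvPolynomial.funext_set (fun _ => Set.range (Nat.cast : ℕ → K))
    (fun _ => Set.infinite_range_of_injective Nat.cast_injective) fun s hs => by
      choose N hN using fun q => hs q trivial
      rw [ev, map_zero, ← h1 N]; simp [hN]
  let L : (D.ix ⊕ D.ix → K) →ₗ[K] (Fin D.r → K) := Fintype.linearCombination K W
  have hL : LinearMap.range L = ⊤ := by
    by_contra hne
    obtain ⟨φ, h0, hφ⟩ := Submodule.exists_le_ker_of_lt_top _ (lt_top_iff_ne_top.2 hne)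
    apply h0
    have hW : ∀ q, φ (W q) = 0 := fun q => hφ ⟨Pi.single q 1, by simp [L]⟩
    have hw : ∀ k, φ (D.w k) = 0 := fun k => by
      have : W (.inr k) = D.w k + W (.inl k) := by
        funext i; simp [W, RD.JJ]
      have h3 := hW (.inr k)
      rwa [this, map_add, hW, add_zero] at h3
    have := D.sp (fun i => φ (Pi.single i 1)) fun a => by
      rw [← hw (.inl a)]
      conv_rhs => rw [← Finset.univ_sum_single (D.w (.inl a))]
      rw [map_sum]
      refine Finset.sum_congr rfl fun i _ => ?_
      rw [mul_comm, ← smul_eq_mul, ← map_smul, ← Pi.single_smul, smul_eq_mul, mul_one]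
    refine LinearMap.pi_ext' fun i => LinearMap.ext_ring ?_
    exact congrFun this i
  refine MvPolynomial.funext fun c => ?_
  obtain ⟨s, rfl⟩ : c ∈ LinearMap.range L := hL ▸ trivial
  have h3 := ev s
  rw [h2, map_zero] at h3
  rw [map_zero, h3]
  congr 2; funext i; simp [L, Fintype.linearCombination_apply]
end
section
variable {K g : Type*} [Field K] [LieRing g] [LieAlgebra K g]
local notation "U" => UniversalEnvelopingAlgebra K g
variable (D : RD K g) [CharZero K]
theorem RD.ex_p : ∃ p : U →ₗ[K] D.A, (∀ u, u - D.j (p u) ∈ D.Q) ∧ (∀ u, u ∈ D.Q → p u = 0) ∧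
    ∀ P, p (D.j P) = P := by
  let m : D.A →ₗ[K] U ⧸ D.Q := D.Q.mkQ.comp D.j.toLinearMap
  have hi : Function.Injective m := (injective_iff_map_eq_zero m).2 fun P h =>
    D.j_inj ((Submodule.Quotient.mk_eq_zero _).1 h)
  have hs : Function.Surjective m := fun y => by
    obtain ⟨u, rfl⟩ := D.Q.mkQ_surjective y
    obtain ⟨d, hd⟩ := FF_top u
    obtain ⟨_, ⟨P, hP, rfl⟩, q, hq, rfl⟩ := Submodule.mem_sup.1 (D.FQ d hd)
    refine ⟨P, ?_⟩
    rw [map_add, (Submodule.Quotient.mk_eq_zero D.Q).2 hq |> (id : D.Q.mkQ q = 0 → _), add_zero]; rfl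
  let E := LinearEquiv.ofBijective m ⟨hi, hs⟩
  refine ⟨E.symm.toLinearMap.comp D.Q.mkQ, fun u => ?_, fun u hu => ?_, fun P => ?_⟩
  · refine (Submodule.Quotient.mk_eq_zero D.Q).1 ?_
    change D.Q.mkQ _ = 0
    rw [map_sub]
    have : D.Q.mkQ (D.j (E.symm (D.Q.mkQ u))) = E (E.symm (D.Q.mkQ u)) := rfl
    simp only [LinearMap.comp_apply, LinearEquiv.coe_coe]
    rw [this, E.apply_symm_apply, sub_self]
  · rw [LinearMap.comp_apply, show D.Q.mkQ u = 0 from (Submodule.Quotient.mk_eq_zero D.Q).2 hu, map_zero]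
  · exact E.symm_apply_apply P
noncomputable def RD.p : U →ₗ[K] D.A := D.ex_p.choose
theorem RD.p_sub (u) : u - D.j (D.p u) ∈ D.Q := D.ex_p.choose_spec.1 u
theorem RD.p_Q {u} (h : u ∈ D.Q) : D.p u = 0 := D.ex_p.choose_spec.2.1 u h
theorem RD.p_j (P) : D.p (D.j P) = P := D.ex_p.choose_spec.2.2 P
theorem RD.p_eq {u P} (h : u - D.j P ∈ D.Q) : D.p u = P := by
  have := D.p_Q h
  rwa [map_sub, D.p_j, sub_eq_zero] at this
theorem RD.UN_Q {u : U} (h : u ∈ D.UN) : u ∈ D.Q := Submodule.mem_sup_right h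
theorem RD.p_UN {u : U} (h : u ∈ D.UN) : D.p u = 0 := D.p_Q (D.UN_Q h)
theorem RD.p_1 : D.p 1 = 1 := by simpa using D.p_j 1
theorem RD.p_mj (u P) : D.p (u * D.j P) = D.p u * P := D.p_eq (by
  rw [map_mul, ← sub_mul]; exact D.Q_j _ (D.p_sub u) P)
theorem RD.p_h (i u) : D.p (D.h i * u) = .X i * D.p u := D.p_eq (by
  rw [map_mul, D.j_X, ← mul_sub]; exact D.Q_h _ (D.p_sub u) i)
theorem RD.p_FF {d u} (h : u ∈ FF K g d) : D.p u ∈ VV K (d + 1) := by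
  obtain ⟨_, ⟨P, hP, rfl⟩, q, hq, rfl⟩ := Submodule.mem_sup.1 (D.FQ d h)
  rw [map_add, D.p_Q hq, add_zero]
  change D.p (D.j P) ∈ _
  rwa [D.p_j]
theorem RD.p_top {d : ℕ} {u : U} (hu : u ∈ FF K g d) {P} (h : D.p u - P ∈ VV K d) (x : g) :
    D.p (io K g x * u) - D.pi x * P ∈ VV K (d + 1) := by
  rw [← D.b.sum_repr x, map_sum, map_sum, Finset.sum_mul, Finset.sum_mul, map_sum,
    ← Finset.sum_sub_distrib]
  refine sum_mem fun k _ => ?_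
  rw [map_smul, map_smul, smul_mul_assoc, smul_mul_assoc, map_smul, ← smul_sub]
  refine Submodule.smul_mem _ _ ?_
  rcases k with a | a | i
  · rw [D.pi_e, zero_mul, sub_zero, ← sub_add_cancel (io K g (D.b (.inl a)) * u)
      (u * io K g (D.b (.inl a))), map_add,
      show D.p (u * io K g (D.b (.inl a))) = 0 from D.p_UN (D.UN_e u a), add_zero]
    exact D.p_FF (FF_comm d _ u hu)
  · rw [D.pi_f, zero_mul, sub_zero, show D.p (io K g (D.b (.inr (.inl a))) * u) = 0 from
      D.p_Q (Submodule.mem_sup_left (D.NU_f u a))]; exact zero_mem _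
  · have := D.p_h i u
    rw [D.pi_h, show io K g (D.b (.inr (.inr i))) = D.h i from rfl, this, ← mul_sub, add_comm]
    exact VV_mul (VV_X i) h
theorem RD.dl_j (P) : D.dl * D.j P = D.j P * D.dl := by
  have : D.dl = D.j (∑ i, D.d i • .X i) := by simp [RD.dl, D.j_X]
  rw [this, ← map_mul, mul_comm, map_mul]
theorem RD.cen_UN {z : U} (hz : ∀ u, z * u = u * z) : z - D.j (D.p z) ∈ D.UN := by
  let N := D.UN.restrictScalars K
  have hN : N ≤ N.comap (LinearMap.mulLeft K D.dl - LinearMap.mulRight K D.dl) := fun u hu => by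
    change D.dl * u - u * D.dl ∈ D.UN
    refine sub_mem (D.UN.mul_mem_left _ hu) ?_
    rw [RD.dl, Finset.mul_sum]
    refine sum_mem fun i _ => ?_
    rw [mul_smul_comm]
    exact N.smul_mem _ (D.UN_h u hu i)
  let Θ : Module.End K (U ⧸ N) := N.mapQ N _ hN
  have hΘ : ∀ u, Θ (N.mkQ u) = N.mkQ (D.dl * u - u * D.dl) := fun u => rfl
  let V : Submodule K (U ⧸ N) := ⨆ (k : ℕ) (_ : 1 ≤ k), Module.End.eigenspace Θ (-k : K)
  have hf : ∀ a u, N.mkQ u ∈ LinearMap.range (N.mkQ.comp D.j.toLinearMap) ⊔ V →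
      N.mkQ (D.f a * u) ∈ V := fun a u hu => by
    have hle : N ≤ N.comap (LinearMap.mulLeft K (D.f a)) := fun u hu => D.UN.mul_mem_left _ hu
    have hz := D.z_e a
    have key : ∀ k : ℕ, ∀ y ∈ Module.End.eigenspace Θ (-k : K), N.mapQ N _ hle y ∈ V :=
      fun k y hy => by
        obtain ⟨u, rfl⟩ := N.mkQ_surjective y
        rw [Module.End.mem_eigenspace_iff, hΘ] at hy
        refine Submodule.mem_iSup_of_mem (k + (D.z (.inl a)).toNat)
          (Submodule.mem_iSup_of_mem (by omega) ?_)
        have hz' : ((D.z (.inl a)).toNat : K) = ((D.z (.inl a) : ℤ) : K) := by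
          rw [← Int.cast_natCast, Int.toNat_of_nonneg hz.le]
        rw [Module.End.mem_eigenspace_iff]
        change Θ (N.mkQ (D.f a * u)) = _ • N.mkQ (D.f a * u)
        have h1 : D.dl * D.f a = D.f a * D.dl + (D.z (.inr (.inl a)) : K) • D.f a := D.dl_b _
        rw [hΘ, ← mul_assoc, h1, D.z_f, add_mul, mul_assoc, add_sub_right_comm, mul_assoc,
          ← mul_sub, map_add]
        have h2 := congrArg (N.mapQ N _ hle) hy
        rw [map_smul] at h2
        change N.mkQ (D.f a * (D.dl * u - u * D.dl)) = -(k : K) • N.mkQ (D.f a * u) at h2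
        rw [h2, smul_mul_assoc, map_smul, ← add_smul]
        push_cast [hz']; congr 1; ring
    refine (show _ ≤ V.comap (N.mapQ N _ hle) from sup_le ?_ (iSup₂_le fun k _ => key k)) hu
    rintro _ ⟨P, rfl⟩
    refine key 0 _ ?_
    rw [Module.End.mem_eigenspace_iff]
    change Θ (N.mkQ (D.j P)) = _
    rw [hΘ, D.dl_j]; simp
  have hall : ∀ m ∈ D.Um, ∀ u, N.mkQ u ∈ LinearMap.range (N.mkQ.comp D.j.toLinearMap) ⊔ V →
      N.mkQ (m * u) ∈ LinearMap.range (N.mkQ.comp D.j.toLinearMap) ⊔ V := fun m hm => by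
    induction hm using Algebra.adjoin_induction with
    | mem x hx =>
      obtain ⟨a, rfl⟩ := hx
      exact fun u hu => Submodule.mem_sup_right (hf a u hu)
    | algebraMap c =>
      intro u hu; rw [← Algebra.smul_def, map_smul]; exact Submodule.smul_mem _ c hu
    | add a b _ _ ha hb => intro x hx; rw [add_mul, map_add]; exact add_mem (ha x hx) (hb x hx)
    | mul a b _ _ ha hb => intro x hx; rw [mul_assoc]; exact ha _ (hb x hx)
  have hz' : N.mkQ z ∈ LinearMap.range (N.mkQ.comp D.j.toLinearMap) ⊔ V := by
    obtain ⟨y, hy, q, hq, hyq⟩ := Submodule.mem_sup.1 (D.UmA z)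
    rw [← hyq, map_add, (Submodule.Quotient.mk_eq_zero N).2 hq |> (id : N.mkQ q = 0 → _), add_zero]
    refine (Submodule.mul_le (P := (_ ⊔ V).comap N.mkQ)).2 ?_ hy
    rintro m hm _ ⟨P, rfl⟩
    exact hall m hm _ (Submodule.mem_sup_left ⟨P, rfl⟩)
  obtain ⟨_, ⟨P, rfl⟩, y, hy, hyz⟩ := Submodule.mem_sup.1 hz'
  have hy0 : y ∈ Module.End.eigenspace Θ 0 := by
    have e1 : Θ (N.mkQ z) = 0 := by rw [hΘ, hz, sub_self, map_zero]
    rw [← hyz, map_add] at e1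
    change Θ (N.mkQ (D.j P)) + _ = 0 at e1
    rw [hΘ, D.dl_j, sub_self, map_zero, zero_add] at e1
    rw [Module.End.mem_eigenspace_iff, e1, zero_smul]
  have hi := Module.End.eigenspaces_iSupIndep Θ
  have : y = 0 := by
    refine (Submodule.disjoint_def.1 (hi 0)) y hy0 ?_
    refine (iSup₂_le fun k hk => ?_ : V ≤ _) hy
    refine le_iSup₂_of_le _ (fun h => ?_) le_rfl
    rw [neg_eq_zero, Nat.cast_eq_zero] at h; omega
  rw [this, add_zero] at hyz
  have h3 : z - D.j P ∈ D.UN := (Submodule.Quotient.mk_eq_zero N).1 (by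
    change N.mkQ (z - D.j P) = 0
    rw [map_sub, ← hyz]; exact sub_self _)
  rwa [D.p_eq (D.UN_Q h3)]
theorem RD.p_mul {z : U} (hz : ∀ u, z * u = u * z) (u) : D.p (u * z) = D.p u * D.p z := by
  rw [← D.p_mj, ← sub_eq_zero, ← map_sub, ← mul_sub]
  exact D.p_UN (D.UN.mul_mem_left _ (D.cen_UN hz))
theorem RD.cen_hw {z : U} (hz : ∀ u, z * u = u * z) {M : Type*} [AddCommGroup M] [Module K M]
    (Φ : U →ₐ[K] Module.End K M) {v : M} {ν : Fin D.r → K}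
    (he : ∀ a, Φ (D.e a) v = 0) (hh : ∀ i, Φ (D.h i) v = ν i • v) :
    Φ z v = (D.p z).eval ν • v := by
  rw [← D.hw_j Φ hh, ← sub_eq_zero, ← LinearMap.sub_apply, ← map_sub]
  exact D.hw_UN Φ he (D.cen_UN hz)
end
section
variable {K g : Type*} [Field K] [LieRing g] [LieAlgebra K g] [CharZero K] [LieAlgebra.IsSemisimple K g]
open LieAlgebra
theorem perf (s : LieIdeal K g) : ⁅s, s⁆ = s := by
  obtain ⟨c, hc⟩ := exists_isCompl ⁅s, s⁆
  have h0 : s ⊓ c = ⊥ := by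
    refine (hasTrivialRadical_iff_no_abelian_ideals K g).1 inferInstance _ ?_
    have : ⁅s ⊓ c, s ⊓ c⁆ = ⊥ := by
      rw [eq_bot_iff, ← hc.inf_eq_bot]
      exact le_inf (LieSubmodule.mono_lie inf_le_left inf_le_left)
        ((LieSubmodule.lie_le_right _ _).trans inf_le_right)
    rwa [LieSubmodule.lie_abelian_iff_lie_self_eq_bot]
  refine le_antisymm (LieSubmodule.lie_le_right _ _) ?_
  calc s = s ⊓ (⁅s, s⁆ ⊔ c) := by rw [hc.sup_eq_top, inf_top_eq]
    _ = (s ⊓ ⁅s, s⁆) ⊔ (s ⊓ c) := inf_sup_left _ _ _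
    _ ≤ _ := by rw [h0, sup_bot_eq]; exact inf_le_right
variable {V : Type*} [AddCommGroup V] [Module K V] [LieRingModule g V] [LieModule K g V]
  [FiniteDimensional K V] [FiniteDimensional K g]
theorem nil_act (s : LieIdeal K g) (h : ∀ x ∈ s, ∀ y ∈ s, LieModule.traceForm K g V x y = 0) :
    ∀ x ∈ s, ∀ v : V, ⁅x, v⁆ = 0 := by
  have h1 : LieModule.traceForm K s V = 0 := by
    ext ⟨x, hx⟩ ⟨y, hy⟩
    exact h x hx y hy
  have h2 : LieModule.IsNilpotent (derivedSeries K s 1) V :=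
    LieModule.isNilpotent_derivedSeries_of_traceForm_eq_zero h1
  obtain ⟨N, hN⟩ := (LieModule.isNilpotent_iff K (derivedSeries K s 1) V).1 h2
  let W : ℕ → Submodule K V := fun k => (LieModule.lowerCentralSeries K (derivedSeries K s 1) V k).toSubmodule
  have hm : ∀ x ∈ s, ∀ hx : x ∈ s, (⟨x, hx⟩ : s) ∈ derivedSeries K s 1 := by
    intro x _ hx
    rw [LieIdeal.derivedSeries_eq_derivedSeriesOfIdeal_comap, LieIdeal.mem_comap]
    change x ∈ derivedSeriesOfIdeal K g 1 s
    rw [derivedSeriesOfIdeal_succ, derivedSeriesOfIdeal_zero, perf]; exact hx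
  have hJ : ∀ j, ∀ x ∈ s, ∀ k, ∀ v ∈ W k, ⁅x, v⁆ ∈ W (k + j + 1) := by
    intro j
    induction j with
    | zero =>
      intro x hx k v hv
      change ⁅x, v⁆ ∈ LieModule.lowerCentralSeries K (derivedSeries K s 1) V (k+1)
      rw [LieModule.lowerCentralSeries_succ]
      exact LieSubmodule.lie_mem_lie (x := (⟨⟨x, hx⟩, hm x hx hx⟩ : derivedSeries K s 1)) (LieSubmodule.mem_top _) hv
    | succ j ih =>
      intro x hx k v hv
      rw [← perf s] at hx
      rw [← LieSubmodule.mem_toSubmodule, LieSubmodule.lieIdeal_oper_eq_linear_span'] at hx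
      induction hx using Submodule.span_induction with
      | mem x hx =>
        obtain ⟨a, ha, b, hb, rfl⟩ := hx
        rw [lie_lie]
        have e1 := ih a ha _ _ (ih b hb _ _ hv)
        have e2 := ih b hb _ _ (ih a ha _ _ hv)
        refine sub_mem ?_ ?_
        · exact LieModule.antitone_lowerCentralSeries K (derivedSeries K s 1) V (by omega) e1
        · exact LieModule.antitone_lowerCentralSeries K (derivedSeries K s 1) V (by omega) e2
      | zero => simp
      | add x y _ _ h1 h2 => rw [add_lie]; exact add_mem h1 h2
      | smul c x _ h => rw [smul_lie]; exact Submodule.smul_mem _ _ h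
  intro x hx v
  have := hJ N x hx 0 v (by change v ∈ LieModule.lowerCentralSeries K _ V 0; simp)
  have h3 : LieModule.lowerCentralSeries K (derivedSeries K s 1) V (0+N+1) ≤ ⊥ :=
    hN ▸ LieModule.antitone_lowerCentralSeries K (derivedSeries K s 1) V (by omega)
  exact (LieSubmodule.mem_bot _).1 (h3 this)
/-- the Casimir operator -/
theorem cas (hV : ∃ x : g, ∃ v : V, ⁅x, v⁆ ≠ 0) : ∃ Ω : V →ₗ[K] V, (∀ x : g, ∀ v, Ω ⁅x, v⁆ = ⁅x, Ω v⁆) ∧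
    (∀ v, Ω v ∈ Submodule.span K {w | ∃ x : g, ∃ v : V, w = ⁅x, v⁆}) ∧ ¬ IsNilpotent Ω := by
  classical
  set B := LieModule.traceForm K g V with hB
  have hinv : B.lieInvariant g := LieModule.traceForm_lieInvariant K g V
  let s : LieIdeal K g := InvariantForm.orthogonal B hinv ⊤
  have hs : ∀ x, x ∈ s ↔ ∀ y, B y x = 0 := fun x => by simp [s, InvariantForm.mem_orthogonal]
  obtain ⟨c, hc⟩ := exists_isCompl s
  have hsym : ∀ x y, B x y = B y x := fun x y => LieModule.traceForm_comm K g V x y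
  let Bc : LinearMap.BilinForm K c := B.restrict c.toSubmodule
  have hnd : Bc.Nondegenerate := by
    have key : ∀ x : c, (∀ y : c, B x y = 0) → x = 0 := by
      intro x hx
      have : (x : g) ∈ s := (hs _).2 fun y => by
        have : y ∈ s ⊔ c := by rw [hc.sup_eq_top]; trivial
        obtain ⟨a, ha, b, hb, rfl⟩ := (LieSubmodule.mem_sup _ _ _).1 this
        rw [map_add, LinearMap.add_apply, hsym a, (hs a).1 ha, hsym b, hx ⟨b, hb⟩, add_zero]
      have h3 : (x : g) ∈ s ⊓ c := ⟨this, x.2⟩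
      rw [hc.inf_eq_bot] at h3
      exact Subtype.ext ((LieSubmodule.mem_bot _).1 h3)
    exact ⟨fun x hx => key x fun y => hx y, fun x hx => key x fun y => (hsym _ _).trans (hx y)⟩
  let n := Module.finrank K c
  let b : Module.Basis (Fin n) K c := Module.finBasis K c
  let b' := Bc.dualBasis hnd b
  have hbb' : ∀ i j, Bc (b' i) (b j) = if j = i then 1 else 0 := fun i j =>
    Bc.apply_dualBasis_left hnd b i j
  let φ := LieModule.toEnd K g V
  let Ω : V →ₗ[K] V := ∑ i, φ (b i) * φ (b' i)
  have hn : 0 < n := by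
    rw [Module.finrank_pos_iff]
    by_contra h
    obtain ⟨x, v, hxv⟩ := hV
    refine hxv (nil_act s (fun x hx y hy => (hs y).1 hy x) x ?_ v)
    have : x ∈ s ⊔ c := by rw [hc.sup_eq_top]; trivial
    obtain ⟨a, ha, b, hb, rfl⟩ := (LieSubmodule.mem_sup _ _ _).1 this
    have : (⟨b, hb⟩ : c) = 0 := by
      rw [not_nontrivial_iff_subsingleton] at h; exact Subsingleton.elim _ _
    rw [show b = 0 from congrArg Subtype.val this, add_zero]; exact ha
  refine ⟨Ω, ?_, ?_, ?_⟩
  · intro x v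
    have e1 : ∀ y : c, y = ∑ j, Bc (b' j) y • b j := fun y => by
      apply b.ext_elem; intro i
      have := fun j : Fin n => b.repr_self j
      conv_lhs => rw [← b.sum_repr y]
      have h5 : ∀ j, Bc (b' j) y = b.repr y j := fun j => by
        conv_lhs => rw [← b.sum_repr y]
        rw [map_sum, Finset.sum_eq_single j (fun i _ hi => by rw [map_smul, hbb', if_neg hi, smul_zero]) (by simp), map_smul, hbb', if_pos rfl, smul_eq_mul, mul_one]
      simp only [h5]
    have e2 : ∀ y : c, y = ∑ j, Bc y (b j) • b' j := fun y => by
      have h5 : ∀ j, Bc y (b j) = b'.repr y j := fun j => by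
        conv_lhs => rw [← b'.sum_repr y]
        rw [map_sum, LinearMap.sum_apply, Finset.sum_eq_single j (fun i _ hi => by rw [map_smul, LinearMap.smul_apply, hbb', if_neg hi.symm, smul_zero]) (by simp), map_smul, LinearMap.smul_apply, hbb', if_pos rfl, smul_eq_mul, mul_one]
      simp only [h5, b'.sum_repr]
    let ax : c → c := fun y => ⟨⁅x, (y:g)⁆, lie_mem_right K g _ x _ y.2⟩
    have hax : ∀ y z : c, Bc (ax y) z = - Bc y (ax z) := fun y z => by
      have := hinv x y z
      exact this
    have f1 : ∀ i, ⁅x, (b i : g)⁆ = ∑ j, Bc (b' j) (ax (b i)) • (b j : g) := fun i => by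
      have := congrArg Subtype.val (e1 (ax (b i)))
      simpa [ax] using this
    have f2 : ∀ i, ⁅x, (b' i : g)⁆ = ∑ j, Bc (ax (b' i)) (b j) • (b' j : g) := fun i => by
      have := congrArg Subtype.val (e2 (ax (b' i)))
      simpa [ax] using this
    have : ⁅x, Ω v⁆ - Ω ⁅x, v⁆ = ∑ i, (⁅⁅x, (b i : g)⁆, ⁅(b' i : g), v⁆⁆ + ⁅(b i : g), ⁅⁅x, (b' i : g)⁆, v⁆⁆) := by
      simp only [Ω, LinearMap.sum_apply, Module.End.mul_apply, φ, LieModule.toEnd_apply_apply, lie_sum,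
        ← Finset.sum_sub_distrib]
      refine Finset.sum_congr rfl fun i _ => ?_
      rw [lie_lie, lie_lie, lie_sub]; abel
    rw [eq_comm, ← sub_eq_zero, this]
    simp only [f1, f2, sum_lie, lie_sum, smul_lie, lie_smul, Finset.sum_add_distrib]
    rw [Finset.sum_comm, ← Finset.sum_add_distrib]
    refine Finset.sum_eq_zero fun i _ => ?_
    rw [← Finset.sum_add_distrib]
    refine Finset.sum_eq_zero fun j _ => ?_
    rw [hax, neg_smul, add_neg_cancel]
  · intro v
    simp only [Ω, LinearMap.sum_apply, Module.End.mul_apply]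
    exact Submodule.sum_mem _ fun i _ => Submodule.subset_span ⟨_, _, rfl⟩
  · intro h
    have h0 := LinearMap.isNilpotent_trace_of_isNilpotent h
    have h1 : LinearMap.trace K V Ω = n := by
      simp only [Ω, map_sum]
      rw [Finset.sum_congr rfl (g := fun _ => (1:K)) fun i _ => ?_]
      · simp
      · have := hbb' i i
        rw [if_pos rfl] at this
        rw [← this]
        exact (hsym (b i) (b' i))
    rw [h1, isNilpotent_iff_eq_zero] at h0
    exact hn.ne' (by exact_mod_cast h0)
end
section
variable {K g : Type*} [Field K] [LieRing g] [LieAlgebra K g] [CharZero K] [LieAlgebra.IsSemisimple K g]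
variable {V : Type*} [AddCommGroup V] [Module K V] [FiniteDimensional K g]
theorem wS (ρ : g →ₗ[K] Module.End K V) (hρ : ∀ x y v, ρ ⁅x, y⁆ v = ρ x (ρ y v) - ρ y (ρ x v)) (n : ℕ) :
    ∀ W : Submodule K V, FiniteDimensional K W → (∀ x, ∀ w ∈ W, ρ x w ∈ W) → Module.finrank K W = n →
    ∀ w ∈ W, ∃ w0 ∈ W, (∀ x, ρ x w0 = 0) ∧ w - w0 ∈ Submodule.span K {y | ∃ x, ∃ v ∈ W, y = ρ x v} := by
  induction n using Nat.strong_induction_on with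
  | _ n ih =>
  intro W hf hst hn w hw
  by_cases ht : ∀ x, ∀ w ∈ W, ρ x w = 0
  · exact ⟨w, hw, fun x => ht x w hw, by simp⟩
  let br : g → W → W := fun x v => ⟨ρ x v, hst x v v.2⟩
  letI : LieRingModule g W :=
    { bracket := br
      add_lie := fun x y v => Subtype.ext (by simp [br])
      lie_add := fun x v w => Subtype.ext (by simp [br])
      leibniz_lie := fun x y v => Subtype.ext (by
        change ρ x (ρ y v) = ρ ⁅x, y⁆ v + ρ y (ρ x v)
        rw [hρ]; abel) }
  letI : LieModule K g W :=
    { smul_lie := fun t x v => Subtype.ext (by change ρ (t • x) v = t • ρ x v; simp)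
      lie_smul := fun t x v => Subtype.ext (by change ρ x (t • (v:V)) = t • ρ x v; simp) }
  have hbr : ∀ (x : g) (v : W), ((⁅x, v⁆ : W) : V) = ρ x v := fun _ _ => rfl
  obtain ⟨Ω, h1, h2, h3⟩ := cas (K := K) (g := g) (V := W) (by
    by_contra h
    push Not at h
    exact ht fun x w hw => congrArg Subtype.val (h x ⟨w, hw⟩))
  obtain ⟨N, hN1, hN⟩ := ((Filter.eventually_ge_atTop 1).and
    (LinearMap.eventually_isCompl_ker_pow_range_pow Ω)).exists
  have hcomm : ∀ N, ∀ x : g, ∀ v, (Ω ^ N) ⁅x, v⁆ = ⁅x, (Ω ^ N) v⁆ := by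
    intro N x
    induction N with
    | zero => intro v; rfl
    | succ N ih => intro v; rw [pow_succ, Module.End.mul_apply, h1, ih]; rfl
  let k : Submodule K V := (LinearMap.ker (Ω ^ N)).map W.subtype
  have hkW : k ≤ W := by rintro _ ⟨y, _, rfl⟩; exact y.2
  haveI : FiniteDimensional K k := Submodule.finiteDimensional_of_le hkW
  have hlt : k < W := lt_of_le_of_ne hkW fun h => h3 ⟨N, by
    ext v
    have : (v : V) ∈ k := h.ge v.2
    obtain ⟨y, hy, hyv⟩ := this
    have : y = v := Subtype.ext hyv
    subst this
    rw [show (Ω ^ N) y = 0 from hy]; rfl⟩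
  have hw' : (⟨w, hw⟩ : W) ∈ LinearMap.ker (Ω ^ N) ⊔ LinearMap.range (Ω ^ N) := by
    rw [hN.sup_eq_top]; trivial
  obtain ⟨a, ha, b, ⟨c, hc⟩, hab⟩ := Submodule.mem_sup.1 hw'
  obtain ⟨w0, hw0, hw1, hw2⟩ := ih _ (hn ▸ Submodule.finrank_lt_finrank_of_lt hlt) k inferInstance (by
    rintro x _ ⟨y, hy, rfl⟩
    exact ⟨⁅x, y⁆, by rw [SetLike.mem_coe, LinearMap.mem_ker, hcomm, show (Ω ^ N) y = 0 from hy, lie_zero], rfl⟩) rfl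
    (a : V) ⟨a, ha, rfl⟩
  refine ⟨w0, hkW hw0, hw1, ?_⟩
  have e : w - w0 = (a - w0) + b := by
    have := congrArg Subtype.val hab
    change (a : V) + b = w at this
    rw [← this]; abel
  rw [e]
  refine add_mem (Submodule.span_mono ?_ hw2) ?_
  · rintro _ ⟨x, v, hv, rfl⟩; exact ⟨x, v, hkW hv, rfl⟩
  · obtain ⟨M, rfl⟩ : ∃ M, N = M + 1 := ⟨N - 1, by omega⟩
    rw [pow_succ', Module.End.mul_apply] at hc
    have := h2 ((Ω ^ M) c)
    rw [hc] at this
    have h4 := Submodule.mem_map_of_mem (f := W.subtype) this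
    rw [Submodule.map_span] at h4
    refine Submodule.span_mono ?_ h4
    rintro _ ⟨_, ⟨x, v, rfl⟩, rfl⟩
    exact ⟨x, v, v.2, rfl⟩
/-- invariants meet `gW` trivially -/
theorem wC (ρ : g →ₗ[K] Module.End K V) (hρ : ∀ x y v, ρ ⁅x, y⁆ v = ρ x (ρ y v) - ρ y (ρ x v))
    (W : Submodule K V) (hf : FiniteDimensional K W) (hst : ∀ x, ∀ w ∈ W, ρ x w ∈ W)
    (w : V) (hw : ∀ x, ρ x w = 0) (hw2 : w ∈ Submodule.span K {y | ∃ x, ∃ v ∈ W, y = ρ x v}) : w = 0 := by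
  have hle : Submodule.span K {y | ∃ x, ∃ v ∈ W, y = ρ x v} ≤ W := by
    rw [Submodule.span_le]; rintro _ ⟨x, v, hv, rfl⟩; exact hst x v hv
  have hwW := hle hw2
  by_contra hne
  let r : g →ₗ[K] W →ₗ[K] W :=
    { toFun := fun x => (ρ x).restrict (hst x)
      map_add' := fun x y => LinearMap.ext fun v => Subtype.ext (by
        change ρ (x + y) v = ρ x v + ρ y v; rw [map_add]; rfl)
      map_smul' := fun t x => LinearMap.ext fun v => Subtype.ext (by
        change ρ (t • x) v = t • ρ x v; rw [map_smul]; rfl) }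
  let σ : g →ₗ[K] Module.End K (Module.Dual K W) :=
    { toFun := fun x => -(r x).dualMap
      map_add' := fun x y => by ext f v; simp; ring
      map_smul' := fun t x => by ext f v; simp }
  have hσ : ∀ x (f : Module.Dual K W) (v : W), σ x f v = - f ⟨ρ x v, hst x v v.2⟩ := fun _ _ _ => rfl
  obtain ⟨f, hf⟩ : ∃ f : Module.Dual K W, f ⟨w, hwW⟩ ≠ 0 := by
    by_contra h
    push Not at h
    exact hne (congrArg Subtype.val ((Module.forall_dual_apply_eq_zero_iff K _).1 h))
  obtain ⟨f0, -, h0, h1⟩ := wS σ (fun x y f => by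
    ext v
    rw [LinearMap.sub_apply]
    simp only [hσ, neg_neg, hρ]
    rw [neg_eq_iff_eq_neg, neg_sub, ← map_sub]; congr 1) _ ⊤ inferInstance (fun _ _ _ => trivial) rfl f trivial
  apply hf
  have e1 : ∀ f' ∈ Submodule.span K {y | ∃ x, ∃ v ∈ (⊤ : Submodule K (Module.Dual K W)), y = σ x v}, f' ⟨w, hwW⟩ = 0 := by
    intro f' hf'
    induction hf' using Submodule.span_induction with
    | mem f' h =>
      obtain ⟨x, v, -, rfl⟩ := h
      rw [hσ]
      have : (⟨ρ x w, hst x w hwW⟩ : W) = 0 := Subtype.ext (hw x)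
      simp [this]
    | zero => rfl
    | add a b _ _ ha hb => rw [LinearMap.add_apply, ha, hb, add_zero]
    | smul c a _ ha => rw [LinearMap.smul_apply, ha, smul_zero]
  have e2 : ∀ y, ∀ hy : y ∈ Submodule.span K {y | ∃ x, ∃ v ∈ W, y = ρ x v}, f0 ⟨y, hle hy⟩ = 0 := by
    intro y hy
    induction hy using Submodule.span_induction with
    | mem y h =>
      obtain ⟨x, v, hv, rfl⟩ := h
      have := congrArg (fun f : Module.Dual K W => f ⟨v, hv⟩) (h0 x)
      simp only [hσ, LinearMap.zero_apply, neg_eq_zero] at this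
      exact this
    | zero => exact map_zero f0
    | add a b ha hb h1 h2 =>
      have : (⟨a + b, hle (add_mem ha hb)⟩ : W) = ⟨a, hle ha⟩ + ⟨b, hle hb⟩ := rfl
      rw [this, map_add, h1, h2, add_zero]
    | smul c a ha h =>
      have : (⟨c • a, hle (Submodule.smul_mem _ c ha)⟩ : W) = c • ⟨a, hle ha⟩ := rfl
      rw [this, map_smul, h, smul_zero]
  have := e1 _ h1
  rw [LinearMap.sub_apply, e2 w hw2, sub_zero] at this
  exact this
/-- simultaneous eigenvectors -/
theorem EV {ι : Type*} [Finite ι] (h : ι → Module.End K V) (hc : ∀ i j, Commute (h i) (h j)) (W : Submodule K V)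
    (hW : W ≠ ⊥) (hs : ∀ i, ∀ w ∈ W, h i w ∈ W)
    (hq : ∀ i, ∃ s : List K, ∀ w ∈ W, (s.map fun c => h i - algebraMap K _ c).prod w = 0) :
    ∃ v ∈ W, v ≠ 0 ∧ ∃ ν : ι → K, ∀ i, h i v = ν i • v := by
  classical
  have key : ∀ t : Finset ι, ∃ W' ≤ W, W' ≠ ⊥ ∧ (∀ i, ∀ w ∈ W', h i w ∈ W') ∧ ∀ i ∈ t, ∃ c : K, ∀ w ∈ W', h i w = c • w := by
    intro t
    induction t using Finset.induction_on with
    | empty => exact ⟨W, le_rfl, hW, hs, by simp⟩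
    | insert a t ha ih =>
      obtain ⟨W', h1, h2, h3, h4⟩ := ih
      obtain ⟨s, hs'⟩ := hq a
      obtain ⟨c, w, hw, hw0, hcw⟩ : ∃ c : K, ∃ w ∈ W', w ≠ 0 ∧ h a w = c • w := by
        obtain ⟨w, hw, hw0⟩ := Submodule.exists_mem_ne_zero_of_ne_bot h2
        have hsw := hs' w (h1 hw)
        clear hs'
        induction s with
        | nil => exact absurd hsw (by simpa using hw0)
        | cons c s ih =>
          by_cases hz : (s.map fun c => h a - algebraMap K _ c).prod w = 0
          · exact ih hz
          · refine ⟨c, (s.map fun c => h a - algebraMap K _ c).prod w, ?_, hz, ?_⟩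
            · clear ih hz hsw
              induction s with
              | nil => simpa using hw
              | cons c s ih =>
                rw [List.map_cons, List.prod_cons, Module.End.mul_apply, LinearMap.sub_apply]
                exact sub_mem (h3 _ _ ih) (Submodule.smul_mem _ _ ih)
            · rw [List.map_cons, List.prod_cons, Module.End.mul_apply, LinearMap.sub_apply, sub_eq_zero] at hsw
              exact hsw
      refine ⟨W' ⊓ LinearMap.ker (h a - algebraMap K _ c), inf_le_left.trans h1, ?_, ?_, ?_⟩
      · intro hb
        have : w ∈ W' ⊓ LinearMap.ker (h a - algebraMap K _ c) :=
          ⟨hw, by rw [SetLike.mem_coe, LinearMap.mem_ker, LinearMap.sub_apply, hcw]; exact sub_self _⟩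
        rw [hb] at this; exact hw0 this
      · rintro i y ⟨hy, hy2⟩
        refine ⟨h3 i y hy, ?_⟩
        rw [SetLike.mem_coe, LinearMap.mem_ker] at hy2 ⊢
        have : Commute (h a - algebraMap K (Module.End K V) c) (h i) :=
          (hc a i).sub_left (Algebra.commutes c (h i))
        rw [← Module.End.mul_apply, this.eq, Module.End.mul_apply, hy2, map_zero]
      · intro i hi
        rcases Finset.mem_insert.1 hi with rfl | hi
        · exact ⟨c, fun y hy => by
            have := hy.2
            rw [SetLike.mem_coe, LinearMap.mem_ker, LinearMap.sub_apply, sub_eq_zero] at this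
            exact this⟩
        · obtain ⟨c', hc'⟩ := h4 i hi
          exact ⟨c', fun y hy => hc' y hy.1⟩
  haveI := Fintype.ofFinite ι
  obtain ⟨W', h1, h2, h3, h4⟩ := key Finset.univ
  obtain ⟨w, hw, hw0⟩ := Submodule.exists_mem_ne_zero_of_ne_bot h2
  choose ν hν using fun i => h4 i (Finset.mem_univ i)
  exact ⟨w, h1 hw, hw0, ν, fun i => hν i w hw⟩
end
section
variable {K g : Type*} [Field K] [LieRing g] [LieAlgebra K g]
local notation "U" => UniversalEnvelopingAlgebra K g
variable (D : RD K g)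
attribute [local instance 100] LieRing.ofAssociativeRing
/-- the symmetric algebra -/
abbrev RD.S := MvPolynomial D.ix K
noncomputable def RD.lin : g →ₗ[K] D.S := D.b.constr K fun k => .X k
theorem RD.lin_b (k : D.ix) : D.lin (D.b k) = .X k := by simp [RD.lin]
noncomputable def RD.F0 : D.R := ∑ a, D.lam a (D.b a)
noncomputable def RD.LL (x : g) : D.R := D.der x D.F0
theorem RD.LL_eq (x : g) : D.LL x = ∑ a, D.lam a ⁅x, D.b a⁆ := by
  simp [RD.LL, RD.F0, map_sum, RD.der_lam]
theorem RD.ex_r [LieAlgebra.IsSemisimple K g] : ∃ r : D.R →ₐ[K] D.S, ∀ x, r (D.LL x) = D.lin x := by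
  let m : g →ₗ[K] (D.ix × D.ix → K) := LinearMap.pi fun q => D.b.coord q.1 ∘ₗ (LieAlgebra.ad K g : g →ₗ[K] Module.End K g).flip (D.b q.2)
  have hm : ∀ x q, m x q = D.b.repr ⁅x, D.b q.2⁆ q.1 := fun _ _ => rfl
  have hk : LinearMap.ker m = ⊥ := by
    rw [LinearMap.ker_eq_bot']
    intro x hx
    refine cen0 K x fun y => ?_
    rw [D.b_sum y, lie_sum]
    refine Finset.sum_eq_zero fun k _ => ?_
    rw [lie_smul]
    have : ⁅x, D.b k⁆ = 0 := D.b.ext_elem fun l => by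
      have := congrFun hx (l, k)
      rw [hm] at this
      simpa using this
    rw [this, smul_zero]
  obtain ⟨π, hπ⟩ := m.exists_leftInverse_of_injective hk
  refine ⟨MvPolynomial.aeval fun q => D.lin (π (Pi.single q 1)), fun x => ?_⟩
  have h1 : D.LL x = ∑ q : D.ix × D.ix, m x q • MvPolynomial.X q := by
    rw [D.LL_eq, Fintype.sum_prod_type, Finset.sum_comm]
    refine Finset.sum_congr rfl fun a _ => ?_
    conv_lhs => rw [D.b_sum ⁅x, D.b a⁆]
    simp only [map_sum, map_smul, D.lam_b, hm]
  rw [h1, map_sum]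
  simp only [map_smul, MvPolynomial.aeval_X]
  conv_rhs => rw [show x = π (m x) from (LinearMap.congr_fun hπ x).symm, show m x = ∑ q, m x q • Pi.single q 1 from (pi_eq_sum_univ' _)]
  simp only [map_sum, map_smul]
theorem RD.der_comp (x y : g) (P) : D.der ⁅x, y⁆ P = D.der x (D.der y P) - D.der y (D.der x P) := by
  rw [D.der_lie, Derivation.commutator_apply]
theorem RD.ex_q : ∃ q : U →ₗ[K] (ℕ → D.R), (q 1 = Pi.single 0 1) ∧ ∀ x u, q (io K g x * u) 0 = D.der x (q u 0) ∧
    ∀ k, q (io K g x * u) (k+1) = D.der x (q u (k+1)) + D.LL x * q u k := by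
  have hL : ∀ x y, D.der ⁅x, y⁆ = D.der x ∘ D.der y - D.der y ∘ D.der x := fun x y => funext fun P => D.der_comp x y P
  have da : ∀ x y, D.der (x + y) = D.der x + D.der y := fun x y => MvPolynomial.derivation_ext fun q => by
      simp [RD.der_X]
  have ds : ∀ (c : K) y, D.der (c • y) = c • D.der y := fun x y => MvPolynomial.derivation_ext fun q => by
      simp [RD.der_X]
  let φ : g →ₗ[K] Module.End K (ℕ → D.R) :=
    { toFun := fun x =>
        { toFun := fun Q k => Nat.casesOn k (D.der x (Q 0)) fun k => D.der x (Q (k+1)) + D.LL x * Q k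
          map_add' := fun Q Q' => by funext k; cases k <;> simp [mul_add]; abel
          map_smul' := fun c Q => by funext k; cases k <;> simp }
      map_add' := fun x y => by
        refine LinearMap.ext fun Q => funext fun k => ?_
        cases k
        · simp [da]
        · simp [da, RD.LL, add_mul]; abel
      map_smul' := fun c x => by
        refine LinearMap.ext fun Q => funext fun k => ?_
        cases k <;> simp [ds, RD.LL] }
  have h0 : ∀ x Q, φ x Q 0 = D.der x (Q 0) := fun _ _ => rfl
  have h1 : ∀ x Q k, φ x Q (k+1) = D.der x (Q (k+1)) + D.LL x * Q k := fun _ _ _ => rfl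
  obtain ⟨Φ, hΦ⟩ := U_lift φ (fun x y => by
    refine LinearMap.ext fun Q => funext fun k => ?_
    change φ ⁅x, y⁆ Q k = φ x (φ y Q) k - φ y (φ x Q) k
    rcases k with _ | k
    · simp only [h0, D.der_comp]
    · rcases k with _ | k
      · simp only [h0, h1, D.der_comp, map_add, Derivation.leibniz, RD.LL, smul_eq_mul]; ring
      · simp only [h1, D.der_comp, map_add, Derivation.leibniz, RD.LL, smul_eq_mul]; ring)
  refine ⟨(LinearMap.applyₗ (Pi.single 0 1)).comp Φ.toLinearMap, by simp, fun x u => ?_⟩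
  have : ∀ k, ((LinearMap.applyₗ (Pi.single 0 1)).comp Φ.toLinearMap) (io K g x * u) k = φ x (Φ u (Pi.single 0 1)) k := by
    intro k
    change Φ (io K g x * u) _ k = _
    rw [map_mul, hΦ]; rfl
  exact ⟨(this 0).trans (h0 _ _), fun k => (this _).trans (h1 _ _ _)⟩
noncomputable def RD.q : U →ₗ[K] (ℕ → D.R) := D.ex_q.choose
theorem RD.q_1 : D.q 1 = Pi.single 0 1 := D.ex_q.choose_spec.1
theorem RD.q_0 (x u) : D.q (io K g x * u) 0 = D.der x (D.q u 0) := (D.ex_q.choose_spec.2 x u).1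
theorem RD.q_s (x u k) : D.q (io K g x * u) (k+1) = D.der x (D.q u (k+1)) + D.LL x * D.q u k :=
  (D.ex_q.choose_spec.2 x u).2 k
theorem RD.Ph_q (u : U) : ∀ N, D.Ph u (D.F0 ^ N) = ∑ k ∈ Finset.range (N + 1), (N.descFactorial k : D.R) * (D.F0 ^ (N - k) * D.q u k) := by
  intro N
  let P : Submodule K U := LinearMap.eqLocus ((LinearMap.applyₗ (D.F0 ^ N)).comp D.Ph.toLinearMap)
    (∑ k ∈ Finset.range (N + 1), (LinearMap.mulLeft K (N.descFactorial k * D.F0 ^ (N - k) : D.R)).comp ((LinearMap.proj k).comp D.q))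
  have hP : ∀ u, u ∈ P ↔ D.Ph u (D.F0 ^ N) = ∑ k ∈ Finset.range (N + 1), (N.descFactorial k : D.R) * (D.F0 ^ (N - k) * D.q u k) := by
    intro u
    rw [LinearMap.mem_eqLocus, LinearMap.sum_apply]
    simp only [LinearMap.comp_apply, LinearMap.mulLeft_apply, mul_assoc]
    rfl
  refine (hP u).1 (U_ind P ((hP 1).2 ?_) (fun x u hu => (hP _).2 ?_) u)
  · rw [Finset.sum_eq_single 0]
    · simp [D.q_1]
    · intro k _ hk; simp [D.q_1, hk]
    · simp
  · rw [hP] at hu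
    rw [map_mul, Module.End.mul_apply, hu, D.Ph_io, map_sum]
    have e : ∀ k, D.der x ((N.descFactorial k : D.R) * (D.F0 ^ (N - k) * D.q u k)) =
        (N.descFactorial (k+1) : D.R) * (D.F0 ^ (N - (k+1)) * (D.LL x * D.q u k)) +
        (N.descFactorial k : D.R) * (D.F0 ^ (N - k) * D.der x (D.q u k)) := by
      intro k
      rw [Derivation.leibniz, Derivation.leibniz, Derivation.leibniz_pow, Derivation.map_natCast, Nat.descFactorial_succ]
      simp only [smul_eq_mul, nsmul_eq_mul, RD.LL, Nat.sub_sub]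
      push_cast; ring
    simp only [e, Finset.sum_add_distrib]
    rw [Finset.sum_range_succ, Nat.descFactorial_eq_zero_iff_lt.2 (Nat.lt_succ_self N), Nat.cast_zero, zero_mul, add_zero,
      Finset.sum_range_succ' (fun k => (N.descFactorial k : D.R) * (D.F0 ^ (N - k) * D.der x (D.q u k))), ← add_assoc, ← Finset.sum_add_distrib, Finset.sum_range_succ', D.q_0]
    congr 1
    refine Finset.sum_congr rfl fun k _ => ?_
    rw [D.q_s]; ring
theorem RD.Ph_ker [CharZero K] {u : U} (h : D.Ph u = 0) : D.q u = 0 := by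
  funext N
  induction N using Nat.strong_induction_on with
  | _ N ih =>
  have := D.Ph_q u N
  rw [h, LinearMap.zero_apply, Finset.sum_range_succ, Finset.sum_eq_zero (fun k hk => by
    rw [ih k (Finset.mem_range.1 hk)]; simp), zero_add, Nat.sub_self, pow_zero, one_mul, Nat.descFactorial_self] at this
  rcases mul_eq_zero.1 this.symm with h | h
  · exact absurd h (by exact_mod_cast N.factorial_ne_zero)
  · exact h
theorem RD.q_FF (d : ℕ) : ∀ u ∈ FF K g d, ∀ k, d < k → D.q u k = 0 := by
  intro u hu k
  induction d generalizing u k with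
  | zero =>
    intro hk
    rw [FF, pow_zero, Submodule.mem_one] at hu
    obtain ⟨c, rfl⟩ := hu
    rw [Algebra.algebraMap_eq_smul_one, map_smul, D.q_1, Pi.smul_apply, Pi.single_eq_of_ne hk.ne', smul_zero]
  | succ d ih =>
    intro hk
    refine FF_succ_le (P := LinearMap.ker ((LinearMap.proj k).comp D.q)) (fun u hu => ih u hu k (by omega)) (fun x u hu => ?_) hu
    obtain ⟨k, rfl⟩ : ∃ l, k = l + 1 := ⟨k - 1, by omega⟩
    change D.q (io K g x * u) (k+1) = 0
    rw [D.q_s, ih u hu _ (by omega), ih u hu _ (by omega)]; simp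
variable [LieAlgebra.IsSemisimple K g]
noncomputable def RD.sy (d : ℕ) : U →ₗ[K] D.S := D.ex_r.choose.toLinearMap ∘ₗ LinearMap.proj d ∘ₗ D.q
theorem RD.sy_eq (d : ℕ) (u : U) : D.sy d u = D.ex_r.choose (D.q u d) := rfl
theorem RD.sy_lt {d k : ℕ} (h : d < k) {u : U} (hu : u ∈ FF K g d) : D.sy k u = 0 := by
  rw [D.sy_eq, D.q_FF d u hu k h, map_zero]
theorem RD.sy_1 : D.sy 0 (1 : U) = 1 := by rw [D.sy_eq, D.q_1]; simp
theorem RD.sy_io {d : ℕ} (x) {u : U} (hu : u ∈ FF K g d) : D.sy (d+1) (io K g x * u) = D.lin x * D.sy d u := by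
  rw [D.sy_eq, D.q_s, D.q_FF d u hu (d+1) (by omega), map_zero, zero_add, map_mul, D.ex_r.choose_spec]; rfl
theorem RD.sy_mul {d e : ℕ} {u v : U} (hu : u ∈ FF K g d) (hv : v ∈ FF K g e) :
    D.sy (d + e) (u * v) = D.sy d u * D.sy e v := by
  induction d generalizing u with
  | zero =>
    rw [FF, pow_zero, Submodule.mem_one] at hu
    obtain ⟨c, rfl⟩ := hu
    rw [Algebra.algebraMap_eq_smul_one, map_smul, D.sy_1, smul_mul_assoc, one_mul, smul_mul_assoc, one_mul, zero_add, map_smul]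
  | succ d ih =>
    have hP := FF_succ_le (d := d) (K := K) (g := g) (P := LinearMap.eqLocus ((D.sy (d+1+e)).comp (LinearMap.mulRight K v)) ((LinearMap.mulRight K (D.sy e v)).comp (D.sy (d+1)))) (fun u hu => ?_) (fun x u hu => ?_)
    · exact hP hu
    · change D.sy (d+1+e) (u * v) = D.sy (d+1) u * D.sy e v
      rw [D.sy_lt (d.lt_succ_self) hu, zero_mul, D.sy_lt (d := d + e) (by omega) (FF_mul hu hv)]
    · change D.sy (d+1+e) (io K g x * u * v) = D.sy (d+1) (io K g x * u) * D.sy e v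
      rw [D.sy_io x hu, mul_assoc, mul_assoc, ← ih hu, show d+1+e = d+e+1 by omega, D.sy_io x (FF_mul hu hv)]
end
section
variable {K g : Type*} [Field K] [LieRing g] [LieAlgebra K g]
local notation "U" => UniversalEnvelopingAlgebra K g
variable (K g) in
noncomputable def FL : ℕ → Submodule K U
  | 0 => ⊥
  | d + 1 => FF K g d
theorem FL_le : ∀ d, FL K g d ≤ FF K g d
  | 0 => bot_le
  | d + 1 => FF_mono d.le_succ
theorem FL_io {d : ℕ} (x : g) {u : U} (hu : u ∈ FL K g d) : io K g x * u ∈ FL K g (d + 1) := by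
  cases d with
  | zero => rw [(Submodule.mem_bot K).1 hu, mul_zero]; exact zero_mem _
  | succ d => exact FF_io x hu
variable (D : RD K g)
noncomputable def RD.M (l : List D.ix) : U := (l.map fun k => io K g (D.b k)).prod
theorem RD.M_cons (k) (l : List D.ix) : D.M (k :: l) = io K g (D.b k) * D.M l := by simp [RD.M]
theorem RD.M_FF (l : List D.ix) : D.M l ∈ FF K g l.length := by
  induction l with
  | nil => simpa [RD.M] using FF_one 0
  | cons k l ih => rw [D.M_cons]; exact FF_io _ ih
theorem RD.M_perm {l l' : List D.ix} (h : l.Perm l') : D.M l - D.M l' ∈ FL K g l.length := by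
  induction h with
  | nil => simp
  | cons x _ ih => rw [D.M_cons, D.M_cons, ← mul_sub]; exact FL_io _ ih
  | swap x y l =>
    simp only [D.M_cons]
    rw [← mul_assoc, ← mul_assoc, ← sub_mul, ← io_lie]
    exact FF_io _ (D.M_FF l)
  | trans h1 h2 ih1 ih2 =>
    rw [← sub_add_sub_cancel]
    exact add_mem ih1 (h1.length_eq ▸ ih2)
noncomputable def RD.sc : D.S →ₗ[K] U := (MvPolynomial.basisMonomials D.ix K).constr K
  fun m => D.M m.toMultiset.toList
theorem RD.sc_m (m) : D.sc (MvPolynomial.monomial m 1) = D.M m.toMultiset.toList := by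
  have := (MvPolynomial.basisMonomials D.ix K).constr_basis K (fun m => D.M m.toMultiset.toList) m
  rwa [MvPolynomial.coe_basisMonomials] at this
theorem hom_ind {σ : Type*} {d : ℕ} (W : Submodule K (MvPolynomial σ K)) (h : ∀ m : σ →₀ ℕ, m.degree = d → MvPolynomial.monomial m (1:K) ∈ W)
    {P : MvPolynomial σ K} (hP : P.IsHomogeneous d) : P ∈ W := by
  rw [P.as_sum]
  refine Submodule.sum_mem _ fun m hm => ?_
  rw [show MvPolynomial.monomial m (P.coeff m) = P.coeff m • MvPolynomial.monomial m (1:K) by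
    rw [MvPolynomial.smul_monomial, smul_eq_mul, mul_one]]
  exact W.smul_mem _ (h m (by
    by_contra hd
    exact (MvPolynomial.mem_support_iff.1 hm) (hP.coeff_eq_zero hd)))
theorem len_m {σ : Type*} (m : σ →₀ ℕ) : m.toMultiset.toList.length = m.degree := by
  rw [Multiset.length_toList, Finsupp.card_toMultiset]; rfl
theorem X_m {σ : Type*} (m : σ →₀ ℕ) : (m.toMultiset.map (MvPolynomial.X (R := K))).prod = MvPolynomial.monomial m 1 := by
  induction m using Finsupp.induction_linear with
  | zero => simp
  | add p q hp hq => rw [map_add, Multiset.map_add, Multiset.prod_add, hp, hq, MvPolynomial.monomial_mul, mul_one]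
  | single a b => rw [Finsupp.toMultiset_single, Multiset.map_nsmul, Multiset.prod_nsmul, Multiset.map_singleton,
      Multiset.prod_singleton, MvPolynomial.X_pow_eq_monomial]
theorem RD.sc_FF {d : ℕ} {P : D.S} (hP : P.IsHomogeneous d) : D.sc P ∈ FF K g d := by
  refine hom_ind ((FF K g d).comap D.sc) (fun m hm => ?_) hP
  change D.sc _ ∈ FF K g d
  rw [D.sc_m, ← hm, ← len_m]
  exact D.M_FF _
theorem RD.sc_ex (d : ℕ) : ∀ u ∈ FF K g d, ∃ P : D.S, P.IsHomogeneous d ∧ u - D.sc P ∈ FL K g d := by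
  intro u hu
  suffices h : FF K g d ≤ (MvPolynomial.homogeneousSubmodule D.ix K d).map D.sc ⊔ FL K g d by
    obtain ⟨_, ⟨P, hP, rfl⟩, v, hv, rfl⟩ := Submodule.mem_sup.1 (h hu)
    exact ⟨P, hP, by rwa [add_sub_cancel_left]⟩
  clear hu u
  induction d with
  | zero =>
    intro u hu
    rw [FF, pow_zero, Submodule.mem_one] at hu
    obtain ⟨c, rfl⟩ := hu
    refine Submodule.mem_sup_left ⟨MvPolynomial.C c, MvPolynomial.isHomogeneous_C _ _, ?_⟩
    rw [show (MvPolynomial.C c : D.S) = c • MvPolynomial.monomial 0 1 by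
      rw [MvPolynomial.smul_monomial, smul_eq_mul, mul_one]; rfl, map_smul, D.sc_m, Algebra.algebraMap_eq_smul_one]
    simp [RD.M]
  | succ d ih =>
    refine FF_succ_le (le_sup_right (b := FL K g (d+1))) fun x u hu => ?_
    obtain ⟨_, ⟨P, hP, rfl⟩, v, hv, rfl⟩ := Submodule.mem_sup.1 (ih hu)
    rw [mul_add]
    refine add_mem ?_ (Submodule.mem_sup_right (FL_io _ hv))
    rw [D.b_sum x, map_sum, Finset.sum_mul]
    refine Submodule.sum_mem _ fun k _ => ?_
    rw [map_smul, smul_mul_assoc]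
    refine Submodule.smul_mem _ _ ?_
    refine hom_ind (Submodule.comap ((LinearMap.mulLeft K (io K g (D.b k))).comp D.sc)
      ((MvPolynomial.homogeneousSubmodule D.ix K (d+1)).map D.sc ⊔ FL K g (d+1))) (fun m hm => ?_) hP
    change io K g (D.b k) * D.sc _ ∈ (MvPolynomial.homogeneousSubmodule D.ix K (d+1)).map D.sc ⊔ FL K g (d+1)
    rw [D.sc_m]
    have h1 := D.M_perm (l := k :: m.toMultiset.toList) (l' := (m + Finsupp.single k 1).toMultiset.toList) (by
      rw [← Multiset.coe_eq_coe, ← Multiset.cons_coe, Multiset.coe_toList, Multiset.coe_toList, Finsupp.toMultiset_add, Finsupp.toMultiset_single, one_smul, add_comm, Multiset.singleton_add])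
    rw [D.M_cons, List.length_cons, len_m, hm, ← D.sc_m (m + Finsupp.single k 1)] at h1
    rw [← sub_add_cancel (io K g (D.b k) * _) (D.sc (MvPolynomial.monomial (m + Finsupp.single k 1) 1))]
    refine add_mem (Submodule.mem_sup_right h1) (Submodule.mem_sup_left ⟨_, ?_, rfl⟩)
    exact MvPolynomial.isHomogeneous_monomial _ (by rw [map_add, hm]; simp)
variable [LieAlgebra.IsSemisimple K g]
theorem RD.sy_M (l : List D.ix) : D.sy l.length (D.M l) = (l.map MvPolynomial.X).prod := by
  induction l with
  | nil => simpa [RD.M] using D.sy_1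
  | cons k l ih => rw [D.M_cons, List.length_cons, D.sy_io _ (D.M_FF l), ih, D.lin_b]; simp
theorem RD.sy_sc {d : ℕ} {P : D.S} (hP : P.IsHomogeneous d) : D.sy d (D.sc P) = P := by
  refine hom_ind (LinearMap.eqLocus (D.sy d ∘ₗ D.sc) LinearMap.id) (fun m hm => ?_) hP
  change D.sy d (D.sc _) = MvPolynomial.monomial m 1
  rw [D.sc_m, ← hm, ← len_m, D.sy_M, ← Multiset.prod_coe, ← Multiset.map_coe, Multiset.coe_toList, X_m]
theorem RD.sy_FL {d : ℕ} {u : U} (hu : u ∈ FL K g d) : D.sy d u = 0 := by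
  cases d with
  | zero => rw [(Submodule.mem_bot K).1 hu, map_zero]
  | succ d => exact D.sy_lt d.lt_succ_self hu
theorem RD.sy_hom {d : ℕ} {u : U} (hu : u ∈ FF K g d) : (D.sy d u).IsHomogeneous d ∧ u - D.sc (D.sy d u) ∈ FL K g d := by
  obtain ⟨P, hP, h⟩ := D.sc_ex d u hu
  have := D.sy_FL h
  rw [map_sub, D.sy_sc hP, sub_eq_zero] at this
  rw [this]; exact ⟨hP, h⟩
theorem RD.sy_0 {d : ℕ} {u : U} (hu : u ∈ FF K g d) (h : D.sy d u = 0) : u ∈ FL K g d := by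
  have := (D.sy_hom hu).2
  rwa [h, map_zero, sub_zero] at this
theorem RD.sy_ex {u : U} (hu : u ≠ 0) : ∃ d, u ∈ FF K g d ∧ D.sy d u ≠ 0 := by
  classical
  have h := FF_top u
  refine ⟨Nat.find h, Nat.find_spec h, fun h0 => ?_⟩
  have h1 := D.sy_0 (Nat.find_spec h) h0
  rcases hd : Nat.find h with _ | d
  · rw [hd] at h1; exact hu ((Submodule.mem_bot K).1 h1)
  · rw [hd] at h1
    exact Nat.find_min h (m := d) (by omega) h1
theorem RD.Ph_inj [CharZero K] {u : U} (h : D.Ph u = 0) : u = 0 := by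
  by_contra hu
  obtain ⟨d, h1, h2⟩ := D.sy_ex hu
  rw [D.sy_eq, D.Ph_ker h] at h2
  exact h2 (map_zero _)
end
section
variable {K V : Type*} [Field K] [AddCommGroup V] [Module K V]
theorem ls_ap (h : Module.End K V) (s : List K) : (s.map fun c => h - algebraMap K _ c).prod =
    Polynomial.aeval h (s.map fun c => Polynomial.X - Polynomial.C c).prod := by
  rw [map_list_prod, List.map_map]; congr 1; simp [Function.comp_def]
theorem ls_l (h : Module.End K V) (s t : List K) {v : V} (hv : (s.map fun c => h - algebraMap K _ c).prod v = 0) :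
    ((s ++ t).map fun c => h - algebraMap K _ c).prod v = 0 := by
  rw [ls_ap] at hv ⊢
  rw [List.map_append, List.prod_append, mul_comm, map_mul, Module.End.mul_apply, hv, map_zero]
theorem ls_r (h : Module.End K V) (s t : List K) {v : V} (hv : (t.map fun c => h - algebraMap K _ c).prod v = 0) :
    ((s ++ t).map fun c => h - algebraMap K _ c).prod v = 0 := by
  rw [ls_ap] at hv ⊢
  rw [List.map_append, List.prod_append, map_mul, Module.End.mul_apply, hv, map_zero]
theorem ls_fd (h : Module.End K V) (ht : ⨆ c, h.eigenspace c = ⊤) (W : Submodule K V) (hW : W.FG) :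
    ∃ s : List K, ∀ w ∈ W, (s.map fun c => h - algebraMap K _ c).prod w = 0 := by
  classical
  have h1 : ∀ w : V, ∃ s : List K, (s.map fun c => h - algebraMap K _ c).prod w = 0 := fun w => by
    have hw : w ∈ ⨆ c, h.eigenspace c := ht ▸ Submodule.mem_top
    induction hw using Submodule.iSup_induction' with
    | mem c x hx => exact ⟨[c], by
        rw [Module.End.mem_eigenspace_iff] at hx
        simp [hx, Module.algebraMap_end_apply]⟩
    | zero => exact ⟨[], by simp⟩
    | add x y _ _ hx hy =>
      obtain ⟨s, hs⟩ := hx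
      obtain ⟨t, ht⟩ := hy
      exact ⟨s ++ t, by rw [map_add, ls_l _ _ _ hs, ls_r _ _ _ ht, add_zero]⟩
  obtain ⟨t, rfl⟩ := hW
  suffices ∃ s : List K, ∀ w ∈ t, (s.map fun c => h - algebraMap K _ c).prod w = 0 by
    obtain ⟨s, hs⟩ := this
    exact ⟨s, fun w hw => LinearMap.mem_ker.1 (Submodule.span_le.2 (fun x hx => LinearMap.mem_ker.2 (hs x hx)) hw)⟩
  induction t using Finset.induction_on with
  | empty => exact ⟨[], by simp⟩
  | insert a t _ ih =>
    obtain ⟨s, hs⟩ := ih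
    obtain ⟨s', hs'⟩ := h1 a
    refine ⟨s ++ s', fun w hw => ?_⟩
    rcases Finset.mem_insert.1 hw with rfl | hw
    · exact ls_r _ _ _ hs'
    · exact ls_l _ _ _ (hs w hw)
end
section
variable {K g : Type*} [Field K] [LieRing g] [LieAlgebra K g] [CharZero K]
local notation "U" => UniversalEnvelopingAlgebra K g
variable (K g) in
noncomputable def adU : g →ₗ[K] Module.End K U :=
  (LinearMap.mul K U - (LinearMap.mul K U).flip) ∘ₗ io K g
theorem adU_a (x : g) (u : U) : adU K g x u = io K g x * u - u * io K g x := rfl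
theorem adU_l (x y : g) (u : U) : adU K g ⁅x, y⁆ u = adU K g x (adU K g y u) - adU K g y (adU K g x u) := by
  simp only [adU_a, io_lie]; noncomm_ring
theorem cen_i {z : U} (h : ∀ x, adU K g x z = 0) (u : U) : z * u = u * z := by
  let P : Submodule K U := LinearMap.eqLocus (LinearMap.mulLeft K z) (LinearMap.mulRight K z)
  refine U_ind P (by simp [P]) (fun x u hu => ?_) u
  change z * u = u * z at hu
  change z * (io K g x * u) = (io K g x * u) * z
  have := h x
  rw [adU_a, sub_eq_zero] at this
  rw [← mul_assoc, ← this, mul_assoc, hu, mul_assoc]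
theorem adU_FL {d : ℕ} (x : g) {u : U} (hu : u ∈ FL K g d) : adU K g x u ∈ FL K g d := by
  cases d with
  | zero => rw [(Submodule.mem_bot K).1 hu, map_zero]; exact zero_mem _
  | succ d => exact FF_comm d x u hu
variable [LieAlgebra.IsSemisimple K g]
theorem lift_c [FiniteDimensional K g] {e : ℕ} {s : U} (hs : s ∈ FF K g e) (h : ∀ x, adU K g x s ∈ FL K g e) :
    ∃ s' ∈ FF K g e, (∀ u, s' * u = u * s') ∧ s - s' ∈ FL K g e := by
  let W := Submodule.span K {s} ⊔ FL K g e
  have hW : W ≤ FF K g e := sup_le (by simpa using hs) (FL_le e)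
  have hfd : FiniteDimensional K W := by
    have := FF_fd (K := K) (g := g) e
    exact Submodule.finiteDimensional_of_le hW
  have h1 : ∀ x, ∀ w ∈ W, adU K g x w ∈ FL K g e := by
    intro x w hw
    obtain ⟨a, ha, v, hv, rfl⟩ := Submodule.mem_sup.1 hw
    obtain ⟨c, rfl⟩ := Submodule.mem_span_singleton.1 ha
    rw [map_add, map_smul]
    exact add_mem (Submodule.smul_mem _ _ (h x)) (adU_FL x hv)
  obtain ⟨w0, hw0, h2, h3⟩ := wS (adU K g) adU_l _ W hfd (fun x w hw => Submodule.mem_sup_right (h1 x w hw)) rfl s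
    (Submodule.mem_sup_left (Submodule.mem_span_singleton_self s))
  refine ⟨w0, hW hw0, cen_i h2, ?_⟩
  refine Submodule.span_le.2 ?_ h3
  rintro _ ⟨x, v, hv, rfl⟩
  exact h1 x v hv
variable (D : RD K g)
theorem RD.R_ind (W : Submodule K D.R) (h1 : 1 ∈ W) (hX : ∀ q, ∀ P ∈ W, P * .X q ∈ W) (P : D.R) : P ∈ W := by
  induction P using MvPolynomial.induction_on with
  | C a => rw [MvPolynomial.C_eq_smul_one]; exact W.smul_mem _ h1
  | add p q hp hq => exact add_mem hp hq
  | mul_X p q hp => exact hX q p hp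
theorem RD.R_eig (i) : ⨆ c, (D.Ph (D.h i)).eigenspace c = ⊤ := by
  rw [eq_top_iff]
  intro P _
  refine D.R_ind _ ?_ ?_ P
  · refine Submodule.mem_iSup_of_mem 0 (Module.End.mem_eigenspace_iff.2 ?_)
    rw [RD.h, D.Ph_io, zero_smul]; exact Derivation.map_one_eq_zero _
  · intro q P hP
    induction hP using Submodule.iSup_induction' with
    | mem c x hx =>
      refine Submodule.mem_iSup_of_mem (c + D.w q.1 i) (Module.End.mem_eigenspace_iff.2 ?_)
      rw [Module.End.mem_eigenspace_iff, RD.h, D.Ph_io] at hx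
      rw [RD.h, D.Ph_io, Derivation.leibniz, hx, D.der_X, D.lie_h, map_smul, D.lam_b]
      simp only [smul_eq_mul, mul_smul_comm, add_smul]
      rw [mul_comm (MvPolynomial.X q), add_comm]
    | zero => simp
    | add x y _ _ hx hy => rw [add_mul]; exact add_mem hx hy
theorem RD.loc (P : D.R) : ∃ W : Submodule K D.R, W.FG ∧ P ∈ W ∧ ∀ x, ∀ w ∈ W, D.der x w ∈ W := by
  let M0 : Submodule K D.R := 1 ⊔ Submodule.span K (Set.range .X)
  have hl : ∀ a x, D.lam a x ∈ M0 := fun a x => by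
    rw [D.b_sum x, map_sum]
    refine Submodule.sum_mem _ fun k _ => ?_
    rw [map_smul, D.lam_b]
    exact Submodule.smul_mem _ _ (Submodule.mem_sup_right (Submodule.subset_span ⟨_, rfl⟩))
  have h0 : ∀ x, M0 ≤ M0.comap (D.der x).toLinearMap := fun x => sup_le (by
      intro P hP
      obtain ⟨c, rfl⟩ := Submodule.mem_one.1 hP
      change D.der x _ ∈ M0
      rw [Derivation.map_algebraMap]; exact zero_mem _) (Submodule.span_le.2 (by
      rintro _ ⟨q, rfl⟩
      change D.der x (.X q) ∈ M0
      rw [D.der_X]; exact hl _ _))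
  have hp : ∀ d x, M0 ^ d ≤ (M0 ^ d).comap (D.der x).toLinearMap := fun d x => by
    induction d with
    | zero =>
      intro P hP
      rw [pow_zero] at hP
      obtain ⟨c, rfl⟩ := Submodule.mem_one.1 hP
      change D.der x _ ∈ M0 ^ 0
      rw [Derivation.map_algebraMap]; exact zero_mem _
    | succ d ih =>
      intro P hP
      rw [pow_succ] at hP
      induction hP using Submodule.mul_induction_on' with
      | mem_mul_mem a ha b hb =>
        change D.der x _ ∈ M0 ^ (d+1)
        rw [Derivation.leibniz, smul_eq_mul, smul_eq_mul, mul_comm b, pow_succ]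
        exact add_mem (Submodule.mul_mem_mul ha (h0 x hb)) (Submodule.mul_mem_mul (ih ha) hb)
      | add a _ b _ ha hb => exact add_mem ha hb
  have hm : Monotone fun d => M0 ^ d := fun a b h => pow_le_pow_right' (M := Submodule K D.R) le_sup_left h
  obtain ⟨d, hd⟩ : ∃ d, P ∈ M0 ^ d := by
    rw [← Submodule.mem_iSup_of_directed _ hm.directed_le]
    refine D.R_ind _ (Submodule.mem_iSup_of_mem 0 (Submodule.mem_one.2 ⟨1, map_one _⟩)) (fun q P hP => ?_) P
    obtain ⟨d, hd⟩ := (Submodule.mem_iSup_of_directed _ hm.directed_le).1 hP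
    refine Submodule.mem_iSup_of_mem (d+1) ?_
    change _ ∈ M0 ^ (d+1)
    rw [pow_succ]
    exact Submodule.mul_mem_mul hd (Submodule.mem_sup_right (Submodule.subset_span ⟨_, rfl⟩))
  refine ⟨M0 ^ d, Submodule.FG.pow (Submodule.FG.sup (by rw [Submodule.one_eq_span]; exact Submodule.fg_span_singleton _) (Submodule.fg_span (Set.finite_range _))) _, hd, fun x w hw => hp d x hw⟩
theorem RD.ex_hw {V : Type*} [AddCommGroup V] [Module K V] (Φ : U →ₐ[K] Module.End K V) (W : Submodule K V) (hW : W ≠ ⊥)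
    (hst : ∀ x, ∀ w ∈ W, Φ (io K g x) w ∈ W)
    (hN : ∃ s : Finset K, ∀ c, ∀ v ∈ W, v ≠ 0 → Φ D.dl v = c • v → c ∈ s)
    (hq : ∀ i, ∃ s : List K, ∀ w ∈ W, (s.map fun c => Φ (D.h i) - algebraMap K _ c).prod w = 0) :
    ∃ v ∈ W, v ≠ 0 ∧ (∀ a, Φ (D.e a) v = 0) ∧ ∃ ν : Fin D.r → K, ∀ i, Φ (D.h i) v = ν i • v := by
  classical
  obtain ⟨v, hv, hv0, ν, hν⟩ := EV (fun i => Φ (D.h i)) (fun i k => by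
    rw [Commute, SemiconjBy, ← map_mul, D.h_comm, map_mul]) W hW (fun i w hw => hst _ w hw) hq
  by_contra! hcon
  have key : ∀ N : ℕ, ∃ v ∈ W, v ≠ 0 ∧ ∃ n : ℕ, N ≤ n ∧ Φ D.dl v = ((∑ i, D.d i * ν i) + n) • v ∧ ∃ ν : Fin D.r → K, ∀ i, Φ (D.h i) v = ν i • v := by
    intro N
    induction N with
    | zero => exact ⟨v, hv, hv0, 0, le_rfl, by rw [D.hw_dl Φ hν]; simp, ν, hν⟩
    | succ N ih =>
      obtain ⟨v, hv, hv0, n, hn, h1, ν', hν'⟩ := ih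
      have : ∃ a, Φ (D.e a) v ≠ 0 := by
        by_contra! h
        obtain ⟨i, hi⟩ := hcon v hv hv0 h ν'
        exact hi (hν' i)
      obtain ⟨a, ha⟩ := this
      have hz := D.z_e a
      refine ⟨_, hst _ v hv, ha, n + (D.z (.inl a)).toNat, by omega, ?_, fun i => ν' i + D.w (.inl a) i, fun i => ?_⟩
      · have := Module.End.mem_eigenspace_iff.1 (D.eig Φ (.inl a) _ (Module.End.mem_eigenspace_iff.2 h1))
        rw [← RD.e] at this ⊢
        rw [this, add_assoc]
        congr 2
        rw [Nat.cast_add]; congr 1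
        rw [← Int.cast_natCast, Int.toNat_of_nonneg hz.le]
      · have := congrArg (fun u => Φ u v) (D.h_b i (.inl a))
        simp only [map_add, map_mul, map_smul, LinearMap.add_apply, Module.End.mul_apply, LinearMap.smul_apply, hν'] at this
        rw [this, add_smul]
  obtain ⟨s, hs⟩ := hN
  have hf : {n : ℕ | (∑ i, D.d i * ν i) + (n:K) ∈ s}.Finite := by
    refine Set.Finite.preimage (f := fun n : ℕ => (∑ i, D.d i * ν i) + (n:K)) (fun a _ b _ h => ?_) s.finite_toSet
    simpa using h
  obtain ⟨B, hB⟩ := hf.bddAbove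
  obtain ⟨v, hv, hv0, n, hn, h1, -⟩ := key (B + 1)
  have := hB (hs _ v hv hv0 h1)
  omega
end
section
variable {K g : Type*} [Field K] [LieRing g] [LieAlgebra K g]
local notation "U" => UniversalEnvelopingAlgebra K g
theorem st_U {V : Type*} [AddCommGroup V] [Module K V] (Φ : U →ₐ[K] Module.End K V) (W : Submodule K V)
    (hst : ∀ x, ∀ w ∈ W, Φ (io K g x) w ∈ W) (u : U) (w : V) (hw : w ∈ W) : Φ u w ∈ W := by
  let P : Submodule K U := W.comap ((LinearMap.applyₗ w).comp Φ.toLinearMap)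
  refine U_ind P (by change Φ 1 w ∈ W; rw [map_one]; exact hw) (fun x u hu => ?_) u
  change Φ (_ * u) w ∈ W
  rw [map_mul]; exact hst x _ hu
theorem sub_rep {V : Type*} [AddCommGroup V] [Module K V] (Φ : U →ₐ[K] Module.End K V) (W : Submodule K V)
    (hst : ∀ x, ∀ w ∈ W, Φ (io K g x) w ∈ W) : ∃ Ψ : U →ₐ[K] Module.End K W, ∀ u w, (Ψ u w : V) = Φ u w := by
  refine ⟨AlgHom.ofLinearMap { toFun := fun u => (Φ u).restrict (st_U Φ W hst u), map_add' := ?_, map_smul' := ?_ } ?_ ?_, fun u w => rfl⟩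
  · intro u v; ext w; simp
  · intro u v; ext w; simp
  · ext w; simp
  · intro u v; ext w; simp
variable [CharZero K] [LieAlgebra.IsSemisimple K g] (D : RD K g)
theorem sq0 [FiniteDimensional K g] {z : U} (hz : ∀ u, z * u = u * z) {V : Type*} [AddCommGroup V] [Module K V] [FiniteDimensional K V]
    (Ψ : U →ₐ[K] Module.End K V) (hz0 : Ψ z * Ψ z = 0) : Ψ z = 0 := by
  have hzz : ∀ u, Ψ z * Ψ u = Ψ u * Ψ z := fun u => by rw [← map_mul, hz, map_mul]
  let ρ : g →ₗ[K] Module.End K (Module.End K V) :=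
    LinearMap.mk₂ K (fun x φ => Ψ (io K g x) * φ - φ * Ψ (io K g x)) (fun x y φ => by rw [map_add, map_add]; noncomm_ring)
      (fun c x φ => by rw [map_smul, map_smul, smul_sub, smul_mul_assoc, mul_smul_comm]) (fun x φ ψ => by noncomm_ring)
      (fun c x φ => by rw [smul_sub, smul_mul_assoc, mul_smul_comm])
  have ρa : ∀ x (φ : Module.End K V), ρ x φ = Ψ (io K g x) * φ - φ * Ψ (io K g x) := fun _ _ => rfl
  have ρl : ∀ x y (φ : Module.End K V), ρ ⁅x, y⁆ φ = ρ x (ρ y φ) - ρ y (ρ x φ) := by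
    intro x y φ; simp only [ρa, io_lie, map_sub, map_mul]; noncomm_ring
  obtain ⟨ψ, hψ⟩ : ∃ ψ : Module.End K V, Ψ z * ψ * Ψ z = Ψ z := by
    obtain ⟨s, hs⟩ := (Ψ z).rangeRestrict.exists_rightInverse_of_surjective (LinearMap.range_rangeRestrict _)
    obtain ⟨ψ, hψ⟩ := s.exists_extend
    refine ⟨ψ, LinearMap.ext fun w => ?_⟩
    have h1 := LinearMap.congr_fun hψ ⟨Ψ z w, ⟨w, rfl⟩⟩
    have h2 := congrArg Subtype.val (LinearMap.congr_fun hs ⟨Ψ z w, ⟨w, rfl⟩⟩)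
    simp only [LinearMap.comp_apply, Submodule.subtype_apply] at h1
    simp only [Module.End.mul_apply, h1]
    exact h2
  obtain ⟨ψ0, -, h0, h1⟩ := wS ρ ρl _ ⊤ inferInstance (fun _ _ _ => Submodule.mem_top) rfl ψ Submodule.mem_top
  have hc : ∀ u, Ψ u * ψ0 = ψ0 * Ψ u := fun u => by
    let P : Submodule K U := LinearMap.eqLocus ((LinearMap.mulRight K ψ0).comp Ψ.toLinearMap) ((LinearMap.mulLeft K ψ0).comp Ψ.toLinearMap)
    refine U_ind P (by simp [P]) (fun x u hu => ?_) u
    change Ψ u * ψ0 = ψ0 * Ψ u at hu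
    change Ψ (_ * u) * ψ0 = ψ0 * Ψ (_ * u)
    have := h0 x
    rw [ρa, sub_eq_zero] at this
    rw [map_mul, mul_assoc, hu, ← mul_assoc, this, mul_assoc]
  have h2 : Ψ z = Ψ z * (ψ - ψ0) * Ψ z := by
    rw [mul_sub, sub_mul, hψ, hc, mul_assoc, hz0, mul_zero, sub_zero]
  refine wC ρ ρl ⊤ inferInstance (fun _ _ _ => Submodule.mem_top) _ (fun x => by rw [ρa, hzz, sub_self]) ?_
  rw [h2]
  refine Submodule.span_induction (p := fun φ _ => Ψ z * φ * Ψ z ∈ Submodule.span K {y | ∃ x, ∃ v ∈ (⊤ : Submodule K (Module.End K V)), y = ρ x v}) ?_ (by simp) (fun a b _ _ ha hb => ?_) (fun c a _ ha => ?_) h1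
  · rintro _ ⟨x, v, -, rfl⟩
    refine Submodule.subset_span ⟨x, Ψ z * v * Ψ z, Submodule.mem_top, ?_⟩
    rw [ρa, ρa, mul_sub, sub_mul]
    congr 1
    · simp only [← mul_assoc, hzz]
    · simp only [mul_assoc, hzz]
  · rw [mul_add, add_mul]; exact add_mem ha hb
  · rw [mul_smul_comm, smul_mul_assoc]; exact Submodule.smul_mem _ _ ha
theorem RD.z_kill {z : U} (hz : ∀ u, z * u = u * z) (hp : D.p z = 0) (n : ℕ) : ∀ W : Submodule K D.R, W.FG →
    (∀ x, ∀ w ∈ W, D.Ph (io K g x) w ∈ W) → Module.finrank K W = n → ∀ w ∈ W, D.Ph z w = 0 := by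
  induction n using Nat.strong_induction_on with
  | _ n ih =>
  intro W hf hst hn
  haveI hfd : FiniteDimensional K W := Module.Finite.iff_fg.2 hf
  by_cases hW : W = ⊥
  · rintro w hw; rw [hW, Submodule.mem_bot] at hw; rw [hw, map_zero]
  obtain ⟨Ψ, hΨ⟩ := sub_rep D.Ph W hst
  obtain ⟨v, hv, hv0, he, ν, hν⟩ := D.ex_hw D.Ph W hW hst (by
    have hfin := Module.End.finite_hasEigenvalue (Ψ D.dl)
    refine ⟨hfin.toFinset, fun c v hv hv0 h => ?_⟩
    rw [Set.Finite.mem_toFinset]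
    refine Module.End.hasEigenvalue_of_hasEigenvector (x := ⟨v, hv⟩) ⟨Module.End.mem_eigenspace_iff.2 (Subtype.ext ?_), fun h => hv0 (congrArg Subtype.val h)⟩
    rw [hΨ, h]; rfl) (fun i => ls_fd _ (D.R_eig i) W hf)
  have hv1 : Ψ z ⟨v, hv⟩ = 0 := Subtype.ext (by
    rw [hΨ, D.cen_hw hz D.Ph he hν, hp, map_zero, zero_smul]; rfl)
  have hzw : ∀ w : W, Ψ z (Ψ z w) = 0 := by
    have hlt : Module.finrank K (W.map (D.Ph z)) < n := by
      have h1 := LinearMap.finrank_range_add_finrank_ker (Ψ z)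
      have h2 : 0 < Module.finrank K (LinearMap.ker (Ψ z)) := by
        refine Nat.pos_of_ne_zero fun h => hv0 ?_
        have := Submodule.finrank_eq_zero.1 h
        exact congrArg Subtype.val ((Submodule.mem_bot K).1 (this.le (LinearMap.mem_ker.2 hv1)))
      have h3 : W.map (D.Ph z) = (LinearMap.range (Ψ z)).map W.subtype := by
        ext y; constructor
        · rintro ⟨w, hw, rfl⟩; exact ⟨_, ⟨⟨w, hw⟩, rfl⟩, hΨ _ _⟩
        · rintro ⟨_, ⟨w, rfl⟩, rfl⟩; exact ⟨w, w.2, (hΨ _ _).symm⟩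
      rw [h3, Submodule.finrank_map_subtype_eq]
      omega
    intro w
    refine Subtype.ext ?_
    rw [hΨ, hΨ]
    refine ih _ hlt (W.map (D.Ph z)) (hf.map _) ?_ rfl _ ⟨w, w.2, rfl⟩
    rintro x _ ⟨w, hw, rfl⟩
    exact ⟨_, hst x w hw, by rw [← Module.End.mul_apply, ← map_mul, hz, map_mul]; rfl⟩
  haveI := Module.Basis.finiteDimensional_of_finite D.b
  have h3 := sq0 hz Ψ (LinearMap.ext hzw)
  intro w hw
  rw [← hΨ z ⟨w, hw⟩, h3]; rfl
theorem RD.p_inj {z : U} (hz : ∀ u, z * u = u * z) (hp : D.p z = 0) : z = 0 := by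
  refine D.Ph_inj (LinearMap.ext fun P => ?_)
  obtain ⟨W, hf, hP, hst⟩ := D.loc P
  exact D.z_kill hz hp _ W hf (fun x w hw => by rw [D.Ph_io]; exact hst x w hw) rfl P hP
end
section
theorem ufd_dvd {S : Type*} [CommRing S] [IsDomain S] [UniqueFactorizationMonoid S] {B C : S} (hB : B ≠ 0) (hC : C ≠ 0)
    (h : ∀ k, C ^ k ∣ B ^ (k + 1)) : C ∣ B := by
  classical
  letI := UniqueFactorizationMonoid.normalizationMonoid (α := S)
  rw [UniqueFactorizationMonoid.dvd_iff_normalizedFactors_le_normalizedFactors hC hB, Multiset.le_iff_count]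
  intro a
  have h1 := h ((UniqueFactorizationMonoid.normalizedFactors B).count a + 1)
  rw [UniqueFactorizationMonoid.dvd_iff_normalizedFactors_le_normalizedFactors (pow_ne_zero _ hC) (pow_ne_zero _ hB), Multiset.le_iff_count] at h1
  have := h1 a
  simp only [UniqueFactorizationMonoid.normalizedFactors_pow, Multiset.count_nsmul] at this
  by_contra! hlt
  nlinarith
theorem hom_fac {K σ : Type*} [Field K] {B C S0 : MvPolynomial σ K} {d c : ℕ} (hB : B.IsHomogeneous d) (hC : C.IsHomogeneous c)
    (h : B = C * S0) (h0 : B ≠ 0) : ∃ e, ∃ S1 : MvPolynomial σ K, S1.IsHomogeneous e ∧ B = C * S1 ∧ d = c + e := by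
  have h1 : ∀ n, MvPolynomial.homogeneousComponent d (C * MvPolynomial.homogeneousComponent n S0) =
      if d = c + n then C * MvPolynomial.homogeneousComponent n S0 else 0 := fun n =>
    MvPolynomial.homogeneousComponent_of_mem (hC.mul (MvPolynomial.homogeneousComponent_isHomogeneous n S0))
  have h2 : B = ∑ n ∈ Finset.range (S0.totalDegree + 1), if d = c + n then C * MvPolynomial.homogeneousComponent n S0 else 0 := by
    simp_rw [← h1]
    rw [← map_sum, ← Finset.mul_sum, MvPolynomial.sum_homogeneousComponent, ← h, MvPolynomial.homogeneousComponent_eq_self hB]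
  obtain ⟨n, hn, hn0⟩ := Finset.exists_ne_zero_of_sum_ne_zero (h2 ▸ h0)
  have hd : d = c + n := by by_contra hd; exact hn0 (if_neg hd)
  refine ⟨n, _, MvPolynomial.homogeneousComponent_isHomogeneous n S0, ?_, hd⟩
  rw [h2, Finset.sum_eq_single n (fun m _ hm => if_neg (by omega)) (fun h => absurd hn h), if_pos hd]
variable {K g : Type*} [Field K] [LieRing g] [LieAlgebra K g] [CharZero K] [LieAlgebra.IsSemisimple K g] (D : RD K g)
local notation "U" => UniversalEnvelopingAlgebra K g
def RD.PZ : Subalgebra K D.A where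
  carrier := {P | ∃ z : U, (∀ u, z * u = u * z) ∧ D.p z = P}
  mul_mem' := by
    rintro _ _ ⟨z, hz, rfl⟩ ⟨y, hy, rfl⟩
    exact ⟨z * y, fun u => by rw [mul_assoc, hy, ← mul_assoc, hz, mul_assoc], D.p_mul hy z⟩
  add_mem' := by
    rintro _ _ ⟨z, hz, rfl⟩ ⟨y, hy, rfl⟩
    exact ⟨z + y, fun u => by rw [add_mul, mul_add, hz, hy], map_add _ _ _⟩
  algebraMap_mem' := fun c => ⟨algebraMap K _ c, fun u => Algebra.commutes _ _, by
    rw [Algebra.algebraMap_eq_smul_one, map_smul, D.p_1, ← Algebra.algebraMap_eq_smul_one]⟩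
theorem RD.sy_pow {d : ℕ} {u : U} (hu : u ∈ FF K g d) (k : ℕ) : u ^ k ∈ FF K g (k * d) ∧ D.sy (k * d) (u ^ k) = D.sy d u ^ k := by
  induction k with
  | zero => simpa [D.sy_1] using FF_one 0
  | succ k ih =>
    rw [pow_succ, Nat.succ_mul, D.sy_mul ih.1 hu, ih.2, ← pow_succ]
    exact ⟨pow_succ u k ▸ FF_mul ih.1 hu, rfl⟩
theorem RD.p_pow {z : U} (hz : ∀ u, z * u = u * z) (k : ℕ) : D.p (z ^ k) = D.p z ^ k := by
  induction k with
  | zero => simpa using D.p_1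
  | succ k ih => rw [pow_succ, D.p_mul hz, ih, pow_succ]
theorem cen_pow {z : U} (hz : ∀ u, z * u = u * z) (k : ℕ) (u : U) : z ^ k * u = u * z ^ k :=
  (Commute.pow_left (show Commute z u from hz u) k).eq
theorem RD.C6a {c : U} (hc0 : c ≠ 0) (hc : ∀ u, c * u = u * c) (d : ℕ) : ∀ f : D.A, (∀ k, f ^ k * D.p c ∈ D.PZ) →
    ∀ b ∈ FL K g d, (∀ u, b * u = u * b) → D.p b = f * D.p c → f ∈ D.PZ := by
  have := Module.Basis.finiteDimensional_of_finite D.b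
  have hpc : D.p c ≠ 0 := fun h => hc0 (D.p_inj hc h)
  induction d with
  | zero =>
    intro f hf b hb hbc hp
    rw [(Submodule.mem_bot K).1 hb, map_zero, eq_comm, mul_eq_zero, or_iff_left hpc] at hp
    rw [hp]; exact zero_mem _
  | succ d ih =>
    intro f hf b hb hbc hp
    change b ∈ FF K g d at hb
    by_cases hB : D.sy d b = 0
    · exact ih f hf b (D.sy_0 hb hB) hbc hp
    obtain ⟨γ, hcγ, hC⟩ := D.sy_ex hc0
    have hb0 : b ≠ 0 := fun h => hB (by rw [h, map_zero])
    have hdv : ∀ k, D.sy γ c ^ k ∣ D.sy d b ^ (k+1) := fun k => by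
      obtain ⟨z, hz, hpz⟩ := hf (k+1)
      have h1 : b ^ (k+1) = c ^ k * z := by
        rw [← sub_eq_zero]
        refine D.p_inj (fun u => by rw [sub_mul, mul_sub, cen_pow hbc, mul_assoc, hz, ← mul_assoc, cen_pow hc, mul_assoc]) ?_
        rw [map_sub, D.p_pow hbc, D.p_mul hz, D.p_pow hc, hpz, hp]; ring
      have hz0 : z ≠ 0 := by
        rintro rfl
        rw [mul_zero] at h1
        have h2 := (D.sy_pow hb (k+1)).2
        rw [h1, map_zero] at h2
        exact pow_ne_zero _ hB h2.symm
      obtain ⟨m, hm, hZ⟩ := D.sy_ex hz0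
      obtain ⟨h2, h3⟩ := D.sy_pow hb (k+1)
      obtain ⟨h4, h5⟩ := D.sy_pow hcγ k
      have h6 := FF_mul h4 hm
      have h7 := D.sy_mul h4 hm
      rw [h5, ← h1] at h7
      rw [← h1] at h6
      have h8 : D.sy γ c ^ k * D.sy m z ≠ 0 := mul_ne_zero (pow_ne_zero _ hC) hZ
      rcases lt_trichotomy ((k+1) * d) (k * γ + m) with h | h | h
      · exact absurd (h7.symm.trans (D.sy_lt h h2)) h8
      · rw [← h, h3] at h7; exact ⟨_, h7⟩
      · exact absurd (h3.symm.trans (D.sy_lt h h6)) (pow_ne_zero _ hB)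
    obtain ⟨S0, hS0⟩ := ufd_dvd hB hC hdv
    obtain ⟨e, S1, hS1, hBC, hde⟩ := hom_fac (D.sy_hom hb).1 (D.sy_hom hcγ).1 hS0 hB
    have hs := D.sc_FF hS1
    have hss := D.sy_sc hS1
    obtain ⟨s', hs', hsc, hs2⟩ := lift_c hs (fun x => by
      have hy := FF_comm e x _ hs
      refine D.sy_0 hy ?_
      have h1 : c * D.sc S1 - b ∈ FL K g d := D.sy_0 (sub_mem (hde ▸ FF_mul hcγ hs) hb) (by
        rw [map_sub, hde, D.sy_mul hcγ hs, hss, ← hBC, ← hde, sub_self])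
      have h2 := D.sy_FL (adU_FL x h1)
      have h3 : adU K g x (c * D.sc S1 - b) = c * (io K g x * D.sc S1 - D.sc S1 * io K g x) := by
        rw [adU_a, mul_sub, sub_mul, ← mul_assoc, ← hc, hbc, mul_sub, mul_assoc, mul_assoc]; abel
      rw [h3, hde, D.sy_mul hcγ hy, mul_eq_zero, or_iff_right hC] at h2
      exact h2)
    have h1 : D.sy e s' = S1 := by
      have := D.sy_FL hs2
      rw [map_sub, hss, sub_eq_zero] at this
      exact this.symm
    have hps : D.p s' ∈ D.PZ := ⟨s', hsc, rfl⟩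
    have := ih (f - D.p s') (fun k => by
      have : ∀ k i, (f - D.p s') ^ k * (f ^ i * D.p c) ∈ D.PZ := fun k => by
        induction k with
        | zero => intro i; rw [pow_zero, one_mul]; exact hf i
        | succ k ih2 =>
          intro i
          have := sub_mem (ih2 (i+1)) (mul_mem hps (ih2 i))
          convert this using 1; ring
      simpa using this k 0) (b - c * s') (D.sy_0 (sub_mem hb (hde ▸ FF_mul hcγ hs')) (by
        rw [map_sub, hde, D.sy_mul hcγ hs', h1, ← hBC, ← hde, sub_self])) (fun u => by
        rw [sub_mul, mul_sub, hbc, mul_assoc, hsc, ← mul_assoc, hc, mul_assoc]) (by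
        rw [map_sub, D.p_mul hsc, hp]; ring)
    have := add_mem this hps
    rwa [sub_add_cancel] at this
theorem RD.C6 {f a : D.A} (ha0 : a ≠ 0) (h : ∀ k, f ^ k * a ∈ D.PZ) : f ∈ D.PZ := by
  obtain ⟨c, hc, hca⟩ := h 0
  rw [pow_zero, one_mul] at hca
  obtain ⟨b, hb, hba⟩ := h 1
  rw [pow_one] at hba
  obtain ⟨d, hd⟩ := FF_top b
  subst hca
  exact D.C6a (fun h0 => ha0 (by rw [h0, map_zero])) hc (d+1) f h b hd hb hba
end
section
variable {K g : Type*} [Field K] [LieRing g] [LieAlgebra K g] [CharZero K] [LieAlgebra.IsSemisimple K g] (D : RD K g)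
local notation "U" => UniversalEnvelopingAlgebra K g
def RD.iw (x : g) (ν : Fin D.r → K) : Prop := ∀ i, ⁅D.b (.inr (.inr i)), x⁆ = ν i • x
theorem RD.iw_lie {x y : g} {ν μ} (hx : D.iw x ν) (hy : D.iw y μ) : D.iw ⁅x, y⁆ (ν + μ) := fun i => by
  rw [leibniz_lie, hx, hy, smul_lie, lie_smul, ← add_smul]; rfl
theorem RD.iw_b (k) : D.iw (D.b k) (D.w k) := fun i => D.lie_h i k
theorem RD.iw_sum {ι : Type*} (s : Finset ι) (x : ι → g) {ν} (h : ∀ i, D.iw (x i) ν) : D.iw (∑ i ∈ s, x i) ν := fun i => by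
  rw [lie_sum, Finset.smul_sum]; exact Finset.sum_congr rfl fun k _ => h k i
theorem RD.wt {x : g} {ν} (h : D.iw x ν) (k) (hk : D.b.repr x k ≠ 0) : D.w k = ν := by
  funext i
  have h1 := congrArg (fun y => D.b.repr y k) (h i)
  have h2 : D.b.repr ⁅D.b (.inr (.inr i)), x⁆ k = D.w k i * D.b.repr x k := by
    conv_lhs => rw [← D.b.sum_repr x]
    rw [lie_sum]
    simp only [lie_smul, D.lie_h, map_sum, map_smul, D.b.repr_self, Finsupp.coe_finset_sum, Finset.sum_apply, Finsupp.smul_apply, Finsupp.single_apply]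
    simp [mul_comm]
  simp only [h2, map_smul, Finsupp.smul_apply, smul_eq_mul] at h1
  exact mul_right_cancel₀ hk h1
theorem RD.z_w {k l} {c : ℤ} {m} (h : D.w k = D.w l + D.w m) : D.z k = D.z l + D.z m := by
  have h1 := D.z_eq k
  have h2 : ∑ i, D.d i * D.w k i = D.z l + D.z m := by
    rw [← D.z_eq l, ← D.z_eq m, ← Finset.sum_add_distrib]
    exact Finset.sum_congr rfl fun i _ => by rw [h, Pi.add_apply, mul_add]
  exact_mod_cast h1.symm.trans h2
theorem RD.z_w' {k l} (h : D.w k = D.w l) : D.z k = D.z l := by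
  have h1 := D.z_eq k
  rw [h, D.z_eq l] at h1
  exact_mod_cast h1.symm
theorem RD.w_inj {a k} (h : D.w k = D.w a) (h0 : D.z a ≠ 0) : k = a := by
  have hz := D.z_w' h
  rcases a with a | a | a <;> rcases k with k | k | k
  · rw [D.inj h]
  · have := D.z_e a; have := D.z_e k; have := D.z_f k; omega
  · have := D.z_e a; have := D.z_h k; omega
  · have := D.z_e a; have := D.z_e k; have := D.z_f a; omega
  · rw [D.w_f, D.w_f, neg_inj] at h; rw [D.inj h]
  · have := D.z_e a; have := D.z_h k; have := D.z_f a; omega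
  all_goals exact absurd (D.z_h a) h0
theorem RD.w_0 {k} (h : D.z k = 0) : ∃ i, k = .inr (.inr i) := by
  rcases k with k | k | k
  · have := D.z_e k; omega
  · have := D.z_e k; have := D.z_f k; omega
  · exact ⟨k, rfl⟩
theorem RD.ex_B : ∃ (B : LinearMap.BilinForm K g) (b' : Module.Basis D.ix K g), (∀ i j, B (b' i) (D.b j) = if j = i then 1 else 0) ∧
    (∀ x y, B x y = B y x) ∧ (∀ x y z, B ⁅x, y⁆ z = B x ⁅y, z⁆) ∧
    ∀ i l, B (D.b (.inr (.inr i))) (D.b (.inr (.inr l))) = ∑ k, D.w k i * D.w k l := by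
  classical
  haveI := Module.Basis.finiteDimensional_of_finite D.b
  haveI : LieAlgebra.IsKilling K g := inferInstance
  have hnd := LieAlgebra.IsKilling.killingForm_nondegenerate K g
  refine ⟨killingForm K g, (killingForm K g).dualBasis hnd D.b, fun i j => LinearMap.BilinForm.apply_dualBasis_left hnd D.b i j,
    fun x y => LieModule.traceForm_comm K g g x y, fun x y z => LieModule.traceForm_apply_lie_apply K g g x y z, fun i l => ?_⟩
  rw [killingForm_apply_apply, LinearMap.trace_eq_matrix_trace K D.b, Matrix.trace]
  refine Finset.sum_congr rfl fun k _ => ?_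
  rw [Matrix.diag_apply, LinearMap.toMatrix_apply]
  simp [D.lie_h, mul_comm]
theorem RD.ex_cas : ∃ (b' : D.ix → g) (G : Fin D.r → Fin D.r → K) (θ : D.ix → K),
    (∀ (x : g) (F : g →ₗ[K] g →ₗ[K] Matrix D.ix D.ix U),
      ∑ k, (F ⁅x, D.b k⁆ (b' k) + F (D.b k) ⁅x, b' k⁆) = 0) ∧
    (∀ i j, ⁅b' (.inr (.inr i)), D.b j⁆ = (∑ l, G i l * D.w j l) • D.b j) ∧
    (∀ j, ∑ a, ⁅D.b (.inr (.inl a)), ⁅b' (.inr (.inl a)), D.b j⁆⁆ = θ j • D.b j) ∧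
    (∀ a j k, D.b.repr ⁅b' (.inr (.inl a)), D.b j⁆ k ≠ 0 → D.z j < D.z k) ∧
    (∀ v : Fin D.r → K, (∀ i, ∑ l, G i l * v l = 0) → v = 0) ∧ ∀ i l, G i l = G l i := by
  classical
  obtain ⟨B, b', h1, h2, h3, h4⟩ := D.ex_B
  have e1 : ∀ y j, B (b' j) y = D.b.repr y j := fun y j => by
    conv_lhs => rw [← D.b.sum_repr y]
    rw [map_sum, Finset.sum_eq_single j (fun i _ hi => by rw [map_smul, h1, if_neg hi, smul_zero]) (by simp), map_smul, h1, if_pos rfl, smul_eq_mul, mul_one]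
  have e2 : ∀ y j, B y (D.b j) = b'.repr y j := fun y j => by
    conv_lhs => rw [← b'.sum_repr y]
    rw [map_sum, LinearMap.sum_apply, Finset.sum_eq_single j (fun i _ hi => by rw [map_smul, LinearMap.smul_apply, h1, if_neg hi.symm, smul_zero]) (by simp), map_smul, LinearMap.smul_apply, h1, if_pos rfl, smul_eq_mul, mul_one]
  have hw : ∀ k, D.iw (b' k) (- D.w k) := fun k i => by
    apply b'.ext_elem; intro j
    rw [← e2, ← lie_skew, map_neg, LinearMap.neg_apply, h3, D.lie_h, map_smul, h1, map_smul, b'.repr_self, Finsupp.smul_apply, Finsupp.single_apply]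
    by_cases hjk : j = k
    · subst hjk; simp
    · simp [hjk, Ne.symm hjk]
  have hG : ∀ i, b' (.inr (.inr i)) = ∑ l, D.b.repr (b' (.inr (.inr i))) (.inr (.inr l)) • D.b (.inr (.inr l)) := fun i => by
    conv_lhs => rw [← D.b.sum_repr (b' (.inr (.inr i)))]
    have h0 : ∀ k, D.z k ≠ 0 → D.b.repr (b' (.inr (.inr i))) k = 0 := fun k hk => by
      by_contra hn
      have := D.wt (hw _) k hn
      rw [D.w_h, neg_zero, ← D.w_h i] at this
      exact hk ((D.z_w' this).trans (D.z_h i))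
    rw [Fintype.sum_sum_type, Fintype.sum_sum_type, Finset.sum_eq_zero, Finset.sum_eq_zero (s := Finset.univ (α := Fin D.n)), zero_add, zero_add]
    · intro a _; rw [h0 _ (by have := D.z_e a; have := D.z_f a; omega), zero_smul]
    · intro a _; rw [h0 _ (by have := D.z_e a; omega), zero_smul]
  have hth : ∀ j, ∃ θ : K, ∑ a, ⁅D.b (.inr (.inl a)), ⁅b' (.inr (.inl a)), D.b j⁆⁆ = θ • D.b j := fun j => by
    have hwt : D.iw (∑ a, ⁅D.b (.inr (.inl a)), ⁅b' (.inr (.inl a)), D.b j⁆⁆) (D.w j) := D.iw_sum _ _ fun a => by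
      convert D.iw_lie (D.iw_b _) (D.iw_lie (hw (.inr (.inl a))) (D.iw_b j)) using 1
      abel
    by_cases hj : D.z j = 0
    · obtain ⟨i, rfl⟩ := D.w_0 hj
      refine ⟨1 / 2, ?_⟩
      apply b'.ext_elem; intro l
      rw [← e2, ← e2]
      by_cases hl : D.z l = 0
      · obtain ⟨l, rfl⟩ := D.w_0 hl
        have hs : ∑ k, D.w k i * D.w k l = 2 * ∑ a : Fin D.n, D.w (.inl a) i * D.w (.inl a) l := by
          rw [Fintype.sum_sum_type, Fintype.sum_sum_type]
          simp [D.w_f, D.w_h]; ring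
        rw [map_smul, LinearMap.smul_apply, h4, hs, map_sum, LinearMap.sum_apply, smul_eq_mul, ← mul_assoc, one_div, inv_mul_cancel₀ two_ne_zero, one_mul]
        refine Finset.sum_congr rfl fun a _ => ?_
        have q : ∀ i, ⁅b' (.inr (.inl a)), D.b (.inr (.inr i))⁆ = - D.w (.inl a) i • b' (.inr (.inl a)) := fun i => by
          rw [← lie_skew, hw, D.w_f, neg_neg, neg_smul]
        rw [q, lie_smul, map_smul, LinearMap.smul_apply, h3, q, map_smul, h2, h1, if_pos rfl]
        simp
      · have q : ∀ x, D.iw x 0 → B x (D.b l) = 0 := fun x hx => by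
          obtain ⟨i', hi'⟩ : ∃ i, D.w l i ≠ 0 := by
            by_contra! hn
            refine hl ?_
            have := D.z_eq l
            simp only [hn, mul_zero, Finset.sum_const_zero] at this
            exact_mod_cast this.symm
          have := h3 x (D.b (.inr (.inr i'))) (D.b l)
          rw [← lie_skew, hx i', D.lie_h] at this
          simp only [Pi.zero_apply, zero_smul, neg_zero, map_zero, LinearMap.zero_apply, map_smul, smul_eq_mul] at this
          exact (mul_eq_zero.1 this.symm).resolve_left hi'
        rw [D.w_h] at hwt
        rw [q _ hwt, q]
        intro i'; rw [lie_smul, D.lie_h, D.w_h]; simp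
    · refine ⟨D.b.repr (∑ a, ⁅D.b (.inr (.inl a)), ⁅b' (.inr (.inl a)), D.b j⁆⁆) j, ?_⟩
      apply D.b.ext_elem; intro k
      rw [map_smul, D.b.repr_self, Finsupp.smul_apply, Finsupp.single_apply]
      split_ifs with hk
      · subst hk; simp
      · rw [smul_zero]
        by_contra hn
        exact hk (D.w_inj (D.wt hwt k hn) hj).symm
  choose θ hθ using hth
  refine ⟨b', fun i l => D.b.repr (b' (.inr (.inr i))) (.inr (.inr l)), θ, ?_, ?_, hθ, ?_, ?_, fun i l => by
    change D.b.repr _ _ = D.b.repr _ _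
    rw [← e1, h2, e1]⟩
  · intro x F
    rw [Finset.sum_add_distrib]
    have f1 : ∀ k, ⁅x, D.b k⁆ = ∑ l, B (b' l) ⁅x, D.b k⁆ • D.b l := fun k => by simp [e1]
    have f2 : ∀ k, ⁅x, b' k⁆ = ∑ l, B ⁅x, b' k⁆ (D.b l) • b' l := fun k => by simp [e2]
    have f3 : ∑ k, F ⁅x, D.b k⁆ (b' k) = ∑ k, ∑ l, B (b' l) ⁅x, D.b k⁆ • F (D.b l) (b' k) :=
      Finset.sum_congr rfl fun k _ => by conv_lhs => rw [f1 k]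
                                         simp
    have f4 : ∑ k, F (D.b k) ⁅x, b' k⁆ = ∑ k, ∑ l, B ⁅x, b' k⁆ (D.b l) • F (D.b k) (b' l) :=
      Finset.sum_congr rfl fun k _ => by conv_lhs => rw [f2 k]
                                         simp
    rw [f3, f4, Finset.sum_comm, ← Finset.sum_add_distrib]
    refine Finset.sum_eq_zero fun k _ => ?_
    rw [← Finset.sum_add_distrib]
    refine Finset.sum_eq_zero fun l _ => ?_
    rw [← add_smul, ← h3, ← lie_skew, map_neg, LinearMap.neg_apply, neg_add_cancel, zero_smul]
  · intro i j
    conv_lhs => rw [hG i]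
    rw [sum_lie, Finset.sum_smul]
    refine Finset.sum_congr rfl fun l _ => ?_
    rw [smul_lie, D.lie_h, smul_smul]
  · intro a j k hk
    have := D.wt (D.iw_lie (hw _) (D.iw_b j)) k hk
    rw [D.w_f, neg_neg] at this
    have := D.z_w (c := 0) this
    have := D.z_e a
    omega
  · intro v hv
    have hs : ∑ l, v l • b' (.inr (.inr l)) = 0 := by
      have : ∀ i l, D.b.repr (b' (.inr (.inr i))) (.inr (.inr l)) = D.b.repr (b' (.inr (.inr l))) (.inr (.inr i)) := fun i l => by
        rw [← e1, h2, e1]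
      rw [Finset.sum_congr rfl fun l _ => congrArg (v l • ·) (hG l)]
      simp only [Finset.smul_sum, smul_smul]
      rw [Finset.sum_comm]
      refine Finset.sum_eq_zero fun i _ => ?_
      rw [← Finset.sum_smul]
      have h5 := hv i
      simp_rw [this i] at h5
      rw [show ∑ x, v x * D.b.repr (b' (.inr (.inr x))) (.inr (.inr i)) = 0 by rw [← h5]; exact Finset.sum_congr rfl fun _ _ => mul_comm _ _, zero_smul]
    funext l
    have := congrArg (fun y => b'.repr y (.inr (.inr l))) hs
    simpa [Finsupp.single_apply] using this
end
section
theorem ev_mem {A S : Type*} [CommRing A] [Ring S] (f : A →+* S) (x : S) (hf : ∀ a, Commute (f a) x) (R : Subring S)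
    (h1 : ∀ a, f a ∈ R) (h2 : x ∈ R) (P : Polynomial A) : Polynomial.eval₂RingHom' f x hf P ∈ R := by
  change Polynomial.eval₂ f x P ∈ R
  rw [Polynomial.eval₂_eq_sum_range]
  exact sum_mem fun i _ => mul_mem (h1 _) (pow_mem h2 _)
variable {K g : Type*} [Field K] [LieRing g] [LieAlgebra K g] [CharZero K] [LieAlgebra.IsSemisimple K g] (D : RD K g)
local notation "U" => UniversalEnvelopingAlgebra K g
attribute [local instance 100] LieRing.ofAssociativeRing
noncomputable def RD.aE : Module.End K g →ₐ[K] Matrix D.ix D.ix U :=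
  ((Algebra.ofId K U).mapMatrix).comp (LinearMap.toMatrixAlgEquiv D.b).toAlgHom
noncomputable def RD.aD : g →ₗ[K] Matrix D.ix D.ix U :=
  D.aE.toLinearMap.comp (LieAlgebra.ad K g : g →ₗ[K] Module.End K g)
theorem RD.aE_a (φ : Module.End K g) (i j) : D.aE φ i j = algebraMap K U (D.b.repr (φ (D.b j)) i) := by
  simp [RD.aE, Algebra.ofId_apply, LinearMap.toMatrixAlgEquiv_apply]
theorem RD.aD_a (x : g) (i j) : D.aD x i j = algebraMap K U (D.b.repr ⁅x, D.b j⁆ i) := D.aE_a _ i j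
theorem RD.aD_E (x : g) : D.aD x = D.aE (LieAlgebra.ad K g x) := rfl
theorem RD.aD_lie (x y : g) : D.aD ⁅x, y⁆ = D.aD x * D.aD y - D.aD y * D.aD x := by
  have : LieAlgebra.ad K g ⁅x, y⁆ = LieAlgebra.ad K g x * LieAlgebra.ad K g y - LieAlgebra.ad K g y * LieAlgebra.ad K g x := LieHom.map_lie _ x y
  rw [D.aD_E, D.aD_E, D.aD_E, this, map_sub, map_mul D.aE, map_mul D.aE]
theorem RD.aD_sc (y : g) (u : U) : Matrix.scalar D.ix u * D.aD y = D.aD y * Matrix.scalar D.ix u := by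
  ext i j
  simp [Matrix.scalar_apply, Matrix.diagonal_mul, Matrix.mul_diagonal, D.aD_a, Algebra.commutes]
noncomputable def RD.dX (x : g) : Matrix D.ix D.ix U := Matrix.scalar D.ix (io K g x) + D.aD x
noncomputable def RD.Cm (b' : D.ix → g) : Matrix D.ix D.ix U :=
  ∑ k, Matrix.scalar D.ix (io K g (D.b k)) * D.aD (b' k)
theorem RD.sc_lie (x y : g) : Matrix.scalar D.ix (io K g ⁅x, y⁆) = Matrix.scalar D.ix (io K g x) * Matrix.scalar D.ix (io K g y)
    - Matrix.scalar D.ix (io K g y) * Matrix.scalar D.ix (io K g x) := by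
  rw [io_lie, map_sub, map_mul, map_mul]
theorem RD.Cm_dX {b' : D.ix → g} (hb : ∀ (x : g) (F : g →ₗ[K] g →ₗ[K] Matrix D.ix D.ix U),
      ∑ k, (F ⁅x, D.b k⁆ (b' k) + F (D.b k) ⁅x, b' k⁆) = 0) (x : g) : D.dX x * D.Cm b' = D.Cm b' * D.dX x := by
  have h := hb x (LinearMap.mk₂ K (fun y y' => Matrix.scalar D.ix (io K g y) * D.aD y')
    (fun a b c => by rw [map_add, map_add, add_mul])
    (fun c a b => by rw [map_smul, ← smul_mul_assoc]; congr 1; ext i j; simp [Matrix.scalar_apply, Matrix.diagonal_apply])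
    (fun a b c => by rw [map_add, mul_add])
    (fun c a b => by rw [map_smul, mul_smul_comm]))
  rw [← sub_eq_zero, ← h, RD.Cm, Finset.mul_sum, Finset.sum_mul, ← Finset.sum_sub_distrib]
  refine Finset.sum_congr rfl fun k _ => ?_
  simp only [LinearMap.mk₂_apply, D.sc_lie, D.aD_lie, RD.dX]
  have h1 := D.aD_sc x (io K g (D.b k))
  have h2 := D.aD_sc (b' k) (io K g x)
  generalize Matrix.scalar D.ix (io K g (D.b k)) = s at *
  generalize Matrix.scalar D.ix (io K g x) = t at *
  generalize D.aD x = a at *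
  generalize D.aD (b' k) = c at *
  simp only [add_mul, mul_add, mul_sub, sub_mul]
  simp only [← mul_assoc, ← h1]
  simp only [mul_assoc, h2]
  abel
theorem RD.tr_cen {M : Matrix D.ix D.ix U} (h : ∀ x, D.dX x * M = M * D.dX x) (u : U) : M.trace * u = u * M.trace := by
  refine (Subalgebra.mem_centralizer_iff K).1 (show u ∈ Subalgebra.centralizer K {M.trace} from
    U_ind (Subalgebra.centralizer K {M.trace}).toSubmodule (one_mem (Subalgebra.centralizer K {M.trace}))
      (fun x v hv => mul_mem (S := Subalgebra K U) ?_ hv) u) _ rfl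
  refine (Subalgebra.mem_centralizer_iff _).2 ?_
  rintro _ rfl
  have h1 := congrArg Matrix.trace (h x)
  simp only [RD.dX, add_mul, mul_add, Matrix.trace_add] at h1
  have h2 : (D.aD x * M).trace = (M * D.aD x).trace := by
    simp only [Matrix.trace, Matrix.diag_apply, Matrix.mul_apply, D.aD_a]
    rw [Finset.sum_comm]
    exact Finset.sum_congr rfl fun i _ => Finset.sum_congr rfl fun j _ => Algebra.commutes _ _
  rw [h2, add_left_inj] at h1
  simpa [Matrix.trace, Matrix.scalar_apply, Finset.mul_sum, Finset.sum_mul, mul_add, add_mul] using h1.symm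
noncomputable def RD.Rm : D.A →+* AddMonoid.End (D.ix → U) where
  toFun a := ⟨⟨fun v i => v i * D.j a, by ext; simp⟩, fun v w => by ext; simp [add_mul]⟩
  map_one' := by refine AddMonoidHom.ext fun v => funext fun i => ?_; change v i * D.j 1 = v i; simp
  map_mul' a b := by
    refine AddMonoidHom.ext fun v => funext fun i => ?_
    change v i * D.j (a * b) = v i * D.j b * D.j a
    rw [mul_comm, map_mul, mul_assoc]
  map_zero' := by refine AddMonoidHom.ext fun v => funext fun i => ?_; change v i * D.j 0 = 0; simp
  map_add' a b := by
    refine AddMonoidHom.ext fun v => funext fun i => ?_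
    change v i * D.j (a + b) = v i * D.j a + v i * D.j b
    rw [map_add, mul_add]
noncomputable def RD.Lm : Matrix D.ix D.ix U →+* AddMonoid.End (D.ix → U) where
  toFun M := ⟨⟨fun v => M.mulVec v, by simp⟩, fun v w => by
    change M.mulVec (v + w) = M.mulVec v + M.mulVec w
    exact Matrix.mulVec_add _ _ _⟩
  map_one' := AddMonoidHom.ext fun v => Matrix.one_mulVec _
  map_mul' a b := AddMonoidHom.ext fun v => by
    change (a * b).mulVec v = a.mulVec (b.mulVec v)
    exact (Matrix.mulVec_mulVec _ _ _).symm
  map_zero' := AddMonoidHom.ext fun v => by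
    change (0 : Matrix D.ix D.ix U).mulVec v = 0
    exact Matrix.zero_mulVec _
  map_add' a b := AddMonoidHom.ext fun v => by
    change (a + b).mulVec v = a.mulVec v + b.mulVec v
    exact Matrix.add_mulVec _ _ _
theorem RD.Rm_a (a v i) : D.Rm a v i = v i * D.j a := rfl
theorem RD.Lm_a (M v) : D.Lm M v = M.mulVec v := rfl
theorem RD.Rm_Lm (a M) : Commute (D.Rm a) (D.Lm M) := by
  refine AddMonoidHom.ext fun v => funext fun i => ?_
  change (M.mulVec v i) * D.j a = M.mulVec (D.Rm a v) i
  simp only [Matrix.mulVec, dotProduct, Finset.sum_mul, D.Rm_a, mul_assoc]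
noncomputable def RD.ev (b' : D.ix → g) : Polynomial D.A →+* AddMonoid.End (D.ix → U) :=
  Polynomial.eval₂RingHom' D.Rm (D.Lm (D.Cm b')) fun a => D.Rm_Lm a _
theorem RD.ev_C (b' a) : D.ev b' (.C a) = D.Rm a := Polynomial.eval₂_C _ _
theorem RD.ev_X (b') : D.ev b' .X = D.Lm (D.Cm b') := Polynomial.eval₂_X _ _
noncomputable def RD.NN : AddSubgroup (D.ix → U) where
  carrier := {v | ∀ i, v i ∈ D.UN}
  add_mem' := fun h h' i => add_mem (h i) (h' i)
  zero_mem' := fun i => zero_mem _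
  neg_mem' := fun h i => neg_mem (h i)
theorem RD.UN_j (u : U) (hu : u ∈ D.UN) (P) : u * D.j P ∈ D.UN := by
  induction P using MvPolynomial.induction_on with
  | C a => rw [show D.j (.C a) = algebraMap K U a from D.j.commutes a, ← Algebra.commutes]; exact D.UN.mul_mem_left _ hu
  | add p q h h' => rw [map_add, mul_add]; exact add_mem h h'
  | mul_X p i h => rw [map_mul, ← mul_assoc, D.j_X]; exact D.UN_h _ h i
theorem RD.Lm_N (M : Matrix D.ix D.ix U) {v} (hv : v ∈ D.NN) : D.Lm M v ∈ D.NN := fun i => by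
  change ∑ k, M i k * v k ∈ D.UN
  exact sum_mem fun k _ => D.UN.mul_mem_left _ (hv k)
theorem RD.ev_N (b' P) {v} (hv : v ∈ D.NN) : D.ev b' P v ∈ D.NN := by
  let R : Subring (AddMonoid.End (D.ix → U)) :=
    { carrier := {φ | ∀ v ∈ D.NN, φ v ∈ D.NN}
      mul_mem' := fun h h' v hv => h _ (h' v hv)
      one_mem' := fun v hv => hv
      add_mem' := fun h h' v hv => add_mem (h v hv) (h' v hv)
      zero_mem' := fun v hv => zero_mem _
      neg_mem' := fun h v hv => neg_mem (h v hv) }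
  exact ev_mem _ _ _ R (fun a v hv i => D.UN_j _ (hv i) _) (fun v hv => D.Lm_N _ hv) P v hv
theorem RD.ev_L {b' : D.ix → g} {M : Matrix D.ix D.ix U} (h : M * D.Cm b' = D.Cm b' * M) (P v) : D.ev b' P (D.Lm M v) = D.Lm M (D.ev b' P v) := by
  have := ev_mem D.Rm (D.Lm (D.Cm b')) (fun a => D.Rm_Lm a _) (Subring.centralizer {D.Lm M}) (fun a => ?_) ?_ P
  · exact (DFunLike.congr_fun (Subring.mem_centralizer_iff.1 this _ rfl) v).symm
  · rw [Subring.mem_centralizer_iff]; rintro _ rfl; exact (D.Rm_Lm a M).symm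
  · rw [Subring.mem_centralizer_iff]; rintro _ rfl; rw [← map_mul, h, map_mul]
end
section
theorem ae_mul {V : Type*} [AddCommGroup V] (φ ψ : AddMonoid.End V) (v : V) : (φ * ψ) v = φ (ψ v) := rfl
variable {K g : Type*} [Field K] [LieRing g] [LieAlgebra K g] [CharZero K] [LieAlgebra.IsSemisimple K g] (D : RD K g)
local notation "U" => UniversalEnvelopingAlgebra K g
noncomputable def RD.tt (G : Fin D.r → Fin D.r → K) (j : D.ix) : D.A := ∑ i, (∑ l, G i l * D.w j l) • .X i
noncomputable def RD.ct (G : Fin D.r → Fin D.r → K) (θ : D.ix → K) (j : D.ix) : D.A := D.tt G j - .C (θ j)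
open Classical in
theorem RD.Cm_step {b' : D.ix → g} {G θ}
    (h2 : ∀ i j, ⁅b' (.inr (.inr i)), D.b j⁆ = (∑ l, G i l * D.w j l) • D.b j)
    (h3 : ∀ j, ∑ a, ⁅D.b (.inr (.inl a)), ⁅b' (.inr (.inl a)), D.b j⁆⁆ = θ j • D.b j) (i : D.ix) :
    D.Lm (D.Cm b') (Pi.single i 1) - D.Rm (D.ct G θ i) (Pi.single i 1) -
      ∑ a, D.Lm (D.dX (D.b (.inr (.inl a)))) (D.Lm (D.aD (b' (.inr (.inl a)))) (Pi.single i 1)) ∈ D.NN := by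
  intro l
  have hs : ∑ a, D.aD (D.b (.inr (.inl a))) * D.aD (b' (.inr (.inl a))) = D.aE (∑ a, LieAlgebra.ad K g (D.b (.inr (.inl a))) * LieAlgebra.ad K g (b' (.inr (.inl a)))) := by
    rw [map_sum]; exact Finset.sum_congr rfl fun a _ => (map_mul D.aE _ _).symm
  have e1 : ∀ M : Matrix D.ix D.ix U, D.Lm M (Pi.single i 1) l = M l i := fun M => by
    rw [D.Lm_a, Matrix.mulVec_single_one]; rfl
  have e2 : ∑ a, D.Lm (D.dX (D.b (.inr (.inl a)))) (D.Lm (D.aD (b' (.inr (.inl a)))) (Pi.single i 1)) l =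
      ∑ a, io K g (D.b (.inr (.inl a))) * D.aD (b' (.inr (.inl a))) l i + algebraMap K U (θ i * if i = l then 1 else 0) := by
    have : ∀ a, D.Lm (D.dX (D.b (.inr (.inl a)))) (D.Lm (D.aD (b' (.inr (.inl a)))) (Pi.single i 1)) l =
      io K g (D.b (.inr (.inl a))) * D.aD (b' (.inr (.inl a))) l i + (D.aD (D.b (.inr (.inl a))) * D.aD (b' (.inr (.inl a)))) l i := fun a => by
      rw [← ae_mul, ← map_mul, e1, RD.dX, add_mul, Matrix.add_apply, Matrix.scalar_apply, Matrix.diagonal_mul]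
    rw [Finset.sum_congr rfl fun a _ => this a, Finset.sum_add_distrib]
    congr 1
    rw [← Matrix.sum_apply, hs, D.aE_a, LinearMap.sum_apply]
    have := h3 i
    simp only [← LieAlgebra.ad_apply K] at this
    simp only [Module.End.mul_apply, this]
    rw [map_smul, D.b.repr_self, Finsupp.smul_apply, Finsupp.single_apply, smul_eq_mul]
  have e3 : D.Cm b' l i = ∑ k, io K g (D.b k) * D.aD (b' k) l i := by
    rw [RD.Cm, Matrix.sum_apply]
    refine Finset.sum_congr rfl fun k _ => ?_
    rw [Matrix.scalar_apply, Matrix.diagonal_mul]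
  have e4 : D.Rm (D.ct G θ i) (Pi.single i 1) l = ∑ k, io K g (D.b (.inr (.inr k))) * D.aD (b' (.inr (.inr k))) l i - algebraMap K U (θ i * if i = l then 1 else 0) := by
    have : ∀ k, io K g (D.b (.inr (.inr k))) * D.aD (b' (.inr (.inr k))) l i = ((∑ l, G k l * D.w i l) * if i = l then 1 else 0) • D.h k := fun k => by
      rw [D.aD_a, h2, map_smul, D.b.repr_self, Finsupp.smul_apply, Finsupp.single_apply, smul_eq_mul, ← Algebra.commutes, ← Algebra.smul_def]; rfl
    rw [Finset.sum_congr rfl fun k _ => this k, D.Rm_a, RD.ct, map_sub, RD.tt, map_sum, show D.j (.C (θ i)) = algebraMap K U (θ i) from D.j.commutes _]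
    simp only [map_smul, D.j_X]
    by_cases hil : i = l
    · subst hil; simp
    · simp [Pi.single_apply, hil, Ne.symm hil]
  rw [Pi.sub_apply, Pi.sub_apply, Finset.sum_apply, e1, e2, e3, e4, Fintype.sum_sum_type, Fintype.sum_sum_type]
  have : ∑ a, io K g (D.b (.inl a)) * D.aD (b' (.inl a)) l i ∈ D.UN := sum_mem fun a _ => by
    rw [D.aD_a, ← Algebra.commutes]; exact D.UN_e _ a
  convert this using 1
  abel
open Classical in
theorem RD.ev_tri {b' : D.ix → g} {G θ}
    (h1 : ∀ x, D.dX x * D.Cm b' = D.Cm b' * D.dX x)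
    (h2 : ∀ i j, ⁅b' (.inr (.inr i)), D.b j⁆ = (∑ l, G i l * D.w j l) • D.b j)
    (h3 : ∀ j, ∑ a, ⁅D.b (.inr (.inl a)), ⁅b' (.inr (.inl a)), D.b j⁆⁆ = θ j • D.b j)
    (h4 : ∀ a j k, D.b.repr ⁅b' (.inr (.inl a)), D.b j⁆ k ≠ 0 → D.z j < D.z k) (B : ℤ) (hB : ∀ l, D.z l < B) (n : ℕ) :
    ∀ (i : D.ix) (S : Finset D.ix), B - D.z i ≤ n → (∀ l, D.z i ≤ D.z l → l ∈ S) →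
    D.ev b' (∏ l ∈ S, (.X - .C (D.ct G θ l))) (Pi.single i 1) ∈ D.NN := by
  induction n with
  | zero => intro i S h; have := hB i; omega
  | succ n ih =>
    intro i S hi hS
    rw [← Finset.prod_erase_mul S _ (hS i le_rfl), map_mul, map_sub, D.ev_X, D.ev_C]
    have := D.ev_N b' (∏ l ∈ S.erase i, (.X - .C (D.ct G θ l))) (D.Cm_step h2 h3 i)
    rw [map_sub] at this
    rw [ae_mul]
    rw [sub_eq_add_neg] at this
    refine (AddSubgroup.add_mem_cancel_right _ (neg_mem ?_)).1 this
    rw [map_sum]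
    refine sum_mem fun a _ => ?_
    rw [D.ev_L (h1 _)]
    refine D.Lm_N _ ?_
    have e : D.Lm (D.aD (b' (.inr (.inl a)))) (Pi.single i 1) = ∑ k, D.Rm (.C (D.b.repr ⁅b' (.inr (.inl a)), D.b i⁆ k)) (Pi.single k 1) := by
      funext l
      rw [D.Lm_a, Matrix.mulVec_single_one, Finset.sum_apply, Finset.sum_eq_single l]
      · change D.aD _ l i = _
        rw [D.aD_a, D.Rm_a, Pi.single_eq_same, one_mul, show ∀ c, D.j (.C c) = algebraMap K U c from fun c => D.j.commutes _]
      · intro k _ hk; rw [D.Rm_a, Pi.single_eq_of_ne hk.symm, zero_mul]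
      · simp
    rw [e, map_sum]
    refine sum_mem fun k _ => ?_
    by_cases hk : D.b.repr ⁅b' (.inr (.inl a)), D.b i⁆ k = 0
    · rw [hk, map_zero, map_zero]; simp [zero_mem]
    · have hz := h4 a i k hk
      rw [← D.ev_C b', ← ae_mul, ← map_mul, mul_comm, map_mul, ae_mul]
      refine D.ev_N _ _ (ih k _ (by push_cast at hi; omega) fun l hl => Finset.mem_erase.2 ⟨?_, hS l (by omega)⟩)
      rintro rfl; omega
end
section
variable {K g : Type*} [Field K] [LieRing g] [LieAlgebra K g] [CharZero K] [LieAlgebra.IsSemisimple K g] (D : RD K g)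
local notation "U" => UniversalEnvelopingAlgebra K g
open Classical in
noncomputable def RD.TT (b' : D.ix → g) : Polynomial D.A →ₗ[D.A] D.A where
  toFun P := ∑ i, D.p (D.ev b' P (Pi.single i 1) i)
  map_add' P Q := by
    rw [← Finset.sum_add_distrib]
    exact Finset.sum_congr rfl fun i _ => by rw [map_add (D.ev b'), ← map_add D.p]; rfl
  map_smul' a P := by
    rw [RingHom.id_apply, smul_eq_mul, Finset.mul_sum]
    refine Finset.sum_congr rfl fun i _ => ?_
    rw [Polynomial.smul_eq_C_mul, map_mul, ae_mul, D.ev_C, D.Rm_a, D.p_mj, mul_comm]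
theorem RD.TT_X (b' : D.ix → g) (k : ℕ) : D.TT b' (.X ^ k) = D.p (Matrix.trace (D.Cm b' ^ k)) := by
  classical
  rw [Matrix.trace, map_sum]
  change ∑ i, D.p (D.ev b' _ (Pi.single i 1) i) = _
  refine Finset.sum_congr rfl fun i _ => ?_
  rw [map_pow, D.ev_X, ← map_pow, D.Lm_a]
  congr 1
  convert congrFun (Matrix.mulVec_single_one (D.Cm b' ^ k) i) i
  rfl
theorem RD.tt_V (G j) : D.tt G j ∈ VV K 2 := sum_mem fun i _ => Submodule.smul_mem _ _ (VV_X i)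
theorem RD.tt_h (G j) : (D.tt G j).IsHomogeneous 1 := MvPolynomial.IsHomogeneous.sum _ _ _ fun i _ => by
  rw [MvPolynomial.smul_eq_C_mul]
  exact (zero_add 1) ▸ (MvPolynomial.isHomogeneous_C _ _).mul (MvPolynomial.isHomogeneous_X _ _)
theorem RD.Cm_io (b' : D.ix → g) (i m) : D.Cm b' i m = io K g (∑ k, D.b.repr ⁅b' k, D.b m⁆ i • D.b k) := by
  rw [RD.Cm, Matrix.sum_apply, map_sum]
  refine Finset.sum_congr rfl fun k _ => ?_
  rw [Matrix.scalar_apply, Matrix.diagonal_mul, D.aD_a, ← Algebra.commutes, ← Algebra.smul_def, map_smul]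
open Classical in
theorem RD.Cm_top {b' : D.ix → g} {G}
    (h2 : ∀ i j, ⁅b' (.inr (.inr i)), D.b j⁆ = (∑ l, G i l * D.w j l) • D.b j) (k : ℕ) : ∀ i l,
    (D.Cm b' ^ k) i l ∈ FF K g k ∧ D.p ((D.Cm b' ^ k) i l) - (if i = l then D.tt G i ^ k else 0) ∈ VV K k := by
  induction k with
  | zero =>
    intro i l
    rw [pow_zero, Matrix.one_apply]
    split_ifs
    · exact ⟨FF_one 0, by rw [D.p_1, pow_zero, sub_self]; exact zero_mem _⟩
    · exact ⟨zero_mem _, by rw [map_zero, sub_self]; exact zero_mem _⟩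
  | succ k ih =>
    intro i l
    rw [pow_succ', Matrix.mul_apply]
    refine ⟨sum_mem fun m _ => by rw [D.Cm_io]; exact FF_io _ (ih m l).1, ?_⟩
    have e : (if i = l then D.tt G i ^ (k + 1) else 0) = ∑ m, D.pi (∑ k, D.b.repr ⁅b' k, D.b m⁆ i • D.b k) * (if m = l then D.tt G m ^ k else 0) := by
      rw [Finset.sum_eq_single l (fun m _ hm => by rw [if_neg hm, mul_zero]) (by simp), if_pos rfl]
      have : D.pi (∑ k, D.b.repr ⁅b' k, D.b l⁆ i • D.b k) = if i = l then D.tt G i else 0 := by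
        rw [map_sum, Fintype.sum_sum_type, Fintype.sum_sum_type]
        simp only [map_smul, D.pi_e, D.pi_f, D.pi_h, smul_zero, Finset.sum_const_zero, zero_add, h2, D.b.repr_self, Finsupp.smul_apply, Finsupp.single_apply, smul_eq_mul]
        by_cases hil : i = l
        · subst hil; simp [RD.tt]
        · simp [hil, Ne.symm hil]
      rw [this]; split_ifs with hil
      · rw [hil, pow_succ']
      · rw [zero_mul]
    rw [e, map_sum, ← Finset.sum_sub_distrib]
    refine sum_mem fun m _ => ?_
    rw [D.Cm_io]
    exact D.p_top (ih m l).1 (ih m l).2 _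
open Classical in
theorem RD.TT_top {b' : D.ix → g} {G} (θ)
    (h2 : ∀ i j, ⁅b' (.inr (.inr i)), D.b j⁆ = (∑ l, G i l * D.w j l) • D.b j) (S : Finset D.ix) : ∀ k,
    D.TT b' (.X ^ k * ∏ l ∈ S, (.X - .C (D.ct G θ l))) - ∑ i, D.tt G i ^ k * ∏ l ∈ S, (D.tt G i - D.tt G l) ∈ VV K (k + S.card) := by
  induction S using Finset.induction_on with
  | empty =>
    intro k
    simp only [Finset.prod_empty, mul_one, Finset.card_empty, add_zero]
    rw [D.TT_X, Matrix.trace, map_sum, ← Finset.sum_sub_distrib]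
    exact sum_mem fun i _ => by simpa using (D.Cm_top h2 k i i).2
  | insert j S hj ih =>
    intro k
    have e1 : (.X ^ k * ∏ l ∈ insert j S, (.X - .C (D.ct G θ l)) : Polynomial D.A) = .X ^ (k + 1) * ∏ l ∈ S, (.X - .C (D.ct G θ l)) -
        D.ct G θ j • (.X ^ k * ∏ l ∈ S, (.X - .C (D.ct G θ l))) := by
      rw [Finset.prod_insert hj, Polynomial.smul_eq_C_mul]; ring
    have e2 : ∑ i, D.tt G i ^ k * ∏ l ∈ insert j S, (D.tt G i - D.tt G l) = ∑ i, D.tt G i ^ (k + 1) * ∏ l ∈ S, (D.tt G i - D.tt G l) -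
        D.tt G j * ∑ i, D.tt G i ^ k * ∏ l ∈ S, (D.tt G i - D.tt G l) := by
      rw [Finset.mul_sum, ← Finset.sum_sub_distrib]
      exact Finset.sum_congr rfl fun i _ => by rw [Finset.prod_insert hj]; ring
    have h1 := ih (k + 1)
    have h0 := ih k
    have hX : ∑ i, D.tt G i ^ k * ∏ l ∈ S, (D.tt G i - D.tt G l) ∈ VV K (k + S.card + 1) := sum_mem fun i _ => by
      have q : ∀ (P : D.A) n, P.IsHomogeneous n → P ∈ VV K (n + 1) := fun P n hP m hm => hP.coeff_eq_zero (by omega)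
      refine q _ _ (MvPolynomial.IsHomogeneous.mul (by simpa using (D.tt_h G i).pow k) ?_)
      have := MvPolynomial.IsHomogeneous.prod S (fun l => D.tt G i - D.tt G l) (fun _ => 1) fun l _ => (D.tt_h G i).sub (D.tt_h G l)
      simpa using this
    rw [e1, e2, map_sub, map_smul, Finset.card_insert_of_notMem hj, smul_eq_mul]
    generalize D.TT b' (.X ^ (k + 1) * ∏ l ∈ S, (.X - .C (D.ct G θ l))) = a1 at *
    generalize D.TT b' (.X ^ k * ∏ l ∈ S, (.X - .C (D.ct G θ l))) = a0 at *
    generalize ∑ i, D.tt G i ^ (k + 1) * ∏ l ∈ S, (D.tt G i - D.tt G l) = x1 at *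
    generalize ∑ i, D.tt G i ^ k * ∏ l ∈ S, (D.tt G i - D.tt G l) = x0 at *
    have : a1 - D.ct G θ j * a0 - (x1 - D.tt G j * x0) = (a1 - x1) - D.tt G j * (a0 - x0) + θ j • (a0 - x0 + x0) := by
      rw [RD.ct, MvPolynomial.smul_eq_C_mul]; ring
    rw [this]
    refine add_mem (sub_mem (VV_mono (by omega) h1) ?_) (Submodule.smul_mem _ _ (add_mem (VV_mono (by omega) h0) (VV_mono (by omega) hX)))
    have := VV_mul (a := 1) (D.tt_V G j) h0
    rwa [show 1 + (k + S.card) = k + (S.card + 1) by omega] at this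
theorem RD.tt_sub {G : Fin D.r → Fin D.r → K} (h5 : ∀ v : Fin D.r → K, (∀ i, ∑ l, G i l * v l = 0) → v = 0) {i l} (hz : D.z l ≠ 0) (h : D.tt G i = D.tt G l) : i = l := by
  refine D.w_inj (sub_eq_zero.1 (h5 _ fun k => ?_)) hz
  have := congrArg (MvPolynomial.coeff (Finsupp.single k 1)) h
  simp only [RD.tt, MvPolynomial.coeff_sum, MvPolynomial.coeff_smul, MvPolynomial.coeff_X, Finsupp.single_left_inj one_ne_zero] at this
  simp only [smul_eq_mul, mul_ite, mul_one, mul_zero, Finset.sum_ite_eq', Finset.mem_univ, if_true] at this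
  simp only [Pi.sub_apply, mul_sub, Finset.sum_sub_distrib, this, sub_self]
open Classical in
theorem RD.ex_T : ∃ (T : Polynomial D.A →ₗ[D.A] D.A) (c : D.ix → D.A), (∀ P, T ((∏ l, (.X - .C (c l))) * P) = 0) ∧ (∀ k, T (.X ^ k) ∈ D.PZ) ∧
    (∀ β, D.z β ≠ 0 → T (∏ l ∈ Finset.univ.erase β, (.X - .C (c l))) ≠ 0) ∧
    (∀ i, MvPolynomial.X i ∈ Submodule.span K ({1} ∪ c '' {β | D.z β ≠ 0})) ∧
    ∃ t : D.ix → D.A, (∀ β, (t β).IsHomogeneous 1 ∧ ∃ θ : K, c β = t β - .C θ) ∧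
      ∀ k, ∃ z ∈ FF K g k, (∀ u, z * u = u * z) ∧ D.p z - ∑ β, t β ^ k ∈ VV K k := by
  obtain ⟨b', G, θ, h1, h2, h3, h4, h5, h6⟩ := D.ex_cas
  have hd := D.Cm_dX h1
  refine ⟨D.TT b', D.ct G θ, fun P => ?_, fun k => ⟨_, D.tr_cen (M := D.Cm b' ^ k) fun x => (Commute.pow_right (hd x) k), (D.TT_X b' k).symm⟩, fun β hβ h0 => ?_, fun i => ?_,
    D.tt G, fun β => ⟨D.tt_h G β, θ β, rfl⟩, fun k => ⟨_, sum_mem fun i _ => (D.Cm_top h2 k i i).1, D.tr_cen (M := D.Cm b' ^ k) fun x => (Commute.pow_right (hd x) k), ?_⟩⟩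
  · obtain ⟨B, hB⟩ : ∃ B, ∀ l, D.z l < B := by
      obtain ⟨B, hB⟩ := (Set.finite_range D.z).bddAbove
      exact ⟨B + 1, fun l => Int.lt_add_one_of_le (hB ⟨l, rfl⟩)⟩
    refine (Finset.sum_eq_zero fun i _ => D.p_UN ?_ : ∑ i, D.p (D.ev b' _ (Pi.single i 1) i) = 0)
    rw [mul_comm, map_mul, ae_mul]
    refine D.ev_N b' P ?_ i
    exact D.ev_tri hd h2 h3 h4 B hB (B - D.z i).toNat i _ (by omega) fun l _ => Finset.mem_univ l
  · have h7 := D.TT_top θ h2 (Finset.univ.erase β) 0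
    rw [pow_zero, one_mul, h0, zero_sub, zero_add, Finset.sum_eq_single β] at h7
    · rw [neg_mem_iff, pow_zero, one_mul] at h7
      have hne : ∏ l ∈ Finset.univ.erase β, (D.tt G β - D.tt G l) ≠ 0 := Finset.prod_ne_zero_iff.2 fun l hl he =>
        Finset.ne_of_mem_erase hl (D.tt_sub h5 hβ (sub_eq_zero.1 he).symm)
      have hh := MvPolynomial.IsHomogeneous.prod (Finset.univ.erase β) (fun l => D.tt G β - D.tt G l) (fun _ => 1) fun l _ => (D.tt_h G β).sub (D.tt_h G l)
      obtain ⟨m, hm⟩ := MvPolynomial.ne_zero_iff.1 hne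
      refine hm (h7 m ?_)
      have := hh hm
      simp only [Finset.sum_const, smul_eq_mul, mul_one] at this
      rw [← this, Finsupp.degree_eq_weight_one]; rfl
    · intro i _ hi
      rw [Finset.prod_eq_zero (Finset.mem_erase.2 ⟨hi, Finset.mem_univ i⟩) (sub_self _), mul_zero]
    · simp
  · let φ : (Fin D.r → K) →ₗ[K] D.A := ∑ i, (LinearMap.proj i : (Fin D.r → K) →ₗ[K] K).smulRight (MvPolynomial.X i)
    have hφ : ∀ v, φ v = ∑ i, v i • MvPolynomial.X i := fun v => by simp [φ]
    let Y : Submodule K (Fin D.r → K) := Submodule.span K (Set.range fun (a : Fin D.n) i => ∑ l, G i l * D.w (.inl a) l)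
    have hY : Y = ⊤ := by
      by_contra hY
      obtain ⟨f, hf0, hf⟩ := Submodule.exists_le_ker_of_lt_top Y (lt_top_iff_ne_top.2 hY)
      refine hf0 (LinearMap.pi_ext' fun i => LinearMap.ext_ring ?_)
      have hfa : ∀ v, f v = ∑ i, v i * f (Pi.single i 1) := fun v => by
        conv_lhs => rw [← Finset.univ_sum_single v]
        rw [map_sum]
        refine Finset.sum_congr rfl fun i _ => ?_
        rw [← smul_eq_mul, ← map_smul, ← Pi.single_smul, smul_eq_mul, mul_one]
      have hc : (fun i => f (Pi.single i 1)) = 0 := by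
        refine h5 _ fun l => ?_
        refine congrFun (D.sp (fun l => ∑ i, G l i * f (Pi.single i 1)) fun a => ?_) l
        have := hf (Submodule.subset_span ⟨a, rfl⟩)
        rw [LinearMap.mem_ker, hfa] at this
        rw [← this]
        simp only [Finset.sum_mul]
        rw [Finset.sum_comm]
        exact Finset.sum_congr rfl fun i _ => Finset.sum_congr rfl fun l _ => by rw [h6 l i]; ring
      simpa using congrFun hc i
    have hm : Y.map φ ≤ Submodule.span K ({1} ∪ D.ct G θ '' {β | D.z β ≠ 0}) := by
      rw [Submodule.map_span_le]
      rintro _ ⟨a, rfl⟩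
      have : φ (fun i => ∑ l, G i l * D.w (.inl a) l) = D.ct G θ (.inl a) + θ (.inl a) • 1 := by
        rw [hφ, RD.ct, MvPolynomial.smul_eq_C_mul, mul_one, sub_add_cancel]; rfl
      rw [this]
      refine add_mem (Submodule.subset_span (Or.inr ⟨_, (D.z_e a).ne', rfl⟩)) (Submodule.smul_mem _ _ (Submodule.subset_span (Or.inl rfl)))
    refine hm ⟨Pi.single i 1, hY ▸ Submodule.mem_top, ?_⟩
    rw [hφ, Finset.sum_eq_single i (fun k _ hk => by rw [Pi.single_eq_of_ne hk, zero_smul]) (by simp), Pi.single_eq_same, one_smul]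
  · change D.p (∑ i, (D.Cm b' ^ k) i i) - _ ∈ VV K k
    rw [map_sum, ← Finset.sum_sub_distrib]
    exact sum_mem fun i _ => by simpa using (D.Cm_top h2 k i i).2
end
section
open Polynomial
variable {A : Type*} [CommRing A] [IsDomain A]
open Classical in
theorem c7_1 {ι : Type*} [Fintype ι] (T : A[X] →ₗ[A] A) (c : ι → A) (h0 : ∀ P, T ((∏ l, (X - C (c l))) * P) = 0) :
    ∃ S : Finset ι, (∀ P, T ((∏ l ∈ S, (X - C (c l))) * P) = 0) ∧ (∀ g, (∀ P, T (g * P) = 0) → (∏ l ∈ S, (X - C (c l))) ∣ g) ∧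
      ∀ β, T (∏ l ∈ Finset.univ.erase β, (X - C (c l))) ≠ 0 → β ∈ S := by
  have hex : ∃ n, ∃ S : Finset ι, S.card = n ∧ ∀ P, T ((∏ l ∈ S, (X - C (c l))) * P) = 0 := ⟨_, Finset.univ, rfl, h0⟩
  obtain ⟨S, hS, hT⟩ := Nat.find_spec hex
  have hmin : ∀ S' : Finset ι, S'.card < S.card → ¬ ∀ P, T ((∏ l ∈ S', (X - C (c l))) * P) = 0 := fun S' h' h => by
    rw [hS] at h'; exact Nat.find_min hex h' ⟨S', rfl, h⟩
  refine ⟨S, hT, fun g hg => ?_, fun β hβ => ?_⟩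
  · have key : ∀ S' : Finset ι, S' ⊆ S → (∏ l ∈ S', (X - C (c l))) ∣ g := by
      intro S'
      induction S' using Finset.induction_on with
      | empty => simp
      | insert j S' hj ih =>
        intro hs
        obtain ⟨s, hs'⟩ := ih (fun x hx => hs (Finset.mem_insert_of_mem hx))
        have hjS : j ∈ S := hs (Finset.mem_insert_self _ _)
        obtain ⟨q, hq⟩ : X - C (c j) ∣ s - C (s.eval (c j)) := X_sub_C_dvd_sub_C_eval
        have hz : s.eval (c j) = 0 := by
          by_contra hne
          refine hmin (S.erase j) (Finset.card_erase_lt_of_mem hjS) fun P => ?_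
          have hsub : S' ⊆ S.erase j := fun x hx => Finset.mem_erase.2 ⟨fun h => hj (h ▸ hx), hs (Finset.mem_insert_of_mem hx)⟩
          obtain ⟨w, hw⟩ : (∏ l ∈ S', (X - C (c l))) ∣ ∏ l ∈ S.erase j, (X - C (c l)) := Finset.prod_dvd_prod_of_subset _ _ _ hsub
          have h1 : C (s.eval (c j)) * ((∏ l ∈ S.erase j, (X - C (c l))) * P) = g * (w * P) - (∏ l ∈ S, (X - C (c l))) * (q * P) := by
            rw [← Finset.mul_prod_erase S _ hjS, hs', hw]
            linear_combination (-(∏ l ∈ S', (X - C (c l))) * w * P) * hq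
          have h2 : T (C (s.eval (c j)) * ((∏ l ∈ S.erase j, (X - C (c l))) * P)) = 0 := by
            rw [h1, map_sub, hg, hT, sub_zero]
          rw [← smul_eq_C_mul, map_smul, smul_eq_mul] at h2
          exact (mul_eq_zero.1 h2).resolve_left hne
        rw [hz, C_0, sub_zero] at hq
        rw [Finset.prod_insert hj]
        exact ⟨q, by rw [hs', hq]; ring⟩
    exact key S subset_rfl
  · by_contra hn
    obtain ⟨w, hw⟩ : (∏ l ∈ S, (X - C (c l))) ∣ ∏ l ∈ Finset.univ.erase β, (X - C (c l)) :=
      Finset.prod_dvd_prod_of_subset _ _ _ fun x hx => Finset.mem_erase.2 ⟨fun h => hn (h ▸ hx), Finset.mem_univ _⟩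
    exact hβ (by rw [hw, hT])
theorem c7_2 {K : Type*} [Field K] [Algebra K A] (PZ : Subalgebra K A) (h6 : ∀ f a : A, a ≠ 0 → (∀ k : ℕ, f ^ k * a ∈ PZ) → f ∈ PZ)
    (T : A[X] →ₗ[A] A) (hX : ∀ k, T (X ^ k) ∈ PZ) {d : ℕ} (c : Fin d → A) (hT : ∀ P, T ((∏ l, (X - C (c l))) * P) = 0)
    (hd : ∀ g, (∀ P, T (g * P) = 0) → (∏ l, (X - C (c l))) ∣ g) (a : K) : ∏ l, (algebraMap K A a - c l) ∈ PZ := by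
  let N : ℕ → A[X] := fun m => ∏ l ∈ Finset.univ.filter (fun l : Fin d => l.val < m), (X - C (c l))
  have hN : ∀ m (hm : m < d), N (m + 1) = (X - C (c ⟨m, hm⟩)) * N m := fun m hm => by
    have : Finset.univ.filter (fun l : Fin d => l.val < m + 1) = insert ⟨m, hm⟩ (Finset.univ.filter (fun l : Fin d => l.val < m)) := by
      ext l; simp [Fin.ext_iff]; omega
    simp only [N]
    rw [this, Finset.prod_insert (by simp)]
  have hNd : N d = ∏ l, (X - C (c l)) := by
    simp only [N]; congr 1; ext l; simp
  have hmon : ∀ m, (N m).Monic := fun m => monic_prod_of_monic _ _ fun l _ => monic_X_sub_C _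
  have hdeg : ∀ m ≤ d, (N m).natDegree = m := by
    intro m hm
    simp only [N]
    rw [natDegree_prod_of_monic _ _ fun l _ => monic_X_sub_C _]
    simp only [natDegree_X_sub_C, Finset.sum_const, smul_eq_mul, mul_one]
    have : Finset.univ.filter (fun l : Fin d => l.val < m) = (Finset.univ : Finset (Fin m)).map (Fin.castLEEmb hm) := by
      ext l; simp only [Finset.mem_filter, Finset.mem_univ, true_and, Finset.mem_map, Fin.castLEEmb_apply]
      exact ⟨fun h => ⟨⟨l, h⟩, rfl⟩, by rintro ⟨k, rfl⟩; exact k.2⟩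
    rw [this]; simp
  let y : A[X] := C (algebraMap K A a) - X
  let H : ℕ → Matrix (Fin d) (Fin d) A := fun k => Matrix.of fun i j => T (y ^ k * X ^ (i.val + j.val))
  let G : ℕ → Matrix (Fin d) (Fin d) A := fun k => Matrix.of fun i j => T (y ^ k * (N i * N j))
  let B : Matrix (Fin d) (Fin d) A := Matrix.of fun i j => (N j).coeff i
  have hB : B.det = 1 := Matrix.det_matrixOfPolynomials (fun j : Fin d => N j) (fun i => hdeg i i.2.le) (fun i => hmon i)
  have hNs : ∀ j : Fin d, N j = ∑ i : Fin d, C (B i j) * X ^ i.val := fun j => by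
    refine Eq.trans ?_ (Fin.sum_univ_eq_sum_range (fun i => C ((N j).coeff i) * X ^ i) d).symm
    exact as_sum_range_C_mul_X_pow' _ (by rw [hdeg j j.2.le]; exact j.2)
  have hGH : ∀ k, (G k).det = (H k).det := fun k => by
    have : G k = B.transpose * H k * B := by
      ext i j
      simp only [G, H, Matrix.mul_apply, Matrix.of_apply, Matrix.transpose_apply]
      rw [hNs i, hNs j, Finset.sum_mul_sum, Finset.mul_sum, map_sum]
      simp_rw [Finset.sum_mul]
      rw [Finset.sum_comm]
      refine Finset.sum_congr rfl fun s _ => ?_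
      rw [Finset.mul_sum, map_sum]
      refine Finset.sum_congr rfl fun t _ => ?_
      have : y ^ k * (C (B s i) * X ^ s.val * (C (B t j) * X ^ t.val)) = (B s i * B t j) • (y ^ k * X ^ (s.val + t.val)) := by
        rw [smul_eq_C_mul, C_mul]; ring
      rw [this, map_smul, smul_eq_mul]; ring
    rw [this, Matrix.det_mul, Matrix.det_mul, Matrix.det_transpose, hB]; ring
  let M : Matrix (Fin d) (Fin d) A := Matrix.of fun i j => if i = j then algebraMap K A a - c i else if i.val + 1 = j.val then -1 else 0
  have hM : M.det = ∏ l, (algebraMap K A a - c l) := by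
    rw [Matrix.det_of_isUpperTriangular]
    · simp [M]
    · intro i j hij
      simp only [id] at hij
      simp only [M, Matrix.of_apply]
      rw [if_neg hij.ne', if_neg]
      have : j.val < i.val := hij
      omega
  have hG : ∀ k, G (k + 1) = M * G k := fun k => by
    ext i j
    simp only [G, M, Matrix.mul_apply, Matrix.of_apply]
    have h1 : y ^ (k + 1) * (N i * N j) = (algebraMap K A a - c i) • (y ^ k * (N i * N j)) - y ^ k * (N (i + 1) * N j) := by
      rw [hN i i.2, smul_eq_C_mul, C_sub]; simp only [y]; ring
    rw [h1, map_sub, map_smul, smul_eq_mul]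
    by_cases hi : i.val + 1 < d
    · rw [Finset.sum_eq_add_of_mem i ⟨i.val + 1, hi⟩ (Finset.mem_univ _) (Finset.mem_univ _) (by simp [Fin.ext_iff])]
      · simp [Fin.ext_iff]; ring
      · intro l _ hl
        rw [if_neg (fun h => hl.1 h.symm), if_neg (fun h => hl.2 (Fin.ext h.symm)), zero_mul]
    · rw [Finset.sum_eq_single i, if_pos rfl]
      · have : N (i + 1) = ∏ l, (X - C (c l)) := by rw [show i.val + 1 = d by omega, hNd]
        rw [this, show y ^ k * ((∏ l, (X - C (c l))) * N j) = (∏ l, (X - C (c l))) * (y ^ k * N j) by ring, hT, sub_zero]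
      · intro l _ hl
        rw [if_neg (fun h => hl h.symm), if_neg (by omega), zero_mul]
      · simp
  have hdet : ∀ k, (H k).det = M.det ^ k * (H 0).det := fun k => by
    induction k with
    | zero => simp
    | succ k ih => rw [← hGH, hG, Matrix.det_mul, hGH, ih, pow_succ]; ring
  have hTm : ∀ P : K[X], T (P.map (algebraMap K A)) ∈ PZ := fun P => by
    induction P using Polynomial.induction_on' with
    | add p q hp hq => rw [Polynomial.map_add, map_add]; exact add_mem hp hq
    | monomial n r =>
      rw [map_monomial, ← C_mul_X_pow_eq_monomial, ← smul_eq_C_mul, map_smul, smul_eq_mul]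
      exact mul_mem (PZ.algebraMap_mem r) (hX n)
  rw [← hM]
  refine h6 _ (H 0).det ?_ fun k => ?_
  · intro h0
    obtain ⟨v, hv0, hv⟩ := Matrix.exists_vecMul_eq_zero_iff.2 h0
    let gg : A[X] := ∑ i : Fin d, C (v i) * X ^ i.val
    have hgc : ∀ i : Fin d, gg.coeff i = v i := fun i => by
      simp only [gg, finsetSum_coeff, coeff_C_mul, coeff_X_pow]
      simp [Fin.val_inj]
    have hgd : gg.degree < d := by
      refine degree_sum_fin_lt _
    have hgT : ∀ j : ℕ, T (gg * X ^ j) = 0 := by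
      have h1 : ∀ j < d, T (gg * X ^ j) = 0 := fun j hj => by
        have := congrFun hv ⟨j, hj⟩
        simp only [Matrix.vecMul, dotProduct, H, Matrix.of_apply, pow_zero, one_mul, Pi.zero_apply] at this
        rw [← this]
        simp only [gg]
        rw [Finset.sum_mul, map_sum]
        refine Finset.sum_congr rfl fun i _ => ?_
        rw [mul_assoc, ← pow_add, ← smul_eq_C_mul, map_smul, smul_eq_mul]
      intro j
      have h2 := modByMonic_add_div (X ^ j : A[X]) (∏ l, (X - C (c l)))
      rw [← h2, mul_add, map_add, show ∀ P, gg * ((∏ l, (X - C (c l))) * P) = (∏ l, (X - C (c l))) * (gg * P) from fun P => by ring, hT, add_zero]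
      rw [as_sum_range' (X ^ j %ₘ ∏ l, (X - C (c l))) d (by
        rw [← hNd]
        refine (natDegree_modByMonic_lt (X ^ j : A[X]) (hmon d) fun h1 => ?_).trans_eq (hdeg d le_rfl)
        have := hdeg d le_rfl
        rw [h1, natDegree_one] at this
        subst this
        exact hv0 (Subsingleton.elim _ _)), Finset.mul_sum, map_sum]
      refine Finset.sum_eq_zero fun i hi => ?_
      rw [← C_mul_X_pow_eq_monomial, show ∀ w : A, gg * (C w * X ^ i) = w • (gg * X ^ i) from fun w => by rw [smul_eq_C_mul]; ring, map_smul, h1 i (Finset.mem_range.1 hi), smul_zero]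
    have h3 := hd gg fun P => by
      induction P using Polynomial.induction_on' with
      | add p q hp hq => rw [mul_add, map_add, hp, hq, add_zero]
      | monomial n r => rw [← C_mul_X_pow_eq_monomial, show gg * (C r * X ^ n) = r • (gg * X ^ n) by rw [smul_eq_C_mul]; ring, map_smul, hgT, smul_zero]
    have h4 : gg = 0 := by
      refine eq_zero_of_dvd_of_degree_lt h3 (hgd.trans_eq ?_)
      rw [← hNd, degree_eq_natDegree (hmon d).ne_zero, hdeg d le_rfl]
    exact hv0 (funext fun i => by rw [← hgc, h4]; simp)
  · rw [← hdet, Matrix.det_apply]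
    refine sum_mem fun σ _ => ?_
    rw [Units.smul_def]
    refine zsmul_mem (prod_mem fun i _ => ?_) _
    convert hTm ((C a - X) ^ k * X ^ ((σ i).val + i.val)) using 2
    simp [y, H]
theorem c7_3 {K : Type*} [Field K] [Infinite K] [Algebra K A] (P : Submodule K A) (q : A[X]) (h : ∀ a : K, q.eval (algebraMap K A a) ∈ P) (i : ℕ) : q.coeff i ∈ P := by
  by_contra hn
  obtain ⟨f, hf, hP⟩ := Submodule.exists_le_ker_of_notMem hn
  let r : K[X] := ∑ j ∈ Finset.range (q.natDegree + 1), monomial j (f (q.coeff j))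
  have h1 : r = 0 := by
    refine Polynomial.funext fun a => ?_
    have := hP (h a)
    rw [LinearMap.mem_ker, eval_eq_sum_range, map_sum] at this
    rw [eval_zero, ← this, eval_finset_sum]
    refine Finset.sum_congr rfl fun j _ => ?_
    rw [eval_monomial, ← map_pow, mul_comm, mul_comm (q.coeff j), ← Algebra.smul_def, map_smul, smul_eq_mul]
  have h2 := congrArg (fun p => p.coeff i) h1
  simp only [r, finsetSum_coeff, coeff_monomial, coeff_zero] at h2
  rw [Finset.sum_eq_single i] at h2
  · exact hf (by simpa using h2)
  · intro j _ hj; simp [hj]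
  · intro hi
    rw [Finset.mem_range, not_lt] at hi
    rw [coeff_eq_zero_of_natDegree_lt (by omega)]; simp
end
section
variable {K : Type*} [Field K] [CharZero K]
theorem nt_nil {B : Type*} [CommRing B] [Algebra K B] {ι : Type*} [Fintype ι] (t : ι → B) (h : ∀ k, 1 ≤ k → ∑ i, t i ^ k = 0) (β : ι) :
    t β ^ Fintype.card ι = 0 := by
  classical
  have h1 : ∀ k, 1 ≤ k → MvPolynomial.aeval t (MvPolynomial.esymm ι K k) = 0 := by
    intro k hk
    have h2 := congrArg (MvPolynomial.aeval t) (MvPolynomial.mul_esymm_eq_sum ι K k)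
    rw [map_mul, map_mul, map_sum, Finset.sum_eq_zero, mul_zero, map_natCast] at h2
    · have : algebraMap K B (k : K) * MvPolynomial.aeval t (MvPolynomial.esymm ι K k) = 0 := by rw [map_natCast]; exact h2
      rw [← Algebra.smul_def] at this
      have hk0 : (k : K) ≠ 0 := by exact_mod_cast (by omega : k ≠ 0)
      have := congrArg (fun x => (k : K)⁻¹ • x) this
      simpa [smul_smul, hk0] using this
    · intro a ha
      rw [Finset.mem_filter, Finset.HasAntidiagonal.mem_antidiagonal] at ha
      rw [map_mul, MvPolynomial.psum, map_sum]
      simp only [map_pow, MvPolynomial.aeval_X]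
      rw [h _ (by omega), mul_zero]
  have h3 := congrArg (Polynomial.eval (t β)) (Multiset.prod_X_sub_X_eq_sum_esymm (Finset.univ.val.map t))
  rw [Multiset.map_map, Polynomial.eval_finset_sum, Finset.sum_eq_single 0] at h3
  · have h4 : Polynomial.eval (t β) (∏ i, (Polynomial.X - Polynomial.C (t i))) = 0 := by
      rw [Polynomial.eval_prod]
      exact Finset.prod_eq_zero (Finset.mem_univ β) (by simp)
    have h5 : Polynomial.eval (t β) (∏ i, (Polynomial.X - Polynomial.C (t i))) = t β ^ Fintype.card ι := by
      refine Eq.trans h3 ?_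
      simp [Multiset.esymm]
    rw [← h5, h4]
  · intro k _ hk
    rw [← MvPolynomial.aeval_esymm_eq_multiset_esymm ι K, h1 k (by omega)]; simp
  · simp
theorem hom_gen {σ : Type*} [Fintype σ] {ι : Type*} [Fintype ι] (t : ι → MvPolynomial σ K) (ht : ∀ β, (t β).IsHomogeneous 1)
    (hX : ∀ i, MvPolynomial.X i ∈ Submodule.span K ({1} ∪ Set.range t)) : ∃ d0, ∀ d, d0 ≤ d → ∀ a : MvPolynomial σ K, a.IsHomogeneous d →
    a ∈ Submodule.span K {y | ∃ k, 1 ≤ k ∧ k ≤ d ∧ ∃ b : MvPolynomial σ K, b.IsHomogeneous (d - k) ∧ y = (∑ β, t β ^ k) * b} := by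
  classical
  let 𝔭 : Ideal (MvPolynomial σ K) := Ideal.span {y | ∃ k, 1 ≤ k ∧ y = ∑ β, t β ^ k}
  have h1 : ∀ β, t β ^ Fintype.card ι ∈ 𝔭 := fun β => by
    rw [← Ideal.Quotient.eq_zero_iff_mem, map_pow]
    refine nt_nil (K := K) (fun β => Ideal.Quotient.mk 𝔭 (t β)) (fun k hk => ?_) β
    simp only [← map_pow, ← map_sum]
    exact Ideal.Quotient.eq_zero_iff_mem.2 (Ideal.subset_span ⟨k, hk, rfl⟩)
  have h2 : ∀ i, MvPolynomial.X i ∈ 𝔭.radical := fun i => by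
    have h3 : ∀ y ∈ Submodule.span K ({1} ∪ Set.range t), y - .C (MvPolynomial.constantCoeff y) ∈ 𝔭.radical := by
      intro y hy
      induction hy using Submodule.span_induction with
      | mem y hy =>
        rcases hy with hy | ⟨β, rfl⟩
        · rw [Set.mem_singleton_iff.1 hy]; simp
        · have : MvPolynomial.constantCoeff (t β) = 0 := by
            by_contra hne
            have := ht β hne
            simp at this
          rw [this, map_zero, sub_zero]
          exact ⟨_, h1 β⟩
      | zero => simp
      | add x y _ _ hx hy => rw [map_add, map_add, add_sub_add_comm]; exact add_mem hx hy
      | smul c x _ hx =>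
        have := 𝔭.radical.mul_mem_left (.C c) hx
        rw [MvPolynomial.smul_eq_C_mul, map_mul, map_mul, MvPolynomial.constantCoeff_C, ← mul_sub]
        exact this
    simpa using h3 _ (hX i)
  choose N hN using h2
  refine ⟨∑ i, N i + 1, fun d hd a ha => ?_⟩
  have h4 : a ∈ 𝔭 := by
    rw [MvPolynomial.as_sum a]
    refine sum_mem fun m hm => ?_
    have hm1 : m.degree = d := by
      have := ha (MvPolynomial.mem_support_iff.1 hm)
      rw [← this, Finsupp.degree_eq_weight_one]; rfl
    obtain ⟨i, hi⟩ : ∃ i, N i ≤ m i := by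
      by_contra! hc
      have := Finset.sum_le_sum (s := Finset.univ) fun i _ => (hc i).le
      rw [Finsupp.degree_eq_sum] at hm1
      omega
    rw [MvPolynomial.monomial_eq]
    refine 𝔭.mul_mem_left _ ?_
    rw [Finsupp.prod_fintype _ _ (by simp), ← Finset.mul_prod_erase _ _ (Finset.mem_univ i)]
    refine 𝔭.mul_mem_right _ ?_
    exact 𝔭.pow_mem_of_pow_mem (hN i) hi
  have h5 : ∀ y ∈ 𝔭, ∀ c, MvPolynomial.homogeneousComponent d (y * c) ∈ Submodule.span K {y | ∃ k, 1 ≤ k ∧ k ≤ d ∧ ∃ b : MvPolynomial σ K, b.IsHomogeneous (d - k) ∧ y = (∑ β, t β ^ k) * b} := by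
    intro y hy
    induction hy using Submodule.span_induction with
    | mem y hy =>
      obtain ⟨k, hk, rfl⟩ := hy
      intro c
      have hh : (∑ β, t β ^ k).IsHomogeneous k := MvPolynomial.IsHomogeneous.sum _ _ _ fun β _ => by simpa using (ht β).pow k
      rw [← MvPolynomial.sum_homogeneousComponent c, Finset.mul_sum, map_sum]
      refine sum_mem fun n _ => ?_
      rw [MvPolynomial.homogeneousComponent_of_mem (hh.mul (MvPolynomial.homogeneousComponent_isHomogeneous n c))]
      split_ifs with hd
      · exact Submodule.subset_span ⟨k, hk, by omega, _, (by rw [hd, Nat.add_sub_cancel_left]; exact MvPolynomial.homogeneousComponent_isHomogeneous n c), rfl⟩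
      · exact zero_mem _
    | zero => intro c; rw [zero_mul, map_zero]; exact zero_mem _
    | add x y _ _ hx hy => intro c; rw [add_mul, map_add]; exact add_mem (hx c) (hy c)
    | smul c x _ hx => intro b; rw [smul_eq_mul, mul_comm c, mul_assoc]; exact hx _
  rw [← MvPolynomial.homogeneousComponent_eq_self ha, ← mul_one a]
  exact h5 a h4 1
end
section
variable {K g : Type*} [Field K] [LieRing g] [LieAlgebra K g]
local notation "U" => UniversalEnvelopingAlgebra K g
variable (D : RD K g)
theorem RD.jVV (d : ℕ) {P : D.A} (hP : P ∈ VV K (d + 1)) : D.j P ∈ FF K g d := by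
  classical
  have h1 : ∀ (m : Fin D.r →₀ ℕ) , D.j (.monomial m 1) ∈ FF K g m.degree := by
    intro m
    induction m using Finsupp.induction_linear with
    | zero => rw [MvPolynomial.monomial_zero', map_one, map_one]; exact FF_one _
    | add a b ha hb =>
      rw [← one_mul (1 : K), ← MvPolynomial.monomial_mul, map_mul, map_add]; exact FF_mul ha hb
    | single i n =>
      rw [← MvPolynomial.X_pow_eq_monomial, map_pow, D.j_X, Finsupp.degree_single]
      induction n with
      | zero => rw [pow_zero]; exact FF_one _
      | succ n ih => rw [pow_succ']; exact FF_io _ ih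
  rw [MvPolynomial.as_sum P, map_sum]
  refine sum_mem fun m hm => ?_
  have h2 : m.degree ≤ d := by
    by_contra hc
    exact MvPolynomial.mem_support_iff.1 hm (hP m (by omega))
  have h3 : MvPolynomial.monomial m (P.coeff m) = P.coeff m • (.monomial m 1 : D.A) := by simp [MvPolynomial.smul_monomial]
  rw [h3, map_smul]
  exact Submodule.smul_mem _ _ (FF_mono h2 (h1 m))
def RD.GG (d : ℕ) : Submodule K U :=
  Submodule.span K {x | ∃ u ∈ FF K g d, x = u ∨ ∃ a, x = D.f a * u ∨ x = u * D.e a}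
theorem RD.GG_F {d u} (h : u ∈ FF K g d) : u ∈ D.GG d := Submodule.subset_span ⟨u, h, .inl rfl⟩
theorem RD.GG_f {d u} (h : u ∈ FF K g d) (a) : D.f a * u ∈ D.GG d := Submodule.subset_span ⟨u, h, .inr ⟨a, .inl rfl⟩⟩
theorem RD.GG_e {d u} (h : u ∈ FF K g d) (a) : u * D.e a ∈ D.GG d := Submodule.subset_span ⟨u, h, .inr ⟨a, .inr rfl⟩⟩
theorem RD.GG_ind {d} {P : Submodule K U} (h1 : ∀ u ∈ FF K g d, u ∈ P) (h2 : ∀ u ∈ FF K g d, ∀ a, D.f a * u ∈ P)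
    (h3 : ∀ u ∈ FF K g d, ∀ a, u * D.e a ∈ P) : D.GG d ≤ P := by
  refine Submodule.span_le.2 ?_
  rintro _ ⟨u, hu, rfl | ⟨a, rfl | rfl⟩⟩
  · exact h1 _ hu
  · exact h2 u hu a
  · exact h3 u hu a
theorem RD.FG1 (d : ℕ) : FF K g (d + 1) ≤ D.GG d ⊔ (VV K (d + 2)).map D.j.toLinearMap := by
  have h1 : ∀ d, (∀ u ∈ FF K g d, ∀ i, D.h i * u ∈ D.GG d ⊔ (VV K (d + 2)).map D.j.toLinearMap) →
      FF K g (d + 1) ≤ D.GG d ⊔ (VV K (d + 2)).map D.j.toLinearMap := by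
    intro d hd
    refine FF_succ_le (fun u hu => Submodule.mem_sup_left (D.GG_F hu)) fun x u hu => ?_
    rw [← D.b.sum_repr x, map_sum, Finset.sum_mul]
    refine sum_mem fun k _ => ?_
    rw [map_smul, smul_mul_assoc]
    refine Submodule.smul_mem _ _ ?_
    rcases k with a | a | i
    · rw [← sub_add_cancel (io K g (D.b (.inl a)) * u) (u * io K g (D.b (.inl a)))]
      exact Submodule.mem_sup_left (add_mem (D.GG_F (FF_comm d _ u hu)) (D.GG_e hu a))
    · exact Submodule.mem_sup_left (D.GG_f hu a)
    · exact hd u hu i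
  refine h1 d ?_
  induction d with
  | zero =>
    intro u hu i
    rw [FF, pow_zero, Submodule.mem_one] at hu
    obtain ⟨c, rfl⟩ := hu
    refine Submodule.mem_sup_right ⟨c • .X i, Submodule.smul_mem _ _ (VV_X i), ?_⟩
    change D.j (c • .X i) = _
    rw [map_smul, D.j_X, Algebra.smul_def, Algebra.commutes]
  | succ d ih =>
    intro u hu i
    obtain ⟨y, hy, _, ⟨P, hP, rfl⟩, rfl⟩ := Submodule.mem_sup.1 (h1 d ih hu)
    rw [mul_add]
    refine Submodule.add_mem_sup ?_ ⟨.X i * P, ?_, ?_⟩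
    · have : D.GG d ≤ (D.GG (d + 1)).comap (LinearMap.mulLeft K (D.h i)) := by
        refine D.GG_ind (fun u hu => D.GG_F (FF_io _ hu)) (fun u hu a => ?_) (fun u hu a => ?_)
        · change D.h i * (D.f a * u) ∈ D.GG (d + 1)
          rw [← mul_assoc, show D.h i * D.f a = _ from D.h_b i (.inr (.inl a)), add_mul, mul_assoc, smul_mul_assoc]
          exact add_mem (D.GG_f (FF_io _ hu) a) (Submodule.smul_mem _ _ (D.GG_f (FF_mono (by omega) hu) a))
        · change D.h i * (u * D.e a) ∈ D.GG (d + 1)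
          rw [← mul_assoc]; exact D.GG_e (FF_io _ hu) a
      exact this hy
    · rw [show d + 1 + 2 = 1 + (d + 2) by ring]; exact VV_mul (VV_X i) hP
    · simp [D.j_X]
theorem RD.GG_mul {k l : ℕ} {x v} (hx : x ∈ D.GG k) (hv : v ∈ FF K g l) : x * v ∈ D.GG (k + l) := by
  refine D.GG_ind (P := (D.GG (k + l)).comap (LinearMap.mulRight K v)) (fun u hu => D.GG_F (FF_mul hu hv)) (fun u hu a => ?_) (fun u hu a => ?_) hx
  · change D.f a * u * v ∈ D.GG (k + l)
    rw [mul_assoc]; exact D.GG_f (FF_mul hu hv) a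
  · change u * D.e a * v ∈ D.GG (k + l)
    rw [show u * D.e a * v = u * v * D.e a + u * (D.e a * v - v * D.e a) by noncomm_ring]
    exact add_mem (D.GG_e (FF_mul hu hv) a) (D.GG_F (FF_mul hu (FF_comm l _ v hv)))
end
section
variable {K g : Type*} [Field K] [LieRing g] [LieAlgebra K g] [CharZero K] [LieAlgebra.IsSemisimple K g] (D : RD K g)
local notation "U" => UniversalEnvelopingAlgebra K g
theorem RD.FG2 {k : ℕ} {u} (hu : u ∈ FF K g (k + 1)) : u - D.j (D.p u) ∈ D.GG k := by
  obtain ⟨y, hy, _, ⟨P, hP, rfl⟩, rfl⟩ := Submodule.mem_sup.1 (D.FG1 k hu)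
  have h1 : D.GG k ≤ (D.GG k).comap (D.j.toLinearMap.comp D.p) := by
    refine D.GG_ind (fun u hu => D.GG_F (D.jVV k (D.p_FF hu))) (fun u hu a => ?_) (fun u hu a => ?_)
    · change D.j (D.p _) ∈ D.GG k
      rw [D.p_Q (Submodule.mem_sup_left (D.NU_f u a)), map_zero]; exact zero_mem _
    · change D.j (D.p _) ∈ D.GG k
      rw [D.p_UN (D.UN_e u a), map_zero]; exact zero_mem _
  have h2 : D.j (D.p y) ∈ D.GG k := h1 hy
  rw [map_add, show D.p (D.j.toLinearMap P) = P from D.p_j P, map_add]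
  change y + D.j P - _ ∈ D.GG k
  rw [add_sub_add_right_eq_sub]
  exact sub_mem hy h2
theorem RD.FG {R : Type*} [Ring R] [Algebra K R] (π : U →ₐ[K] R)
    (hχ : ∀ z, (∀ u, z * u = u * z) → ∃ c : K, π z = algebraMap K R c) :
    ∃ d0, ∀ d, d0 ≤ d → FF K g (d + 1) ≤ D.GG d ⊔ LinearMap.ker π.toLinearMap := by
  classical
  obtain ⟨T, c, -, -, -, hX, t, ht, hz⟩ := D.ex_T
  have hX' : ∀ i, (MvPolynomial.X i : D.A) ∈ Submodule.span K ({1} ∪ Set.range t) := by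
    intro i
    refine Submodule.span_le.2 ?_ (hX i)
    rintro x (hx | ⟨β, -, rfl⟩)
    · exact Submodule.subset_span (.inl hx)
    · obtain ⟨-, θ, h⟩ := ht β
      rw [h]
      refine sub_mem (Submodule.subset_span (.inr ⟨β, rfl⟩)) ?_
      rw [← mul_one (MvPolynomial.C θ), ← MvPolynomial.smul_eq_C_mul]
      exact Submodule.smul_mem _ _ (Submodule.subset_span (.inl rfl))
  obtain ⟨d0, h0⟩ := hom_gen t (fun β => (ht β).1) hX'
  refine ⟨d0, fun d hd u hu => ?_⟩
  obtain ⟨y, hy, _, ⟨P, hP, rfl⟩, rfl⟩ := Submodule.mem_sup.1 (D.FG1 d hu)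
  refine add_mem (Submodule.mem_sup_left hy) ?_
  have hV : ∀ n (b : D.A), b.IsHomogeneous n → b ∈ VV K (n + 1) := by
    intro n b hb m hm
    by_contra hne
    have h1 := hb hne
    rw [Finsupp.degree_eq_weight_one] at hm
    change n + 1 ≤ Finsupp.weight 1 m at hm
    omega
  rw [← sub_add_cancel P (MvPolynomial.homogeneousComponent (d + 1) P), map_add]
  refine add_mem (Submodule.mem_sup_left (D.GG_F (D.jVV d fun m hm => ?_))) ?_
  · rw [MvPolynomial.coeff_sub, MvPolynomial.coeff_homogeneousComponent]
    split_ifs with h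
    · exact sub_self _
    · rw [hP m (by omega), sub_zero]
  · have := h0 (d + 1) (by omega) _ (MvPolynomial.homogeneousComponent_isHomogeneous (d + 1) P)
    refine (Submodule.span_le (p := (D.GG d ⊔ LinearMap.ker π.toLinearMap).comap D.j.toLinearMap)).2 ?_ this
    rintro _ ⟨k, hk, hkd, b, hb, rfl⟩
    obtain ⟨z, hzF, hzc, hzp⟩ := hz k
    obtain ⟨c, hc⟩ := hχ z hzc
    obtain ⟨k, rfl⟩ : ∃ k', k = k' + 1 := ⟨k - 1, by omega⟩
    have hjb := D.jVV _ (hV _ b hb)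
    change D.j _ ∈ D.GG d ⊔ LinearMap.ker π.toLinearMap
    have e : D.j ((∑ β, t β ^ (k + 1)) * b) = - D.j (b * (D.p z - ∑ β, t β ^ (k + 1))) - (z - D.j (D.p z)) * D.j b + c • D.j b + (z * D.j b - c • D.j b) := by
      rw [mul_comm b, map_mul, map_mul, map_sub]; noncomm_ring
    rw [e]
    refine add_mem (Submodule.mem_sup_left (add_mem (sub_mem (neg_mem ?_) ?_) (Submodule.smul_mem _ _ ?_))) (Submodule.mem_sup_right ?_)
    · refine D.GG_F (D.jVV d ?_)
      have := VV_mul (hV _ b hb) hzp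
      rwa [show d + 1 - (k + 1) + (k + 1) = d + 1 by omega] at this
    · have := D.GG_mul (D.FG2 hzF) hjb
      rwa [show k + (d + 1 - (k + 1)) = d by omega] at this
    · exact D.GG_F (FF_mono (by omega) hjb)
    · change π _ = 0
      rw [map_sub, map_mul, hc, map_smul, Algebra.smul_def, sub_self]
open Classical in
theorem RD.ex_qS : ∃ (S : Finset D.ix) (c : D.ix → D.A), (∀ k, (∏ l ∈ S, (Polynomial.X - Polynomial.C (c l))).coeff k ∈ D.PZ) ∧ (∀ β, D.z β ≠ 0 → β ∈ S) ∧
    ∀ i, MvPolynomial.X i ∈ Submodule.span K ({1} ∪ c '' {β | D.z β ≠ 0}) := by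
  obtain ⟨T, c, h1, h2, h3, hX, -⟩ := D.ex_T
  obtain ⟨S, hS1, hS2, hS3⟩ := c7_1 T c h1
  refine ⟨S, c, fun k => ?_, fun β hβ => hS3 β (by convert h3 β hβ), hX⟩
  have e : ∀ {B : Type _} [CommRing B] (F : D.A → B), ∏ l : Fin S.card, F (c (S.equivFin.symm l)) = ∏ l ∈ S, F (c l) := by
    intro B _ F
    rw [← Finset.prod_coe_sort S (fun l => F (c l))]
    exact Equiv.prod_comp S.equivFin.symm (fun l : S => F (c l))
  refine c7_3 (Subalgebra.toSubmodule D.PZ) _ (fun a => ?_) k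
  have := c7_2 D.PZ (fun f a ha h => D.C6 ha h) T h2 (fun l : Fin S.card => c (S.equivFin.symm l))
    (by rw [e fun x => Polynomial.X - Polynomial.C x]; exact hS1) (by rw [e fun x => Polynomial.X - Polynomial.C x]; exact hS2) a
  rw [e fun x => algebraMap K D.A a - x] at this
  simpa [Polynomial.eval_prod] using this
variable {R : Type*} [Ring R] [Algebra K R] (π : UniversalEnvelopingAlgebra K g →ₐ[K] R)
noncomputable def RD.N0 : Ideal U := D.UN ⊔ RingHom.ker π
noncomputable def RD.aI : Ideal D.A := Ideal.comap D.j (D.N0 π)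
theorem RD.aI_mem {P} : P ∈ D.aI π ↔ D.j P ∈ D.N0 π := Iff.rfl
variable {π} {ν : Fin D.r → K} (hχ : ∀ z, (∀ u, z * u = u * z) → π z = algebraMap K R ((D.p z).eval ν))
theorem RD.N6_1 (hχ : ∀ z, (∀ u, z * u = u * z) → π z = algebraMap K R ((D.p z).eval ν)) {P} (hP : P ∈ D.PZ) (h0 : P.eval ν = 0) : P ∈ D.aI π := by
  obtain ⟨z, hz, rfl⟩ := hP
  rw [D.aI_mem, show D.j (D.p z) = -(z - D.j (D.p z)) + z by abel]
  refine Submodule.add_mem_sup (neg_mem (D.cen_UN hz)) ?_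
  rw [RingHom.mem_ker, hχ z hz, h0, map_zero]
theorem RD.N6 (hχ : ∀ z, (∀ u, z * u = u * z) → π z = algebraMap K R ((D.p z).eval ν)) : ∃ c : D.ix → D.A, (∀ i, MvPolynomial.X i ∈ Submodule.span K ({1} ∪ c '' {β | D.z β ≠ 0})) ∧
    (∀ β, D.z β ≠ 0 → ∃ s : List K, (s.map fun x => c β - .C x).prod ∈ D.aI π) ∧ Module.Finite K (D.A ⧸ D.aI π) := by
  classical
  obtain ⟨S, c, h1, h2, hX⟩ := D.ex_qS
  have h3 : ∀ β, D.z β ≠ 0 → ∃ s : List K, (s.map fun x => c β - .C x).prod ∈ D.aI π := by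
    intro β hβ
    refine ⟨S.toList.map fun l => (c l).eval ν, ?_⟩
    let q : Polynomial D.A := ∏ l ∈ S, (.X - .C (c l))
    have hq0 : q.eval (c β) = 0 := by
      simp only [q, Polynomial.eval_prod]
      exact Finset.prod_eq_zero (h2 β hβ) (by simp)
    have hq1 : (q.map ((algebraMap K D.A).comp (MvPolynomial.eval ν))).eval (c β) = ((S.toList.map fun l => (c l).eval ν).map fun x => c β - .C x).prod := by
      simp [q, Polynomial.map_prod, Polynomial.eval_prod]
    rw [← hq1, ← sub_zero (Polynomial.eval _ _), ← hq0, ← Polynomial.eval_sub, Polynomial.eval_eq_sum_range]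
    refine sum_mem fun k _ => Ideal.mul_mem_right _ _ (D.N6_1 hχ ?_ ?_)
    · rw [Polynomial.coeff_sub, Polynomial.coeff_map]
      exact sub_mem (D.PZ.algebraMap_mem _) (h1 k)
    · rw [Polynomial.coeff_sub, Polynomial.coeff_map]; simp
  refine ⟨c, hX, h3, ?_⟩
  have h4 : ∀ β, D.z β ≠ 0 → IsIntegral K (Ideal.Quotient.mk (D.aI π) (c β)) := fun β hβ => by
    obtain ⟨s, hs⟩ := h3 β hβ
    have hm : ∀ s : List K, (s.map fun x => Polynomial.X - Polynomial.C x).prod.Monic := fun s => by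
      induction s with
      | nil => simp
      | cons x s ih => rw [List.map_cons, List.prod_cons]; exact (Polynomial.monic_X_sub_C x).mul ih
    refine ⟨_, hm s, ?_⟩
    rw [← Ideal.Quotient.eq_zero_iff_mem, map_list_prod, List.map_map] at hs
    rw [← Polynomial.aeval_def, map_list_prod, List.map_map, ← hs]
    congr 1
    refine List.map_congr_left fun x _ => ?_
    simp; rfl
  have h5 : ∀ i, IsIntegral K (Ideal.Quotient.mk (D.aI π) (.X i)) := fun i => by
    have : Submodule.span K ({1} ∪ c '' {β | D.z β ≠ 0}) ≤ ((integralClosure K (D.A ⧸ D.aI π)).toSubmodule).comap (Ideal.Quotient.mkₐ K (D.aI π)).toLinearMap := by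
      rw [Submodule.span_le]
      rintro x (hx | ⟨β, hβ, rfl⟩)
      · rw [Set.mem_singleton_iff.1 hx]
        exact (integralClosure K (D.A ⧸ D.aI π)).one_mem
      · exact h4 β hβ
    exact this (hX i)
  have h6 : Algebra.IsIntegral K (D.A ⧸ D.aI π) := ⟨fun x => by
    obtain ⟨P, rfl⟩ := Ideal.Quotient.mk_surjective x
    induction P using MvPolynomial.induction_on with
    | C a => exact isIntegral_algebraMap (R := K) (A := D.A ⧸ D.aI π) (x := a)
    | add p q hp hq => rw [map_add]; exact hp.add hq
    | mul_X p i h => rw [map_mul]; exact h.mul (h5 i)⟩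
  exact Algebra.IsIntegral.finite
end
section
open Polynomial
theorem cop_lem {K : Type*} [Field K] [CharZero K] {P : K[X]} (hP : P ≠ 0) : ∃ m : ℕ, ∀ i ≥ m, IsCoprime P (P.comp (X - C (i : K))) := by
  classical
  let L := AlgebraicClosure K
  have hP' : P.map (algebraMap K L) ≠ 0 := (Polynomial.map_ne_zero_iff (algebraMap K L).injective).2 hP
  let s := (P.map (algebraMap K L)).roots.toFinset
  let t : Set ℕ := {i | ∃ x ∈ s, ∃ y ∈ s, x - y = (i : L)}
  have ht : t.Finite := by
    refine Set.Finite.of_finite_image (f := fun i : ℕ => (i : L)) ?_ (fun a _ b _ h => Nat.cast_injective h)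
    refine ((s ×ˢ s).image fun p => p.1 - p.2).finite_toSet.subset ?_
    rintro _ ⟨i, ⟨x, hx, y, hy, h⟩, rfl⟩
    exact Finset.mem_coe.2 (Finset.mem_image.2 ⟨(x, y), Finset.mem_product.2 ⟨hx, hy⟩, h⟩)
  obtain ⟨m, hm⟩ := ht.bddAbove
  refine ⟨m + 1, fun i hi => ?_⟩
  rw [← Polynomial.isCoprime_map (algebraMap K L)]
  refine isCoprime_of_dvd _ _ (fun h => hP' h.1) fun q hq hq0 hq1 hq2 => ?_
  obtain ⟨x, hx⟩ := IsAlgClosed.exists_root q (fun h => hq ((isUnit_iff_degree_eq_zero).2 h))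
  have h1 := hx.dvd hq1
  have h2 := hx.dvd hq2
  rw [Polynomial.map_comp, IsRoot, eval_comp] at h2
  have : i ∈ t := ⟨x, by simpa [s, hP] using h1, x - i, by simpa [s, hP] using h2, by ring⟩
  have := hm this
  omega
variable {K : Type*} [Field K] [CharZero K] {M : Type*} [AddCommGroup M] [Module K M] [Module K[X] M] [IsScalarTower K K[X] M]
    {θ : Module.End K M} (hθ : ∀ x, θ ((X : K[X]) • x) = (X : K[X]) • θ x + (X : K[X]) • x)
theorem al_der (hθ : ∀ x, θ ((X : K[X]) • x) = (X : K[X]) • θ x + (X : K[X]) • x) (F : K[X]) (x : M) : θ (F • x) = F • θ x + (X * derivative F) • x := by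
  induction F using Polynomial.induction_on generalizing x with
  | C a =>
    have : ∀ y : M, (C a : K[X]) • y = a • y := fun y => by rw [← algebraMap_smul K[X] a y]; rfl
    rw [this, map_smul, derivative_C, mul_zero, zero_smul, add_zero, this]
  | add p q hp hq => rw [add_smul, map_add, hp, hq, derivative_add, mul_add, add_smul, add_smul]; abel
  | monomial n a ih =>
    rw [pow_succ, ← mul_assoc, mul_smul, ih, hθ, derivative_mul (f := C a * X ^ n), derivative_X]
    module
theorem al_pow (hθ : ∀ x, θ ((X : K[X]) • x) = (X : K[X]) • θ x + (X : K[X]) • x) (i : ℕ) (F : K[X]) (x : M) : aeval θ (F.comp (X - C (i : K))) ((X : K[X]) ^ i • x) = (X : K[X]) ^ i • aeval θ F x := by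
  have h1 : ∀ x, θ ((X : K[X]) ^ i • x) = (X : K[X]) ^ i • θ x + (i : K) • (X : K[X]) ^ i • x := fun x => by
    rw [al_der hθ]
    congr 1
    rw [← algebraMap_smul K[X] (i : K), smul_smul, derivative_X_pow]
    congr 1
    rcases i with _ | i
    · simp
    · simp [pow_succ]; ring
  induction F using Polynomial.induction_on generalizing x with
  | C a => simp [smul_comm a]
  | add p q hp hq => rw [add_comp, map_add, LinearMap.add_apply, hp, hq, map_add, LinearMap.add_apply, smul_add]
  | monomial n a ih =>
    rw [pow_succ, ← mul_assoc, mul_comp, X_comp, map_mul, map_mul, Module.End.mul_apply, Module.End.mul_apply, aeval_X, ← ih]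
    congr 1
    simp only [map_sub, aeval_X, aeval_C, LinearMap.sub_apply, Module.algebraMap_end_apply, h1, add_sub_cancel_right]
theorem AL (hθ : ∀ x, θ ((X : K[X]) • x) = (X : K[X]) • θ x + (X : K[X]) • x) (N : Submodule K[X] M) (hN : ∀ x ∈ N, θ x ∈ N) (R0 : Submodule K[X] M) (hf : R0.FG)
    (hR : ∀ x : M, ∃ q : K[X], q.eval 0 = 1 ∧ q • x ∈ R0) (P : K[X]) (h1 : ∀ x, ∃ y, aeval θ P x = (X : K[X]) • y)
    (h2 : ∀ x ∈ N, ∃ y ∈ N, aeval θ P x = (X : K[X]) • y) (m : ℕ) (h3 : ∀ x ∈ N, ∃ y, x = (X : K[X]) ^ m • y)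
    (hc : ∀ i ≥ m, IsCoprime P (P.comp (X - C (i : K)))) : ∀ x ∈ N, ∃ y ∈ N, x = (X - 1 : K[X]) • y := by
  classical
  have hNa : ∀ F : K[X], ∀ x ∈ N, aeval θ F x ∈ N := by
    intro F x hx
    induction F using Polynomial.induction_on generalizing x with
    | C a => rw [aeval_C, Module.algebraMap_end_apply, ← algebraMap_smul K[X] a x]; exact N.smul_mem _ hx
    | add p q hp hq => rw [map_add]; exact add_mem (hp x hx) (hq x hx)
    | monomial n a ih => rw [pow_succ, ← mul_assoc, map_mul, Module.End.mul_apply, aeval_X]; exact ih _ (hN x hx)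
  have s1 : ∀ k, ∃ Q : K[X], IsCoprime P Q ∧ ∀ x : M, ∃ y : M, aeval θ Q ((X : K[X]) ^ m • x) = (X : K[X]) ^ (m + k) • y := by
    intro k
    induction k with
    | zero => exact ⟨1, isCoprime_one_right, fun x => ⟨x, by simp⟩⟩
    | succ k ih =>
      obtain ⟨Q, hQ, h⟩ := ih
      refine ⟨P.comp (X - C ((m + k : ℕ) : K)) * Q, (hc _ (by omega)).mul_right hQ, fun x => ?_⟩
      obtain ⟨y, hy⟩ := h x
      obtain ⟨y', hy'⟩ := h1 y
      exact ⟨y', by rw [map_mul, Module.End.mul_apply, hy, al_pow hθ, hy', smul_smul, ← pow_succ]; rfl⟩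
  have s2 : ∀ k, ∀ x ∈ N, ∃ y ∈ N, ∃ w : M, (X : K[X]) ^ k • w ∈ N ∧ x = (X : K[X]) • y + (X : K[X]) ^ k • w := by
    intro k x hx
    obtain ⟨Q, ⟨a, b, hab⟩, h⟩ := s1 k
    obtain ⟨y, hy, hy'⟩ := h2 _ (hNa a x hx)
    obtain ⟨w, hw⟩ := h3 _ (hNa b x hx)
    obtain ⟨w', hw'⟩ := h w
    rw [← hw] at hw'
    have e : x = (X : K[X]) • y + (X : K[X]) ^ k • ((X : K[X]) ^ m • w') := by
      rw [smul_smul, ← pow_add, add_comm k m, ← hw', ← hy', ← Module.End.mul_apply, ← Module.End.mul_apply, ← map_mul, ← map_mul, ← LinearMap.add_apply, ← map_add,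
        mul_comm P, mul_comm Q, hab, map_one, Module.End.one_apply]
    exact ⟨y, hy, _, by rw [smul_smul, ← pow_add, add_comm k m, ← hw']; exact hNa Q _ (hNa b x hx), e⟩
  have : Module.Finite K[X] R0 := Module.Finite.iff_fg.2 hf
  let M0 : Submodule K[X] R0 := N.comap R0.subtype
  let I : Ideal K[X] := Ideal.span {X}
  have hI : ∀ q : K[X], q.eval 0 = 1 → ∃ r, q = 1 + X * r := fun q hq => by
    obtain ⟨r, hr⟩ : (X : K[X]) ∣ q - 1 := X_dvd_iff.2 (by rw [coeff_zero_eq_eval_zero]; simp [hq])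
    exact ⟨r, by rw [← hr]; ring⟩
  have s3 : M0 ≤ I • M0 := by
    intro x hx
    obtain ⟨k, hk⟩ := Ideal.exists_pow_inf_eq_pow_smul I M0
    obtain ⟨y, hy, w, hw, e⟩ := s2 (k + 1) _ hx
    obtain ⟨q1, hq1, hy1⟩ := hR y
    obtain ⟨q2, hq2, hw1⟩ := hR w
    obtain ⟨r, hr⟩ := hI (q1 * q2) (by rw [eval_mul, hq1, hq2, one_mul])
    have hX : ∀ z ∈ M0, (X : K[X]) • z ∈ I • M0 := fun z hz => Submodule.smul_mem_smul (Ideal.mem_span_singleton_self _) hz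
    let y' : R0 := ⟨(q1 * q2) • y, by rw [mul_comm, mul_smul]; exact R0.smul_mem _ hy1⟩
    let w' : R0 := ⟨(q1 * q2) • w, by rw [mul_smul]; exact R0.smul_mem _ hw1⟩
    have e2 : (q1 * q2) • x = (X : K[X]) • y' + (X : K[X]) ^ (k + 1) • w' := by
      apply Subtype.ext
      change (q1 * q2) • (x : M) = (X : K[X]) • (q1 * q2) • y + (X : K[X]) ^ (k + 1) • (q1 * q2) • w
      rw [show (x : M) = _ from e]
      module
    have h5 : (X : K[X]) ^ (k + 1) • w' ∈ I • M0 := by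
      have : (X : K[X]) ^ (k + 1) • w' ∈ I ^ (k + 1) • ⊤ ⊓ M0 := by
        refine ⟨Submodule.smul_mem_smul (Ideal.pow_mem_pow (Ideal.mem_span_singleton_self _) _) trivial, ?_⟩
        change (X : K[X]) ^ (k + 1) • (q1 * q2) • w ∈ N
        rw [smul_comm]; exact N.smul_mem _ hw
      rw [hk (k + 1) (by omega), Nat.add_sub_cancel_left, pow_one] at this
      exact Submodule.smul_mono le_rfl inf_le_right this
    have e3 : x = ((X : K[X]) • y' + (X : K[X]) ^ (k + 1) • w') - (X : K[X]) • r • x := by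
      rw [← e2, hr]; module
    rw [e3]
    refine sub_mem (add_mem (hX _ (N.smul_mem _ hy)) h5) (hX _ (N.smul_mem _ hx))
  obtain ⟨r, hr1, hr2⟩ := Submodule.exists_sub_one_mem_and_smul_eq_zero_of_fg_of_le_smul I M0 (IsNoetherian.noetherian M0) s3
  have s5 : ∀ k, ∀ x ∈ N, (X - C (1 : K)) ^ k • x = 0 → ∃ y ∈ N, x = (X - C (1 : K) : K[X]) • y := by
    intro k
    induction k with
    | zero => intro x _ h; exact ⟨0, zero_mem _, by simpa using h⟩
    | succ k ih =>
      intro x hx h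
      have h6 := congrArg θ h
      rw [al_der hθ, map_zero, derivative_pow_succ, derivative_sub, derivative_X, derivative_C, sub_zero, mul_one] at h6
      obtain ⟨y, hy, e⟩ := ih ((X - C (1 : K)) • θ x + (C (k + 1 : K) * X) • x) (add_mem (N.smul_mem _ (hN x hx)) (N.smul_mem _ hx)) (by
        rw [← h6]; module)
      have hk : (C ((k + 1 : K)⁻¹) * C (k + 1 : K) : K[X]) = 1 := by
        rw [← C_mul, inv_mul_cancel₀ (by exact_mod_cast (Nat.succ_ne_zero k)), C_1]
      refine ⟨C ((k + 1 : K)⁻¹) • (y - θ x) - x, sub_mem (N.smul_mem _ (sub_mem hy (hN x hx))) hx, ?_⟩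
      have e4 : (C (k + 1 : K) * X) • x = (X - C (1 : K)) • (y - θ x) := by rw [smul_sub, ← e]; module
      rw [smul_sub, smul_comm, ← e4, smul_smul, ← mul_assoc, hk, C_1]; module
  intro x hx
  obtain ⟨q, hq, hqx⟩ := hR x
  have h7 : (r * q) • x = 0 := by
    have := hr2 ⟨q • x, hqx⟩ (N.smul_mem _ hx)
    rw [mul_smul]; exact congrArg Subtype.val this
  have h8 : r * q ≠ 0 := by
    intro h0
    obtain ⟨c, hc⟩ := Ideal.mem_span_singleton.1 hr1
    have := congrArg (eval 0) h0
    rw [eval_mul, hq, mul_one, show r = 1 + X * c by rw [← hc]; ring] at this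
    simp at this
  obtain ⟨s, hs1, hs2⟩ := exists_eq_pow_rootMultiplicity_mul_and_not_dvd _ h8 (1 : K)
  obtain ⟨a, b, hab⟩ : IsCoprime (X - C (1 : K)) s := (irreducible_X_sub_C 1).coprime_iff_not_dvd.2 hs2
  obtain ⟨y, hy, e⟩ := s5 _ (s • x) (N.smul_mem _ hx) (by rw [smul_smul, ← hs1, h7])
  refine ⟨a • x + b • y, add_mem (N.smul_mem _ hx) (N.smul_mem _ hy), ?_⟩
  rw [← C_1, smul_add, smul_comm _ b, ← e]
  conv_lhs => rw [← one_smul K[X] x, ← hab]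
  module
end
section
open Polynomial
universe uY
variable {K : Type*} [Field K] [CharZero K] {Y : Type uY} [AddCommGroup Y] [Module K Y] {κ : Type*} {L Rr : κ → Y →ₗ[K] Y} {δ : Y →ₗ[K] Y} {zl zr : κ → ℕ}
theorem ex_def (hL : ∀ k y, L k (δ y) = δ (L k y)) (hR : ∀ k y, δ (Rr k y) = Rr k (δ y) - ((zl k : K) - zr k) • Rr k y) :
    ∃ (M : Type uY) (_ : AddCommGroup M) (_ : Module K M) (_ : Module K[X] M) (_ : IsScalarTower K K[X] M) (m : Y →ₗ[K] M) (θ : Module.End K M),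
      (∀ x, θ ((X : K[X]) • x) = (X : K[X]) • θ x + (X : K[X]) • x) ∧ (∀ y, θ (m y) = - m (δ y)) ∧ Submodule.span K[X] (Set.range m) = ⊤ ∧
      (∀ k y, (X : K[X]) ^ zr k • m (Rr k y) = (X : K[X]) ^ zl k • m (L k y)) ∧
      ∀ y w, m y = (X - 1 : K[X]) • w → y ∈ Submodule.span K {x | ∃ k y, x = Rr k y - L k y} := by
  let θ0 : Module.End K (PolynomialModule K Y) :=
    (Finsupp.lsum K (fun n : ℕ => (PolynomialModule.lsingle K n).comp ((n : K) • LinearMap.id - δ))) ∘ₗ (PolynomialModule.coeffLinearEquiv (R := K) (S := K) (M := Y)).toLinearMap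
  have h0 : ∀ n y, θ0 (PolynomialModule.single K n y) = PolynomialModule.single K n ((n : K) • y - δ y) := fun n y => by
    simp only [θ0, LinearMap.comp_apply]
    refine (Finsupp.lsum_single _ _ _ _).trans ?_
    rfl
  have hXs : ∀ (i n : ℕ) (y : Y), (X : K[X]) ^ i • PolynomialModule.single K n y = PolynomialModule.single K (n + i) y := fun i n y => by
    rw [X_pow_eq_monomial, PolynomialModule.monomial_smul_single, one_smul, add_comm]
  have hsub : ∀ n (x y : Y), PolynomialModule.single K n (x - y) = PolynomialModule.single K n x - PolynomialModule.single K n y := fun n x y =>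
    map_sub (PolynomialModule.lsingle K n) x y
  have hsm : ∀ n (c : K) (y : Y), PolynomialModule.single K n (c • y) = c • PolynomialModule.single K n y := fun n c y =>
    map_smul (PolynomialModule.lsingle K n) c y
  have hθ0 : ∀ x, θ0 ((X : K[X]) • x) = (X : K[X]) • θ0 x + (X : K[X]) • x := by
    intro x
    induction x using PolynomialModule.induction_linear with
    | zero => simp
    | add f g hf hg => rw [smul_add, map_add, hf, hg, map_add, smul_add]; abel
    | single n y =>
      rw [← pow_one X, hXs, h0, h0, hXs, ← PolynomialModule.single_add]
      congr 1; push_cast; module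
  let S : Set (PolynomialModule K Y) := {x | ∃ k y, x = PolynomialModule.single K (zr k) (Rr k y) - PolynomialModule.single K (zl k) (L k y)}
  let Rel : Submodule K[X] (PolynomialModule K Y) := Submodule.span K[X] S
  have hS : ∀ x ∈ Rel, θ0 x ∈ Rel := by
    intro x hx
    induction hx using Submodule.span_induction with
    | mem x hx =>
      obtain ⟨k, y, rfl⟩ := hx
      have e : θ0 (PolynomialModule.single K (zr k) (Rr k y) - PolynomialModule.single K (zl k) (L k y)) =
          (C (zl k : K) : K[X]) • (PolynomialModule.single K (zr k) (Rr k y) - PolynomialModule.single K (zl k) (L k y)) -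
          (PolynomialModule.single K (zr k) (Rr k (δ y)) - PolynomialModule.single K (zl k) (L k (δ y))) := by
        rw [map_sub, h0, h0, hL, hR, ← monomial_zero_left, smul_sub, PolynomialModule.monomial_smul_single, PolynomialModule.monomial_smul_single, zero_add, zero_add]
        simp only [hsub, hsm]
        module
      rw [e]
      exact sub_mem (Rel.smul_mem _ (Submodule.subset_span ⟨k, y, rfl⟩)) (Submodule.subset_span ⟨k, δ y, rfl⟩)
    | zero => rw [map_zero]; exact zero_mem _
    | add x y _ _ hx hy => rw [map_add]; exact add_mem hx hy
    | smul c x h hx => rw [al_der hθ0]; exact add_mem (Rel.smul_mem _ hx) (Rel.smul_mem _ h)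
  let E := Submodule.Quotient.restrictScalarsEquiv K Rel
  let θ : Module.End K (PolynomialModule K Y ⧸ Rel) := E.toLinearMap ∘ₗ (Submodule.mapQ (Rel.restrictScalars K) (Rel.restrictScalars K) θ0 hS) ∘ₗ E.symm.toLinearMap
  have hθ : ∀ x, θ (Rel.mkQ x) = Rel.mkQ (θ0 x) := fun x => rfl
  refine ⟨PolynomialModule K Y ⧸ Rel, inferInstance, inferInstance, inferInstance, inferInstance,
    (Rel.mkQ.restrictScalars K) ∘ₗ (PolynomialModule.lsingle K 0), θ, ?_, ?_, ?_, ?_, ?_⟩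
  · intro x
    obtain ⟨x, rfl⟩ := Rel.mkQ_surjective x
    rw [← map_smul, hθ, hθ0, hθ, map_add, map_smul, map_smul]
  · intro y
    change θ (Rel.mkQ (PolynomialModule.single K 0 y)) = - Rel.mkQ (PolynomialModule.single K 0 (δ y))
    rw [hθ, h0, ← map_neg, hsub]; simp
  · rw [eq_top_iff]
    rintro x -
    obtain ⟨x, rfl⟩ := Rel.mkQ_surjective x
    induction x using PolynomialModule.induction_linear with
    | zero => simp
    | add f g hf hg => rw [map_add]; exact add_mem hf hg
    | single n y =>
      have := hXs n 0 y
      rw [zero_add] at this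
      rw [← this, map_smul]
      exact Submodule.smul_mem _ _ (Submodule.subset_span ⟨y, rfl⟩)
  · intro k y
    change X ^ zr k • Rel.mkQ (PolynomialModule.single K 0 (Rr k y)) = X ^ zl k • Rel.mkQ (PolynomialModule.single K 0 (L k y))
    rw [← map_smul, ← map_smul, hXs, hXs, ← sub_eq_zero, ← map_sub, zero_add, zero_add]
    exact (Submodule.Quotient.mk_eq_zero _).2 (Submodule.subset_span ⟨k, y, rfl⟩)
  · intro y w h
    obtain ⟨w, rfl⟩ := Rel.mkQ_surjective w
    change Rel.mkQ (PolynomialModule.single K 0 y) = _ at h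
    rw [← map_smul, ← sub_eq_zero, ← map_sub] at h
    have h1 : ∀ x ∈ Rel, PolynomialModule.eval 1 x ∈ Submodule.span K {x | ∃ k y, x = Rr k y - L k y} := by
      intro x hx
      induction hx using Submodule.span_induction with
      | mem x hx =>
        obtain ⟨k, y, rfl⟩ := hx
        rw [map_sub, PolynomialModule.eval_single, PolynomialModule.eval_single, one_pow, one_pow, one_smul, one_smul]
        exact Submodule.subset_span ⟨k, y, rfl⟩
      | zero => rw [map_zero]; exact zero_mem _
      | add x y _ _ hx hy => rw [map_add]; exact add_mem hx hy
      | smul c x h hx => rw [PolynomialModule.eval_smul]; exact Submodule.smul_mem _ _ hx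
    have := h1 _ ((Submodule.Quotient.mk_eq_zero _).1 h)
    rw [map_sub, PolynomialModule.eval_smul, PolynomialModule.eval_single] at this
    simpa using this
end
section
open Polynomial
universe uZ
variable {K : Type*} [Field K] [CharZero K] {Y : Type uZ} [AddCommGroup Y] [Module K Y] {κ : Type*} {L Rr : κ → Y →ₗ[K] Y} {δ : Y →ₗ[K] Y} {zl zr : κ → ℕ}
def pS (Rr : κ → Y →ₗ[K] Y) (zl zr : κ → ℕ) (M0 : Submodule K Y) : Submodule K Y := Submodule.span K {x | ∃ k, ∃ y ∈ M0, zr k = 0 ∧ 0 < zl k ∧ x = Rr k y}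
theorem DL (hL : ∀ k y, L k (δ y) = δ (L k y)) (hR : ∀ k y, δ (Rr k y) = Rr k (δ y) - ((zl k : K) - zr k) • Rr k y)
    (M0 : Submodule K Y) (hM : ∀ k, ∀ y ∈ M0, L k y ∈ M0) (hMδ : ∀ y ∈ M0, δ y ∈ M0)
    (Yd : ℕ → Submodule K Y) (hfd : ∀ d, (Yd d).FG) (htop : ∀ y, ∃ d, y ∈ Yd d) (d0 : ℕ)
    (hLd : ∀ d k, ∀ y ∈ Yd d, L k y ∈ Yd (d + 1)) (hRd : ∀ d k, ∀ y ∈ Yd d, Rr k y ∈ Yd (d + 1)) (hmono : ∀ d, Yd d ≤ Yd (d + 1))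
    (hgen : ∀ d ≥ d0, Yd (d + 1) ≤ Submodule.span K {x | ∃ k, ∃ y ∈ Yd d, (zl k = 0 ∧ 0 < zr k ∧ x = L k y) ∨ (zr k = 0 ∧ 0 < zl k ∧ x = Rr k y)} ⊔ Yd d)
    (P : K[X]) (hP : ∀ y, aeval (-δ) P y ∈ pS Rr zl zr ⊤) (hPM : ∀ y ∈ M0, aeval (-δ) P y ∈ pS Rr zl zr M0)
    (EE : ℕ → Submodule K Y) (hE : ∀ m, EE (m + 1) ≤ pS Rr zl zr (EE m)) (hEL : ∀ m k, ∀ y ∈ EE m, L k y ∈ EE m) (m : ℕ) (hm : M0 ≤ EE m)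
    (hc : ∀ i ≥ m, IsCoprime P (P.comp (X - C (i : K)))) : ∀ x ∈ M0, x ∈ Submodule.span K {x | ∃ k y, x = Rr k y - L k y} := by
  obtain ⟨M, _, _, _, _, μ, θ, hθ, hμ, hsp, hrel, hend⟩ := ex_def hL hR
  have hsc : ∀ (c : K) (x : M), c • x = (C c : K[X]) • x := fun c x => (algebraMap_smul K[X] c x).symm
  let XX : M →ₗ[K] M := { toFun := fun x => (X : K[X]) • x, map_add' := smul_add _, map_smul' := fun c x => by simp only [hsc, RingHom.id_apply]; exact smul_comm _ _ _ }
  have hθP : ∀ F : K[X], ∀ y, aeval θ F (μ y) = μ (aeval (-δ) F y) := by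
    intro F y
    induction F using Polynomial.induction_on generalizing y with
    | C a => simp
    | add p q hp hq => simp only [map_add, LinearMap.add_apply, hp, hq]
    | monomial n a ih =>
      rw [pow_succ, ← mul_assoc, map_mul (aeval θ) (C a * X ^ n) X, map_mul (aeval (-δ)) (C a * X ^ n) X, Module.End.mul_apply, Module.End.mul_apply, aeval_X, aeval_X, hμ, ← map_neg, ih]; rfl
  let NN : Submodule K Y → Submodule K[X] M := fun V => Submodule.span K[X] (μ '' V)
  have hpos : ∀ k, zr k = 0 → 0 < zl k → ∀ y, ∃ F : K[X], μ (Rr k y) = (X : K[X]) • F • μ (L k y) := fun k h1 h2 y => by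
    have := hrel k y
    rw [h1, pow_zero, one_smul] at this
    exact ⟨X ^ (zl k - 1), by rw [this, smul_smul, ← pow_succ', Nat.sub_add_cancel h2]⟩
  have hneg : ∀ k, zl k = 0 → 0 < zr k → ∀ y, ∃ F : K[X], μ (L k y) = (X : K[X]) • F • μ (Rr k y) := fun k h1 h2 y => by
    have := hrel k y
    rw [h1, pow_zero, one_smul] at this
    exact ⟨X ^ (zr k - 1), by rw [← this, smul_smul, ← pow_succ', Nat.sub_add_cancel h2]⟩
  have hN1 : ∀ V : Submodule K Y, ∀ x ∈ NN V, ∃ y ∈ V, ∃ x' ∈ NN V, x = μ y + (X : K[X]) • x' := by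
    intro V x hx
    induction hx using Submodule.span_induction with
    | mem x hx => obtain ⟨y, hy, rfl⟩ := hx; exact ⟨y, hy, 0, zero_mem _, by simp⟩
    | zero => exact ⟨0, zero_mem _, 0, zero_mem _, by simp⟩
    | add x y _ _ hx hy =>
      obtain ⟨a, ha, b, hb, rfl⟩ := hx
      obtain ⟨c, hc, d, hd, rfl⟩ := hy
      exact ⟨a + c, add_mem ha hc, b + d, add_mem hb hd, by rw [map_add, smul_add]; abel⟩
    | smul F x _ hx =>
      obtain ⟨a, ha, b, hb, rfl⟩ := hx
      refine ⟨F.coeff 0 • a, V.smul_mem _ ha, F.divX • μ a + F • b, add_mem ((NN V).smul_mem _ (Submodule.subset_span ⟨a, ha, rfl⟩)) ((NN V).smul_mem _ hb), ?_⟩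
      have e : F • μ a = (X : K[X]) • F.divX • μ a + C (F.coeff 0) • μ a := by conv_lhs => { rw [← divX_mul_X_add F] }; module
      rw [smul_add, e, map_smul, hsc]; module
  have hN2 : ∀ V : Submodule K Y, (∀ k, ∀ y ∈ V, L k y ∈ V) → (∀ y ∈ V, aeval (-δ) P y ∈ pS Rr zl zr V) → (∀ y ∈ V, δ y ∈ V) →
      (∀ x ∈ NN V, θ x ∈ NN V) ∧ ∀ x ∈ NN V, ∃ y ∈ NN V, aeval θ P x = (X : K[X]) • y := by
    intro V hV hVP hVδ
    have h1 : ∀ x ∈ NN V, θ x ∈ NN V := by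
      intro x hx
      induction hx using Submodule.span_induction with
      | mem x hx => obtain ⟨y, hy, rfl⟩ := hx; rw [hμ]; exact neg_mem (Submodule.subset_span ⟨_, hVδ y hy, rfl⟩)
      | zero => rw [map_zero]; exact zero_mem _
      | add x y _ _ hx hy => rw [map_add]; exact add_mem hx hy
      | smul F x h hx => rw [al_der hθ]; exact add_mem ((NN V).smul_mem _ hx) ((NN V).smul_mem _ h)
    have hNa : ∀ F : K[X], ∀ x ∈ NN V, aeval θ F x ∈ NN V := by
      intro F x hx
      induction F using Polynomial.induction_on generalizing x with
      | C a => rw [aeval_C, Module.algebraMap_end_apply, hsc]; exact (NN V).smul_mem _ hx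
      | add p q hp hq => rw [map_add]; exact add_mem (hp x hx) (hq x hx)
      | monomial n a ih => rw [pow_succ, ← mul_assoc, map_mul, Module.End.mul_apply, aeval_X]; exact ih _ (h1 x hx)
    refine ⟨h1, fun x hx => ?_⟩
    obtain ⟨y, hy, x', hx', rfl⟩ := hN1 V x hx
    obtain ⟨w, hw, hw'⟩ : ∃ w ∈ NN V, μ (aeval (-δ) P y) = (X : K[X]) • w := by
      have : pS Rr zl zr V ≤ (((NN V).restrictScalars K).map XX).comap μ := by
        refine Submodule.span_le.2 ?_
        rintro _ ⟨k, y, hy, h1, h2, rfl⟩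
        obtain ⟨F, hF⟩ := hpos k h1 h2 y
        exact ⟨F • μ (L k y), (NN V).smul_mem _ (Submodule.subset_span ⟨_, hV k y hy, rfl⟩), hF.symm⟩
      obtain ⟨w, hw, h⟩ := this (hVP y hy)
      exact ⟨w, hw, h.symm⟩
    have e := al_pow hθ 1 (P.comp (X + C 1)) x'
    rw [comp_assoc] at e
    simp only [add_comp, X_comp, C_comp, Nat.cast_one, sub_add_cancel, comp_X, pow_one] at e
    exact ⟨w + aeval θ (P.comp (X + C 1)) x', add_mem hw (hNa _ _ hx'), by rw [map_add, hθP, hw', e, smul_add]⟩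
  have hNt : ∀ x, x ∈ NN ⊤ := fun x => by
    have : NN ⊤ = ⊤ := by simp only [NN, Submodule.top_coe, Set.image_univ]; exact hsp
    rw [this]; trivial
  have hE' : ∀ m, ∀ y ∈ EE m, ∃ w, μ y = (X : K[X]) ^ m • w := by
    intro m
    have key : ∀ m, ∀ x ∈ (LinearMap.range ((XX ^ m : Module.End K M))), ∃ w, x = (X : K[X]) ^ m • w := by
      intro m
      induction m with
      | zero => intro x hx; exact ⟨x, by simp⟩
      | succ m ih =>
        rintro _ ⟨w, rfl⟩
        obtain ⟨w', h⟩ := ih _ ⟨w, rfl⟩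
        exact ⟨w', by rw [pow_succ', Module.End.mul_apply, h, pow_succ', mul_smul]; rfl⟩
    suffices EE m ≤ (LinearMap.range ((XX ^ m : Module.End K M))).comap μ from fun y hy => key m _ (this hy)
    induction m with
    | zero => intro y hy; exact ⟨μ y, by simp⟩
    | succ m ih =>
      refine (hE m).trans (Submodule.span_le.2 ?_)
      rintro _ ⟨k, y, hy, h1, h2, rfl⟩
      obtain ⟨F, hF⟩ := hpos k h1 h2 y
      obtain ⟨w, hw⟩ := key m _ (ih (hEL m k y hy))
      have hXX : ∀ n (w : M), (XX ^ n : Module.End K M) w = (X : K[X]) ^ n • w := fun n => by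
        induction n with
        | zero => intro w; simp
        | succ n ih => intro w; rw [pow_succ', Module.End.mul_apply, ih, pow_succ', mul_smul]; rfl
      exact ⟨F • w, by rw [hXX, hF, hw]; module⟩
  have hfg : ∀ d, (NN (Yd d)).FG := fun d => by
    obtain ⟨S, hS⟩ := hfd d
    classical
    refine ⟨S.image μ, ?_⟩
    rw [Finset.coe_image]
    refine le_antisymm (Submodule.span_mono (Set.image_mono (hS ▸ Submodule.subset_span))) (Submodule.span_le.2 ?_)
    rintro _ ⟨y, hy, rfl⟩
    rw [SetLike.mem_coe, ← hS] at hy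
    have : Submodule.span K (S : Set Y) ≤ ((Submodule.span K[X] (μ '' S)).restrictScalars K).comap μ := Submodule.span_le.2 fun y hy => Submodule.subset_span ⟨y, hy, rfl⟩
    exact this hy
  have hq : ∀ d ≥ d0, ∃ q : K[X], q.eval 0 = 1 ∧ ∀ x ∈ NN (Yd (d + 1)), q • x ∈ NN (Yd d) := by
    intro d hd
    obtain ⟨q, hq1, hq2⟩ := Submodule.exists_sub_one_mem_and_smul_le_of_fg_of_le_sup (I := Ideal.span {(X : K[X])}) (N := NN (Yd d)) (hfg (d + 1)) le_rfl (by
      refine Submodule.span_le.2 ?_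
      rintro _ ⟨y, hy, rfl⟩
      have hX : ∀ (F : K[X]) y, y ∈ Yd (d + 1) → (X : K[X]) • F • μ y ∈ NN (Yd d) ⊔ Ideal.span {(X : K[X])} • NN (Yd (d + 1)) := fun F y hy =>
        Submodule.mem_sup_right (Submodule.smul_mem_smul (Ideal.mem_span_singleton_self _) (Submodule.smul_mem _ _ (Submodule.subset_span ⟨y, hy, rfl⟩)))
      have h2 : Yd (d + 1) ≤ ((NN (Yd d) ⊔ Ideal.span {(X : K[X])} • NN (Yd (d + 1))).restrictScalars K).comap μ := by
        refine (hgen d hd).trans (sup_le (Submodule.span_le.2 ?_) ?_)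
        · rintro _ ⟨k, y, hy, ⟨h1, h2, rfl⟩ | ⟨h1, h2, rfl⟩⟩
          · obtain ⟨F, hF⟩ := hneg k h1 h2 y
            change μ (L k y) ∈ NN (Yd d) ⊔ Ideal.span {(X : K[X])} • NN (Yd (d + 1))
            rw [hF]; exact hX F _ (hRd d k y hy)
          · obtain ⟨F, hF⟩ := hpos k h1 h2 y
            change μ (Rr k y) ∈ NN (Yd d) ⊔ Ideal.span {(X : K[X])} • NN (Yd (d + 1))
            rw [hF]; exact hX F _ (hLd d k y hy)
        · intro y hy
          exact Submodule.mem_sup_left (Submodule.subset_span ⟨y, hy, rfl⟩)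
      exact h2 hy)
    obtain ⟨c, hc⟩ := Ideal.mem_span_singleton.1 hq1
    refine ⟨q, ?_, fun x hx => hq2 (Submodule.smul_mem_pointwise_smul _ _ _ hx)⟩
    rw [show q = 1 + X * c by rw [← hc]; ring]; simp
  have hq' : ∀ k, ∃ q : K[X], q.eval 0 = 1 ∧ ∀ x ∈ NN (Yd (d0 + k)), q • x ∈ NN (Yd d0) := by
    intro k
    induction k with
    | zero => exact ⟨1, by simp, fun x hx => by simpa using hx⟩
    | succ k ih =>
      obtain ⟨q, h1, h2⟩ := ih
      obtain ⟨q', h3, h4⟩ := hq (d0 + k) (by omega)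
      exact ⟨q * q', by rw [eval_mul, h1, h3, one_mul], fun x hx => by rw [mul_smul]; exact h2 _ (h4 x hx)⟩
  have hNm : Monotone (fun d => NN (Yd d)) := monotone_nat_of_le_succ fun d => Submodule.span_mono (Set.image_mono (hmono d))
  have hfin := AL hθ (NN M0) (hN2 M0 hM hPM hMδ).1 (NN (Yd d0)) (hfg d0) (fun x => by
    have : ∃ d, x ∈ NN (Yd d) := by
      rw [← Submodule.mem_iSup_of_directed _ hNm.directed_le]
      have h1 : NN ⊤ ≤ ⨆ d, NN (Yd d) := Submodule.span_le.2 (by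
        rintro _ ⟨y, -, rfl⟩
        obtain ⟨d, hd⟩ := htop y
        exact (le_iSup (fun d => NN (Yd d)) d) (Submodule.subset_span ⟨y, hd, rfl⟩))
      exact h1 (hNt x)
    obtain ⟨d, hd⟩ := this
    obtain ⟨q, h1, h2⟩ := hq' d
    exact ⟨q, h1, h2 x (hNm (by omega) hd)⟩) P (fun x => by
      obtain ⟨y, -, h⟩ := (hN2 ⊤ (fun _ _ _ => trivial) (fun y _ => hP y) (fun _ _ => trivial)).2 x (hNt x)
      exact ⟨y, h⟩) (hN2 M0 hM hPM hMδ).2 m (fun x hx => by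
    induction hx using Submodule.span_induction with
    | mem x hx => obtain ⟨y, hy, rfl⟩ := hx; exact hE' m y (hm hy)
    | zero => exact ⟨0, by simp⟩
    | add x y _ _ hx hy =>
      obtain ⟨a, rfl⟩ := hx
      obtain ⟨b, rfl⟩ := hy
      exact ⟨a + b, (smul_add _ _ _).symm⟩
    | smul F x _ hx =>
      obtain ⟨a, rfl⟩ := hx
      exact ⟨F • a, smul_comm _ _ _⟩) hc
  intro x hx
  obtain ⟨y, -, h⟩ := hfin (μ x) (Submodule.subset_span ⟨x, hx, rfl⟩)
  exact hend x y h
end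
section
variable {K g : Type*} [Field K] [LieRing g] [LieAlgebra K g] [CharZero K] [LieAlgebra.IsSemisimple K g] (D : RD K g)
local notation "U" => UniversalEnvelopingAlgebra K g
def RD.UE : ℕ → Submodule K U
  | 0 => ⊤
  | m + 1 => Submodule.span K {x | ∃ a, ∃ u ∈ RD.UE m, x = u * D.e a}
theorem RD.UE_mul (m) : ∀ x, ∀ u ∈ D.UE m, x * u ∈ D.UE m := by
  induction m with
  | zero => exact fun _ _ _ => trivial
  | succ m ih =>
    intro x u hu
    have : D.UE (m + 1) ≤ (D.UE (m + 1)).comap (LinearMap.mulLeft K x) := Submodule.span_le.2 (by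
      rintro _ ⟨a, u, hu, rfl⟩
      exact Submodule.subset_span ⟨a, x * u, ih x u hu, (mul_assoc _ _ _).symm⟩)
    exact this hu
theorem hom_sp {E R : Type*} [AddCommGroup E] [Module K E] [FiniteDimensional K E] [AddCommGroup R] [Module K R] (V : Submodule K R)
    (W : Submodule K (E →ₗ[K] R)) (h : ∀ f : Module.Dual K E, ∀ x ∈ V, f.smulRight x ∈ W) (φ : E →ₗ[K] R) (hφ : ∀ e, φ e ∈ V) : φ ∈ W := by
  let b := Module.finBasis K E
  have : φ = ∑ i, (b.coord i).smulRight (φ (b i)) := by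
    ext e
    conv_lhs => rw [← b.sum_repr e]
    simp only [map_sum, map_smul, LinearMap.sum_apply, LinearMap.smulRight_apply, Module.Basis.coord_apply]
  rw [this]
  exact sum_mem fun i _ => h _ _ (hφ _)
variable {R : Type*} [Ring R] [Algebra K R]
theorem RD.C8a (π : U →ₐ[K] R) (hs : Function.Surjective π) {ν : Fin D.r → K}
    (hχ : ∀ z, (∀ u, z * u = u * z) → π z = algebraMap K R ((D.p z).eval ν)) : ∃ m, ∀ J : Submodule K R, (∀ r, ∀ y ∈ J, r * y ∈ J ∧ y * r ∈ J) →
    J ≤ (D.UE m).map π.toLinearMap → ∀ (E : Type _) [AddCommGroup E] [Module K E] [FiniteDimensional K E] (α : g →ₗ[K] Module.End K E)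
      (hα : ∀ x y v, α ⁅x, y⁆ v = α x (α y v) - α y (α x v)) (ω : E →ₗ[K] R) (hω : ∀ x e, ω (α x e) = π (io K g x) * ω e - ω e * π (io K g x))
      (hJ : ∀ e, ω e ∈ J), ω = 0 := by
  classical
  have : FiniteDimensional K g := Module.Basis.finiteDimensional_of_finite D.b
  obtain ⟨-, -, -, hfin⟩ := D.N6 hχ
  obtain ⟨d0, hFG⟩ := D.FG π (fun z hz => ⟨_, hχ z hz⟩)
  let δ' : D.A := ∑ i, D.d i • MvPolynomial.X i
  have hδ' : D.j δ' = D.dl := by simp [δ', RD.dl, D.j_X]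
  obtain ⟨P, hP0, hPa⟩ : ∃ P : Polynomial K, P ≠ 0 ∧ Polynomial.aeval (-δ') P ∈ D.aI π := by
    have hi := Algebra.IsIntegral.isIntegral (R := K) (Ideal.Quotient.mkₐ K (D.aI π) (-δ'))
    refine ⟨_, minpoly.ne_zero hi, ?_⟩
    have := minpoly.aeval K (Ideal.Quotient.mkₐ K (D.aI π) (-δ'))
    rw [Polynomial.aeval_algHom_apply] at this
    exact Ideal.Quotient.eq_zero_iff_mem.1 this
  obtain ⟨w0, hw0, hw0'⟩ : ∃ w ∈ D.UN, π (Polynomial.aeval (-D.dl) P) = π w := by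
    rw [RD.aI_mem, ← Polynomial.aeval_algHom_apply, map_neg, hδ'] at hPa
    obtain ⟨a, ha, b, hb, e⟩ := Submodule.mem_sup.1 hPa
    exact ⟨a, ha, by rw [← e, map_add, show π b = 0 from hb, add_zero]⟩
  obtain ⟨m, hm⟩ := cop_lem hP0
  refine ⟨m, fun J hJJ hJm E _ _ _ α hα ω hω hJ => ?_⟩
  let G : g →ₗ[K] R := π.toLinearMap ∘ₗ io K g
  have hG : ∀ x y, G ⁅x, y⁆ = G x * G y - G y * G x := fun x y => by
    change π (io K g ⁅x, y⁆) = _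
    rw [io_lie, map_sub, map_mul, map_mul]; rfl
  let LL : g →ₗ[K] (E →ₗ[K] R) →ₗ[K] (E →ₗ[K] R) := LinearMap.mk₂ K (fun x φ => LinearMap.mulLeft K (G x) ∘ₗ φ - φ ∘ₗ α x)
    (by intros; ext; simp [add_mul]; abel) (by intros; ext; simp [smul_sub]) (by intros; ext; simp [mul_add]; abel) (by intros; ext; simp [smul_sub])
  let RM : R →ₗ[K] (E →ₗ[K] R) →ₗ[K] (E →ₗ[K] R) := LinearMap.mk₂ K (fun x φ => LinearMap.mulRight K x ∘ₗ φ)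
    (by intros; ext; simp [mul_add]) (by intros; ext; simp) (by intros; ext; simp [add_mul]) (by intros; ext; simp)
  have hLL : ∀ x φ e, LL x φ e = G x * φ e - φ (α x e) := fun _ _ _ => rfl
  have hRM : ∀ x φ e, RM x φ e = φ e * x := fun _ _ _ => rfl
  have hRMm : ∀ x y φ, RM y (RM x φ) = RM (x * y) φ := fun x y φ => by ext e; simp only [hRM, mul_assoc]
  let YV : Submodule K R → Submodule K (E →ₗ[K] R) := fun V =>
    { carrier := {φ | ∀ e, φ e ∈ V}, add_mem' := fun h1 h2 e => add_mem (h1 e) (h2 e), zero_mem' := fun e => zero_mem _, smul_mem' := fun c φ h e => V.smul_mem c (h e) }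
  have hYV : ∀ V φ, φ ∈ YV V ↔ ∀ e, φ e ∈ V := fun _ _ => Iff.rfl
  let πF : ℕ → Submodule K R := fun d => (FF K g d).map π.toLinearMap
  have hYfd : ∀ d, FiniteDimensional K (YV (πF d)) := fun d => by
    have := FF_fd (K := K) (g := g) d
    have : FiniteDimensional K (πF d) := inferInstanceAs (FiniteDimensional K ((FF K g d).map π.toLinearMap))
    have : YV (πF d) ≤ LinearMap.range (LinearMap.compRight K (πF d).subtype : (E →ₗ[K] πF d) →ₗ[K] _) := fun φ hφ => ⟨φ.codRestrict _ hφ, rfl⟩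
    exact Submodule.finiteDimensional_of_le this
  have hπm : ∀ {a b}, a ≤ b → πF a ≤ πF b := fun h => Submodule.map_mono (FF_mono h)
  have htop : ∀ y : E →ₗ[K] R, ∃ d, y ∈ YV (πF d) := fun y => by
    have : y ∈ ⨆ d, YV (πF d) := hom_sp ⊤ _ (fun f x _ => by
      obtain ⟨u, rfl⟩ := hs x
      obtain ⟨d, hd⟩ := FF_top u
      exact (le_iSup (fun d => YV (πF d)) d) fun e => Submodule.smul_mem _ _ ⟨u, hd, rfl⟩) y (fun _ => trivial)
    have hmo : Monotone fun d => YV (πF d) := fun a b h φ hφ e => hπm h (hφ e)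
    exact (Submodule.mem_iSup_of_directed _ hmo.directed_le).1 this
  have hGl : ∀ d x y, y ∈ πF d → G x * y ∈ πF (d + 1) := by
    rintro d x _ ⟨u, hu, rfl⟩
    exact ⟨io K g x * u, FF_io x hu, map_mul π _ _⟩
  have hGr : ∀ d x y, y ∈ πF d → y * G x ∈ πF (d + 1) := by
    rintro d x _ ⟨u, hu, rfl⟩
    exact ⟨u * io K g x, FF_mul hu (FF_io1 x), map_mul π _ _⟩
  have hLd : ∀ d x, ∀ y ∈ YV (πF d), LL x y ∈ YV (πF (d + 1)) := fun d x y hy e => sub_mem (hGl _ _ _ (hy e)) (hπm d.le_succ (hy _))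
  have hRd : ∀ d x, ∀ y ∈ YV (πF d), RM (G x) y ∈ YV (πF (d + 1)) := fun d x y hy e => hGr _ _ _ (hy e)
  have hze : ∀ a, (-D.z (.inl a)).toNat = 0 ∧ 0 < (D.z (.inl a)).toNat := fun a => by have := D.z_e a; omega
  have hzf : ∀ a, (D.z (.inr (.inl a))).toNat = 0 ∧ 0 < (-D.z (.inr (.inl a))).toNat := fun a => by have := D.z_e a; have := D.z_f a; omega
  have hPy : ∀ y, Polynomial.aeval (-(RM (π D.dl))) P y = RM (π w0) y := by
    rw [← hw0']
    generalize P = P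
    intro y
    induction P using Polynomial.induction_on generalizing y with
    | C a => ext e; simp [hRM, Algebra.smul_def, Algebra.commutes]
    | add p q hp hq => simp only [map_add, LinearMap.add_apply, hp, hq]
    | monomial n a ih =>
      rw [pow_succ, ← mul_assoc, map_mul (Polynomial.aeval (-(RM (π D.dl)))) (Polynomial.C a * Polynomial.X ^ n) Polynomial.X, mul_comm _ Polynomial.X, map_mul (Polynomial.aeval (-D.dl)) Polynomial.X (Polynomial.C a * Polynomial.X ^ n), Module.End.mul_apply, Polynomial.aeval_X, Polynomial.aeval_X, ih, map_mul π, ← hRMm]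
      congr 1
      rw [map_neg π, map_neg RM]
  have hUN : ∀ M0 : Submodule K (E →ₗ[K] R), (∀ r, ∀ y ∈ M0, RM r y ∈ M0) → ∀ y ∈ M0, RM (π w0) y ∈ pS (fun k => RM (G (D.b k))) (fun k => (D.z k).toNat) (fun k => (-D.z k).toNat) M0 := by
    intro M0 hM0 y hy
    refine D.UN_ind ((pS (fun k => RM (G (D.b k))) (fun k => (D.z k).toNat) (fun k => (-D.z k).toNat) M0).comap ((RM.flip y) ∘ₗ π.toLinearMap)) ?_ w0 hw0
    intro u a
    refine Submodule.subset_span ⟨.inl a, RM (π u) y, hM0 _ _ hy, (hze a).1, (hze a).2, ?_⟩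
    rw [hRMm]
    change RM (π (u * D.e a)) y = _
    rw [map_mul]; rfl
  have hzc : ∀ k, (((D.z k).toNat : ℕ) : K) - (((-D.z k).toNat : ℕ) : K) = (D.z k : K) := fun k => by
    conv_rhs => rw [← Int.toNat_sub_toNat_neg (D.z k)]
    push_cast; rfl
  have key := DL (L := fun k => LL (D.b k)) (Rr := fun k => RM (G (D.b k))) (δ := RM (π D.dl)) (zl := fun k => (D.z k).toNat) (zr := fun k => (-D.z k).toNat)
    (fun k y => by ext e; simp only [hLL, hRM, sub_mul, mul_assoc])
    (fun k y => by
      rw [hzc, hRMm, hRMm]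
      have : π D.dl * G (D.b k) = G (D.b k) * π D.dl + (D.z k : K) • G (D.b k) := by
        have := congrArg π (D.dl_b k)
        rwa [map_mul, map_add, map_mul, map_smul] at this
      rw [this, map_add, map_smul, LinearMap.add_apply, LinearMap.smul_apply, add_sub_cancel_right])
    (YV J) (fun k y hy e => sub_mem (hJJ _ _ (hy e)).1 (hy _)) (fun y hy e => (hJJ _ _ (hy e)).2)
    (fun d => YV (πF d)) (fun d => Module.Finite.iff_fg.1 (hYfd d)) htop d0 (fun d k => hLd d _) (fun d k => hRd d _) (fun d φ hφ e => hπm d.le_succ (hφ e))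
    (by
      intro d hd φ hφ
      refine hom_sp ((D.GG d).map π.toLinearMap) _ ?_ φ (fun e => ?_)
      · rintro f _ ⟨u, hu, rfl⟩
        have hB : ∀ u ∈ FF K g d, f.smulRight (π u) ∈ YV (πF d) := fun u hu e => Submodule.smul_mem _ _ ⟨u, hu, rfl⟩
        have := D.GG_ind (d := d) (P := (Submodule.span K {x | ∃ k, ∃ y ∈ YV (πF d), ((D.z k).toNat = 0 ∧ 0 < (-D.z k).toNat ∧ x = LL (D.b k) y) ∨ ((-D.z k).toNat = 0 ∧ 0 < (D.z k).toNat ∧ x = RM (G (D.b k)) y)} ⊔ YV (πF d)).comap (LinearMap.smulRightₗ f ∘ₗ π.toLinearMap))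
          (fun u hu => Submodule.mem_sup_right (hB u hu)) (fun u hu a => by
            have e : LinearMap.smulRight f (π (D.f a * u)) = LL (D.b (.inr (.inl a))) (f.smulRight (π u)) + f.smulRight (π u) ∘ₗ α (D.b (.inr (.inl a))) := by
              ext e
              simp only [LinearMap.smulRight_apply, LinearMap.add_apply, hLL, LinearMap.comp_apply, sub_add_cancel, map_mul, mul_smul_comm]; rfl
            change LinearMap.smulRight f (π (D.f a * u)) ∈ Submodule.span K _ ⊔ YV (πF d)
            rw [e]
            exact (Submodule.add_mem_sup (Submodule.subset_span ⟨_, _, hB u hu, .inl ⟨(hzf a).1, (hzf a).2, rfl⟩⟩) fun e => hB u hu _))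
          (fun u hu a => by
            have e : LinearMap.smulRight f (π (u * D.e a)) = RM (G (D.b (.inl a))) (f.smulRight (π u)) := by
              ext e
              simp only [LinearMap.smulRight_apply, hRM, map_mul, smul_mul_assoc]; rfl
            change LinearMap.smulRight f (π (u * D.e a)) ∈ Submodule.span K _ ⊔ YV (πF d)
            rw [e]
            exact (Submodule.mem_sup_left (Submodule.subset_span ⟨_, _, hB u hu, .inr ⟨(hze a).1, (hze a).2, rfl⟩⟩)))
        exact this hu
      · obtain ⟨u, hu, h⟩ := hφ e
        obtain ⟨a, ha, b, hb, e'⟩ := Submodule.mem_sup.1 (hFG d hd hu)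
        exact ⟨a, ha, by rw [← h, ← e', map_add, LinearMap.mem_ker.1 hb, add_zero]⟩)
    P (fun y => by rw [hPy]; exact hUN ⊤ (fun _ _ _ => trivial) y trivial) (fun y hy => by rw [hPy]; exact hUN (YV J) (fun r y hy e => (hJJ _ _ (hy e)).2) y hy)
    (fun m => YV ((D.UE m).map π.toLinearMap)) (by
      intro m φ hφ
      refine hom_sp _ _ ?_ φ hφ
      rintro f _ ⟨u, hu, rfl⟩
      have : D.UE (m + 1) ≤ (pS (fun k => RM (G (D.b k))) (fun k => (D.z k).toNat) (fun k => (-D.z k).toNat) (YV ((D.UE m).map π.toLinearMap))).comap (LinearMap.smulRightₗ f ∘ₗ π.toLinearMap) := Submodule.span_le.2 (by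
        rintro _ ⟨a, u, hu, rfl⟩
        refine Submodule.subset_span ⟨.inl a, f.smulRight (π u), fun e => Submodule.smul_mem _ _ ⟨u, hu, rfl⟩, (hze a).1, (hze a).2, ?_⟩
        ext e
        change f e • π (u * D.e a) = (f e • π u) * π (D.e a)
        rw [map_mul, smul_mul_assoc])
      exact this hu) (by
      intro m k y hy e
      refine sub_mem ?_ (hy _)
      obtain ⟨u, hu, h⟩ := hy e
      exact ⟨_, D.UE_mul m (io K g (D.b k)) u hu, (map_mul π _ _).trans (congrArg (G (D.b k) * ·) h)⟩) m (fun φ hφ e => hJm (hφ e)) hm ω hJ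
  let ρ : g →ₗ[K] Module.End K (E →ₗ[K] R) := LinearMap.mk₂ K (fun x φ => LL x φ - RM (G x) φ)
    (by intros; simp only [map_add, LinearMap.add_apply]; abel) (by intros; simp only [map_smul, LinearMap.smul_apply, smul_sub]) (by intros; simp only [map_add]; abel) (by intros; simp only [map_smul, smul_sub])
  have hρ' : ∀ x φ e, ρ x φ e = G x * φ e - φ (α x e) - φ e * G x := fun _ _ _ => rfl
  have hst : ∀ d x, ∀ w ∈ YV (πF d), ρ x w ∈ YV (πF d) := by
    intro d x φ hφ e
    rw [hρ', sub_right_comm]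
    refine sub_mem ?_ (hφ _)
    obtain ⟨u, hu, h⟩ := hφ e
    refine ⟨_, FF_comm d x u hu, ?_⟩
    rw [← h]
    change π _ = _
    rw [map_sub, map_mul, map_mul]; rfl
  obtain ⟨d, hd⟩ : ∃ d, ω ∈ Submodule.span K {y | ∃ x, ∃ v ∈ YV (πF d), y = ρ x v} := by
    have : ω ∈ ⨆ d, Submodule.span K {y | ∃ x, ∃ v ∈ YV (πF d), y = ρ x v} := by
      refine (Submodule.span_le.2 ?_ : _ ≤ _) key
      rintro _ ⟨k, y, rfl⟩
      obtain ⟨d, hd⟩ := htop (-y)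
      exact (le_iSup (fun d => Submodule.span K {y | ∃ x, ∃ v ∈ YV (πF d), y = ρ x v}) d) (Submodule.subset_span ⟨D.b k, -y, hd, by
        rw [map_neg]; exact (neg_sub _ _).symm⟩)
    have hmo : Monotone fun d => Submodule.span K {y | ∃ x, ∃ v ∈ YV (πF d), y = ρ x v} := fun a b h => Submodule.span_mono fun y ⟨x, v, hv, e⟩ => ⟨x, v, fun e => hπm h (hv e), e⟩
    exact (Submodule.mem_iSup_of_directed _ hmo.directed_le).1 this
  refine wC ρ ?_ _ (hYfd d) (hst d) ω ?_ hd
  · intro x y φ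
    ext e
    simp only [LinearMap.sub_apply, hρ', hG, hα, map_sub]
    noncomm_ring
  · intro x
    ext e
    rw [hρ', hω]
    change G x * _ - (G x * _ - _ * G x) - _ = 0
    abel
theorem RD.C8 (π : U →ₐ[K] R) (hs : Function.Surjective π) {ν : Fin D.r → K}
    (hχ : ∀ z, (∀ u, z * u = u * z) → π z = algebraMap K R ((D.p z).eval ν)) : ∃ m, ∀ J : Submodule K R, (∀ r, ∀ y ∈ J, r * y ∈ J ∧ y * r ∈ J) →
    J ≤ (D.UE m).map π.toLinearMap → J = ⊥ := by
  have : FiniteDimensional K g := Module.Basis.finiteDimensional_of_finite D.b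
  obtain ⟨m, hm⟩ := D.C8a π hs hχ
  refine ⟨m, fun J hJ hJm => (Submodule.eq_bot_iff _).2 fun r hr => ?_⟩
  obtain ⟨u, rfl⟩ := hs r
  obtain ⟨d, hd⟩ := FF_top u
  have := FF_fd (K := K) (g := g) d
  let J0 : Submodule K R := J ⊓ (FF K g d).map π.toLinearMap
  have : FiniteDimensional K J0 := Submodule.finiteDimensional_of_le inf_le_right
  have h0 : ∀ x, ∀ y ∈ J0, π (io K g x) * y - y * π (io K g x) ∈ J0 := by
    rintro x y ⟨h1, u, hu, rfl⟩
    exact ⟨sub_mem (hJ _ _ h1).1 (hJ _ _ h1).2, _, FF_comm d x u hu, by simp⟩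
  let α : g →ₗ[K] Module.End K J0 := LinearMap.mk₂ K (fun x y => ⟨π (io K g x) * y - y * π (io K g x), h0 x y y.2⟩)
    (by intros; ext; simp [add_mul, mul_add]; abel) (by intros; ext; simp [smul_sub]) (by intros; ext; simp [add_mul, mul_add]; abel) (by intros; ext; simp [smul_sub])
  have hα : ∀ x (y : J0), (α x y : R) = π (io K g x) * y - y * π (io K g x) := fun _ _ => rfl
  have := hm J hJ hJm J0 α (fun x y v => by
    ext
    simp only [hα, AddSubgroupClass.coe_sub, io_lie, map_sub, map_mul]
    noncomm_ring) J0.subtype hα (fun e => e.2.1)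
  exact congrArg (fun f : J0 →ₗ[K] R => f ⟨π u, hr, u, hd, rfl⟩) this
end
section
variable {K g : Type*} [Field K] [LieRing g] [LieAlgebra K g] [CharZero K] [LieAlgebra.IsSemisimple K g] (D : RD K g)
local notation "U" => UniversalEnvelopingAlgebra K g
variable {R : Type*} [Ring R] [Algebra K R] (π : UniversalEnvelopingAlgebra K g →ₐ[K] R)
theorem RD.C9a (hs : Function.Surjective π) {ν : Fin D.r → K}
    (hχ : ∀ z, (∀ u, z * u = u * z) → π z = algebraMap K R ((D.p z).eval ν)) (h1 : π 1 ≠ 0) (hpr : ∀ a b, (∀ w, π (a * w * b) = 0) → π a = 0 ∨ π b = 0)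
    (u : U) (hu : ∀ w, u * w ∈ D.N0 π) : π u = 0 := by
  obtain ⟨m, hm⟩ := D.C8 π hs hχ
  let J : Submodule K U := { carrier := {u | ∀ w, u * w ∈ D.N0 π}, add_mem' := fun h1 h2 w => by rw [add_mul]; exact add_mem (h1 w) (h2 w), zero_mem' := fun w => by rw [zero_mul]; exact zero_mem _, smul_mem' := fun c x h w => by rw [smul_mul_assoc, Algebra.smul_def]; exact Ideal.mul_mem_left _ _ (h w) }
  have hJ : ∀ x, x ∈ J ↔ ∀ w, x * w ∈ D.N0 π := fun _ => Iff.rfl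
  have hJr : J * ⊤ ≤ J := Submodule.mul_le.2 fun x hx y _ w => by rw [mul_assoc]; exact hx _
  have hS : ∀ k, (⊤ * J ^ k : Submodule K U) * ⊤ ≤ D.UE k ⊔ LinearMap.ker π.toLinearMap := by
    intro k
    induction k with
    | zero => exact le_sup_of_le_left le_top
    | succ k ih =>
      rw [pow_succ, ← mul_assoc, mul_assoc]
      refine (mul_le_mul_right hJr _).trans (Submodule.mul_le.2 fun x hx y hy => ?_)
      have := hy 1
      rw [mul_one] at this
      obtain ⟨a, ha, b, hb, rfl⟩ := Submodule.mem_sup.1 this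
      rw [mul_add]
      refine add_mem ?_ (Submodule.mem_sup_right ?_)
      · refine D.UN_ind ((D.UE (k + 1) ⊔ LinearMap.ker π.toLinearMap).comap (LinearMap.mulLeft K x)) (fun w i => ?_) a ha
        obtain ⟨c, hc, d, hd, e⟩ := Submodule.mem_sup.1 (ih (Submodule.mul_mem_mul hx (Submodule.mem_top (x := w))))
        change x * (w * D.e i) ∈ D.UE (k + 1) ⊔ LinearMap.ker π.toLinearMap
        rw [← mul_assoc, ← e, add_mul]
        exact Submodule.add_mem_sup (Submodule.subset_span ⟨i, c, hc, rfl⟩) (by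
          rw [LinearMap.mem_ker] at hd ⊢
          exact (map_mul π _ _).trans (by rw [show π d = 0 from hd, zero_mul]))
      · rw [LinearMap.mem_ker]
        exact (map_mul π _ _).trans (by rw [show π b = 0 from hb, mul_zero])
  have hz : (⊤ * J ^ m : Submodule K U).map π.toLinearMap = ⊥ := by
    refine hm _ (fun r y hy => ?_) ?_
    · obtain ⟨r, rfl⟩ := hs r
      obtain ⟨y, hy, rfl⟩ := hy
      refine ⟨⟨r * y, ?_, map_mul π _ _⟩, ⟨y * r, ?_, map_mul π _ _⟩⟩
      · have : (⊤ * (⊤ * J ^ m) : Submodule K U) ≤ ⊤ * J ^ m := by rw [← mul_assoc]; exact mul_le_mul_left le_top _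
        exact this (Submodule.mul_mem_mul trivial hy)
      · have : (⊤ * J ^ m * ⊤ : Submodule K U) ≤ ⊤ * J ^ m := by
          cases m with
          | zero => simp only [pow_zero, mul_one]; exact le_top
          | succ m => rw [pow_succ, ← mul_assoc, mul_assoc]; exact mul_le_mul_right hJr _
        exact this (Submodule.mul_mem_mul hy trivial)
    · rintro _ ⟨y, hy, rfl⟩
      have := hS m (Submodule.mul_mem_mul hy (Submodule.mem_top (x := 1)))
      rw [mul_one] at this
      obtain ⟨c, hc, d, hd, e⟩ := Submodule.mem_sup.1 this
      exact ⟨c, hc, by rw [← e, map_add, LinearMap.mem_ker.1 hd, add_zero]⟩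
  have hz' : ∀ x ∈ (⊤ * J ^ m : Submodule K U), π x = 0 := fun x hx => (Submodule.eq_bot_iff _).1 hz _ ⟨x, hx, rfl⟩
  by_contra h0
  clear hz hm
  induction m with
  | zero => exact h1 (hz' 1 (by simp))
  | succ m ih =>
    refine ih fun x hx => (hpr x u fun w => hz' _ ?_).resolve_right h0
    rw [pow_succ, ← mul_assoc ⊤, mul_assoc x]
    refine Submodule.mul_mem_mul hx ((hJ _).2 fun w' => ?_)
    rw [mul_assoc]; exact Ideal.mul_mem_left _ _ (hu w')
inductive RD.Nm : ℤ → U → Prop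
  | j (P) : RD.Nm 0 (D.j P)
  | f (k x a) : RD.Nm k x → RD.Nm (k + D.z (.inl a)) (D.f a * x)
theorem RD.Nm_pos {k x} (h : D.Nm k x) : 0 ≤ k := by
  induction h with
  | j P => rfl
  | f k x a _ ih => have := D.z_e a; omega
noncomputable def RD.NF (k : ℤ) : Submodule K U := Submodule.span K {x | ∃ k' ≤ k, D.Nm k' x} ⊔ (D.N0 π).restrictScalars K
theorem RD.NF_mono {k l : ℤ} (h : k ≤ l) : D.NF π k ≤ D.NF π l := by
  refine sup_le_sup_right (Submodule.span_mono ?_) _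
  rintro x ⟨k', h', hx⟩
  exact ⟨k', h'.trans h, hx⟩
theorem RD.NF_N0 {k u} (h : u ∈ D.N0 π) : u ∈ D.NF π k := Submodule.mem_sup_right h
theorem RD.NF_m {k x} (h : D.Nm k x) : x ∈ D.NF π k := Submodule.mem_sup_left (Submodule.subset_span ⟨k, le_rfl, h⟩)
theorem RD.NF_ind {k : ℤ} {P : Submodule K U} (h1 : ∀ k' ≤ k, ∀ x, D.Nm k' x → x ∈ P) (h2 : ∀ u ∈ D.N0 π, u ∈ P) : D.NF π k ≤ P :=
  sup_le (Submodule.span_le.2 fun x ⟨k', h, hx⟩ => h1 k' h x hx) h2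
theorem RD.NF_neg {k : ℤ} (h : k < 0) {u} (hu : u ∈ D.NF π k) : u ∈ D.N0 π := by
  have : D.NF π k ≤ (D.N0 π).restrictScalars K := D.NF_ind π (fun k' h' x hx => absurd (D.Nm_pos hx) (by omega)) (fun _ h => h)
  exact this hu
theorem RD.NF_f (k a) : ∀ u ∈ D.NF π k, D.f a * u ∈ D.NF π (k + D.z (.inl a)) := by
  have : D.NF π k ≤ (D.NF π (k + D.z (.inl a))).comap (LinearMap.mulLeft K (D.f a)) := D.NF_ind π
    (fun k' h x hx => D.NF_mono π (by omega) (D.NF_m π (.f k' x a hx))) (fun u hu => D.NF_N0 π (Ideal.mul_mem_left _ _ hu))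
  exact this
theorem RD.NF_b (k β) : ∀ u ∈ D.NF π k, io K g (D.b β) * u ∈ D.NF π (k - D.z β) := by
  have key : ∀ k x, D.Nm k x → ∀ β, io K g (D.b β) * x ∈ D.NF π (k - D.z β) := by
    intro k x hx
    induction hx with
    | j P =>
      rintro (a | a | i)
      · exact D.NF_N0 π (Submodule.mem_sup_left (D.UN_j _ (Ideal.subset_span ⟨a, rfl⟩) P))
      · have := D.NF_m π (.f _ _ a (.j (D := D) P))
        rw [D.z_f, sub_neg_eq_add]; exact this
      · have := D.NF_m π (.j (D := D) (.X i * P))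
        rw [map_mul, D.j_X] at this
        rw [D.z_h, sub_zero]; exact this
    | f k x a hx ih =>
      intro β
      have e : io K g (D.b β) * (D.f a * x) = D.f a * (io K g (D.b β) * x) + io K g ⁅D.b β, D.b (.inr (.inl a))⁆ * x := by
        rw [io_lie, sub_mul, mul_assoc, mul_assoc]; exact (add_sub_cancel _ _).symm
      rw [e]
      refine add_mem ?_ ?_
      · have := D.NF_f π _ a _ (ih β)
        rwa [sub_add_eq_add_sub] at this
      · rw [← D.b.sum_repr ⁅D.b β, D.b (.inr (.inl a))⁆, map_sum, Finset.sum_mul]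
        refine sum_mem fun γ _ => ?_
        by_cases h : D.b.repr ⁅D.b β, D.b (.inr (.inl a))⁆ γ = 0
        · rw [h, zero_smul, map_zero, zero_mul]; exact zero_mem _
        · rw [map_smul, smul_mul_assoc]
          refine Submodule.smul_mem _ _ ?_
          have := ih γ
          rwa [D.gradz h, D.z_f, show k - (D.z β + -D.z (.inl a)) = k + D.z (.inl a) - D.z β by ring] at this
  have : D.NF π k ≤ (D.NF π (k - D.z β)).comap (LinearMap.mulLeft K (io K g (D.b β))) := D.NF_ind π
    (fun k' h x hx => D.NF_mono π (by omega) (key _ _ hx β)) (fun u hu => D.NF_N0 π (Ideal.mul_mem_left _ _ hu))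
  exact this
theorem RD.NF_top (u : U) : ∃ k : ℕ, u ∈ D.NF π k := by
  have hmo : Monotone fun k : ℕ => D.NF π k := fun a b h => D.NF_mono π (by exact_mod_cast h)
  rw [← Submodule.mem_iSup_of_directed _ hmo.directed_le]
  refine U_ind _ ?_ ?_ u
  · exact (le_iSup (fun k : ℕ => D.NF π k) 0) (D.NF_m π (by simpa using RD.Nm.j (D := D) 1))
  · intro x u hu
    obtain ⟨k, hk⟩ := (Submodule.mem_iSup_of_directed _ hmo.directed_le).1 hu
    rw [← D.b.sum_repr x, map_sum, Finset.sum_mul]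
    refine sum_mem fun γ _ => ?_
    rw [map_smul, smul_mul_assoc]
    refine Submodule.smul_mem _ _ ?_
    exact (le_iSup (fun k : ℕ => D.NF π k) (k - D.z γ).toNat) (D.NF_mono π (by omega) (D.NF_b π k γ u hk))
theorem RD.NF_fd (hf : Module.Finite K (D.A ⧸ D.aI π)) (k : ℕ) : ∃ W : Submodule K U, FiniteDimensional K W ∧ D.NF π k ≤ W ⊔ (D.N0 π).restrictScalars K := by
  classical
  obtain ⟨S, hS⟩ := hf.1
  obtain ⟨s, hs⟩ := (Ideal.Quotient.mkₐ_surjective K (D.aI π)).hasRightInverse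
  let W0 : Submodule K U := Submodule.span K ((fun y => D.j (s y)) '' S)
  have hW0 : ∀ P, D.j P ∈ W0 ⊔ (D.N0 π).restrictScalars K := fun P => by
    have : Submodule.span K (S : Set (D.A ⧸ D.aI π)) ≤ (Submodule.span K (s '' S)).map (Ideal.Quotient.mkₐ K (D.aI π)).toLinearMap := Submodule.span_le.2 fun y hy => ⟨s y, Submodule.subset_span ⟨y, hy, rfl⟩, hs y⟩
    obtain ⟨Q, hQ, h⟩ := this (show Ideal.Quotient.mkₐ K (D.aI π) P ∈ _ by rw [hS]; trivial)
    have h2 : P - Q ∈ D.aI π := Ideal.Quotient.eq.1 h.symm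
    rw [← add_sub_cancel Q P, map_add]
    refine Submodule.add_mem_sup ?_ h2
    have h3 : Submodule.span K (s '' S) ≤ W0.comap D.j.toLinearMap := Submodule.span_le.2 (by rintro _ ⟨y, hy, rfl⟩; exact Submodule.subset_span ⟨y, hy, rfl⟩)
    exact h3 hQ
  have hfd0 : FiniteDimensional K W0 := FiniteDimensional.span_of_finite K (S.finite_toSet.image _)
  induction k with
  | zero =>
    refine ⟨W0, hfd0, D.NF_ind π (fun k' h x hx => ?_) fun u hu => Submodule.mem_sup_right hu⟩
    cases hx with
    | j P => exact hW0 P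
    | f k x a hx => have := D.Nm_pos hx; have := D.z_e a; simp at h; omega
  | succ k ih =>
    obtain ⟨W, hW, hWk⟩ := ih
    refine ⟨W0 ⊔ ⨆ a, W.map (LinearMap.mulLeft K (D.f a)), inferInstance, D.NF_ind π (fun k' h x hx => ?_) fun u hu => Submodule.mem_sup_right hu⟩
    cases hx with
    | j P => exact (sup_le_sup_right le_sup_left _ : W0 ⊔ (D.N0 π).restrictScalars K ≤ _) (hW0 P)
    | f k' x a hx =>
      have hx' := hWk (D.NF_mono π (by have := D.z_e a; push_cast at h; omega) (D.NF_m π hx))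
      obtain ⟨w, hw, n, hn, rfl⟩ := Submodule.mem_sup.1 hx'
      rw [mul_add]
      exact Submodule.add_mem_sup (Submodule.mem_sup_right ((le_iSup (fun a => W.map (LinearMap.mulLeft K (D.f a))) a) ⟨w, hw, rfl⟩)) (Ideal.mul_mem_left _ _ hn)
variable {R : Type*} [Ring R] [Algebra K R] (π : UniversalEnvelopingAlgebra K g →ₐ[K] R)
theorem RD.NF_A (k) (Q : D.A) : ∀ u ∈ D.NF π k, D.j Q * u ∈ D.NF π k := by
  induction Q using MvPolynomial.induction_on with
  | C a => intro u hu; rw [show D.j (.C a) = algebraMap K U a from D.j.commutes a, ← Algebra.smul_def]; exact Submodule.smul_mem _ _ hu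
  | add p q hp hq => intro u hu; rw [map_add, add_mul]; exact add_mem (hp u hu) (hq u hu)
  | mul_X p i hp =>
    intro u hu
    rw [map_mul, mul_assoc, D.j_X]
    have := D.NF_b π k (.inr (.inr i)) u hu
    rw [D.z_h, sub_zero] at this
    exact hp _ this
theorem sc_lem {B : Type*} [Ring B] [Algebra K B] {x y f : B} (h : y * f = f * x) (Q : Polynomial K) : Polynomial.aeval y Q * f = f * Polynomial.aeval x Q := by
  induction Q using Polynomial.induction_on with
  | C a => simp [Algebra.commutes]
  | add p q hp hq => simp only [map_add, add_mul, mul_add, hp, hq]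
  | monomial n a ih =>
    rw [pow_succ, ← mul_assoc, map_mul _ _ Polynomial.X, map_mul _ _ Polynomial.X, Polynomial.aeval_X, Polynomial.aeval_X, mul_assoc, h, ← mul_assoc, ih, mul_assoc]
theorem RD.C10k {ν : Fin D.r → K} (hχ : ∀ z, (∀ u, z * u = u * z) → π z = algebraMap K R ((D.p z).eval ν)) :
    ∃ k0 : ℕ, ∀ C' C : Ideal U, D.N0 π ≤ C' → C' < C → ∃ v ∈ C, v ∉ C' ∧ v ∈ D.NF π k0 ∧ (∀ a, D.e a * v ∈ C') ∧
      ∃ μ : Fin D.r → K, ∀ i, D.h i * v - μ i • v ∈ C' := by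
  classical
  obtain ⟨c, hcX, hcs, hfin⟩ := D.N6 hχ
  let δ' : D.A := ∑ i, D.d i • MvPolynomial.X i
  have hδ' : D.j δ' = D.dl := by simp [δ', RD.dl, D.j_X]
  obtain ⟨P, hP0, hPa⟩ : ∃ P : Polynomial K, P ≠ 0 ∧ Polynomial.aeval δ' P ∈ D.aI π := by
    have hi := Algebra.IsIntegral.isIntegral (R := K) (Ideal.Quotient.mkₐ K (D.aI π) δ')
    refine ⟨_, minpoly.ne_zero hi, ?_⟩
    have := minpoly.aeval K (Ideal.Quotient.mkₐ K (D.aI π) δ')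
    rw [Polynomial.aeval_algHom_apply] at this
    exact Ideal.Quotient.eq_zero_iff_mem.1 this
  obtain ⟨k0, hk0⟩ := cop_lem hP0
  let Pj : ℤ → Polynomial K := fun k => P.comp (Polynomial.X + Polynomial.C (k : K))
  have hco : ∀ k : ℤ, (k0 : ℤ) ≤ k → IsCoprime P (Pj k) := by
    intro k hk
    lift k to ℕ using by omega
    have := (hk0 k (by exact_mod_cast hk)).map (Polynomial.compRingHom (Polynomial.X + Polynomial.C (k : K)))
    simp only [Polynomial.coe_compRingHom, Polynomial.comp_assoc] at this
    simp only [Polynomial.sub_comp, Polynomial.X_comp, Polynomial.C_comp, add_sub_cancel_right, Polynomial.comp_X] at this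
    simpa [Pj] using this.symm
  have hjd : ∀ Q : Polynomial K, D.j (Polynomial.aeval δ' Q) = Polynomial.aeval D.dl Q := fun Q => by rw [← hδ', Polynomial.aeval_algHom_apply]
  have hPN : ∀ k x, D.Nm k x → Polynomial.aeval D.dl (Pj k) * x ∈ D.N0 π := by
    intro k x hx
    induction hx with
    | j Q =>
      simp only [Pj, Int.cast_zero, map_zero, add_zero, Polynomial.comp_X]
      rw [← hjd, ← map_mul]
      exact Ideal.mul_mem_right _ (D.aI π) hPa
    | f k x a hx ih =>
      have h1 : (D.dl + algebraMap K U (D.z (.inl a))) * D.f a = D.f a * D.dl := by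
        have h2 : D.dl * D.f a = _ := D.dl_b (.inr (.inl a))
        rw [add_mul, h2, D.z_f, ← Algebra.smul_def, Int.cast_neg, neg_smul, add_assoc]
        exact (congrArg _ (neg_add_cancel _)).trans (add_zero _)
      have h3 : Polynomial.aeval D.dl (Pj (k + D.z (.inl a))) = Polynomial.aeval (D.dl + algebraMap K U (D.z (.inl a))) (Pj k) := by
        have : Pj (k + D.z (.inl a)) = (Pj k).comp (Polynomial.X + Polynomial.C ((D.z (.inl a) : ℤ) : K)) := by
          simp only [Pj, Polynomial.comp_assoc]
          simp only [Polynomial.add_comp, Polynomial.X_comp, Polynomial.C_comp, Int.cast_add, map_add]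
          congr 1; ring
        rw [this, Polynomial.aeval_comp]; simp
      rw [h3, ← mul_assoc, sc_lem h1, mul_assoc]
      exact Ideal.mul_mem_left _ _ ih
  refine ⟨k0, fun C' C hN hlt => ?_⟩
  have hex : ∃ k : ℕ, ∃ v ∈ C, v ∉ C' ∧ v ∈ D.NF π k := by
    obtain ⟨v, h1, h2⟩ := SetLike.exists_of_lt hlt
    obtain ⟨k, hk⟩ := D.NF_top π v
    exact ⟨k, v, h1, h2, hk⟩
  let k := Nat.find hex
  obtain ⟨v0, hv0, hv0', hv0k⟩ : ∃ v ∈ C, v ∉ C' ∧ v ∈ D.NF π k := Nat.find_spec hex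
  have hmin : ∀ l : ℕ, l < k → ∀ v ∈ C, v ∈ D.NF π l → v ∈ C' := fun l hl v hv hvl => by
    by_contra h
    exact Nat.find_min hex hl ⟨v, hv, h, hvl⟩
  have hEv : ∀ v ∈ C, v ∈ D.NF π k → ∀ a, D.e a * v ∈ C' := fun v hv hvk a => by
    have h1 : D.e a * v ∈ _ := D.NF_b π k (.inl a) v hvk
    have hz := D.z_e a
    by_cases h : (k : ℤ) - D.z (.inl a) < 0
    · exact hN (D.NF_neg π h h1)
    · refine hmin ((k : ℤ) - D.z (.inl a)).toNat (by omega) _ (C.mul_mem_left _ hv) ?_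
      rwa [Int.toNat_of_nonneg (by omega)]
  have hav : ∀ v ∈ C, v ∈ D.NF π k → ∀ Q ∈ D.aI π, D.j Q * v ∈ C' := fun v hv hvk Q hQ => by
    obtain ⟨a, ha, b, hb, e⟩ := Submodule.mem_sup.1 ((D.aI_mem π).1 hQ)
    rw [← e, add_mul]
    refine add_mem ?_ (hN (Submodule.mem_sup_right ((RingHom.mem_ker).2 ?_)))
    · refine D.UN_ind ((C'.restrictScalars K).comap (LinearMap.mulRight K v)) (fun u i => ?_) a ha
      change u * D.e i * v ∈ C'
      rw [mul_assoc]; exact C'.mul_mem_left _ (hEv v hv hvk i)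
    · rw [map_mul, (RingHom.mem_ker).1 hb, zero_mul]
  have hkk : k ≤ k0 := by
    by_contra hlt
    let F := ∏ i ∈ Finset.Icc ((k0 : ℤ)) k, Pj i
    obtain ⟨α, β, hab⟩ : IsCoprime P F := IsCoprime.prod_right fun i hi => hco i (Finset.mem_Icc.1 hi).1
    have hF : D.NF π k ≤ (D.NF π k0).comap (LinearMap.mulLeft K (Polynomial.aeval D.dl F)) := by
      refine D.NF_ind π (fun k' hk' x hx => ?_) fun u hu => D.NF_N0 π (Ideal.mul_mem_left _ _ hu)
      change Polynomial.aeval D.dl F * x ∈ D.NF π k0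
      by_cases h : k' ≤ k0
      · rw [← hjd]; exact D.NF_A π _ _ _ (D.NF_mono π h (D.NF_m π hx))
      · have : k' ∈ Finset.Icc (k0 : ℤ) k := Finset.mem_Icc.2 ⟨by omega, hk'⟩
        rw [show F = _ from (Finset.prod_erase_mul _ _ this).symm, map_mul, mul_assoc]
        exact D.NF_N0 π (Ideal.mul_mem_left _ _ (hPN _ _ hx))
    refine hv0' ?_
    have e : v0 = Polynomial.aeval D.dl α * (Polynomial.aeval D.dl P * v0) + Polynomial.aeval D.dl β * (Polynomial.aeval D.dl F * v0) := by
      rw [← mul_assoc, ← mul_assoc, ← map_mul, ← map_mul, ← add_mul, ← map_add, hab, map_one, one_mul]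
    rw [e]
    refine add_mem (C'.mul_mem_left _ ?_) (C'.mul_mem_left _ (hmin k0 (by omega) _ (C.mul_mem_left _ hv0) (hF hv0k)))
    rw [← hjd]; exact hav v0 hv0 hv0k _ hPa
  let Ψ : D.A →ₐ[K] Module.End K (U ⧸ C') := (Algebra.lsmul K K (U ⧸ C')).comp D.j
  let mk : U →ₗ[K] (U ⧸ C') := C'.mkQ.restrictScalars K
  have hΨ : ∀ Q u, Ψ Q (mk u) = mk (D.j Q * u) := fun _ _ => rfl
  have hmk : ∀ u, mk u = 0 ↔ u ∈ C' := fun u => Submodule.Quotient.mk_eq_zero C'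
  let V : Submodule K U := C.restrictScalars K ⊓ D.NF π k
  obtain ⟨w, ⟨v, ⟨hvC, hvk⟩, rfl⟩, hw0, ν, hν⟩ := EV (ι := {β // D.z β ≠ 0}) (fun β => Ψ (c β)) (fun i j => by
      rw [Commute, SemiconjBy, ← map_mul, mul_comm, map_mul]) (V.map mk) (fun h => hv0' ((hmk _).1 ((Submodule.eq_bot_iff _).1 h _ ⟨v0, ⟨hv0, hv0k⟩, rfl⟩)))
    (by
      rintro β _ ⟨v, ⟨h1, h2⟩, rfl⟩
      exact ⟨_, ⟨C.mul_mem_left _ h1, D.NF_A π _ _ _ h2⟩, (hΨ _ _).symm⟩)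
    (by
      intro β
      obtain ⟨s, hs⟩ := hcs β β.2
      refine ⟨s, ?_⟩
      rintro _ ⟨v, ⟨h1, h2⟩, rfl⟩
      have : (s.map fun x => Ψ (c β) - algebraMap K _ x).prod = Ψ (s.map fun x => c β - .C x).prod := by
        rw [map_list_prod, List.map_map]
        congr 2
        funext x
        simp only [Function.comp, map_sub]
        congr 1
        exact (Ψ.commutes x).symm
      rw [this, hΨ, hmk]
      exact hav v h1 h2 _ hs)
  refine ⟨v, hvC, fun h => hw0 ((hmk v).2 h), D.NF_mono π (by exact_mod_cast hkk) hvk, hEv v hvC hvk, ?_⟩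
  have hX : ∀ i, ∃ m : K, Ψ (.X i) (mk v) = m • mk v := by
    intro i
    refine (Submodule.span_induction (p := fun Q _ => ∃ m : K, Ψ Q (mk v) = m • mk v) ?_ ⟨0, by simp⟩ ?_ ?_ (hcX i))
    · rintro Q (rfl | ⟨β, hβ, rfl⟩)
      · exact ⟨1, by simp⟩
      · exact ⟨_, hν ⟨β, hβ⟩⟩
    · rintro x y _ _ ⟨a, ha⟩ ⟨b, hb⟩
      exact ⟨a + b, by rw [map_add, LinearMap.add_apply, ha, hb, add_smul]⟩
    · rintro a x _ ⟨b, hb⟩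
      exact ⟨a * b, by rw [map_smul, LinearMap.smul_apply, hb, smul_smul]⟩
  choose m hm using hX
  refine ⟨m, fun i => ?_⟩
  rw [← hmk, map_sub, map_smul, ← hm, hΨ, D.j_X, sub_self]
end
section
variable {K g : Type*} [Field K] [LieRing g] [LieAlgebra K g] [CharZero K] [LieAlgebra.IsSemisimple K g] (D : RD K g)
local notation "U" => UniversalEnvelopingAlgebra K g
theorem RD.C11 {R : Type*} [Ring R] [Algebra K R] (π : U →ₐ[K] R) (hs : Function.Surjective π) {ν : Fin D.r → K}
    (hχ : ∀ z, (∀ u, z * u = u * z) → π z = algebraMap K R ((D.p z).eval ν)) (h1 : π 1 ≠ 0) (hpr : ∀ a b, (∀ w, π (a * w * b) = 0) → π a = 0 ∨ π b = 0) :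
    ∃ (L : Ideal U) (μ : Fin D.r → K), 1 ∉ L ∧ (∀ a, D.e a ∈ L) ∧ (∀ i, D.h i - μ i • 1 ∈ L) ∧
      (∀ B : Ideal U, L ≤ B → 1 ∉ B → B ≤ L) ∧ ∀ u, π u = 0 ↔ ∀ w, u * w ∈ L := by
  classical
  obtain ⟨k0, hk0⟩ := D.C10k π hχ
  obtain ⟨-, -, -, hfin⟩ := D.N6 hχ
  obtain ⟨W, hW, hWN⟩ := D.NF_fd π hfin k0
  let mk : U →ₗ[K] (U ⧸ D.N0 π) := (D.N0 π).mkQ.restrictScalars K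
  have hmk : ∀ u, mk u = 0 ↔ u ∈ D.N0 π := fun u => Submodule.Quotient.mk_eq_zero _
  let ℓ : Ideal U → ℕ := fun C => Module.finrank K ((C.restrictScalars K ⊓ D.NF π k0).map mk)
  have hfd : ∀ C : Ideal U, FiniteDimensional K ((C.restrictScalars K ⊓ D.NF π k0).map mk) := fun C => by
    refine Submodule.finiteDimensional_of_le (S₂ := W.map mk) ?_
    rintro _ ⟨v, ⟨-, hv⟩, rfl⟩
    obtain ⟨w, hw, n, hn, rfl⟩ := Submodule.mem_sup.1 (hWN hv)
    exact ⟨w, hw, by rw [map_add, (hmk n).2 hn, add_zero]⟩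
  have hlt : ∀ C' C : Ideal U, D.N0 π ≤ C' → C' < C → ℓ C' < ℓ C := by
    intro C' C hN h
    obtain ⟨v, h1, h2, h3, -⟩ := hk0 C' C hN h
    refine Submodule.finrank_lt_finrank_of_lt (lt_of_le_of_ne (Submodule.map_mono (inf_le_inf_right _ h.le)) fun e => h2 ?_)
    have : mk v ∈ (C.restrictScalars K ⊓ D.NF π k0).map mk := ⟨v, ⟨h1, h3⟩, rfl⟩
    rw [← e] at this
    obtain ⟨v', ⟨h4, -⟩, h5⟩ := this
    have h6 := hN ((hmk (v - v')).1 (by rw [map_sub, h5, sub_self]))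
    have := C'.add_mem h6 h4
    rwa [sub_add_cancel] at this
  have hex : ∃ n : ℕ, ∃ C' C : Ideal U, D.N0 π ≤ C' ∧ C' ≤ C ∧ (∀ u, (∀ c ∈ C, u * c ∈ C') → π u = 0) ∧ n = ℓ C - ℓ C' :=
    ⟨_, D.N0 π, ⊤, le_rfl, le_top, fun u hu => D.C9a π hs hχ h1 hpr u fun w => hu w trivial, rfl⟩
  obtain ⟨C', C, hN, hle, hT, hn⟩ := Nat.find_spec hex
  have hne : C' < C := lt_of_le_of_ne hle fun e => h1 (hT 1 fun c hc => by rw [one_mul, e]; exact hc)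
  have hsim : ∀ B : Ideal U, C' ≤ B → B ≤ C → B = C' ∨ B = C := by
    intro B hB1 hB2
    by_contra! hcon
    have l1 := hlt C' B hN (lt_of_le_of_ne hB1 hcon.1.symm)
    have l2 := hlt B C (hN.trans hB1) (lt_of_le_of_ne hB2 hcon.2)
    by_cases hB : ∀ u, (∀ c ∈ B, u * c ∈ C') → π u = 0
    · exact Nat.find_min hex (m := ℓ B - ℓ C') (by omega) ⟨C', B, hN, hB1, hB, rfl⟩
    · push Not at hB
      obtain ⟨a, ha, ha0⟩ := hB
      refine Nat.find_min hex (m := ℓ C - ℓ B) (by omega) ⟨B, C, hN.trans hB1, hB2, fun b hb => ?_, rfl⟩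
      refine (hpr a b fun w => hT _ fun c hc => ?_).resolve_left ha0
      rw [mul_assoc, mul_assoc]
      exact ha _ (B.mul_mem_left _ (hb c hc))
  obtain ⟨v, hv, hv', -, he, μ, hμ⟩ := hk0 C' C hN hne
  let rm : U →ₗ[U] U := LinearMap.toSpanSingleton U U v
  have hrm : ∀ u, rm u = u * v := fun _ => rfl
  have hBB : ∀ B : Ideal U, Submodule.map rm B ⊔ C' = C' ∨ Submodule.map rm B ⊔ C' = C := fun B => hsim _ le_sup_right (sup_le (by
    rintro _ ⟨b, -, rfl⟩; exact C.mul_mem_left _ hv) hle)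
  refine ⟨Submodule.comap rm C', μ, ?_, he, fun i => ?_, fun B hLB hB1 b hb => ?_, fun u => ⟨fun hu w => ?_, fun hu => hT u fun c hc => ?_⟩⟩
  · rw [Submodule.mem_comap, hrm, one_mul]; exact hv'
  · have := hμ i
    rw [Submodule.mem_comap, hrm, sub_mul, smul_mul_assoc, one_mul]; exact this
  · rcases hBB B with h | h
    · exact h.le (Submodule.mem_sup_left ⟨b, hb, rfl⟩)
    · exfalso
      obtain ⟨_, ⟨b, hb, rfl⟩, y, hy, e⟩ := Submodule.mem_sup.1 (h.ge hv)
      have : 1 - b ∈ B := hLB (by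
        rw [Submodule.mem_comap, hrm, sub_mul, one_mul, ← hrm b, sub_eq_iff_eq_add'.2 e.symm]; exact hy)
      exact hB1 (by simpa using B.add_mem this hb)
  · refine hN (Submodule.mem_sup_right ((RingHom.mem_ker).2 ?_))
    change π ((u * w) * v) = 0
    rw [map_mul, map_mul, hu, zero_mul, zero_mul]
  · rcases hBB ⊤ with h | h
    · refine absurd (h.le (Submodule.mem_sup_left ⟨1, trivial, rfl⟩)) ?_
      rw [hrm, one_mul]; exact hv'
    · obtain ⟨_, ⟨b, hb, rfl⟩, y, hy, rfl⟩ := Submodule.mem_sup.1 (h.ge hc)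
      rw [mul_add]
      refine add_mem ?_ (C'.mul_mem_left _ hy)
      rw [hrm, ← mul_assoc]; exact hu b
theorem RD.C12 {μ : Fin D.r → K} (B : Ideal U) (he : ∀ a, D.e a ∈ B) (hh : ∀ i, D.h i - μ i • 1 ∈ B) (h1 : 1 ∉ B) :
    ∀ u ∈ B, (D.p u).eval μ = 0 := by
  intro u hu
  by_contra h0
  let Φ : U →ₐ[K] Module.End K (U ⧸ B) := Algebra.lsmul K K (U ⧸ B)
  let v : U ⧸ B := Submodule.Quotient.mk 1
  have hΦ : ∀ u, Φ u v = Submodule.Quotient.mk u := fun u => by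
    change Submodule.Quotient.mk (u * 1) = _
    rw [mul_one]
  have he' : ∀ a, Φ (D.e a) v = 0 := fun a => by rw [hΦ]; exact (Submodule.Quotient.mk_eq_zero B).2 (he a)
  have hh' : ∀ i, Φ (D.h i) v = μ i • v := fun i => by
    rw [hΦ]; exact (Submodule.Quotient.eq B).2 (hh i)
  have hv : v ≠ 0 := fun h => h1 ((Submodule.Quotient.mk_eq_zero B).1 h)
  have h2 : Φ u v = 0 := by rw [hΦ]; exact (Submodule.Quotient.mk_eq_zero B).2 hu
  obtain ⟨x, hx, y, hy, e⟩ := Submodule.mem_sup.1 (D.p_sub u)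
  have h3 := congrArg (fun t => Φ t v) e
  simp only [map_add, map_sub, LinearMap.add_apply, LinearMap.sub_apply] at h3
  rw [D.hw_UN Φ he' hy, h2, D.hw_j Φ hh', add_zero, zero_sub] at h3
  have h4 := D.hw_NU Φ he' hh' hx
  rw [h3, neg_mem_iff] at h4
  have h5 := (D.hwL Φ μ).smul_mem ((D.p u).eval μ)⁻¹ h4
  rw [smul_smul, inv_mul_cancel₀ h0, one_smul] at h5
  exact hv (D.hw_not Φ hh' h5)
theorem RD.C13 {T : TriangularDecomposition K g} (hn : T.npos.toSubmodule = Submodule.span K (Set.range fun a => D.b (.inl a)))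
    (hH : T.H.toSubmodule = Submodule.span K (Set.range fun i => D.b (.inr (.inr i)))) (lam : Module.Dual K T.H) :
    ∃ ν : Fin D.r → K, ∀ u ∈ vermaIdeal T lam, (D.p u).eval ν = 0 := by
  have hb : ∀ i, D.b (.inr (.inr i)) ∈ T.H := fun i => by
    rw [← LieSubalgebra.mem_toSubmodule, hH]; exact Submodule.subset_span ⟨i, rfl⟩
  let ν : Fin D.r → K := fun i => lam ⟨_, hb i⟩
  refine ⟨ν, ?_⟩
  suffices ∀ u ∈ vermaIdeal T lam, ∀ w, (D.p (w * u)).eval ν = 0 from fun u hu => by simpa using this u hu 1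
  intro u hu
  induction hu using Submodule.span_induction with
  | zero => simp
  | add x y _ _ hx hy => intro w; rw [mul_add, map_add, map_add, hx, hy, add_zero]
  | smul a x _ hx => intro w; rw [smul_eq_mul, ← mul_assoc]; exact hx _
  | mem x hx =>
    intro w
    rcases hx with ⟨x, rfl⟩ | ⟨h, rfl⟩
    · have hx : (x : g) ∈ T.npos.toSubmodule := x.2
      rw [hn] at hx
      have : Submodule.span K (Set.range fun a => D.b (.inl a)) ≤ ((LinearMap.ker D.p).comap (LinearMap.mulLeft K w)).comap (io K g) := Submodule.span_le.2 (by
        rintro _ ⟨a, rfl⟩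
        exact D.p_UN (D.UN_e w a))
      have h2 : D.p (w * io K g x) = 0 := this hx
      exact (congrArg (MvPolynomial.eval ν) h2).trans (map_zero _)
    · obtain ⟨h, hh⟩ := h
      have hx : h ∈ T.H.toSubmodule := hh
      rw [hH] at hx
      change (D.p (w * (io K g h - algebraMap K U (lam ⟨h, hh⟩)))).eval ν = 0
      revert hh
      induction hx using Submodule.span_induction with
      | mem x hx =>
        obtain ⟨i, rfl⟩ := hx
        intro hh
        have : io K g (D.b (.inr (.inr i))) - algebraMap K U (lam ⟨_, hh⟩) = D.j (.X i - .C (ν i)) := by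
          rw [map_sub, D.j_X]; exact congrArg _ (D.j.commutes _).symm
        rw [this, D.p_mj]; simp
      | zero =>
        intro hh
        rw [map_zero, show (⟨0, hh⟩ : T.H) = 0 from rfl, map_zero, map_zero]; simp
      | add x y hx hy hx' hy' =>
        rw [← hH] at hx hy
        intro hh
        rw [map_add, show (⟨x + y, hh⟩ : T.H) = ⟨x, hx⟩ + ⟨y, hy⟩ from rfl, map_add, map_add, add_sub_add_comm, mul_add, map_add, map_add, hx' hx, hy' hy, add_zero]
      | smul c x hx hx' =>
        rw [← hH] at hx
        intro hh
        rw [map_smul, show (⟨c • x, hh⟩ : T.H) = c • ⟨x, hx⟩ from rfl, map_smul, Algebra.algebraMap_eq_smul_one, smul_assoc, ← Algebra.algebraMap_eq_smul_one, ← smul_sub, mul_smul_comm, map_smul, MvPolynomial.smul_eval, hx' hx, mul_zero]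
theorem RD.C14 {T : TriangularDecomposition K g} (hn : T.npos.toSubmodule = Submodule.span K (Set.range fun a => D.b (.inl a)))
    (hH : T.H.toSubmodule = Submodule.span K (Set.range fun i => D.b (.inr (.inr i)))) (μ : Fin D.r → K) :
    ∃ mu : Module.Dual K T.H, (∀ a, D.e a ∈ vermaIdeal T mu) ∧ (∀ i, D.h i - μ i • 1 ∈ vermaIdeal T mu) ∧
      ∀ L : Ideal U, (∀ a, D.e a ∈ L) → (∀ i, D.h i - μ i • 1 ∈ L) → vermaIdeal T mu ≤ L := by
  let m : g →ₗ[K] K := ∑ i, μ i • D.b.coord (.inr (.inr i))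
  have hm : ∀ i, m (D.b (.inr (.inr i))) = μ i := fun i => by
    classical
    simp [m, Finsupp.single_apply]
  refine ⟨m ∘ₗ T.H.toSubmodule.subtype, fun a => ?_, fun i => ?_, fun L he hh => Ideal.span_le.2 ?_⟩
  · exact Ideal.subset_span (.inl ⟨⟨D.b (.inl a), by rw [← LieSubalgebra.mem_toSubmodule, hn]; exact Submodule.subset_span ⟨a, rfl⟩⟩, rfl⟩)
  · refine Ideal.subset_span (.inr ⟨⟨D.b (.inr (.inr i)), by rw [← LieSubalgebra.mem_toSubmodule, hH]; exact Submodule.subset_span ⟨i, rfl⟩⟩, ?_⟩)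
    change io K g (D.b (.inr (.inr i))) - algebraMap K U (m (D.b (.inr (.inr i)))) = _
    rw [hm, Algebra.algebraMap_eq_smul_one]; rfl
  · rintro _ (⟨x, rfl⟩ | ⟨h, rfl⟩)
    · have hx : (x : g) ∈ T.npos.toSubmodule := x.2
      rw [hn] at hx
      have : Submodule.span K (Set.range fun a => D.b (.inl a)) ≤ (L.restrictScalars K).comap (io K g) := Submodule.span_le.2 (by
        rintro _ ⟨a, rfl⟩; exact he a)
      exact this hx
    · have hx : (h : g) ∈ T.H.toSubmodule := h.2
      rw [hH] at hx
      have : Submodule.span K (Set.range fun i => D.b (.inr (.inr i))) ≤ (L.restrictScalars K).comap (io K g - (Algebra.linearMap K U) ∘ₗ m) := Submodule.span_le.2 (by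
        rintro _ ⟨i, rfl⟩
        have := hh i
        rw [← Algebra.algebraMap_eq_smul_one, ← hm] at this
        exact this)
      exact this hx
end
universe u v

/-- **Duflo's theorem.**  Let `K` be a field of characteristic `0` and `g` a split semisimple
Lie algebra over `K`.  Let `I` be a primitive ideal of `U(g)` (the annihilator of a simple
left `U(g)`-module) with `K`-rational infinitesimal central character, i.e.
`I ⊇ ker(χ_λ)·U(g)` for some `λ ∈ 𝔥*`, where `χ_λ : Z(U(g)) → K` is the central character
by which the centre acts on the Verma module `M(λ)`.  Then `I = Ann_{U(g)}(L(μ))` for some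
`μ ∈ 𝔥*`, where `L(μ)` is the quotient of `M(μ)` by its unique maximal submodule. -/
theorem primitive_ideal_eq_annihilator_simple_highest_weight
    {K : Type u} {g : Type v} [Field K] [CharZero K] [LieRing g] [LieAlgebra K g]
    [LieAlgebra.IsSemisimple K g]
    (T : TriangularDecomposition K g)
    (I : TwoSidedIdeal (UniversalEnvelopingAlgebra K g))
    -- `I` is primitive: it is the annihilator of a simple left `U(g)`-module
    (hprimitive : ∃ (S : Type (max u v)) (_ : AddCommGroup S)
      (_ : Module (UniversalEnvelopingAlgebra K g) S),
      IsSimpleModule (UniversalEnvelopingAlgebra K g) S ∧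
        I = annihilatorTwoSided (UniversalEnvelopingAlgebra K g) S)
    -- `I` has `K`-rational infinitesimal central character: for some weight `λ`, the centre
    -- acts on `M(λ)` via a character `χ_λ : Z(U(g)) → K` and `I ⊇ ker(χ_λ)·U(g)`
    (hcentral : ∃ (lam : Module.Dual K ↥T.H)
      (χ : Subring.center (UniversalEnvelopingAlgebra K g) →+* K),
      (∀ z : Subring.center (UniversalEnvelopingAlgebra K g),
        ∀ m : VermaModule T lam,
          (z : UniversalEnvelopingAlgebra K g) • m =
            (algebraMap K (UniversalEnvelopingAlgebra K g) (χ z)) • m) ∧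
      (∀ z : Subring.center (UniversalEnvelopingAlgebra K g), χ z = 0 →
        ∀ u : UniversalEnvelopingAlgebra K g,
          (z : UniversalEnvelopingAlgebra K g) * u ∈ I)) :
    ∃ (mu : Module.Dual K ↥T.H)
      (N : Submodule (UniversalEnvelopingAlgebra K g) (VermaModule T mu)),
      (N ≠ ⊤ ∧ ∀ P : Submodule (UniversalEnvelopingAlgebra K g) (VermaModule T mu),
        P ≠ ⊤ → P ≤ N) ∧
      I = annihilatorTwoSided (UniversalEnvelopingAlgebra K g) (VermaModule T mu ⧸ N) := by
  obtain ⟨D, hn, hH⟩ := ex_RD T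
  obtain ⟨S, _, _, hS, rfl⟩ := hprimitive
  obtain ⟨lam, χ, hV, hI⟩ := hcentral
  set I := annihilatorTwoSided (UniversalEnvelopingAlgebra K g) S with hIdef
  have hIm : ∀ a, a ∈ I ↔ ∀ m : S, a • m = 0 := fun a => by
    rw [hIdef, annihilatorTwoSided, TwoSidedIdeal.mem_mk']; rfl
  let π := RingCon.mkₐ K I.ringCon
  have hπ : ∀ u, π u = 0 ↔ u ∈ I := fun u => by
    rw [TwoSidedIdeal.mem_iff, ← RingCon.eq]; rfl
  obtain ⟨ν, hν⟩ := D.C13 hn hH lam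
  have hpc : ∀ c : K, (D.p (algebraMap K (UniversalEnvelopingAlgebra K g) c)).eval ν = c := fun c => by
    rw [← D.j.commutes c, D.p_j]; exact MvPolynomial.eval_C c
  have hz : ∀ z : Subring.center (UniversalEnvelopingAlgebra K g), (D.p (z : UniversalEnvelopingAlgebra K g)).eval ν = χ z := by
    intro z
    have h := hV z ((vermaIdeal T lam).mkQ 1)
    have h2 : (z : UniversalEnvelopingAlgebra K g) * 1 - algebraMap K (UniversalEnvelopingAlgebra K g) (χ z) * 1 ∈ vermaIdeal T lam :=
      (Submodule.Quotient.eq _).1 h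
    rw [mul_one, mul_one] at h2
    have h3 := hν _ h2
    rwa [map_sub, map_sub, hpc, sub_eq_zero] at h3
  have hχ : ∀ z, (∀ u, z * u = u * z) → π z = algebraMap K I.ringCon.Quotient ((D.p z).eval ν) := by
    intro z hc
    let z' : Subring.center (UniversalEnvelopingAlgebra K g) := ⟨z, Subring.mem_center_iff.2 fun u => (hc u).symm⟩
    let c' : Subring.center (UniversalEnvelopingAlgebra K g) := ⟨algebraMap K _ (χ z'), Subring.mem_center_iff.2 fun u => (Algebra.commutes _ u).symm⟩
    have h1 : χ c' = χ z' := by rw [← hz c']; exact hpc _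
    have h2 := hI (z' - c') (by rw [map_sub, h1, sub_self]) 1
    rw [mul_one] at h2
    have h3 : π (z - algebraMap K _ (χ z')) = 0 := (hπ _).2 h2
    rw [map_sub, sub_eq_zero, AlgHom.commutes] at h3
    rw [h3, ← hz z']
  have hnt : Nontrivial S := IsSimpleModule.nontrivial (UniversalEnvelopingAlgebra K g) S
  have h1 : π 1 ≠ 0 := fun h => by
    obtain ⟨m, hm⟩ := exists_ne (0 : S)
    exact hm (by simpa using (hIm 1).1 ((hπ 1).1 h) m)
  have hpr : ∀ a b, (∀ w, π (a * w * b) = 0) → π a = 0 ∨ π b = 0 := by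
    intro a b h
    by_contra! hc
    have hb := hc.2
    rw [Ne, hπ, hIm] at hb
    push Not at hb
    obtain ⟨s, hs⟩ := hb
    refine hc.1 ((hπ a).2 ((hIm a).2 fun m => ?_))
    obtain ⟨w, rfl⟩ := IsSimpleModule.toSpanSingleton_surjective (UniversalEnvelopingAlgebra K g) hs m
    have := (hIm _).1 ((hπ _).1 (h w)) s
    rwa [mul_smul, mul_smul] at this
  obtain ⟨L, μ, hL1, he, hh, hmax, hL⟩ := D.C11 π (RingCon.mkₐ_surjective _) hχ h1 hpr
  obtain ⟨mu, hv1, hv2, hv3⟩ := D.C14 hn hH μ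
  let mkV : UniversalEnvelopingAlgebra K g →ₗ[UniversalEnvelopingAlgebra K g] VermaModule T mu := (vermaIdeal T mu).mkQ
  have hsV : Function.Surjective mkV := Submodule.mkQ_surjective _
  have hVL := hv3 L he hh
  have hN : ∀ u, mkV u ∈ Submodule.map mkV L ↔ u ∈ L := by
    refine fun u => ⟨?_, fun h => ⟨u, h, rfl⟩⟩
    rintro ⟨x, hx, e⟩
    have h2 : u - x ∈ vermaIdeal T mu := (Submodule.Quotient.eq _).1 e.symm
    simpa using L.add_mem (hVL h2) hx
  refine ⟨mu, Submodule.map mkV L, ⟨fun h => hL1 ((hN 1).1 (h ▸ trivial)), fun P hP => ?_⟩, ?_⟩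
  · let P' : Ideal (UniversalEnvelopingAlgebra K g) := Submodule.comap mkV P
    have hVP : vermaIdeal T mu ≤ P' := fun u hu => by
      have : mkV u = 0 := (Submodule.Quotient.mk_eq_zero _).2 hu
      change mkV u ∈ P
      rw [this]; exact P.zero_mem
    have hP1 : 1 ∉ P' := fun h => hP (by
      rw [eq_top_iff]
      rintro m -
      obtain ⟨u, rfl⟩ := hsV m
      have := P'.mul_mem_left u h
      rwa [mul_one] at this)
    have k1 := D.C12 P' (fun a => hVP (hv1 a)) (fun i => hVP (hv2 i)) hP1
    have k2 := D.C12 L he hh hL1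
    have k3 : P' ⊔ L ≤ L := hmax _ le_sup_right fun h => by
      obtain ⟨x, hx, y, hy, e⟩ := Submodule.mem_sup.1 h
      have := congrArg (fun t => (D.p t).eval μ) e
      simp only [map_add, k1 x hx, k2 y hy, add_zero] at this
      rw [D.p_1] at this
      simp at this
    intro m hm
    obtain ⟨u, rfl⟩ := hsV m
    exact ⟨u, k3 (Submodule.mem_sup_left hm), rfl⟩
  · ext a
    rw [← hπ, hL, annihilatorTwoSided, TwoSidedIdeal.mem_mk']
    constructor
    · intro h m
      obtain ⟨m, rfl⟩ := Submodule.mkQ_surjective _ m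
      obtain ⟨w, rfl⟩ := hsV m
      exact (Submodule.Quotient.mk_eq_zero _).2 ((hN (a * w)).2 (h w))
    · intro h w
      exact (hN (a * w)).1 ((Submodule.Quotient.mk_eq_zero _).1 (h (Submodule.Quotient.mk (mkV w))))
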